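/- Let a = (a_j)_{j≥0} and b = (b_j)_{j≥0} be strictly decreasing real sequences satisfying (Hyp 1), assume that the sequence (a_j) is Littlewood–Paley, and assume that the collection I_{a,b} can be split into a finite number of subcollections which are pairwise disjoint and Littlewood–Paley. Then for every triple of exponents with 1 < p₁, p₂, p₃ < ∞ and 1/p₁ + 1/p₂ + 1/p₃ = 1, there exists a finite constant C = C(p₁,p₂,a,b) such that ‖B_{m_{a,b}}(f,g)‖_{L^{p₃'}(ℝ)} ≤ C ‖f‖_{L^{p₁}(ℝ)} ‖g‖_{L^{p₂}(ℝ)} for all Schwartz functions f, g on ℝ. -/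

import Mathlib

open MeasureTheory Set
open scoped ENNReal NNReal

noncomputable section

/-- The character `e^{2π i t x}`. -/
def eChar (t x : ℝ) : ℂ := Complex.exp (2 * Real.pi * Complex.I * t * x)

/-- The Fourier transform `f̂(ξ) = ∫ f(x) e^{-2π i ξ x} dx`. -/
def fourierT (f : ℝ → ℂ) (ξ : ℝ) : ℂ := ∫ x : ℝ, f x * eChar (-ξ) x

/-- The bilinear multiplier operator `B_m` with symbol `m`. -/
def Bm (m : ℝ → ℝ → ℂ) (f g : ℝ → ℂ) (x : ℝ) : ℂ :=
  ∫ ξ : ℝ, ∫ η : ℝ, m ξ η * fourierT f ξ * fourierT g η * eChar (ξ + η) x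

/-- Complex-valued indicator function of a set of reals. -/
def indC (s : Set ℝ) (x : ℝ) : ℂ := s.indicator 1 x

/-- The set `-A - B = {-x-y : x ∈ A, y ∈ B}`. -/
def mink2 (A B : Set ℝ) : Set ℝ := Set.image2 (fun x y => -x - y) A B

/-- The paraproduct symbol `m_{a,b}(ξ,η) = Σ_{j≥1} 1_{[a_{j+1},a_j)}(ξ) 1_{[b_j,b_0)}(η)`. -/
def mab (a b : ℕ → ℝ) (ξ η : ℝ) : ℂ :=
  ∑' j : ℕ, indC (Ico (a (j + 2)) (a (j + 1))) ξ * indC (Ico (b (j + 1)) (b 0)) η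

/-- The interval `-[a_{j+1},a_j) - [b_j, b_0)` from the collection `I_{a,b}`. -/
def Iab (a b : ℕ → ℝ) (j : ℕ) : Set ℝ := mink2 (Ico (a (j + 1)) (a j)) (Ico (b j) (b 0))

/-- The interval `-[a_{j+1},a_j) - (b_∞, b_j)` from the collection `J_{a,b}`. -/
def Jab (a b : ℕ → ℝ) (binf : ℝ) (j : ℕ) : Set ℝ :=
  mink2 (Ico (a (j + 1)) (a j)) (Ioo binf (b j))

/-- The symbol `m̃_{u,v}(ξ,η) = Σ_{j≥1} 1_{(u_0,u_j]}(ξ) 1_{[v_j,v_{j+1})}(η)`. -/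
def muv (u v : ℕ → ℝ) (ξ η : ℝ) : ℂ :=
  ∑' j : ℕ, indC (Ioc (u 0) (u (j + 1))) ξ * indC (Ico (v (j + 1)) (v (j + 2))) η

/-- The interval `-(u_0,u_j] - [v_j, v_{j+1})`. -/
def Iuv (u v : ℕ → ℝ) (j : ℕ) : Set ℝ :=
  mink2 (Ioc (u 0) (u j)) (Ico (v j) (v (j + 1)))

/-- The frequency projection `(1_S f̂)^∨`. -/
def fproj (S : Set ℝ) (f : ℝ → ℂ) (x : ℝ) : ℂ := ∫ ξ in S, fourierT f ξ * eChar ξ x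

/-- The `L^p(ℓ²)` norm of the family of frequency projections onto the sets `T i`. -/
def sqNormLp {ι : Type*} (T : ι → Set ℝ) (f : ℝ → ℂ) (p : ℝ) : ℝ≥0∞ :=
  (∫⁻ x : ℝ, (∑' i, ((‖fproj (T i) f x‖₊ : ℝ≥0∞)) ^ 2) ^ (p / 2)) ^ (1 / p)

/-- The collection of connected components of a set `U ⊆ ℝ`. -/
def componentsOf (U : Set ℝ) : Set (Set ℝ) := {S | ∃ x ∈ U, S = connectedComponentIn U x}

/-- A closed Lebesgue-null set `E ⊆ ℝ` is Littlewood–Paley if for every `1 < p < ∞` the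
square function associated with the connected components of `ℝ \ E` is comparable with the
`L^p` norm (stated on the dense class of Schwartz functions). -/
def IsLPSet (E : Set ℝ) : Prop :=
  IsClosed E ∧ volume E = 0 ∧
    ∀ p : ℝ, 1 < p → ∃ c : ℝ, 0 < c ∧ ∃ C : ℝ, 0 < C ∧
      ∀ f : SchwartzMap ℝ ℂ,
        ENNReal.ofReal c * eLpNorm (⇑f) (ENNReal.ofReal p) volume ≤
            sqNormLp (fun ω : componentsOf Eᶜ => (ω : Set ℝ)) (⇑f) p ∧
          sqNormLp (fun ω : componentsOf Eᶜ => (ω : Set ℝ)) (⇑f) p ≤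
            ENNReal.ofReal C * eLpNorm (⇑f) (ENNReal.ofReal p) volume

/-- A strictly monotone real sequence is Littlewood–Paley if the closure of its range is a
Littlewood–Paley set. -/
def IsLPSeq (a : ℕ → ℝ) : Prop := IsLPSet (closure (Set.range a))

/-- A family of (pairwise disjoint) intervals is Littlewood–Paley if for every `1 < p < ∞`
the associated square function is bounded by the `L^p` norm. -/
def IsLPFamily {ι : Type*} (T : ι → Set ℝ) : Prop :=
  ∀ p : ℝ, 1 < p → ∃ C : ℝ, 0 < C ∧ ∀ f : SchwartzMap ℝ ℂ,
    sqNormLp T (⇑f) p ≤ ENNReal.ofReal C * eLpNorm (⇑f) (ENNReal.ofReal p) volume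

/-- Slope of the `j`-th segment of the piecewise linear curve with vertices `(a_j, b_j)`. -/
def pslope (a b : ℕ → ℝ) (j : ℕ) : ℝ := (b j - b (j + 1)) / (a j - a (j + 1))

/-- The epigraph of the piecewise linear curve with vertices `(a_j, b_j)`. -/
def polyEpi (a b : ℕ → ℝ) : Set (ℝ × ℝ) :=
  ⋃ j : ℕ, {p : ℝ × ℝ | a (j + 1) ≤ p.1 ∧ p.1 ≤ a j ∧
    b (j + 1) + pslope a b j * (p.1 - a (j + 1)) ≤ p.2}

end

/-- Complex-valued indicator function of a set in the plane, as a bilinear symbol. -/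
noncomputable def indC2 (S : Set (ℝ × ℝ)) (ξ η : ℝ) : ℂ := S.indicator 1 (ξ, η)

/-! ### Grids and weights -/

/-- The side length of the intervals of the `k`-th generation. -/
noncomputable def len (lam : ℝ) (k : ℤ) : ℝ := lam * 16 ^ k

/-- The index of the interval of generation `k` containing the point `x`. -/
noncomputable def idx (lam : ℝ) (k : ℤ) (x : ℝ) : ℤ := ⌊x / len lam k⌋

/-- The index of the frequency interval of length `(len lam k)⁻¹` containing `ξ`. -/
noncomputable def fidx (lam : ℝ) (k : ℤ) (ξ : ℝ) : ℤ := ⌊ξ * len lam k⌋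

theorem len_pos {lam : ℝ} (h : 0 < lam) (k : ℤ) : 0 < len lam k := by
  unfold len; positivity

theorem len_add_one (lam : ℝ) (k : ℤ) : len lam (k + 1) = 16 * len lam k := by
  unfold len; rw [zpow_add_one₀ (by norm_num)]; ring

theorem len_add_nat (lam : ℝ) (k : ℤ) (i : ℕ) : len lam (k + i) = 16 ^ i * len lam k := by
  unfold len; rw [zpow_add₀ (by norm_num), zpow_natCast]; ring

theorem len_mono {lam : ℝ} (h : 0 < lam) {k k' : ℤ} (hk : k ≤ k') : len lam k ≤ len lam k' := by
  unfold len
  exact mul_le_mul_of_nonneg_left (zpow_le_zpow_right₀ (by norm_num) hk) h.le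

theorem len_lt_of_lt {lam : ℝ} (h : 0 < lam) {k k' : ℤ} (hk : k < k') :
    16 * len lam k ≤ len lam k' := by
  rw [← len_add_one]; exact len_mono h (by omega)

theorem idx_eq_iff {lam : ℝ} (h : 0 < lam) (k n : ℤ) (x : ℝ) :
    idx lam k x = n ↔ len lam k * n ≤ x ∧ x < len lam k * n + len lam k := by
  have hl := len_pos h k
  rw [idx, Int.floor_eq_iff, le_div_iff₀ hl, div_lt_iff₀ hl]
  constructor <;> rintro ⟨h1, h2⟩ <;> constructor <;> linarith

theorem fidx_eq_iff {lam : ℝ} (k l : ℤ) (ξ : ℝ) :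
    fidx lam k ξ = l ↔ (l : ℝ) ≤ ξ * len lam k ∧ ξ * len lam k < l + 1 := by
  rw [fidx, Int.floor_eq_iff]

theorem floor_div_nat (x : ℝ) (m : ℕ) : ⌊x / m⌋ = ⌊x⌋ / (m : ℤ) := by
  exact Int.floor_div_natCast x m

theorem idx_add_nat {lam : ℝ} (k : ℤ) (i : ℕ) (x : ℝ) :
    idx lam (k + i) x = idx lam k x / 16 ^ i := by
  have := floor_div_nat (x / len lam k) (16 ^ i)
  rw [idx, idx, len_add_nat]
  push_cast at this
  rw [← this]; congr 1; field_simp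

theorem fidx_sub_nat {lam : ℝ} (k : ℤ) (i : ℕ) (x : ℝ) :
    fidx lam (k - i) x = fidx lam k x / 16 ^ i := by
  have := floor_div_nat (x * len lam k) (16 ^ i)
  have h2 := len_add_nat lam (k - i) i
  rw [sub_add_cancel] at h2
  rw [fidx, fidx]
  push_cast at this
  rw [← this, h2]; congr 1; field_simp

theorem fidx_sub_one {lam : ℝ} (k : ℤ) (x : ℝ) : fidx lam (k - 1) x = fidx lam k x / 16 := by
  simpa using fidx_sub_nat (lam := lam) k 1 x

theorem idx_congr {lam : ℝ} {k k' : ℤ} (hk : k ≤ k') {x y : ℝ} (h : idx lam k x = idx lam k y) :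
    idx lam k' x = idx lam k' y := by
  obtain ⟨i, rfl⟩ := Int.le.dest hk
  rw [idx_add_nat, idx_add_nat, h]

theorem fidx_congr {lam : ℝ} {k k' : ℤ} (hk : k ≤ k') {x y : ℝ}
    (h : fidx lam k' x = fidx lam k' y) : fidx lam k x = fidx lam k y := by
  obtain ⟨i, rfl⟩ := Int.le.dest hk
  have := fidx_sub_nat (lam := lam) (k + i) i x
  have h2 := fidx_sub_nat (lam := lam) (k + i) i y
  rw [add_sub_cancel_right] at this h2
  rw [this, h2, h]

theorem idx_near_mono {lam : ℝ} {k k' : ℤ} (hk : k ≤ k') {x y : ℝ}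
    (h : |idx lam k x - idx lam k y| ≤ 1) : |idx lam k' x - idx lam k' y| ≤ 1 := by
  obtain ⟨i, rfl⟩ := Int.le.dest hk
  rw [idx_add_nat, idx_add_nat]
  rw [abs_le] at h ⊢
  have h16 : (0 : ℤ) < 16 ^ i := by positivity
  have h1 : (1 : ℤ) ≤ 16 ^ i := h16
  have hm : ∀ u v : ℤ, u - v ≤ 1 → u / 16 ^ i - v / 16 ^ i ≤ 1 := by
    intro u v huv
    have : u ≤ v + 16 ^ i := by linarith
    have h3 := Int.ediv_le_ediv h16 this
    rw [Int.add_ediv_of_dvd_right (dvd_refl _), Int.ediv_self h16.ne'] at h3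
    linarith
  constructor
  · have := hm (idx lam k y) (idx lam k x) (by linarith); linarith
  · exact hm _ _ (by linarith)

theorem measurable_idx (lam : ℝ) (k : ℤ) : Measurable (idx lam k) :=
  (measurable_id.div_const _).floor

theorem measurable_fidx (lam : ℝ) (k : ℤ) : Measurable (fidx lam k) :=
  (measurable_id.mul_const _).floor

theorem measurableSet_idx_eq (lam : ℝ) (k n : ℤ) : MeasurableSet {x | idx lam k x = n} :=
  measurable_idx lam k (measurableSet_singleton n)

theorem idx_setOf_eq {lam : ℝ} (h : 0 < lam) (k n : ℤ) :
    {x | idx lam k x = n} = Ico (len lam k * n) (len lam k * n + len lam k) := by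
  ext x; simp [idx_eq_iff h]

theorem volume_idx_eq {lam : ℝ} (h : 0 < lam) (k n : ℤ) :
    volume {x | idx lam k x = n} = ENNReal.ofReal (len lam k) := by
  rw [idx_setOf_eq h, Real.volume_Ico]; congr 1; ring

theorem abs_sub_lt_of_idx_eq {lam : ℝ} (h : 0 < lam) {k : ℤ} {x y : ℝ}
    (hxy : idx lam k x = idx lam k y) : |x - y| < len lam k := by
  have h1 := (idx_eq_iff h k _ x).1 hxy
  have h2 := (idx_eq_iff h k _ y).1 rfl
  rw [abs_lt]; constructor <;> linarith [h1.1, h1.2, h2.1, h2.2]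

theorem abs_sub_le_of_idx_near {lam : ℝ} (h : 0 < lam) {k : ℤ} {x y : ℝ}
    (hxy : |idx lam k x - idx lam k y| ≤ 1) : |x - y| ≤ 2 * len lam k := by
  have h1 := (idx_eq_iff h k _ x).1 rfl
  have h2 := (idx_eq_iff h k _ y).1 rfl
  have hl := len_pos h k
  have h3 : |(idx lam k x : ℝ) - idx lam k y| ≤ 1 := by exact_mod_cast hxy
  rw [abs_le] at h3 ⊢
  constructor <;> nlinarith [h1.1, h1.2, h2.1, h2.2, h3.1, h3.2]

theorem le_abs_sub_of_idx_far {lam : ℝ} (h : 0 < lam) {k : ℤ} {x y : ℝ}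
    (hxy : ¬ |idx lam k x - idx lam k y| ≤ 1) : len lam k ≤ |x - y| := by
  by_contra hlt
  push Not at hlt
  apply hxy
  have hl := len_pos h k
  have h1 := (idx_eq_iff h k _ x).1 rfl
  have h2 := (idx_eq_iff h k _ y).1 rfl
  rw [abs_lt] at hlt
  have ha : (idx lam k x : ℝ) - idx lam k y < 2 := by
    by_contra hc
    push Not at hc
    nlinarith [h1.1, h1.2, h2.1, h2.2, hlt.1, hlt.2]
  have hb : (idx lam k y : ℝ) - idx lam k x < 2 := by
    by_contra hc
    push Not at hc
    nlinarith [h1.1, h1.2, h2.1, h2.2, hlt.1, hlt.2]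
  have ha' : idx lam k x - idx lam k y < 2 := by exact_mod_cast ha
  have hb' : idx lam k y - idx lam k x < 2 := by exact_mod_cast hb
  rw [abs_le]; omega

/-- The basic decaying weight adapted to the interval of length `L` centred at `c`. -/
noncomputable def wt (c L x : ℝ) : ℝ := (1 + |x - c| / L)⁻¹

section Weight
variable {c c' L L' x y : ℝ}

theorem wt_pos (hL : 0 < L) : 0 < wt c L x := by unfold wt; positivity

theorem wt_nonneg (hL : 0 < L) : 0 ≤ wt c L x := (wt_pos hL).le

theorem wt_le_one (hL : 0 < L) : wt c L x ≤ 1 := by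
  unfold wt; exact inv_le_one_of_one_le₀ (by have : 0 ≤ |x - c| / L := by positivity
                                             linarith)

theorem wt_comm (c L x : ℝ) : wt c L x = wt x L c := by unfold wt; rw [abs_sub_comm]

theorem wt_pow_le_pow (hL : 0 < L) {m n : ℕ} (h : m ≤ n) : wt c L x ^ n ≤ wt c L x ^ m :=
  pow_le_pow_of_le_one (wt_nonneg hL) (wt_le_one hL) h

theorem wt_mul_le (hL : 0 < L) (hL' : 0 < L') (h : L' ≤ L) :
    wt c' L' x * wt c L x ≤ wt c L c' := by
  unfold wt
  rw [← mul_inv]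
  apply inv_anti₀ (by positivity)
  have h1 : |c' - c| ≤ |x - c'| + |x - c| := by
    have := abs_sub_le c' x c; rwa [abs_sub_comm c' x] at this
  have h2 : |x - c'| / L ≤ |x - c'| / L' := div_le_div_of_nonneg_left (abs_nonneg _) hL' h
  have h3 : |c' - c| / L ≤ |x - c'| / L + |x - c| / L := by
    rw [← add_div]; exact div_le_div_of_nonneg_right h1 hL.le
  have h4 : 0 ≤ |x - c'| / L' * (|x - c| / L) := by positivity
  nlinarith

/-- Moving the argument by at most `A * L`. -/
theorem wt_le_of_abs_le (hL : 0 < L) {A : ℝ} (hA : 0 ≤ A) (h : |x - y| ≤ A * L) :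
    wt c L x ≤ (1 + A) * wt c L y := by
  unfold wt
  have h1 : |y - c| ≤ A * L + |x - c| := by
    have := abs_sub_le y x c; rw [abs_sub_comm y x] at this; linarith
  have h2 : |y - c| / L ≤ A + |x - c| / L := by
    rw [div_le_iff₀ hL, add_mul, div_mul_cancel₀ _ hL.ne']; exact h1
  have h3 : 0 ≤ |x - c| / L := by positivity
  rw [inv_le_iff_one_le_mul₀ (by positivity), ← div_eq_mul_inv, div_mul_eq_mul_div, le_div_iff₀ (by positivity)]
  nlinarith

/-- Moving the centre by at most `A * L`. -/
theorem wt_le_of_abs_center_le (hL : 0 < L) {A : ℝ} (hA : 0 ≤ A) (h : |c - c'| ≤ A * L) :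
    wt c L x ≤ (1 + A) * wt c' L x := by
  rw [wt_comm c, wt_comm c']; exact wt_le_of_abs_le hL hA h

theorem wt_mono_len (hL : 0 < L) (h : L ≤ L') : wt c L x ≤ wt c L' x := by
  unfold wt
  have : 0 < L' := hL.trans_le h
  apply inv_anti₀ (by positivity)
  have := div_le_div_of_nonneg_left (abs_nonneg (x - c)) hL h
  linarith

theorem wt_le_div (hL : 0 < L) {d : ℝ} (hd : 0 < d) (h : d ≤ |x - c|) : wt c L x ≤ L / d := by
  unfold wt
  rw [inv_le_comm₀ (by positivity) (by positivity), inv_div]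
  have := div_le_div_of_nonneg_right h hL.le
  linarith

theorem continuous_wt (hL : 0 < L) : Continuous (wt c L) := by
  unfold wt
  refine Continuous.inv₀ (by fun_prop) (fun x => ?_)
  positivity

theorem measurable_wt : Measurable (wt c L) := by
  unfold wt; fun_prop

theorem wt_sq_le (hL : 0 < L) : wt c L x ^ 2 ≤ (1 + ((x - c) / L) ^ 2)⁻¹ := by
  unfold wt
  rw [inv_pow]
  apply inv_anti₀ (by positivity)
  have : ((x - c) / L) ^ 2 = (|x - c| / L) ^ 2 := by rw [div_pow, div_pow, sq_abs]
  rw [this]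
  have : 0 ≤ |x - c| / L := by positivity
  nlinarith

theorem integrable_inv_one_add_sq_scaled (hL : 0 < L) :
    Integrable fun x : ℝ => (1 + ((x - c) / L) ^ 2)⁻¹ :=
  (integrable_inv_one_add_sq.comp_div hL.ne').comp_sub_right c

theorem integrable_wt_pow (hL : 0 < L) {m : ℕ} (hm : 2 ≤ m) :
    Integrable fun x => wt c L x ^ m := by
  refine (integrable_inv_one_add_sq_scaled (c := c) hL).mono'
    ((continuous_wt hL).pow m).aestronglyMeasurable (Filter.Eventually.of_forall fun x => ?_)
  rw [Real.norm_of_nonneg (pow_nonneg (wt_nonneg hL) _)]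
  exact (wt_pow_le_pow hL hm).trans (wt_sq_le hL)

theorem integral_wt_sq_le (hL : 0 < L) : ∫ x, wt c L x ^ 2 ≤ 4 * L := by
  have h1 : ∫ x, wt c L x ^ 2 ≤ ∫ x : ℝ, (1 + ((x - c) / L) ^ 2)⁻¹ :=
    integral_mono (integrable_wt_pow hL le_rfl) (integrable_inv_one_add_sq_scaled hL)
      fun x => wt_sq_le hL
  have h2 : ∫ x : ℝ, (1 + ((x - c) / L) ^ 2)⁻¹ = L * Real.pi := by
    rw [integral_sub_right_eq_self (fun x => (1 + (x / L) ^ 2)⁻¹) c,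
      Measure.integral_comp_div (fun x : ℝ => (1 + x ^ 2)⁻¹) L, integral_univ_inv_one_add_sq,
      abs_of_pos hL, smul_eq_mul]
  nlinarith [Real.pi_le_four]

theorem integral_wt_pow_le (hL : 0 < L) {m : ℕ} (hm : 2 ≤ m) : ∫ x, wt c L x ^ m ≤ 4 * L :=
  (integral_mono (integrable_wt_pow hL hm) (integrable_wt_pow hL le_rfl)
    fun _ => wt_pow_le_pow hL hm).trans (integral_wt_sq_le hL)

theorem lintegral_wt_pow_le (hL : 0 < L) {m : ℕ} (hm : 2 ≤ m) :
    ∫⁻ x, ENNReal.ofReal (wt c L x ^ m) ≤ ENNReal.ofReal (4 * L) := by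
  rw [← ofReal_integral_eq_lintegral_ofReal (integrable_wt_pow hL hm)
    (Filter.Eventually.of_forall fun x => pow_nonneg (wt_nonneg hL) _)]
  exact ENNReal.ofReal_le_ofReal (integral_wt_pow_le hL hm)

end Weight

/-- Sums of integrals over a finite family of sets with bounded overlap. -/
theorem sum_setIntegral_le {ι : Type*} (U : Finset ι) (I : ι → Set ℝ)
    (hI : ∀ i ∈ U, MeasurableSet (I i)) {B : Set ℝ} (hB : MeasurableSet B)
    (hsub : ∀ i ∈ U, I i ⊆ B) {m : ℕ} (V : ℝ → Finset ι) (hV : ∀ x, ∀ i ∈ U, x ∈ I i → i ∈ V x)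
    (hm : ∀ x, (V x).card ≤ m) {h : ℝ → ℝ} (h0 : ∀ x, 0 ≤ h x) (hgInt : Integrable h) :
    ∑ i ∈ U, ∫ x in I i, h x ≤ m * ∫ x in B, h x := by
  classical
  have h1 : ∑ i ∈ U, ∫ x in I i, h x = ∫ x, ∑ i ∈ U, (I i).indicator h x := by
    rw [integral_finsetSum]
    · exact Finset.sum_congr rfl fun i hi => (integral_indicator (hI i hi)).symm
    · exact fun i hi => hgInt.indicator (hI i hi)
  rw [h1, ← integral_const_mul, ← integral_indicator hB]
  refine integral_mono (integrable_finsetSum _ fun i hi => hgInt.indicator (hI i hi))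
    ((hgInt.const_mul _).indicator hB) fun x => ?_
  by_cases hx : x ∈ B
  · rw [indicator_of_mem hx]
    calc ∑ i ∈ U, (I i).indicator h x ≤ ∑ i ∈ U, if i ∈ V x then h x else 0 := by
          refine Finset.sum_le_sum fun i hi => ?_
          by_cases hxi : x ∈ I i
          · rw [indicator_of_mem hxi, if_pos (hV x i hi hxi)]
          · rw [indicator_of_notMem hxi]; split_ifs; exacts [h0 x, le_rfl]
      _ = ((U.filter (· ∈ V x)).card : ℝ) * h x := by
          rw [← Finset.sum_filter, Finset.sum_const, nsmul_eq_mul]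
      _ ≤ m * h x := by
          refine mul_le_mul_of_nonneg_right ?_ (h0 x)
          exact_mod_cast (Finset.card_le_card (fun i hi => (Finset.mem_filter.1 hi).2)).trans (hm x)
  · rw [indicator_of_notMem hx]
    refine (Finset.sum_eq_zero fun i hi => ?_).le
    exact indicator_of_notMem (fun h => hx (hsub i hi h)) _

/-- Sums of weights over the grid of generation `k`. -/
theorem sum_wt_grid_le {t : ℝ} (ht0 : 0 ≤ t) (ht1 : t < 1) {lam : ℝ} (hlam : 0 < lam) (k : ℤ)
    (U : Finset ℤ) (x : ℝ) : ∑ n ∈ U, wt (len lam k * (n + t)) (len lam k) x ^ 2 ≤ 16 := by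
  have hL := len_pos hlam k
  set L := len lam k with hLdef
  have hdist : ∀ n : ℤ, ∀ y, idx lam k y = n → |L * (n + t) - y| ≤ 1 * L := by
    intro n y hy
    have := (idx_eq_iff hlam k n y).1 hy
    rw [abs_le]; constructor <;> nlinarith [this.1, this.2]
  have key : ∀ n : ℤ, L * wt (L * (n + t)) L x ^ 2 ≤
      ∫ y in {y | idx lam k y = n}, 4 * wt x L y ^ 2 := by
    intro n
    have hv : volume.real {y | idx lam k y = n} = L := by
      rw [Measure.real, volume_idx_eq hlam, ENNReal.toReal_ofReal hL.le]
    calc L * wt (L * (n + t)) L x ^ 2 = ∫ y in {y | idx lam k y = n}, wt (L * (n + t)) L x ^ 2 := by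
          rw [setIntegral_const, hv, smul_eq_mul]
      _ ≤ _ := by
          refine setIntegral_mono_on (integrableOn_const (by rw [volume_idx_eq hlam]; simp))
            ((integrable_wt_pow hL le_rfl).const_mul 4).integrableOn (measurableSet_idx_eq _ _ _)
            fun y hy => ?_
          have h1 := wt_le_of_abs_le (c := x) hL zero_le_one (hdist n y hy)
          rw [wt_comm]
          have h2 := wt_nonneg (c := x) (x := L * (n + t)) hL
          calc wt x L (L * (n + t)) ^ 2 ≤ ((1 + 1) * wt x L y) ^ 2 := pow_le_pow_left₀ h2 h1 2
            _ = 4 * wt x L y ^ 2 := by ring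
  have h3 : L * ∑ n ∈ U, wt (L * (n + t)) L x ^ 2 ≤ L * 16 := by
    rw [Finset.mul_sum]
    calc _ ≤ ∑ n ∈ U, ∫ y in {y | idx lam k y = n}, 4 * wt x L y ^ 2 :=
          Finset.sum_le_sum fun n _ => key n
      _ ≤ ((1 : ℕ) : ℝ) * ∫ y in univ, 4 * wt x L y ^ 2 :=
          sum_setIntegral_le U _ (fun n _ => measurableSet_idx_eq _ _ _) MeasurableSet.univ
            (fun _ _ => subset_univ _) (fun y => {idx lam k y})
            (fun y n _ h => Finset.mem_singleton.2 (Eq.symm h)) (fun y => by simp)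
            (fun y => by positivity) ((integrable_wt_pow hL le_rfl).const_mul 4)
      _ ≤ L * 16 := by
          rw [setIntegral_univ, integral_const_mul]
          have := integral_wt_sq_le (c := x) hL
          push_cast; linarith
  exact le_of_mul_le_mul_left h3 hL

/-- A measure with quadratic growth on dyadic dilates integrates the third power of the weight. -/
theorem lintegral_wt_cube_le (ν : Measure ℝ) {p L : ℝ} (hL : 0 < L) (A : ℝ≥0∞)
    (h : ∀ j : ℕ, ν {x | |x - p| ≤ 2 ^ j * L} ≤ A * 4 ^ j) :
    ∫⁻ x, ENNReal.ofReal (wt p L x ^ 3) ∂ν ≤ 16 * A := by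
  have hpt : ∀ x, ENNReal.ofReal (wt p L x ^ 3) ≤
      ∑' j : ℕ, (8 * (1 / 8) ^ j) * ({x | |x - p| ≤ 2 ^ j * L}).indicator 1 x := by
    intro x
    have hex : ∃ j : ℕ, |x - p| ≤ 2 ^ j * L := by
      obtain ⟨j, hj⟩ := pow_unbounded_of_one_lt (|x - p| / L) (one_lt_two)
      exact ⟨j, by rw [div_lt_iff₀ hL] at hj; exact hj.le⟩
    classical
    set j := Nat.find hex with hjdef
    have hj : |x - p| ≤ 2 ^ j * L := Nat.find_spec hex
    refine le_trans ?_ (ENNReal.le_tsum j)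
    rw [indicator_of_mem (by exact hj), Pi.one_apply, mul_one]
    have hw : wt p L x ≤ 2 * (1 / 2) ^ j := by
      rcases Nat.eq_zero_or_pos j with h0 | h0
      · rw [h0]; norm_num; exact (wt_le_one hL).trans (by norm_num)
      · have hlt : ¬ |x - p| ≤ 2 ^ (j - 1) * L := Nat.find_min hex (by omega)
        push Not at hlt
        refine (wt_le_div hL (by positivity) hlt.le).trans (le_of_eq ?_)
        obtain ⟨i, hi⟩ : ∃ i, j = i + 1 := ⟨j - 1, by omega⟩
        rw [hi, Nat.add_sub_cancel]
        rw [pow_succ, one_div, inv_pow]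
        field_simp
    have hw3 : wt p L x ^ 3 ≤ 8 * (1 / 8) ^ j := by
      calc wt p L x ^ 3 ≤ (2 * (1 / 2) ^ j) ^ 3 := pow_le_pow_left₀ (wt_nonneg hL) hw 3
        _ = 8 * (1 / 8) ^ j := by rw [mul_pow, ← pow_mul, mul_comm j 3, pow_mul]; norm_num
    refine (ENNReal.ofReal_le_ofReal hw3).trans (le_of_eq ?_)
    rw [ENNReal.ofReal_mul (by norm_num), ENNReal.ofReal_pow (by norm_num),
      ENNReal.ofReal_div_of_pos (by norm_num)]
    norm_num
  have hms : ∀ j : ℕ, MeasurableSet {x : ℝ | |x - p| ≤ 2 ^ j * L} := fun j =>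
    measurableSet_le (by fun_prop) (by fun_prop)
  calc ∫⁻ x, ENNReal.ofReal (wt p L x ^ 3) ∂ν
      ≤ ∫⁻ x, ∑' j : ℕ, (8 * (1 / 8) ^ j) * ({x | |x - p| ≤ 2 ^ j * L}).indicator 1 x ∂ν :=
        lintegral_mono hpt
    _ = ∑' j : ℕ, (8 * (1 / 8) ^ j) * ν {x | |x - p| ≤ 2 ^ j * L} := by
        rw [lintegral_tsum]
        · congr 1; ext j
          rw [lintegral_const_mul _ (measurable_one.indicator (hms j)),
            lintegral_indicator_one (hms j)]
        · exact fun j => ((measurable_one.indicator (hms j)).const_mul _).aemeasurable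
    _ ≤ ∑' j : ℕ, (8 * A) * (1 / 2) ^ j := by
        refine ENNReal.tsum_le_tsum fun j => ?_
        calc (8 * (1 / 8 : ℝ≥0∞) ^ j) * ν {x | |x - p| ≤ 2 ^ j * L}
            ≤ (8 * (1 / 8 : ℝ≥0∞) ^ j) * (A * 4 ^ j) := by gcongr; exact h j
          _ = (8 * A) * ((1 / 8 * 4 : ℝ≥0∞)) ^ j := by rw [mul_pow]; ring
          _ = (8 * A) * (1 / 2) ^ j := by
              congr 2
              rw [← ENNReal.toReal_eq_toReal_iff' (by finiteness) (by finiteness)]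
              simp only [one_div, ENNReal.toReal_mul, ENNReal.toReal_inv, ENNReal.toReal_ofNat]
              norm_num
    _ = 16 * A := by
        rw [ENNReal.tsum_mul_left]
        have : ∑' j : ℕ, ((1 : ℝ≥0∞) / 2) ^ j = 2 := by
          rw [ENNReal.tsum_geometric, one_div, ENNReal.one_sub_inv_two, inv_inv]
        rw [this]; ring

/-! ### Wave packets -/

section Packets

open scoped FourierTransform SchwartzMap ComplexConjugate ContDiff

/-- The character `u ↦ e^{2πiu}`. -/
noncomputable def ee (u : ℝ) : ℂ := Complex.exp (2 * Real.pi * Complex.I * u)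

theorem ee_add (u v : ℝ) : ee (u + v) = ee u * ee v := by
  unfold ee; rw [← Complex.exp_add]; push_cast; ring_nf

theorem ee_eq (u : ℝ) : ee u = Complex.exp (((2 * Real.pi * u : ℝ) : ℂ) * Complex.I) := by
  unfold ee; push_cast; ring_nf

@[simp] theorem norm_ee (u : ℝ) : ‖ee u‖ = 1 := by
  rw [ee_eq, Complex.norm_exp_ofReal_mul_I]

theorem conj_ee (u : ℝ) : conj (ee u) = ee (-u) := by
  rw [ee_eq, ee_eq, ← Complex.exp_conj, map_mul, Complex.conj_ofReal, Complex.conj_I]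
  push_cast; ring_nf

@[fun_prop] theorem continuous_ee : Continuous ee := by unfold ee; fun_prop

theorem eChar_eq (t x : ℝ) : eChar t x = ee (t * x) := by
  unfold eChar ee; push_cast; ring_nf

theorem norm_ee_sub_ee_le (u v : ℝ) : ‖ee u - ee v‖ ≤ 2 * Real.pi * |u - v| := by
  have h : ee u - ee v = ee v * (Complex.exp (Complex.I * (2 * Real.pi * (u - v) : ℝ)) - 1) := by
    rw [mul_sub, mul_one]; congr 1
    unfold ee; rw [← Complex.exp_add]; push_cast; ring_nf
  rw [h, norm_mul, norm_ee, one_mul]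
  refine (Real.norm_exp_I_mul_ofReal_sub_one_le).trans ?_
  rw [Real.norm_eq_abs, abs_mul, abs_of_pos (by positivity : (0 : ℝ) < 2 * Real.pi)]

theorem fourier_eq_ee (f : ℝ → ℂ) (w : ℝ) : 𝓕 f w = ∫ v, f v * ee (-(v * w)) := by
  rw [Real.fourier_real_eq_integral_exp_smul]
  congr 1; ext v
  rw [smul_eq_mul, mul_comm]; congr 1
  unfold ee; push_cast; ring_nf

theorem fourierInv_eq_ee (f : ℝ → ℂ) (w : ℝ) : 𝓕⁻ f w = ∫ v, f v * ee (v * w) := by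
  rw [Real.fourierInv_eq_fourier_neg, fourier_eq_ee]
  simp

theorem integral_fourier_mul_ee (Ψ : 𝓢(ℝ, ℂ)) (s : ℝ) : ∫ w, 𝓕 (Ψ : ℝ → ℂ) w * ee (w * s) = Ψ s := by
  rw [← fourierInv_eq_ee, Continuous.fourierInv_fourier_eq Ψ.continuous Ψ.integrable]
  rw [← SchwartzMap.fourier_coe]; exact (𝓕 Ψ).integrable

/-- The wave packet with frequency profile `Ψ`, scale `L`, position `z` and modulation `ν`. -/
noncomputable def pk (Ψ : 𝓢(ℝ, ℂ)) (L z ν y : ℝ) : ℂ :=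
  ((√L)⁻¹ : ℝ) * 𝓕 (Ψ : ℝ → ℂ) ((y - z) / L) * ee (ν * (y - z))

theorem continuous_fourier_schwartz (Ψ : 𝓢(ℝ, ℂ)) : Continuous (𝓕 (Ψ : ℝ → ℂ)) := by
  rw [← SchwartzMap.fourier_coe]; exact (𝓕 Ψ).continuous

theorem continuous_pk₂ (Ψ : 𝓢(ℝ, ℂ)) (L z : ℝ) : Continuous fun p : ℝ × ℝ => pk Ψ L z p.1 p.2 := by
  have := continuous_fourier_schwartz Ψ
  unfold pk
  fun_prop

theorem continuous_pk₃ (Ψ : 𝓢(ℝ, ℂ)) (L ν : ℝ) : Continuous fun p : ℝ × ℝ => pk Ψ L p.1 ν p.2 := by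
  have := continuous_fourier_schwartz Ψ
  unfold pk
  fun_prop

theorem continuous_pk (Ψ : 𝓢(ℝ, ℂ)) (L z ν : ℝ) : Continuous (pk Ψ L z ν) := by
  have := continuous_fourier_schwartz Ψ
  unfold pk
  fun_prop

/-- Schwartz functions decay faster than any power of the weight. -/
theorem schwartz_decay (Φ : 𝓢(ℝ, ℂ)) (M : ℕ) :
    ∃ C : ℝ, 0 < C ∧ ∀ L > 0, ∀ z y : ℝ, ‖Φ ((y - z) / L)‖ ≤ C * wt z L y ^ M := by
  refine ⟨2 ^ M * (Finset.Iic ((M, 0) : ℕ × ℕ)).sup (fun m => SchwartzMap.seminorm ℝ m.1 m.2) Φ + 1,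
    by positivity, fun L hL z y => ?_⟩
  have h := SchwartzMap.one_add_le_sup_seminorm_apply (𝕜 := ℝ) (m := (M, 0)) (k := M) (n := 0)
    le_rfl le_rfl Φ ((y - z) / L)
  rw [norm_iteratedFDeriv_zero] at h
  unfold wt
  rw [Real.norm_eq_abs, abs_div, abs_of_pos hL] at h
  have hp : 0 < 1 + |y - z| / L := by positivity
  rw [inv_pow, ← div_eq_mul_inv, le_div_iff₀ (by positivity), mul_comm]
  simp only at h
  linarith

theorem fourier_decay (Ψ : 𝓢(ℝ, ℂ)) (M : ℕ) :
    ∃ C : ℝ, 0 < C ∧ ∀ L > 0, ∀ z y : ℝ,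
      ‖𝓕 (Ψ : ℝ → ℂ) ((y - z) / L)‖ ≤ C * wt z L y ^ M := by
  rw [← SchwartzMap.fourier_coe]; exact schwartz_decay (𝓕 Ψ) M

theorem norm_pk (Ψ : 𝓢(ℝ, ℂ)) (L z ν y : ℝ) :
    ‖pk Ψ L z ν y‖ = (√L)⁻¹ * ‖𝓕 (Ψ : ℝ → ℂ) ((y - z) / L)‖ := by
  unfold pk
  rw [norm_mul, norm_mul, norm_ee, mul_one, Complex.norm_real, Real.norm_of_nonneg (by positivity)]

theorem pk_decay (Ψ : 𝓢(ℝ, ℂ)) (M : ℕ) :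
    ∃ C : ℝ, 0 < C ∧ ∀ L > 0, ∀ z ν y : ℝ, ‖pk Ψ L z ν y‖ ≤ C * (√L)⁻¹ * wt z L y ^ M := by
  obtain ⟨C, hC, h⟩ := fourier_decay Ψ M
  refine ⟨C, hC, fun L hL z ν y => ?_⟩
  rw [norm_pk, mul_comm C, mul_assoc]
  exact mul_le_mul_of_nonneg_left (h L hL z y) (by positivity)

theorem pk_lipschitz_freq (Ψ : 𝓢(ℝ, ℂ)) (M : ℕ) :
    ∃ C : ℝ, 0 < C ∧ ∀ L > 0, ∀ z ν ν' y : ℝ,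
      ‖pk Ψ L z ν y - pk Ψ L z ν' y‖ ≤ C * (√L)⁻¹ * (|ν - ν'| * L) * wt z L y ^ M := by
  obtain ⟨C, hC, h⟩ := fourier_decay Ψ (M + 1)
  refine ⟨C * (2 * Real.pi), by positivity, fun L hL z ν ν' y => ?_⟩
  unfold pk
  rw [← mul_sub, norm_mul, norm_mul, Complex.norm_real, Real.norm_of_nonneg (by positivity)]
  have h1 := norm_ee_sub_ee_le (ν * (y - z)) (ν' * (y - z))
  rw [← sub_mul, abs_mul] at h1
  have h2 : |y - z| * wt z L y ≤ L := by
    unfold wt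
    rw [← div_eq_mul_inv, div_le_iff₀ (by positivity), mul_add, mul_one,
      mul_div_cancel₀ _ hL.ne']
    linarith
  have hw : 0 ≤ wt z L y := wt_nonneg hL
  calc (√L)⁻¹ * ‖𝓕 (Ψ : ℝ → ℂ) ((y - z) / L)‖ * ‖ee (ν * (y - z)) - ee (ν' * (y - z))‖
      ≤ (√L)⁻¹ * (C * wt z L y ^ (M + 1)) * (2 * Real.pi * (|ν - ν'| * |y - z|)) := by
        gcongr
        exact h L hL z y
    _ = C * (2 * Real.pi) * (√L)⁻¹ * (|ν - ν'| * (|y - z| * wt z L y)) * wt z L y ^ M := by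
        rw [pow_succ]; ring
    _ ≤ _ := by gcongr

theorem integrable_pk (Ψ : 𝓢(ℝ, ℂ)) {L : ℝ} (hL : 0 < L) (z ν : ℝ) : Integrable (pk Ψ L z ν) := by
  obtain ⟨C, hC, h⟩ := pk_decay Ψ 2
  exact ((integrable_wt_pow hL le_rfl).const_mul (C * (√L)⁻¹)).mono'
    (continuous_pk Ψ L z ν).aestronglyMeasurable (Filter.Eventually.of_forall fun y => h L hL z ν y)

theorem pk_bounded (Ψ : 𝓢(ℝ, ℂ)) : ∃ C : ℝ, 0 < C ∧ ∀ L > 0, ∀ z ν y : ℝ,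
    ‖pk Ψ L z ν y‖ ≤ C * (√L)⁻¹ := by
  obtain ⟨C, hC, h⟩ := pk_decay Ψ 0
  exact ⟨C, hC, fun L hL z ν y => by simpa using h L hL z ν y⟩

theorem integral_comp_sub_div {L : ℝ} (hL : 0 < L) (G : ℝ → ℂ) (z : ℝ) :
    ∫ y, G ((y - z) / L) = L • ∫ y, G y := by
  rw [integral_sub_right_eq_self (fun y => G (y / L)) z, Measure.integral_comp_div G L,
    abs_of_pos hL]

/-- The Fourier transform of a wave packet. -/
theorem integral_pk_mul_ee (Ψ : 𝓢(ℝ, ℂ)) {L : ℝ} (hL : 0 < L) (z ν ξ : ℝ) :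
    ∫ y, pk Ψ L z ν y * ee (-(ξ * y)) = (√L : ℝ) * Ψ (L * (ν - ξ)) * ee (-(ξ * z)) := by
  have h1 : ∀ y, pk Ψ L z ν y * ee (-(ξ * y)) = (fun w => ((√L)⁻¹ : ℝ) * ee (-(ξ * z)) *
      (𝓕 (Ψ : ℝ → ℂ) w * ee (w * (L * (ν - ξ))))) ((y - z) / L) := by
    intro y
    have h2 : ee ((y - z) / L * (L * (ν - ξ))) = ee (ν * (y - z)) * ee (-(ξ * (y - z))) := by
      rw [← ee_add]; congr 1; field_simp
      ring
    have h3 : ee (-(ξ * y)) = ee (-(ξ * z)) * ee (-(ξ * (y - z))) := by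
      rw [← ee_add]; congr 1; ring
    simp only [pk, h2, h3]; ring
  rw [integral_congr_ae (Filter.Eventually.of_forall h1), integral_comp_sub_div hL (fun w =>
    ((√L)⁻¹ : ℝ) * ee (-(ξ * z)) * (𝓕 (Ψ : ℝ → ℂ) w * ee (w * (L * (ν - ξ))))),
    integral_const_mul, integral_fourier_mul_ee]
  rw [Complex.real_smul]
  have : (L : ℂ) * ((√L)⁻¹ : ℝ) = (√L : ℝ) := by
    rw [← Complex.ofReal_mul]; congr 1
    rw [← div_eq_mul_inv, Real.div_sqrt]
  rw [← this]; ring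

/-- Pairing of a wave packet with an integrable function, on the frequency side. -/
theorem integral_pk_mul (Ψ : 𝓢(ℝ, ℂ)) (L z ν : ℝ) {g : ℝ → ℂ} (hg : Integrable g) :
    ∫ y, pk Ψ L z ν y * g y = ((√L)⁻¹ : ℝ) *
      ∫ v, Ψ v * ee ((v / L - ν) * z) * ∫ y, g y * ee (-((v / L - ν) * y)) := by
  have h1 : ∀ y, pk Ψ L z ν y * g y = ((√L)⁻¹ : ℝ) *
      ∫ v, Ψ v * ee ((v / L - ν) * z) * (g y * ee (-((v / L - ν) * y))) := by
    intro y
    rw [pk, fourier_eq_ee, mul_assoc, mul_assoc, ← integral_mul_const]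
    congr 2; ext v
    have : ee (-(v * ((y - z) / L))) * ee (ν * (y - z)) =
        ee ((v / L - ν) * z) * ee (-((v / L - ν) * y)) := by
      rw [← ee_add, ← ee_add]; congr 1; ring
    calc _ = Ψ v * (ee (-(v * ((y - z) / L))) * ee (ν * (y - z))) * g y := by ring
      _ = _ := by rw [this]; ring
  simp_rw [h1]
  rw [integral_const_mul, integral_integral_swap]
  · simp_rw [integral_const_mul]
  · refine ((hg.mul_prod Ψ.integrable).norm).mono' ?_ (Filter.Eventually.of_forall fun p => ?_)
    · refine AEStronglyMeasurable.mul ?_ (AEStronglyMeasurable.mul ?_ ?_)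
      · have := Ψ.continuous
        exact Continuous.aestronglyMeasurable (by fun_prop)
      · exact hg.1.comp_fst
      · exact Continuous.aestronglyMeasurable (by fun_prop)
    · simp only [Function.uncurry, norm_mul, norm_ee, mul_one]
      rw [mul_comm]

theorem conj_pk_mul_ee (Ψ : 𝓢(ℝ, ℂ)) {L : ℝ} (hL : 0 < L) (z ν ξ : ℝ) :
    ∫ y, conj (pk Ψ L z ν y) * ee (-(ξ * y)) =
      conj ((√L : ℝ) * Ψ (L * (ν + ξ)) * ee (ξ * z)) := by
  have := integral_pk_mul_ee Ψ hL z ν (-ξ)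
  simp only [neg_mul, neg_neg, sub_neg_eq_add] at this
  rw [← this, ← integral_conj]
  congr 1; ext y
  rw [map_mul, conj_ee]

/-- Wave packets with disjoint frequency supports are orthogonal. -/
theorem integral_pk_mul_conj_pk_eq_zero (Ψ Ψ' : 𝓢(ℝ, ℂ)) {L L' : ℝ} (hL' : 0 < L')
    (z z' ν ν' : ℝ)
    (h : ∀ v v', Ψ v ≠ 0 → Ψ' v' ≠ 0 → ν - v / L ≠ ν' - v' / L') :
    ∫ y, pk Ψ L z ν y * conj (pk Ψ' L' z' ν' y) = 0 := by
  rw [integral_pk_mul _ _ _ _ (by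
    simpa using (Complex.conjCLE.toContinuousLinearMap.integrable_comp
      (integrable_pk Ψ' hL' z' ν')))]
  rw [integral_eq_zero_of_ae, mul_zero]
  refine Filter.Eventually.of_forall fun v => ?_
  simp only [Pi.zero_apply]
  rw [conj_pk_mul_ee _ hL']
  by_cases h1 : Ψ v = 0
  · rw [h1]; ring
  by_cases h2 : Ψ' (L' * (ν' + (v / L - ν))) = 0
  · rw [h2]; simp
  exfalso
  apply h v _ h1 h2
  rw [mul_div_cancel_left₀ _ hL'.ne']; ring

theorem integral_pk_mul_norm_le (Ψ Ψ' : 𝓢(ℝ, ℂ)) (M : ℕ) :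
    ∃ C : ℝ, 0 < C ∧ ∀ L L' : ℝ, 0 < L' → L' ≤ L → ∀ z z' ν ν' : ℝ,
      ∫ y, ‖pk Ψ L z ν y‖ * ‖pk Ψ' L' z' ν' y‖ ≤ C * √(L' / L) * wt z L z' ^ M := by
  obtain ⟨C, hC, h⟩ := pk_decay Ψ M
  obtain ⟨C', hC', h'⟩ := pk_decay Ψ' (M + 2)
  refine ⟨C * C' * 4, by positivity, fun L L' hL' hLL z z' ν ν' => ?_⟩
  have hL : 0 < L := hL'.trans_le hLL
  have hpt : ∀ y, ‖pk Ψ L z ν y‖ * ‖pk Ψ' L' z' ν' y‖ ≤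
      (C * C' * ((√L)⁻¹ * (√L')⁻¹) * wt z L z' ^ M) * wt z' L' y ^ 2 := by
    intro y
    have hw := wt_mul_le (c := z) (c' := z') (x := y) hL hL' hLL
    have hw1 := wt_nonneg (c := z) (x := y) hL
    have hw2 := wt_nonneg (c := z') (x := y) hL'
    calc _ ≤ (C * (√L)⁻¹ * wt z L y ^ M) * (C' * (√L')⁻¹ * wt z' L' y ^ (M + 2)) := by
          gcongr
          · exact h L hL z ν y
          · exact h' L' hL' z' ν' y
      _ = (C * C' * ((√L)⁻¹ * (√L')⁻¹) * (wt z' L' y * wt z L y) ^ M) * wt z' L' y ^ 2 := by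
          rw [mul_pow]; ring
      _ ≤ _ := by gcongr
  calc _ ≤ ∫ y, (C * C' * ((√L)⁻¹ * (√L')⁻¹) * wt z L z' ^ M) * wt z' L' y ^ 2 := by
        refine integral_mono_of_nonneg (Filter.Eventually.of_forall fun y => by positivity)
          ((integrable_wt_pow hL' le_rfl).const_mul _) (Filter.Eventually.of_forall hpt)
    _ ≤ (C * C' * ((√L)⁻¹ * (√L')⁻¹) * wt z L z' ^ M) * (4 * L') := by
        rw [integral_const_mul]
        have hw := wt_nonneg (c := z) (x := z') hL
        exact mul_le_mul_of_nonneg_left (integral_wt_sq_le hL') (by positivity)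
    _ = _ := by
        rw [Real.sqrt_div' _ hL.le]
        have : √L' * √L' = L' := Real.mul_self_sqrt hL'.le
        have h3 : √L' ≠ 0 := (Real.sqrt_pos.2 hL').ne'
        have h4 : √L ≠ 0 := (Real.sqrt_pos.2 hL).ne'
        field_simp
        rw [pow_two, this]; ring

theorem norm_integral_pk_mul_conj_le (Ψ Ψ' : 𝓢(ℝ, ℂ)) (M : ℕ) :
    ∃ C : ℝ, 0 < C ∧ ∀ L L' : ℝ, 0 < L' → L' ≤ L → ∀ z z₁ ν ν₁ : ℝ,
      ‖∫ y, pk Ψ L z ν y * conj (pk Ψ' L' z₁ ν₁ y)‖ ≤ C * √(L' / L) * wt z L z₁ ^ M := by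
  obtain ⟨C, hC, h⟩ := integral_pk_mul_norm_le Ψ Ψ' M
  refine ⟨C, hC, fun L L' hL' hLL z z₁ ν ν₁ => ?_⟩
  refine (norm_integral_le_integral_norm _).trans ?_
  simpa [norm_mul] using h L L' hL' hLL z z₁ ν ν₁

/-- Action of a smooth low-pass filter on a wave packet. -/
theorem integral_lowpass_mul_pk (θ Ψ : 𝓢(ℝ, ℂ)) {L L' : ℝ} (hL : 0 < L)
    (x z ν ξ : ℝ) (c : ℂ) (h : ∀ v, Ψ v ≠ 0 → θ (-(L * ((ξ - ν) + v / L'))) = c) :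
    ((√L)⁻¹ : ℝ) * ∫ y, pk θ L x (-ξ) y * pk Ψ L' z ν y = c * pk Ψ L' z ν x := by
  have h1 : ∫ y, pk θ L x (-ξ) y * pk Ψ L' z ν y = ∫ y, pk Ψ L' z ν y * pk θ L x (-ξ) y := by
    congr 1; ext y; ring
  rw [h1, integral_pk_mul _ _ _ _ (integrable_pk θ hL x (-ξ))]
  simp_rw [integral_pk_mul_ee θ hL]
  have h2 : ∀ v, Ψ v * ee ((v / L' - ν) * z) *
      ((√L : ℝ) * θ (L * (-ξ - (v / L' - ν))) * ee (-((v / L' - ν) * x))) =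
      ((√L : ℝ) * c * ee (ν * (x - z))) * (Ψ v * ee (-(v * ((x - z) / L')))) := by
    intro v
    by_cases hv : Ψ v = 0
    · rw [hv]; ring
    have h3 : θ (L * (-ξ - (v / L' - ν))) = c := by
      rw [← h v hv]; congr 1; ring
    have h4 : ee (ν * (x - z)) * ee (-(v * ((x - z) / L'))) =
        ee ((v / L' - ν) * z) * ee (-((v / L' - ν) * x)) := by
      rw [← ee_add, ← ee_add]; congr 1; ring
    rw [h3]
    calc _ = (√L : ℝ) * c * Ψ v * (ee ((v / L' - ν) * z) * ee (-((v / L' - ν) * x))) := by ring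
      _ = _ := by rw [← h4]; ring
  simp_rw [h2]
  rw [integral_const_mul, ← fourier_eq_ee, pk]
  have h5 : (((√L)⁻¹ : ℝ) : ℂ) * (√L : ℝ) = 1 := by
    rw [← Complex.ofReal_mul, inv_mul_cancel₀ (Real.sqrt_pos.2 hL).ne', Complex.ofReal_one]
  linear_combination (c * ((√L')⁻¹ : ℝ) * 𝓕 (Ψ : ℝ → ℂ) ((x - z) / L') * ee (ν * (x - z))) * h5

theorem fourier_neg_arg (Ψ Ψ' : 𝓢(ℝ, ℂ)) (h : ∀ v, Ψ' v = Ψ (-v)) (w : ℝ) :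
    𝓕 (Ψ' : ℝ → ℂ) w = 𝓕 (Ψ : ℝ → ℂ) (-w) := by
  rw [fourier_eq_ee, fourier_eq_ee, ← integral_neg_eq_self]
  congr 1; ext v
  rw [h]; simp

theorem pk_swap (Ψ Ψ' : 𝓢(ℝ, ℂ)) (h : ∀ v, Ψ' v = Ψ (-v)) (L z ν y : ℝ) :
    pk Ψ L z ν y = pk Ψ' L y (-ν) z := by
  unfold pk
  rw [fourier_neg_arg Ψ Ψ' h]
  have h1 : -((z - y) / L) = (y - z) / L := by ring
  have h2 : -ν * (z - y) = ν * (y - z) := by ring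
  rw [h1, h2]

/-- Reproducing formula: integrating over all positions gives back the convolution kernel. -/
theorem integral_pk_mul_pk (χ ζ : 𝓢(ℝ, ℂ)) {L : ℝ} (hL : 0 < L) (N μ x y : ℝ)
    (h : ∀ v, ζ v ≠ 0 → χ (L * N - L * μ - v) = 1) :
    ∫ z, pk ζ L z N x * pk χ L z (-μ) y = ee (N * (x - y)) * 𝓕 (ζ : ℝ → ℂ) ((x - y) / L) := by
  obtain ⟨ζ', hζ'⟩ : ∃ ζ' : 𝓢(ℝ, ℂ), ∀ v, ζ' v = ζ (-v) :=
    ⟨SchwartzMap.compCLMOfContinuousLinearEquiv ℝ (ContinuousLinearEquiv.neg ℝ) ζ, fun v => rfl⟩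
  obtain ⟨χ', hχ'⟩ : ∃ χ' : 𝓢(ℝ, ℂ), ∀ v, χ' v = χ (-v) :=
    ⟨SchwartzMap.compCLMOfContinuousLinearEquiv ℝ (ContinuousLinearEquiv.neg ℝ) χ, fun v => rfl⟩
  simp_rw [pk_swap ζ ζ' hζ', pk_swap χ χ' hχ', neg_neg]
  rw [integral_pk_mul _ _ _ _ (integrable_pk χ' hL y μ)]
  simp_rw [integral_pk_mul_ee χ' hL]
  have h2 : ∀ v, ζ' v * ee ((v / L - -N) * x) *
      ((√L : ℝ) * χ' (L * (μ - (v / L - -N))) * ee (-((v / L - -N) * y))) =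
      ((√L : ℝ) * ee (N * (x - y))) * (ζ' v * ee (-(v * (-((x - y) / L))))) := by
    intro v
    by_cases hv : ζ' v = 0
    · rw [hv]; ring
    have h3 : χ' (L * (μ - (v / L - -N))) = 1 := by
      rw [hχ', ← h (-v) (by rwa [← hζ'])]; congr 1; field_simp; ring
    have h4 : ee (N * (x - y)) * ee (-(v * (-((x - y) / L)))) =
        ee ((v / L - -N) * x) * ee (-((v / L - -N) * y)) := by
      rw [← ee_add, ← ee_add]; congr 1; ring
    rw [h3]
    calc _ = (√L : ℝ) * ζ' v * (ee ((v / L - -N) * x) * ee (-((v / L - -N) * y))) := by ring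
      _ = _ := by rw [← h4]; ring
  simp_rw [h2]
  rw [integral_const_mul, ← fourier_eq_ee, fourier_neg_arg ζ ζ' hζ', neg_neg]
  have h5 : (((√L)⁻¹ : ℝ) : ℂ) * (√L : ℝ) = 1 := by
    rw [← Complex.ofReal_mul, inv_mul_cancel₀ (Real.sqrt_pos.2 hL).ne', Complex.ofReal_one]
  linear_combination (𝓕 (ζ : ℝ → ℂ) ((x - y) / L) * ee (N * (x - y))) * h5

end Packets

/-! ### Tiles, tops and the energy decomposition -/

/-- A tile: generation, position index and frequency index. -/
structure Tile where
  k : ℤ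
  n : ℤ
  l : ℤ

/-- The top of a tree: generation and position index of an interval, and a frequency. -/
structure TreeTop where
  k : ℤ
  m : ℤ
  ξ : ℝ

/-- The left endpoint of the spatial interval of a tile. -/
noncomputable def Tile.pt (lam : ℝ) (s : Tile) : ℝ := len lam s.k * s.n

/-- The centre of the wave packet of a tile. -/
noncomputable def Tile.ctr (lam t : ℝ) (s : Tile) : ℝ := len lam s.k * (s.n + t)

/-- The tile `s` belongs to the maximal tree with top `τ`. -/
def Under (lam : ℝ) (s : Tile) (τ : TreeTop) : Prop :=
  s.k ≤ τ.k ∧ idx lam τ.k (s.pt lam) = τ.m ∧ fidx lam (s.k - 1) τ.ξ = s.l / 16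

/-- The tile `s` belongs to the maximal lacunary tree with top `τ`. -/
def Lac (lam : ℝ) (s : Tile) (τ : TreeTop) : Prop :=
  s.k ≤ τ.k ∧ idx lam τ.k (s.pt lam) = τ.m ∧ fidx lam s.k τ.ξ = s.l

/-- The frequency `η` lies in the interval carrying the wave packet of `s`. -/
def InPacket (lam : ℝ) (s : Tile) (η : ℝ) : Prop :=
  s.l - 13 ≤ fidx lam s.k η ∧ fidx lam s.k η ≤ s.l - 2

open scoped Classical in
/-- The energy of the coefficients `a` on the collection `S` is at most `ε`. -/
def EnergyLE (lam : ℝ) (a : Tile → ℝ) (S : Finset Tile) (ε : ℝ) : Prop :=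
  ∀ τ : TreeTop, ∑ s ∈ S.filter (Lac lam · τ), a s ^ 2 ≤ ε ^ 2 * len lam τ.k

theorem Lac.under {lam : ℝ} {s : Tile} {τ : TreeTop} (h : Lac lam s τ) : Under lam s τ :=
  ⟨h.1, h.2.1, by rw [fidx_sub_one, h.2.2]⟩

section TileLemmas
variable {lam t : ℝ}

theorem idx_pt (h : 0 < lam) (s : Tile) : idx lam s.k (s.pt lam) = s.n := by
  have := len_pos h s.k
  rw [idx_eq_iff h, Tile.pt]; constructor <;> linarith

theorem idx_ctr (h : 0 < lam) (ht0 : 0 ≤ t) (ht1 : t < 1) (s : Tile) :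
    idx lam s.k (s.ctr lam t) = s.n := by
  have := len_pos h s.k
  rw [idx_eq_iff h, Tile.ctr]; constructor <;> nlinarith

theorem idx_ctr_eq_pt (h : 0 < lam) (ht0 : 0 ≤ t) (ht1 : t < 1) (s : Tile) {K : ℤ}
    (hK : s.k ≤ K) : idx lam K (s.ctr lam t) = idx lam K (s.pt lam) :=
  idx_congr hK (by rw [idx_pt h, idx_ctr h ht0 ht1])

theorem fidx_left (h : 0 < lam) (s : Tile) : fidx lam s.k (s.l / len lam s.k) = s.l := by
  have := len_pos h s.k
  rw [fidx_eq_iff, div_mul_cancel₀ _ this.ne']; constructor <;> linarith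

theorem lt_of_fidx_lt {k : ℤ} (h : 0 < lam) {ξ η : ℝ} (hlt : fidx lam k ξ < fidx lam k η) :
    ξ < η := by
  by_contra hc
  push Not at hc
  have := len_pos h k
  exact absurd (Int.floor_mono (mul_le_mul_of_nonneg_right hc this.le)) (not_le.2 hlt)

theorem InPacket.fidx_sub_one {s : Tile} (hg : 13 ≤ s.l % 16) {η : ℝ} (h : InPacket lam s η) :
    fidx lam (s.k - 1) η = s.l / 16 := by
  rw [_root_.fidx_sub_one]
  obtain ⟨h1, h2⟩ := h
  omega

/-- If the packet frequencies of two tiles of different generations meet, the coarse frequency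
interval of the larger tile is contained in the packet interval of the smaller one. -/
theorem InPacket.of_overlap {s s' : Tile} (hg : 13 ≤ s.l % 16) (hk : s'.k < s.k)
    {η : ℝ} (h : InPacket lam s η) (h' : InPacket lam s' η) {ξ : ℝ}
    (hξ : fidx lam (s.k - 1) ξ = s.l / 16) : InPacket lam s' ξ := by
  have h1 := h.fidx_sub_one hg
  have : fidx lam s'.k ξ = fidx lam s'.k η := fidx_congr (by omega) (hξ.trans h1.symm)
  unfold InPacket
  rw [this]; exact h'

theorem sum_len_le (h : 0 < lam) (A : Finset ℤ) (K : ℤ) (hA : ∀ k ∈ A, k ≤ K) :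
    ∑ k ∈ A, len lam k ≤ 2 * len lam K := by
  have hinj : Set.InjOn (fun k : ℤ => (K - k).toNat) A := by
    intro k hk k' hk' he
    have := hA k hk; have := hA k' hk'
    simp only at he; omega
  have hterm : ∀ k ∈ A, len lam k = len lam K * (1 / 16) ^ (K - k).toNat := by
    intro k hk
    have h1 := len_add_nat lam k (K - k).toNat
    have h2 : k + ((K - k).toNat : ℤ) = K := by have := hA k hk; omega
    rw [h2] at h1
    rw [h1, one_div, inv_pow]
    field_simp
  rw [Finset.sum_congr rfl hterm, ← Finset.mul_sum,
    ← Finset.sum_image (f := fun i : ℕ => (1 / 16 : ℝ) ^ i) hinj]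
  have hs : Summable fun i : ℕ => (1 / 16 : ℝ) ^ i :=
    summable_geometric_of_lt_one (by norm_num) (by norm_num)
  have h3 : ∑ i ∈ A.image (fun k : ℤ => (K - k).toNat), (1 / 16 : ℝ) ^ i ≤ 2 := by
    refine (hs.sum_le_tsum _ fun i _ => by positivity).trans ?_
    rw [tsum_geometric_of_lt_one (by norm_num) (by norm_num)]; norm_num
  have := len_pos h K
  nlinarith

open scoped Classical in
theorem sum_by_scale (h : 0 < lam) (T : Finset Tile) (f : Tile → ℝ) {C : ℝ} (hC : 0 ≤ C) {K : ℤ}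
    (hk : ∀ s ∈ T, s.k ≤ K)
    (hf : ∀ k ≤ K, ∑ s ∈ T.filter (·.k = k), f s ≤ C * len lam k) :
    ∑ s ∈ T, f s ≤ 2 * C * len lam K := by
  rw [← Finset.sum_fiberwise_of_maps_to (t := T.image Tile.k)
    (fun s hs => Finset.mem_image_of_mem _ hs)]
  have hA : ∀ k ∈ T.image Tile.k, k ≤ K := by
    intro k hk'
    obtain ⟨s, hs, rfl⟩ := Finset.mem_image.1 hk'
    exact hk s hs
  calc _ ≤ ∑ k ∈ T.image Tile.k, C * len lam k := Finset.sum_le_sum fun k hk' => hf k (hA k hk')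
    _ ≤ C * (2 * len lam K) := by
        rw [← Finset.mul_sum]; exact mul_le_mul_of_nonneg_left (sum_len_le h _ K hA) hC
    _ = _ := by ring

open scoped Classical in
/-- Sums of weights over tiles of one generation with few frequency indices. -/
theorem sum_wt_tiles_le (ht0 : 0 ≤ t) (ht1 : t < 1) (h : 0 < lam) (k : ℤ) (T : Finset Tile)
    (hT : ∀ s ∈ T, s.k = k) (A : Finset ℤ) (hA : ∀ s ∈ T, s.l ∈ A) (x : ℝ) :
    ∑ s ∈ T, wt (s.ctr lam t) (len lam k) x ^ 2 ≤ 16 * A.card := by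
  have hL := len_pos h k
  rw [← Finset.sum_fiberwise_of_maps_to (t := T.image Tile.n)
    (fun s hs => Finset.mem_image_of_mem _ hs)]
  calc _ ≤ ∑ n ∈ T.image Tile.n, A.card * wt (len lam k * (n + t)) (len lam k) x ^ 2 := by
        refine Finset.sum_le_sum fun n _ => ?_
        have h1 : ∀ s ∈ T.filter (·.n = n), wt (s.ctr lam t) (len lam k) x ^ 2 =
            wt (len lam k * (n + t)) (len lam k) x ^ 2 := by
          intro s hs
          obtain ⟨hs1, hs2⟩ := Finset.mem_filter.1 hs
          rw [Tile.ctr, hT s hs1, hs2]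
        rw [Finset.sum_congr rfl h1, Finset.sum_const, nsmul_eq_mul]
        refine mul_le_mul_of_nonneg_right ?_ (by positivity)
        have : (T.filter (·.n = n)).card ≤ A.card := by
          refine Finset.card_le_card_of_injOn Tile.l
            (fun s hs => hA s (Finset.mem_filter.1 hs).1) ?_
          intro s hs s' hs' he
          obtain ⟨hs1, hs2⟩ := Finset.mem_filter.1 hs
          obtain ⟨hs1', hs2'⟩ := Finset.mem_filter.1 hs'
          have e1 := hT s hs1
          have e2 := hT s' hs1'
          cases s; cases s'
          simp_all
        exact_mod_cast this
    _ ≤ A.card * 16 := by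
        rw [← Finset.mul_sum]
        exact mul_le_mul_of_nonneg_left (sum_wt_grid_le ht0 ht1 h k _ x) (by positivity)
    _ = _ := by ring

/-- A value of the weight is controlled by its average over a short interval. -/
theorem len_mul_wt_le_integral (h : 0 < lam) {k n : ℤ} {c L : ℝ} (hkL : len lam k ≤ L) {y : ℝ}
    (hy : idx lam k y = n) {M : ℕ} (hM : 2 ≤ M) :
    len lam k * wt c L y ^ M ≤ 2 ^ M * ∫ x in {x | idx lam k x = n}, wt c L x ^ M := by
  have hl := len_pos h k
  have hL := hl.trans_le hkL
  have hv : volume.real {y | idx lam k y = n} = len lam k := by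
    rw [Measure.real, volume_idx_eq h, ENNReal.toReal_ofReal hl.le]
  rw [← integral_const_mul]
  calc len lam k * wt c L y ^ M = ∫ x in {x | idx lam k x = n}, wt c L y ^ M := by
        rw [setIntegral_const, hv, smul_eq_mul]
    _ ≤ _ := by
        refine setIntegral_mono_on (integrableOn_const (by rw [volume_idx_eq h]; simp))
          ((integrable_wt_pow hL hM).const_mul _).integrableOn (measurableSet_idx_eq _ _ _)
          fun x hx => ?_
        have h1 : |y - x| ≤ 1 * L := by
          rw [one_mul]; exact (abs_sub_lt_of_idx_eq h (hy.trans hx.symm)).le.trans hkL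
        have h2 := wt_le_of_abs_le (c := c) hL zero_le_one h1
        rw [← mul_pow]
        exact pow_le_pow_left₀ (wt_nonneg hL) (by linarith) M

theorem wt_sq_le_endpoints (h : 0 < lam) {K m : ℤ} {c L x : ℝ} (hL : 0 < L)
    (hc : idx lam K c = m) (hx : idx lam K x ≠ m) :
    wt c L x ^ 2 ≤ wt (len lam K * m) L x ^ 2 + wt (len lam K * (m + 1)) L x ^ 2 := by
  have h1 := (idx_eq_iff h K m c).1 hc
  have h2 : x < len lam K * m ∨ len lam K * m + len lam K ≤ x := by
    by_contra hcon
    push Not at hcon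
    exact hx ((idx_eq_iff h K m x).2 hcon)
  have hmono : ∀ p : ℝ, |x - p| ≤ |x - c| → wt c L x ^ 2 ≤ wt p L x ^ 2 := by
    intro p hp
    refine pow_le_pow_left₀ (wt_nonneg hL) ?_ 2
    unfold wt
    apply inv_anti₀ (by positivity)
    have := div_le_div_of_nonneg_right hp hL.le
    linarith
  rcases h2 with h2 | h2
  · have := hmono (len lam K * m) (by
      rw [abs_of_nonpos (by linarith), abs_of_nonpos (by linarith)]; linarith)
    have h3 : 0 ≤ wt (len lam K * (m + 1)) L x ^ 2 := by positivity
    linarith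
  · have := hmono (len lam K * (m + 1)) (by
      rw [abs_of_nonneg (by linarith), abs_of_nonneg (by linarith)]; linarith)
    have h3 : 0 ≤ wt (len lam K * m) L x ^ 2 := by positivity
    linarith

open scoped Classical in
/-- The tails of the packets of a lacunary tree outside the top interval. -/
theorem sum_lac_tail_le (ht0 : 0 ≤ t) (ht1 : t < 1) (h : 0 < lam) (T : Finset Tile) (τ : TreeTop)
    (hT : ∀ s ∈ T, Lac lam s τ) :
    ∑ s ∈ T, ∫ x in {x | idx lam τ.k x ≠ τ.m}, wt (s.ctr lam t) (len lam s.k) x ^ 4 ≤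
      256 * len lam τ.k := by
  have hms : MeasurableSet {x | idx lam τ.k x ≠ τ.m} := (measurableSet_idx_eq lam τ.k τ.m).compl
  have := sum_by_scale h T (fun s => ∫ x in {x | idx lam τ.k x ≠ τ.m},
    wt (s.ctr lam t) (len lam s.k) x ^ 4) (C := 128) (by norm_num) (K := τ.k)
    (fun s hs => (hT s hs).1) ?_
  · linarith
  intro k hk
  have hL := len_pos h k
  have e1 : ∀ s ∈ T.filter (·.k = k), ∫ x in {x | idx lam τ.k x ≠ τ.m},
      wt (s.ctr lam t) (len lam s.k) x ^ 4 = ∫ x in {x | idx lam τ.k x ≠ τ.m},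
      wt (s.ctr lam t) (len lam k) x ^ 4 := by
    intro s hs; rw [(Finset.mem_filter.1 hs).2]
  rw [Finset.sum_congr rfl e1, ← integral_finsetSum _ fun s _ =>
    (integrable_wt_pow hL (by norm_num)).integrableOn]
  set p := len lam τ.k * τ.m
  set q := len lam τ.k * (τ.m + 1)
  have hgInt : Integrable fun x => 16 * (wt p (len lam k) x ^ 2 + wt q (len lam k) x ^ 2) :=
    ((integrable_wt_pow hL le_rfl).add (integrable_wt_pow hL le_rfl)).const_mul 16
  calc _ ≤ ∫ x in {x | idx lam τ.k x ≠ τ.m},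
        16 * (wt p (len lam k) x ^ 2 + wt q (len lam k) x ^ 2) := by
        refine setIntegral_mono_on (integrable_finsetSum _ fun s _ =>
          (integrable_wt_pow hL (by norm_num)).integrableOn) hgInt.integrableOn hms fun x hx => ?_
        calc _ ≤ ∑ s ∈ T.filter (·.k = k), wt (s.ctr lam t) (len lam k) x ^ 2 *
              (wt p (len lam k) x ^ 2 + wt q (len lam k) x ^ 2) := by
              refine Finset.sum_le_sum fun s hs => ?_
              obtain ⟨hs1, hs2⟩ := Finset.mem_filter.1 hs
              have hl := hT s hs1
              have hc : idx lam τ.k (s.ctr lam t) = τ.m := by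
                rw [idx_ctr_eq_pt h ht0 ht1 s hl.1, hl.2.1]
              have := wt_sq_le_endpoints h hL hc hx
              calc wt (s.ctr lam t) (len lam k) x ^ 4 = wt (s.ctr lam t) (len lam k) x ^ 2 *
                    wt (s.ctr lam t) (len lam k) x ^ 2 := by ring
                _ ≤ _ := mul_le_mul_of_nonneg_left this (by positivity)
          _ ≤ 16 * (({fidx lam k τ.ξ} : Finset ℤ).card : ℝ) *
              (wt p (len lam k) x ^ 2 + wt q (len lam k) x ^ 2) := by
              rw [← Finset.sum_mul]
              refine mul_le_mul_of_nonneg_right ?_ (by positivity)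
              refine sum_wt_tiles_le ht0 ht1 h k _ (fun s hs => (Finset.mem_filter.1 hs).2) _
                (fun s hs => ?_) x
              obtain ⟨hs1, hs2⟩ := Finset.mem_filter.1 hs
              rw [Finset.mem_singleton, ← (hT s hs1).2.2, hs2]
          _ = _ := by simp
    _ ≤ ∫ x, 16 * (wt p (len lam k) x ^ 2 + wt q (len lam k) x ^ 2) :=
        setIntegral_le_integral hgInt (Filter.Eventually.of_forall fun x => by positivity)
    _ ≤ 128 * len lam k := by
        rw [integral_const_mul, integral_add (integrable_wt_pow hL le_rfl)
          (integrable_wt_pow hL le_rfl)]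
        have h1 := integral_wt_sq_le (c := p) hL
        have h2 := integral_wt_sq_le (c := q) hL
        linarith

open scoped Classical in
theorem EnergyLE.mono {a : Tile → ℝ} {S S' : Finset Tile} {ε : ℝ} (hS : S' ⊆ S)
    (h : EnergyLE lam a S ε) : EnergyLE lam a S' ε := fun τ =>
  (Finset.sum_le_sum_of_subset_of_nonneg (Finset.filter_subset_filter _ hS)
    fun _ _ _ => sq_nonneg _).trans (h τ)

open scoped Classical in
theorem EnergyLE.coeff_le (h : 0 < lam) {a : Tile → ℝ} (ha : ∀ s, 0 ≤ a s) {S : Finset Tile}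
    {ε : ℝ} (hε : 0 ≤ ε) (hE : EnergyLE lam a S ε) {s : Tile} (hs : s ∈ S) :
    a s ≤ ε * √(len lam s.k) := by
  have h1 := hE ⟨s.k, s.n, s.l / len lam s.k⟩
  have h2 : a s ^ 2 ≤ ε ^ 2 * len lam s.k := by
    refine le_trans ?_ h1
    refine Finset.single_le_sum (f := fun s => a s ^ 2) (fun _ _ => sq_nonneg _) ?_
    exact Finset.mem_filter.2 ⟨hs, le_rfl, idx_pt h s, fidx_left h s⟩
  have h3 : (ε * √(len lam s.k)) ^ 2 = ε ^ 2 * len lam s.k := by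
    rw [mul_pow, Real.sq_sqrt (len_pos h s.k).le]
  rw [← h3] at h2
  exact (pow_le_pow_iff_left₀ (ha s) (by positivity) two_ne_zero).1 h2

end TileLemmas

section EnergyDecomposition
variable {lam t : ℝ}

open scoped Classical in
/-- A finite family of lacunary trees selected greedily from the collection `S`. -/
structure GreedyTrees (lam : ℝ) (a : Tile → ℝ) (S : Finset Tile) (ε : ℝ)
    (𝒯 : Finset TreeTop) (T : TreeTop → Finset Tile) : Prop where
  mem : ∀ τ ∈ 𝒯, ∀ s ∈ T τ, s ∈ S ∧ Lac lam s τ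
  large : ∀ τ ∈ 𝒯, ε ^ 2 * len lam τ.k < ∑ s ∈ T τ, a s ^ 2
  disj : ∀ τ ∈ 𝒯, ∀ τ' ∈ 𝒯, τ ≠ τ' → Disjoint (T τ) (T τ')
  sep : ∀ τ ∈ 𝒯, ∀ τ' ∈ 𝒯, τ.ξ < τ'.ξ → ∀ s ∈ T τ', ¬ Under lam s τ
  cand : ∀ τ ∈ 𝒯, ∃ s ∈ S, τ.ξ = s.l / len lam s.k

open scoped Classical in
theorem exists_greedyTrees (h : 0 < lam) (a : Tile → ℝ) (ε : ℝ) (S : Finset Tile) :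
    ∃ 𝒯 T, GreedyTrees lam a S ε 𝒯 T ∧
      EnergyLE lam a (S.filter fun s => ∀ τ ∈ 𝒯, ¬ Under lam s τ) ε := by
  induction hn : S.card using Nat.strong_induction_on generalizing S with
  | _ n ih =>
  by_cases hE : EnergyLE lam a S ε
  · exact ⟨∅, fun _ => ∅, ⟨by simp, by simp, by simp, by simp, by simp⟩, by simpa using hE⟩
  set bad : TreeTop → Prop := fun τ => ε ^ 2 * len lam τ.k < ∑ s ∈ S.filter (Lac lam · τ), a s ^ 2
    with hbad
  have hne : ∀ {F : Finset Tile} {τ : TreeTop}, ε ^ 2 * len lam τ.k < ∑ s ∈ F, a s ^ 2 →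
      F.Nonempty := by
    intro F τ hτ
    by_contra hF
    rw [Finset.not_nonempty_iff_eq_empty] at hF
    rw [hF, Finset.sum_empty] at hτ
    have := len_pos h τ.k
    nlinarith [sq_nonneg ε]
  set cand := (S.image fun s => s.l / len lam s.k).filter fun ξ => ∃ K m, bad ⟨K, m, ξ⟩
    with hcand
  have hcne : cand.Nonempty := by
    unfold EnergyLE at hE
    push Not at hE
    obtain ⟨τ, hτ⟩ := hE
    obtain ⟨s, hs, hmax⟩ := Finset.exists_max_image _ Tile.k (hne hτ)
    obtain ⟨hs1, hs2⟩ := Finset.mem_filter.1 hs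
    refine ⟨s.l / len lam s.k, Finset.mem_filter.2 ⟨Finset.mem_image_of_mem _ hs1, τ.k, τ.m,
      hτ.trans_le (Finset.sum_le_sum_of_subset_of_nonneg ?_ fun _ _ _ => sq_nonneg _)⟩⟩
    intro s' hs'
    obtain ⟨hs1', hs2'⟩ := Finset.mem_filter.1 hs'
    refine Finset.mem_filter.2 ⟨hs1', hs2'.1, hs2'.2.1, ?_⟩
    have := hmax s' hs'
    rw [← hs2'.2.2]
    exact fidx_congr this (by rw [fidx_left h, hs2.2.2])
  obtain ⟨ξ, hξ, hmin⟩ := Finset.exists_min_image cand id hcne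
  obtain ⟨hξ1, K, m, hb⟩ := Finset.mem_filter.1 hξ
  set τ : TreeTop := ⟨K, m, ξ⟩ with hτ
  set S' := S.filter fun s => ¬ Under lam s τ with hS'
  have hlt : S'.card < n := by
    obtain ⟨s, hs⟩ := hne hb
    obtain ⟨hs1, hs2⟩ := Finset.mem_filter.1 hs
    rw [← hn]
    refine Finset.card_lt_card (Finset.filter_ssubset.2 ⟨s, hs1, ?_⟩)
    exact not_not.2 hs2.under
  obtain ⟨𝒯, T, hG, hR⟩ := ih _ hlt S' rfl
  have hτn : τ ∉ 𝒯 := by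
    intro hc
    obtain ⟨s, hs⟩ := hne (hG.large τ hc)
    obtain ⟨h1, h2⟩ := hG.mem τ hc s hs
    exact (Finset.mem_filter.1 h1).2 h2.under
  have hTne : ∀ τ' ∈ 𝒯, τ' ≠ τ := fun τ' h' he => hτn (he ▸ h')
  have hTS : ∀ τ' ∈ 𝒯, ∀ s ∈ T τ', s ∈ S ∧ ¬ Under lam s τ := fun τ' h' s hs =>
    Finset.mem_filter.1 (hG.mem τ' h' s hs).1
  refine ⟨insert τ 𝒯, Function.update T τ (S.filter (Lac lam · τ)), ⟨?_, ?_, ?_, ?_, ?_⟩, ?_⟩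
  · intro τ' h' s hs
    rcases Finset.mem_insert.1 h' with rfl | h'
    · rw [Function.update_self] at hs
      exact Finset.mem_filter.1 hs
    · rw [Function.update_of_ne (hTne _ h')] at hs
      exact ⟨(hTS _ h' s hs).1, (hG.mem _ h' s hs).2⟩
  · intro τ' h'
    rcases Finset.mem_insert.1 h' with rfl | h'
    · rw [Function.update_self]; exact hb
    · rw [Function.update_of_ne (hTne _ h')]; exact hG.large _ h'
  · have key : ∀ τ' ∈ 𝒯, Disjoint (S.filter (Lac lam · τ)) (T τ') := by
      intro τ' h'
      rw [Finset.disjoint_left]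
      intro s hs hs'
      exact (hTS _ h' s hs').2 (Finset.mem_filter.1 hs).2.under
    intro τ₁ h₁ τ₂ h₂ hne'
    rcases Finset.mem_insert.1 h₁ with rfl | h₁
    · rcases Finset.mem_insert.1 h₂ with rfl | h₂
      · exact absurd rfl hne'
      · rw [Function.update_self, Function.update_of_ne (hTne _ h₂)]; exact key _ h₂
    · rw [Function.update_of_ne (hTne _ h₁)]
      rcases Finset.mem_insert.1 h₂ with rfl | h₂
      · rw [Function.update_self]; exact (key _ h₁).symm
      · rw [Function.update_of_ne (hTne _ h₂)]; exact hG.disj _ h₁ _ h₂ hne'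
  · intro τ₁ h₁ τ₂ h₂ hlt s hs
    rcases Finset.mem_insert.1 h₂ with rfl | h₂
    · rcases Finset.mem_insert.1 h₁ with rfl | h₁
      · exact absurd hlt (lt_irrefl _)
      · exfalso
        have : τ₁.ξ ∈ cand := by
          obtain ⟨s₁, hs₁, he⟩ := hG.cand _ h₁
          refine Finset.mem_filter.2 ⟨Finset.mem_image.2
            ⟨s₁, (Finset.mem_filter.1 hs₁).1, he.symm⟩, τ₁.k, τ₁.m, ?_⟩
          refine (hG.large _ h₁).trans_le (Finset.sum_le_sum_of_subset_of_nonneg ?_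
            fun _ _ _ => sq_nonneg _)
          intro s' hs'
          exact Finset.mem_filter.2 ⟨(hTS _ h₁ s' hs').1, (hG.mem _ h₁ s' hs').2⟩
        exact absurd (hmin _ this) (not_le.2 hlt)
    · rw [Function.update_of_ne (hTne _ h₂)] at hs
      rcases Finset.mem_insert.1 h₁ with rfl | h₁
      · exact (hTS _ h₂ s hs).2
      · exact hG.sep _ h₁ _ h₂ hlt s hs
  · intro τ' h'
    rcases Finset.mem_insert.1 h' with rfl | h'
    · obtain ⟨s, hs, he⟩ := Finset.mem_image.1 hξ1
      exact ⟨s, hs, he.symm⟩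
    · obtain ⟨s, hs, he⟩ := hG.cand _ h'
      exact ⟨s, (Finset.mem_filter.1 hs).1, he⟩
  · convert hR using 1
    rw [hS', Finset.filter_filter]
    refine Finset.filter_congr fun s _ => ?_
    simp

section Greedy
variable {a : Tile → ℝ} {S : Finset Tile} {ε : ℝ} {𝒯 : Finset TreeTop} {T : TreeTop → Finset Tile}

/-- If the top frequency of a greedy tree lies in the packet of a smaller tile selected in another
tree, the spatial interval of this tile is disjoint from the top interval. -/
theorem GreedyTrees.idx_ne (hG : GreedyTrees lam a S ε 𝒯 T) (h : 0 < lam)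
    (hgood : ∀ s ∈ S, 13 ≤ s.l % 16) {τ τ' : TreeTop} (hτ : τ ∈ 𝒯) (hτ' : τ' ∈ 𝒯) {s' : Tile}
    (hs' : s' ∈ T τ') (hk : s'.k ≤ τ.k) (hp : InPacket lam s' τ.ξ) :
    idx lam τ.k (s'.pt lam) ≠ τ.m := by
  intro hc
  obtain ⟨h1, h2⟩ := hG.mem _ hτ' _ hs'
  have hlt : τ.ξ < τ'.ξ := by
    refine lt_of_fidx_lt (k := s'.k) h ?_
    rw [h2.2.2]
    have := hp.2
    omega
  exact hG.sep _ hτ _ hτ' hlt _ hs' ⟨hk, hc, hp.fidx_sub_one (hgood _ h1)⟩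

open scoped Classical in
theorem GreedyTrees.sum_len_wt_le (hG : GreedyTrees lam a S ε 𝒯 T) (h : 0 < lam) (ht0 : 0 ≤ t)
    (ht1 : t < 1) (hgood : ∀ s ∈ S, 13 ≤ s.l % 16) {τ : TreeTop} (hτ : τ ∈ 𝒯) {s : Tile}
    (hs : s ∈ T τ) (U' : Finset Tile)
    (hU : ∀ s' ∈ U', s' ∈ 𝒯.biUnion T ∧ s'.k < s.k ∧
      ∃ η, InPacket lam s η ∧ InPacket lam s' η) :
    ∑ s' ∈ U', len lam s'.k * wt (s.ctr lam t) (len lam s.k) (s'.ctr lam t) ^ 4 ≤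
      192 * ∫ x in {x | idx lam τ.k x ≠ τ.m}, wt (s.ctr lam t) (len lam s.k) x ^ 4 := by
  have hL := len_pos h s.k
  obtain ⟨hsS, hsl⟩ := hG.mem _ hτ _ hs
  have hP : ∀ s' ∈ U', InPacket lam s' τ.ξ := by
    intro s' hs'
    obtain ⟨-, hk, η, hη, hη'⟩ := hU s' hs'
    exact InPacket.of_overlap (hgood _ hsS) hk hη hη' hsl.under.2.2
  have hsame : ∀ x, ∀ s' ∈ U', ∀ s'' ∈ U', idx lam s'.k x = s'.n → idx lam s''.k x = s''.n →
      s'.k ≤ s''.k := by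
    intro x s' hs' s'' hs'' hx hx'
    by_contra hlt
    push Not at hlt
    obtain ⟨τ', hτ', hm'⟩ := Finset.mem_biUnion.1 (hU s' hs').1
    obtain ⟨τ'', hτ'', hm''⟩ := Finset.mem_biUnion.1 (hU s'' hs'').1
    obtain ⟨hS', hl'⟩ := hG.mem _ hτ' _ hm'
    refine hG.idx_ne h hgood hτ' hτ'' hm'' (hlt.le.trans hl'.1)
      (InPacket.of_overlap (hgood _ hS') hlt (hP s' hs') (hP s'' hs'') hl'.under.2.2) ?_
    rw [← hl'.2.1]
    refine idx_congr hl'.1 ?_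
    rw [idx_pt h s', ← hx]
    exact idx_congr hlt.le (by rw [idx_pt h, hx'])
  have hcard : ∀ x, (U'.filter fun s' => idx lam s'.k x = s'.n).card ≤ 12 := by
    intro x
    rcases (U'.filter fun s' => idx lam s'.k x = s'.n).eq_empty_or_nonempty with he | ⟨s₀, h₀⟩
    · rw [he]; simp
    obtain ⟨h₀U, h₀x⟩ := Finset.mem_filter.1 h₀
    have hk : ∀ s' ∈ U'.filter (fun s' => idx lam s'.k x = s'.n), s'.k = s₀.k := by
      intro s' hs'
      obtain ⟨h1, h2⟩ := Finset.mem_filter.1 hs'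
      exact le_antisymm (hsame x _ h1 _ h₀U h2 h₀x) (hsame x _ h₀U _ h1 h₀x h2)
    have hc : (Finset.Icc (fidx lam s₀.k τ.ξ + 2) (fidx lam s₀.k τ.ξ + 13)).card = 12 := by
      simp only [Int.card_Icc]; omega
    rw [← hc]
    refine Finset.card_le_card_of_injOn Tile.l ?_ ?_
    · intro s' hs'
      have h1 := hP s' (Finset.mem_filter.1 hs').1
      unfold InPacket at h1
      rw [hk s' hs'] at h1
      simp only [Finset.coe_Icc, Set.mem_Icc]
      omega
    · intro s' hs' s'' hs'' he
      have e1 := hk s' hs'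
      have e2 := hk s'' hs''
      have e3 := (Finset.mem_filter.1 hs').2
      have e4 := (Finset.mem_filter.1 hs'').2
      rw [e1] at e3
      rw [e2, e3] at e4
      cases s'; cases s''
      simp_all
  have hov := sum_setIntegral_le U' (fun s' => {x | idx lam s'.k x = s'.n})
    (fun s' _ => measurableSet_idx_eq _ _ _)
    (B := {x | idx lam τ.k x ≠ τ.m}) (measurableSet_idx_eq lam τ.k τ.m).compl ?_ (m := 12)
    (fun x => U'.filter fun s' => idx lam s'.k x = s'.n)
    (fun x s' hs' hx => Finset.mem_filter.2 ⟨hs', hx⟩) hcard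
    (h := fun x => wt (s.ctr lam t) (len lam s.k) x ^ 4)
    (fun x => by have := wt_nonneg (c := s.ctr lam t) (x := x) hL; positivity)
    (integrable_wt_pow hL (by norm_num))
  · calc _ ≤ ∑ s' ∈ U', 2 ^ 4 * ∫ x in {x | idx lam s'.k x = s'.n},
          wt (s.ctr lam t) (len lam s.k) x ^ 4 :=
        Finset.sum_le_sum fun s' hs' => len_mul_wt_le_integral h
          (len_mono h (hU s' hs').2.1.le) (idx_ctr h ht0 ht1 s') (by norm_num)
      _ ≤ _ := by
        rw [← Finset.mul_sum]
        push_cast at hov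
        linarith
  · intro s' hs' x hx
    obtain ⟨hb, hk, -⟩ := hU s' hs'
    obtain ⟨τ', hτ', hm'⟩ := Finset.mem_biUnion.1 hb
    have hk' : s'.k ≤ τ.k := hk.le.trans hsl.1
    have := hG.idx_ne h hgood hτ hτ' hm' hk' (hP s' hs')
    intro hc
    refine this ?_
    rw [← show idx lam τ.k x = τ.m from hc]
    exact idx_congr hk' (by rw [idx_pt h, show idx lam s'.k x = s'.n from hx])

end Greedy

open scoped Classical in
/-- The energy decomposition: a collection of energy at most `2ε` splits into trees with
controlled tops and a remainder of energy at most `ε`. -/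
theorem energy_decomposition (h : 0 < lam) (ht0 : 0 ≤ t) (ht1 : t < 1) {a : Tile → ℝ}
    (ha : ∀ s, 0 ≤ a s) {G : Tile → Tile → ℝ} (hG0 : ∀ s s', 0 ≤ G s s')
    (hGs : ∀ s s', G s s' = G s' s)
    (hGp : ∀ s s', G s s' ≠ 0 → ∃ η, InPacket lam s η ∧ InPacket lam s' η) {CG A : ℝ}
    (hCG : 0 ≤ CG) (hA : 0 ≤ A)
    (hGd : ∀ s s' : Tile, s'.k ≤ s.k → G s s' ≤
      CG * √(len lam s'.k / len lam s.k) * wt (s.ctr lam t) (len lam s.k) (s'.ctr lam t) ^ 4)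
    (hH : ∀ U : Finset Tile, (∑ s ∈ U, a s ^ 2) ^ 2 ≤
      A * ∑ s ∈ U, ∑ s' ∈ U, a s * a s' * G s s') {S : Finset Tile}
    (hgood : ∀ s ∈ S, 13 ≤ s.l % 16) {ε : ℝ} (hε : 0 ≤ ε) (hE : EnergyLE lam a S (2 * ε)) :
    ∃ 𝒯 : Finset TreeTop, ε ^ 2 * ∑ τ ∈ 𝒯, len lam τ.k ≤ 400000 * CG * A ∧
      EnergyLE lam a (S.filter fun s => ∀ τ ∈ 𝒯, ¬ Under lam s τ) ε := by
  obtain ⟨𝒯, T, hG, hR⟩ := exists_greedyTrees h a ε S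
  refine ⟨𝒯, ?_, hR⟩
  set U := 𝒯.biUnion T with hU
  have hUS : ∀ s ∈ U, s ∈ S := by
    intro s hs
    obtain ⟨τ, hτ, hm⟩ := Finset.mem_biUnion.1 hs
    exact (hG.mem τ hτ s hm).1
  have hdisj : (𝒯 : Set TreeTop).PairwiseDisjoint T := fun τ hτ τ' hτ' hne =>
    hG.disj τ hτ τ' hτ' hne
  set X := ∑ s ∈ U, a s ^ 2 with hX
  have hX' : X = ∑ τ ∈ 𝒯, ∑ s ∈ T τ, a s ^ 2 := Finset.sum_biUnion hdisj
  have hlen : ε ^ 2 * ∑ τ ∈ 𝒯, len lam τ.k ≤ X := by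
    rw [hX', Finset.mul_sum]
    exact Finset.sum_le_sum fun τ hτ => (hG.large τ hτ).le
  refine hlen.trans ?_
  have hX0 : 0 ≤ X := Finset.sum_nonneg fun _ _ => sq_nonneg _
  -- tiles of the same generation
  have hsame : ∑ s ∈ U, ∑ s' ∈ U.filter (·.k = s.k), a s * a s' * G s s' ≤ 400 * CG * X := by
    have hrow : ∀ s ∈ U, ∑ s' ∈ U.filter (·.k = s.k), G s s' ≤ 400 * CG := by
      intro s hs
      have hL := len_pos h s.k
      set F := U.filter (·.k = s.k) with hF
      have h1 : ∑ s' ∈ F, G s s' = ∑ s' ∈ F.filter (fun s' => G s s' ≠ 0), G s s' :=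
        (Finset.sum_filter_ne_zero _).symm
      rw [h1]
      calc _ ≤ ∑ s' ∈ F.filter (fun s' => G s s' ≠ 0),
            CG * wt (s'.ctr lam t) (len lam s.k) (s.ctr lam t) ^ 2 := by
            refine Finset.sum_le_sum fun s' hs' => ?_
            have hk : s'.k = s.k := (Finset.mem_filter.1 (Finset.mem_filter.1 hs').1).2
            have := hGd s s' hk.le
            rw [hk, div_self hL.ne', Real.sqrt_one, mul_one] at this
            refine this.trans (mul_le_mul_of_nonneg_left ?_ hCG)
            rw [wt_comm]
            exact wt_pow_le_pow hL (by norm_num)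
        _ ≤ CG * (16 * ((Finset.Icc (s.l - 12) (s.l + 12)).card : ℝ)) := by
            rw [← Finset.mul_sum]
            refine mul_le_mul_of_nonneg_left ?_ hCG
            refine sum_wt_tiles_le ht0 ht1 h s.k _ (fun s' hs' =>
              (Finset.mem_filter.1 (Finset.mem_filter.1 hs').1).2) _ (fun s' hs' => ?_) _
            obtain ⟨hF', hne⟩ := Finset.mem_filter.1 hs'
            have hk : s'.k = s.k := (Finset.mem_filter.1 hF').2
            obtain ⟨η, h1, h2⟩ := hGp s s' hne
            unfold InPacket at h1 h2
            rw [hk] at h2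
            rw [Finset.mem_Icc]
            omega
        _ = 400 * CG := by
            have : (Finset.Icc (s.l - 12) (s.l + 12)).card = 25 := by
              simp only [Int.card_Icc]; omega
            rw [this]; push_cast; ring
    have hsw : ∑ s ∈ U, ∑ s' ∈ U.filter (·.k = s.k), a s' ^ 2 * G s s' =
        ∑ s ∈ U, ∑ s' ∈ U.filter (·.k = s.k), a s ^ 2 * G s s' := by
      simp only [Finset.sum_filter]
      rw [Finset.sum_comm]
      refine Finset.sum_congr rfl fun s _ => Finset.sum_congr rfl fun s' _ => ?_
      rw [hGs s' s]
      simp only [eq_comm]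
    calc _ ≤ ∑ s ∈ U, ∑ s' ∈ U.filter (·.k = s.k),
          (a s ^ 2 * G s s' / 2 + a s' ^ 2 * G s s' / 2) := by
          refine Finset.sum_le_sum fun s _ => Finset.sum_le_sum fun s' _ => ?_
          nlinarith [mul_nonneg (sq_nonneg (a s - a s')) (hG0 s s')]
      _ = ∑ s ∈ U, a s ^ 2 * ∑ s' ∈ U.filter (·.k = s.k), G s s' := by
          simp only [Finset.sum_add_distrib, ← Finset.sum_div, hsw, ← Finset.mul_sum]
          ring
      _ ≤ ∑ s ∈ U, a s ^ 2 * (400 * CG) :=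
          Finset.sum_le_sum fun s hs => mul_le_mul_of_nonneg_left (hrow s hs) (sq_nonneg _)
      _ = _ := by rw [← Finset.sum_mul]; ring
  have hcross : ∑ s ∈ U, ∑ s' ∈ U.filter (·.k < s.k), a s * a s' * G s s' ≤
      196608 * CG * X := by
    rw [hU, Finset.sum_biUnion hdisj, ← hU]
    have htree : ∀ τ ∈ 𝒯, ∑ s ∈ T τ, ∑ s' ∈ U.filter (·.k < s.k), a s * a s' * G s s' ≤
        196608 * CG * (ε ^ 2 * len lam τ.k) := by
      intro τ hτ
      calc _ ≤ ∑ s ∈ T τ, 4 * ε ^ 2 * CG * (192 * ∫ x in {x | idx lam τ.k x ≠ τ.m},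
            wt (s.ctr lam t) (len lam s.k) x ^ 4) := by
            refine Finset.sum_le_sum fun s hs => ?_
            have hL := len_pos h s.k
            set F := (U.filter (·.k < s.k)).filter (fun s' => a s * a s' * G s s' ≠ 0) with hF
            have h1 : ∑ s' ∈ U.filter (·.k < s.k), a s * a s' * G s s' =
              ∑ s' ∈ F, a s * a s' * G s s' := (Finset.sum_filter_ne_zero _).symm
            rw [h1]
            have h2 := hG.sum_len_wt_le h ht0 ht1 hgood hτ hs F ?_
            · refine le_trans ?_ (mul_le_mul_of_nonneg_left h2 (by positivity))
              rw [Finset.mul_sum]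
              refine Finset.sum_le_sum fun s' hs' => ?_
              obtain ⟨h3, hk⟩ := Finset.mem_filter.1 (Finset.mem_filter.1 hs').1
              have hL' := len_pos h s'.k
              have e1 := EnergyLE.coeff_le h ha (by positivity) hE (hG.mem _ hτ _ hs).1
              have e2 := EnergyLE.coeff_le h ha (by positivity) hE (hUS _ h3)
              have e3 := hGd s s' hk.le
              have hw := wt_nonneg (c := s.ctr lam t) (x := s'.ctr lam t) hL
              calc a s * a s' * G s s' ≤ (2 * ε * √(len lam s.k)) * (2 * ε * √(len lam s'.k)) *
                    (CG * √(len lam s'.k / len lam s.k) *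
                      wt (s.ctr lam t) (len lam s.k) (s'.ctr lam t) ^ 4) :=
                    mul_le_mul (mul_le_mul e1 e2 (ha _) (by positivity)) e3 (hG0 _ _)
                      (by positivity)
                _ = 4 * ε ^ 2 * CG * ((√(len lam s.k) * √(len lam s'.k) *
                    √(len lam s'.k / len lam s.k)) *
                      wt (s.ctr lam t) (len lam s.k) (s'.ctr lam t) ^ 4) := by ring
                _ = _ := by
                    rw [← Real.sqrt_mul hL.le, ← Real.sqrt_mul (by positivity)]
                    have : len lam s.k * len lam s'.k * (len lam s'.k / len lam s.k) =
                      len lam s'.k ^ 2 := by field_simp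
                    rw [this, Real.sqrt_sq hL'.le]
            · intro s' hs'
              obtain ⟨h3, h4⟩ := Finset.mem_filter.1 hs'
              obtain ⟨h5, h6⟩ := Finset.mem_filter.1 h3
              exact ⟨h5, h6, hGp s s' (right_ne_zero_of_mul h4)⟩
        _ ≤ 4 * ε ^ 2 * CG * (192 * (256 * len lam τ.k)) := by
            rw [← Finset.mul_sum, ← Finset.mul_sum]
            refine mul_le_mul_of_nonneg_left ?_ (by positivity)
            exact mul_le_mul_of_nonneg_left (sum_lac_tail_le ht0 ht1 h (T τ) τ
              fun s hs => (hG.mem τ hτ s hs).2) (by norm_num)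
        _ = _ := by ring
    calc _ ≤ ∑ τ ∈ 𝒯, 196608 * CG * (ε ^ 2 * len lam τ.k) := Finset.sum_le_sum htree
      _ = 196608 * CG * (ε ^ 2 * ∑ τ ∈ 𝒯, len lam τ.k) := by
          rw [← Finset.mul_sum, ← Finset.mul_sum]
      _ ≤ _ := mul_le_mul_of_nonneg_left hlen (by positivity)
  have htot : ∑ s ∈ U, ∑ s' ∈ U, a s * a s' * G s s' ≤ 400000 * CG * X := by
    have hsplit : ∑ s ∈ U, ∑ s' ∈ U, a s * a s' * G s s' =
        ∑ s ∈ U, ∑ s' ∈ U.filter (·.k = s.k), a s * a s' * G s s' +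
        (∑ s ∈ U, ∑ s' ∈ U.filter (·.k < s.k), a s * a s' * G s s' +
        ∑ s ∈ U, ∑ s' ∈ U.filter (s.k < ·.k), a s * a s' * G s s') := by
      rw [← Finset.sum_add_distrib, ← Finset.sum_add_distrib]
      refine Finset.sum_congr rfl fun s _ => ?_
      simp only [Finset.sum_filter]
      rw [← Finset.sum_add_distrib, ← Finset.sum_add_distrib]
      refine Finset.sum_congr rfl fun s' _ => ?_
      rcases lt_trichotomy s'.k s.k with hlt | he | hlt
      · simp [hlt, hlt.ne, hlt.not_gt]
      · simp [he]
      · simp [hlt, hlt.ne', hlt.not_gt]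
    have hsw : ∑ s ∈ U, ∑ s' ∈ U.filter (s.k < ·.k), a s * a s' * G s s' =
        ∑ s ∈ U, ∑ s' ∈ U.filter (·.k < s.k), a s * a s' * G s s' := by
      simp only [Finset.sum_filter]
      rw [Finset.sum_comm]
      refine Finset.sum_congr rfl fun s _ => Finset.sum_congr rfl fun s' _ => ?_
      rw [hGs s' s, mul_comm (a s')]
    rw [hsplit, hsw]
    nlinarith [mul_nonneg hCG hX0]
  have hfin : X * X ≤ (400000 * CG * A) * X := by
    calc X * X = X ^ 2 := by ring
      _ ≤ A * ∑ s ∈ U, ∑ s' ∈ U, a s * a s' * G s s' := hH U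
      _ ≤ A * (400000 * CG * X) := mul_le_mul_of_nonneg_left htot hA
      _ = _ := by ring
  rcases hX0.eq_or_lt with h0 | h0
  · rw [← h0]; positivity
  · exact le_of_mul_le_mul_right hfin h0

end EnergyDecomposition

/-! ### Mass -/

/-- The mass of the collection `S` with respect to the set `E` and the frequency function `N` is
at most `μ`. -/
def MassLE (lam : ℝ) (E : Set ℝ) (N : ℝ → ℝ) (S : Finset Tile) (μ : ℝ) : Prop :=
  ∀ s ∈ S, ∀ k : ℤ, s.k ≤ k → ∀ ξ : ℝ, fidx lam (s.k - 1) ξ = s.l / 16 → ∀ j : ℕ,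
    volume (E ∩ {x | fidx lam (k - 1) (N x) = fidx lam (k - 1) ξ} ∩
      {x | |x - s.pt lam| ≤ 2 ^ j * len lam k}) ≤ ENNReal.ofReal (μ * 4 ^ j * len lam k)

theorem MassLE.mono {lam : ℝ} {E : Set ℝ} {N : ℝ → ℝ} {S S' : Finset Tile} {μ : ℝ} (hS : S' ⊆ S)
    (h : MassLE lam E N S μ) : MassLE lam E N S' μ := fun s hs => h s (hS hs)

/-- A finite Vitali selection: from a finite family with sizes `k` select pairwise unrelated
members so that each member is related to a selected one of at least its size. -/
theorem exists_vitali_selection {α : Type*} (H : Finset α) (k : α → ℤ) (R : α → α → Prop)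
    (hrefl : ∀ s, R s s) (hsymm : ∀ s s', R s s' → R s' s) :
    ∃ F ⊆ H, (∀ r ∈ F, ∀ r' ∈ F, r ≠ r' → ¬ R r r') ∧
      ∀ s ∈ H, ∃ r ∈ F, k s ≤ k r ∧ R s r := by
  classical
  induction hn : H.card using Nat.strong_induction_on generalizing H with
  | _ n ih =>
  rcases H.eq_empty_or_nonempty with rfl | hne
  · exact ⟨∅, by simp, by simp, by simp⟩
  obtain ⟨s₀, hs₀, hmax⟩ := Finset.exists_max_image H k hne
  have hlt : (H.filter fun s => ¬ R s s₀).card < n := by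
    rw [← hn]
    exact Finset.card_lt_card (Finset.filter_ssubset.2 ⟨s₀, hs₀, not_not.2 (hrefl _)⟩)
  obtain ⟨F, hF, hd, hc⟩ := ih _ hlt _ rfl
  refine ⟨insert s₀ F, Finset.insert_subset hs₀ (hF.trans (Finset.filter_subset _ _)), ?_, ?_⟩
  · intro r hr r' hr' hne
    rcases Finset.mem_insert.1 hr with h1 | h1 <;> rcases Finset.mem_insert.1 hr' with h2 | h2
    · exact absurd (h1.trans h2.symm) hne
    · exact fun hR => (Finset.mem_filter.1 (hF h2)).2 (h1 ▸ hsymm _ _ hR)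
    · exact fun hR => (Finset.mem_filter.1 (hF h1)).2 (h2 ▸ hR)
    · exact hd r h1 r' h2 hne
  · intro s hs
    by_cases hR : R s s₀
    · exact ⟨s₀, Finset.mem_insert_self _ _, hmax s hs, hR⟩
    · obtain ⟨r, hr, h1, h2⟩ := hc s (Finset.mem_filter.2 ⟨hs, hR⟩)
      exact ⟨r, Finset.mem_insert_of_mem hr, h1, h2⟩

theorem sum_biUnion_le {α β : Type*} [DecidableEq β] (F : Finset α) (t : α → Finset β) {f : β → ℝ}
    (hf : ∀ b, 0 ≤ f b) : ∑ b ∈ F.biUnion t, f b ≤ ∑ a ∈ F, ∑ b ∈ t a, f b := by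
  classical
  induction F using Finset.induction_on with
  | empty => simp
  | insert a F ha ih =>
    rw [Finset.biUnion_insert, Finset.sum_insert ha]
    have := Finset.sum_union_inter (s₁ := t a) (s₂ := F.biUnion t) (f := f)
    have h0 : 0 ≤ ∑ b ∈ t a ∩ F.biUnion t, f b := Finset.sum_nonneg fun b _ => hf b
    linarith

theorem abs_idx_sub_le {lam : ℝ} (h : 0 < lam) {k : ℤ} {x y : ℝ} {m : ℕ}
    (hxy : |x - y| ≤ m * len lam k) : |idx lam k x - idx lam k y| ≤ m + 1 := by
  have hL := len_pos h k
  obtain ⟨h1, h2⟩ := (idx_eq_iff h k _ x).1 rfl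
  obtain ⟨h3, h4⟩ := (idx_eq_iff h k _ y).1 rfl
  obtain ⟨h5, h6⟩ := abs_le.1 hxy
  rw [abs_le]
  constructor
  · have : (idx lam k y : ℝ) < idx lam k x + (m + 1) := by
      by_contra hc
      push Not at hc
      nlinarith
    have h7 : idx lam k y < idx lam k x + (m + 1) := by exact_mod_cast this
    omega
  · have : (idx lam k x : ℝ) < idx lam k y + (m + 1) := by
      by_contra hc
      push Not at hc
      nlinarith
    have h7 : idx lam k x < idx lam k y + (m + 1) := by exact_mod_cast this
    omega

open scoped Classical in
/-- The mass decomposition: tiles of mass larger than `μ` are organised into trees with controlled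
tops. -/
theorem mass_decomposition {lam : ℝ} (h : 0 < lam) {E : Set ℝ} (hEm : MeasurableSet E)
    (hEf : volume E ≠ ∞) {N : ℝ → ℝ} (hN : Measurable N) (S : Finset Tile) {μ : ℝ} (hμ : 0 < μ) :
    ∃ 𝒯 : Finset TreeTop, μ * ∑ τ ∈ 𝒯, len lam τ.k ≤ 16 * volume.real E ∧
      MassLE lam E N (S.filter fun s => ∀ τ ∈ 𝒯, ¬ Under lam s τ) μ := by
  set P : Tile → ℤ × ℝ × ℕ → Prop := fun s q => s.k ≤ q.1 ∧ fidx lam (s.k - 1) q.2.1 = s.l / 16 ∧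
    ENNReal.ofReal (μ * 4 ^ q.2.2 * len lam q.1) <
      volume (E ∩ {x | fidx lam (q.1 - 1) (N x) = fidx lam (q.1 - 1) q.2.1} ∩
        {x | |x - s.pt lam| ≤ 2 ^ q.2.2 * len lam q.1}) with hP
  set H := S.filter fun s => ∃ q, P s q with hH
  have hch : ∀ s : Tile, ∃ q, s ∈ H → P s q := by
    intro s
    by_cases hs : s ∈ H
    · obtain ⟨q, hq⟩ := (Finset.mem_filter.1 hs).2
      exact ⟨q, fun _ => hq⟩
    · exact ⟨(0, 0, 0), fun h => absurd h hs⟩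
  choose q hq using hch
  -- the rectangles
  set Rec : Tile → Set (ℝ × ℝ) := fun s => {p | |p.1 - s.pt lam| ≤ 2 ^ (q s).2.2 * len lam (q s).1 ∧
    fidx lam ((q s).1 - 1) p.2 = fidx lam ((q s).1 - 1) (q s).2.1} with hRec
  have hlenq : ∀ s, 0 < len lam (q s).1 := fun s => len_pos h _
  have hsel : ∀ j : ℕ, ∃ F ⊆ H.filter (fun s => (q s).2.2 = j),
      (∀ r ∈ F, ∀ r' ∈ F, r ≠ r' → ¬ (Rec r ∩ Rec r').Nonempty) ∧
      ∀ s ∈ H.filter (fun s => (q s).2.2 = j), ∃ r ∈ F, (q s).1 ≤ (q r).1 ∧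
        (Rec s ∩ Rec r).Nonempty := fun j =>
    exists_vitali_selection _ (fun s => (q s).1) (fun s s' => (Rec s ∩ Rec s').Nonempty)
      (fun s => ⟨(s.pt lam, (q s).2.1), by
        rw [inter_self]
        refine ⟨?_, rfl⟩
        have := hlenq s
        simp only [sub_self, abs_zero]
        positivity⟩) (fun s s' hs => by rwa [inter_comm])
  choose F hFH hFd hFc using hsel
  have hsum : ∀ j : ℕ, μ * 4 ^ j * ∑ r ∈ F j, len lam (q r).1 ≤ volume.real E := by
    intro j
    set A : Tile → Set ℝ := fun s => E ∩ {x | fidx lam ((q s).1 - 1) (N x) =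
      fidx lam ((q s).1 - 1) (q s).2.1} ∩
        {x | |x - s.pt lam| ≤ 2 ^ (q s).2.2 * len lam (q s).1} with hA
    have hAm : ∀ s, MeasurableSet (A s) := fun s =>
      (hEm.inter (((measurable_fidx lam _).comp hN) (measurableSet_singleton _))).inter
        (measurableSet_le (by fun_prop) measurable_const)
    have hAf : ∀ s, volume (A s) ≠ ∞ := fun s => ne_top_of_le_ne_top hEf
      (measure_mono (inter_subset_left.trans inter_subset_left))
    have hdis : ((F j : Finset Tile) : Set Tile).PairwiseDisjoint A := by
      intro r hr r' hr' hne
      rw [Function.onFun, Set.disjoint_left]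
      intro x hx hx'
      exact hFd j r hr r' hr' hne ⟨(x, N x), ⟨hx.2, hx.1.2⟩, ⟨hx'.2, hx'.1.2⟩⟩
    calc μ * 4 ^ j * ∑ r ∈ F j, len lam (q r).1 ≤ ∑ r ∈ F j, volume.real (A r) := by
          rw [Finset.mul_sum]
          refine Finset.sum_le_sum fun r hr => ?_
          obtain ⟨hr1, hr2⟩ := Finset.mem_filter.1 (hFH j hr)
          have h1 := (hq r hr1).2.2
          rw [Measure.real, ← ENNReal.ofReal_le_iff_le_toReal (hAf r), ← hr2]
          exact h1.le
      _ = volume.real (⋃ r ∈ F j, A r) :=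
          (measureReal_biUnion_finset hdis (fun r _ => hAm r) fun r _ => hAf r).symm
      _ ≤ volume.real E := by
          refine measureReal_mono ?_ hEf
          exact iUnion₂_subset fun r _ => inter_subset_left.trans inter_subset_left
  set tops : ℕ → Tile → Finset TreeTop := fun j r =>
    (Finset.Icc (idx lam (q r).1 (r.pt lam) - (2 ^ (j + 1) + 1))
      (idx lam (q r).1 (r.pt lam) + (2 ^ (j + 1) + 1))).image
        fun m => ⟨(q r).1, m, (q r).2.1⟩ with htops
  set Js := H.image fun s => (q s).2.2 with hJs
  refine ⟨Js.biUnion fun j => (F j).biUnion (tops j), ?_, ?_⟩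
  · have hlen0 : ∀ τ : TreeTop, 0 ≤ len lam τ.k := fun τ => (len_pos h _).le
    have h1 : ∀ j, ∀ r ∈ F j, ∑ τ ∈ tops j r, len lam τ.k ≤ 2 ^ (j + 3) * len lam (q r).1 := by
      intro j r _
      have hk : ∀ τ ∈ tops j r, len lam τ.k = len lam (q r).1 := by
        intro τ hτ
        obtain ⟨m, -, rfl⟩ := Finset.mem_image.1 hτ
        rfl
      rw [Finset.sum_congr rfl hk, Finset.sum_const, nsmul_eq_mul]
      refine mul_le_mul_of_nonneg_right ?_ (hlenq r).le
      have h2 : (tops j r).card ≤ 2 ^ (j + 3) := by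
        refine Finset.card_image_le.trans ?_
        rw [Int.card_Icc]
        have h3 : (1 : ℤ) ≤ 2 ^ j := one_le_pow₀ (by norm_num)
        have h4 : ((2 ^ (j + 3) : ℕ) : ℤ) = 8 * 2 ^ j := by push_cast; ring
        have h5 : (2 : ℤ) ^ (j + 1) = 2 * 2 ^ j := by ring
        rw [Int.toNat_le, h4, h5]
        linarith
      exact_mod_cast h2
    have h2 : ∀ j, μ * ∑ τ ∈ (F j).biUnion (tops j), len lam τ.k ≤
        8 * volume.real E * (1 / 2) ^ j := by
      intro j
      calc _ ≤ μ * ∑ r ∈ F j, 2 ^ (j + 3) * len lam (q r).1 :=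
            mul_le_mul_of_nonneg_left (((sum_biUnion_le _ _ hlen0)).trans
              (Finset.sum_le_sum (h1 j))) hμ.le
        _ = 8 * (1 / 2) ^ j * (μ * 4 ^ j * ∑ r ∈ F j, len lam (q r).1) := by
            rw [← Finset.mul_sum]
            have : (4 : ℝ) ^ j * (1 / 2) ^ j = 2 ^ j := by rw [← mul_pow]; norm_num
            calc _ = μ * (2 ^ j * 8 * ∑ r ∈ F j, len lam (q r).1) := by ring
              _ = _ := by rw [← this]; ring
        _ ≤ _ := by
            have := mul_le_mul_of_nonneg_left (hsum j)
              (by positivity : (0 : ℝ) ≤ 8 * (1 / 2) ^ j)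
            linarith
    calc _ ≤ ∑ j ∈ Js, 8 * volume.real E * (1 / 2) ^ j := by
          refine (mul_le_mul_of_nonneg_left (sum_biUnion_le _ _ hlen0) hμ.le).trans ?_
          rw [Finset.mul_sum]
          exact Finset.sum_le_sum fun j _ => h2 j
      _ ≤ 8 * volume.real E * 2 := by
          rw [← Finset.mul_sum]
          refine mul_le_mul_of_nonneg_left ?_ (by positivity)
          refine (summable_geometric_two.sum_le_tsum _ fun i _ => by positivity).trans ?_
          rw [tsum_geometric_two]
      _ = _ := by ring
  · intro s hs k hk ξ hξ j
    by_contra hc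
    push Not at hc
    obtain ⟨hsS, hsn⟩ := Finset.mem_filter.1 hs
    have hsH : s ∈ H := Finset.mem_filter.2 ⟨hsS, (k, ξ, j), hk, hξ, hc⟩
    obtain ⟨hq1, hq2, -⟩ := hq s hsH
    obtain ⟨r, hr, hkr, ⟨x, η⟩, ⟨hx1, hx2⟩, ⟨hx3, hx4⟩⟩ :=
      hFc _ s (Finset.mem_filter.2 ⟨hsH, rfl⟩)
    obtain ⟨hrH, hrj⟩ := Finset.mem_filter.1 (hFH _ hr)
    refine hsn ⟨(q r).1, idx lam (q r).1 (s.pt lam), (q r).2.1⟩ ?_ ⟨hq1.trans hkr, rfl, ?_⟩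
    · refine Finset.mem_biUnion.2 ⟨_, Finset.mem_image_of_mem _ hsH, Finset.mem_biUnion.2
        ⟨r, hr, Finset.mem_image.2 ⟨_, ?_, rfl⟩⟩⟩
      have hd : |s.pt lam - r.pt lam| ≤ ((2 ^ ((q s).2.2 + 1) : ℕ) : ℝ) * len lam (q r).1 := by
        have e1 := len_mono h hkr
        have e2 : |s.pt lam - r.pt lam| ≤ |x - s.pt lam| + |x - r.pt lam| := by
          rw [abs_sub_comm x (s.pt lam)]
          exact abs_sub_le _ _ _
        simp only at hx1 hx3
        rw [hrj] at hx3
        have e3 := mul_le_mul_of_nonneg_left e1 (by positivity : (0 : ℝ) ≤ 2 ^ (q s).2.2)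
        push_cast
        rw [pow_succ]
        linarith
      have := abs_le.1 (abs_idx_sub_le h hd)
      push_cast at this
      rw [Finset.mem_Icc]
      constructor <;> linarith [this.1, this.2]
    · simp only at hx2 hx4 ⊢
      rw [← hq2]
      have e1 : fidx lam (s.k - 1) (q r).2.1 = fidx lam (s.k - 1) η :=
        fidx_congr (by omega) hx4.symm
      rw [e1]
      exact fidx_congr (by omega) hx2

/-! ### The uncentred Hardy–Littlewood maximal function -/

/-- The uncentred Hardy–Littlewood maximal function on the real line. -/
noncomputable def hlM (f : ℝ → ℝ≥0∞) (y : ℝ) : ℝ≥0∞ :=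
  ⨆ (p : ℝ) (r : ℝ) (_ : 0 < r) (_ : |y - p| < r),
    (∫⁻ z in Metric.ball p r, f z) / ENNReal.ofReal (2 * r)

theorem lintegral_ball_le_hlM (f : ℝ → ℝ≥0∞) {y p r : ℝ} (hr : 0 < r) (hy : |y - p| < r) :
    ∫⁻ z in Metric.ball p r, f z ≤ hlM f y * ENNReal.ofReal (2 * r) := by
  have h2 : ENNReal.ofReal (2 * r) ≠ 0 := by simp [hr]
  rw [← ENNReal.div_le_iff h2 ENNReal.ofReal_ne_top]
  exact le_iSup₂_of_le p r (le_iSup₂_of_le hr hy le_rfl)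

theorem lintegral_closedBall_le_hlM (f : ℝ → ℝ≥0∞) {y p r : ℝ} (hr : 0 < r) (hy : |y - p| ≤ r) :
    ∫⁻ z in {z | |z - p| ≤ r}, f z ≤ hlM f y * ENNReal.ofReal (4 * r) := by
  have h1 := lintegral_ball_le_hlM f (p := p) (r := 2 * r) (by linarith) (by linarith : |y - p| < _)
  rw [show 2 * (2 * r) = 4 * r by ring] at h1
  refine le_trans (lintegral_mono_set fun z hz => ?_) h1
  rw [Metric.mem_ball, Real.dist_eq]
  have : |z - p| ≤ r := hz
  linarith

theorem lt_hlM_iff (f : ℝ → ℝ≥0∞) {y : ℝ} {c : ℝ≥0∞} : c < hlM f y ↔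
    ∃ p r : ℝ, 0 < r ∧ |y - p| < r ∧
      c < (∫⁻ z in Metric.ball p r, f z) / ENNReal.ofReal (2 * r) := by
  simp only [hlM, lt_iSup_iff, exists_prop]

theorem setOf_lt_hlM (f : ℝ → ℝ≥0∞) (c : ℝ≥0∞) : {y | c < hlM f y} =
    ⋃ q ∈ {q : ℝ × ℝ | 0 < q.2 ∧ c < (∫⁻ z in Metric.ball q.1 q.2, f z) /
      ENNReal.ofReal (2 * q.2)}, Metric.ball q.1 q.2 := by
  ext y
  simp only [mem_ofPred_eq, lt_hlM_iff, mem_iUnion, Metric.mem_ball, Real.dist_eq, Prod.exists,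
    exists_prop]
  constructor
  · rintro ⟨p, r, h1, h2, h3⟩; exact ⟨p, r, ⟨h1, h3⟩, h2⟩
  · rintro ⟨p, r, ⟨h1, h3⟩, h2⟩; exact ⟨p, r, h1, h2, h3⟩

theorem isOpen_lt_hlM (f : ℝ → ℝ≥0∞) (c : ℝ≥0∞) : IsOpen {y | c < hlM f y} := by
  rw [setOf_lt_hlM]
  exact isOpen_biUnion fun _ _ => Metric.isOpen_ball

theorem measurable_hlM (f : ℝ → ℝ≥0∞) : Measurable (hlM f) :=
  measurable_of_Ioi fun c => (isOpen_lt_hlM f c).measurableSet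

theorem hlM_le_of_le {f : ℝ → ℝ≥0∞} {B : ℝ≥0∞} (hf : ∀ x, f x ≤ B) (y : ℝ) : hlM f y ≤ B := by
  refine iSup₂_le fun p r => iSup₂_le fun hr _ => ?_
  refine ENNReal.div_le_of_le_mul ((lintegral_mono hf).trans ?_)
  rw [lintegral_const, Measure.restrict_apply_univ, Real.volume_ball]

theorem mul_volume_lt_hlM_le (f : ℝ → ℝ≥0∞) (c : ℝ≥0∞) :
    c * volume {y | c < hlM f y} ≤ 5 * ∫⁻ x, f x := by
  rcases eq_or_ne c 0 with rfl | hc0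
  · simp
  rcases eq_or_ne (∫⁻ x, f x) ∞ with hf | hf
  · rw [hf]; simp
  rcases eq_or_ne c ∞ with rfl | hct
  · simp
  set t : Set (ℝ × ℝ) := {q : ℝ × ℝ | 0 < q.2 ∧ c < (∫⁻ z in Metric.ball q.1 q.2, f z) /
      ENNReal.ofReal (2 * q.2)} with ht
  have ht' : ∀ q ∈ t, c * ENNReal.ofReal (2 * q.2) ≤ ∫⁻ z in Metric.ball q.1 q.2, f z := by
    intro q hq
    have h2 : ENNReal.ofReal (2 * q.2) ≠ 0 := by simp [hq.1]
    have := hq.2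
    rw [ENNReal.lt_div_iff_mul_lt (Or.inl h2) (Or.inl ENNReal.ofReal_ne_top)] at this
    exact this.le
  have hR : ∀ q ∈ t, q.2 ≤ ((∫⁻ x, f x) / c).toReal := by
    intro q hq
    have h1 := (ht' q hq).trans (setLIntegral_le_lintegral _ _)
    rw [mul_comm, ← ENNReal.le_div_iff_mul_le (Or.inl hc0) (Or.inl hct),
      ENNReal.ofReal_le_iff_le_toReal (ENNReal.div_ne_top hf hc0)] at h1
    linarith [hq.1]
  obtain ⟨u, hut, hdis, hcov⟩ := Vitali.exists_disjoint_subfamily_covering_enlargement_closedBall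
    t Prod.fst Prod.snd _ hR 5 (by norm_num)
  have hdis' : u.PairwiseDisjoint fun q => Metric.ball q.1 q.2 :=
    hdis.mono fun q => Metric.ball_subset_closedBall
  have hcount : u.Countable := hdis'.countable_of_isOpen (fun _ _ => Metric.isOpen_ball)
    fun q hq => Metric.nonempty_ball.2 (hut hq).1
  rw [setOf_lt_hlM, ← ht]
  calc c * volume (⋃ q ∈ t, Metric.ball q.1 q.2)
      ≤ c * volume (⋃ q ∈ u, Metric.closedBall q.1 (5 * q.2)) := by
        refine mul_le_mul_right (measure_mono (iUnion₂_subset fun q hq => ?_)) c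
        obtain ⟨b, hb, hsub⟩ := hcov q hq
        exact (Metric.ball_subset_closedBall.trans hsub).trans
          (subset_biUnion_of_mem (u := fun q : ℝ × ℝ => Metric.closedBall q.1 (5 * q.2)) hb)
    _ ≤ c * ∑' q : u, volume (Metric.closedBall q.1.1 (5 * q.1.2)) := by
        gcongr
        exact measure_biUnion_le _ hcount _
    _ = 5 * ∑' q : u, c * ENNReal.ofReal (2 * q.1.2) := by
        rw [← ENNReal.tsum_mul_left, ← ENNReal.tsum_mul_left]
        refine tsum_congr fun q => ?_
        rw [Real.volume_closedBall, show 2 * (5 * q.1.2) = 5 * (2 * q.1.2) by ring,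
          ENNReal.ofReal_mul (by norm_num)]
        simp only [ENNReal.ofReal_ofNat]
        ring
    _ ≤ 5 * ∑' q : u, ∫⁻ z in Metric.ball q.1.1 q.1.2, f z := by
        gcongr with q
        exact ht' _ (hut q.2)
    _ ≤ 5 * ∫⁻ x, f x := by
        gcongr
        rw [← lintegral_biUnion hcount (fun q _ => Metric.isOpen_ball.measurableSet) hdis']
        exact setLIntegral_le_lintegral _ _

theorem hlM_le_add_const {f g : ℝ → ℝ≥0∞} {B : ℝ≥0∞} (hf : ∀ x, f x ≤ g x + B) (y : ℝ) :
    hlM f y ≤ hlM g y + B := by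
  refine iSup₂_le fun p r => iSup₂_le fun hr hy => ?_
  refine ENNReal.div_le_of_le_mul ((lintegral_mono hf).trans ?_)
  rw [lintegral_add_right _ measurable_const, lintegral_const, Measure.restrict_apply_univ,
    Real.volume_ball, add_mul]
  gcongr
  exact lintegral_ball_le_hlM g hr hy

theorem lintegral_hlM_sq_le {γ : ℝ → ℝ} (hm : Measurable γ) (h0 : ∀ x, 0 ≤ γ x) {B : ℝ}
    (hB : ∀ x, γ x ≤ B) : ∫⁻ y, hlM (fun x => ENNReal.ofReal (γ x)) y ^ 2 ≤
      40 * ∫⁻ x, ENNReal.ofReal (γ x ^ 2) := by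
  set f : ℝ → ℝ≥0∞ := fun x => ENNReal.ofReal (γ x) with hf
  have hfin : ∀ y, hlM f y ≠ ∞ := fun y => ne_top_of_le_ne_top ENNReal.ofReal_ne_top
    (hlM_le_of_le (fun x => ENNReal.ofReal_le_ofReal (hB x)) y)
  have hlev : ∀ c : ℝ, 0 < c → volume {y | c < (hlM f y).toReal} * ENNReal.ofReal c ≤
      10 * ∫⁻ x, {x | c < 2 * γ x}.indicator f x := by
    intro c hc
    have h1 : {y | c < (hlM f y).toReal} ⊆
        {y | ENNReal.ofReal (c / 2) < hlM ({x | c < 2 * γ x}.indicator f) y} := by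
      intro y hy
      by_contra hcon
      simp only [mem_ofPred_eq, not_lt] at hcon hy
      have h2 : hlM f y ≤ hlM ({x | c < 2 * γ x}.indicator f) y + ENNReal.ofReal (c / 2) := by
        refine hlM_le_add_const (fun x => ?_) y
        by_cases hx : c < 2 * γ x
        · rw [indicator_of_mem (by exact hx)]; exact le_self_add
        · rw [indicator_of_notMem (by exact hx), zero_add]
          exact ENNReal.ofReal_le_ofReal (by linarith)
      have h3 : hlM f y ≤ ENNReal.ofReal c := by
        refine (h2.trans (add_le_add_left hcon _)).trans ?_
        rw [← ENNReal.ofReal_add (by positivity) (by positivity), add_halves]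
      exact absurd (ENNReal.toReal_le_of_le_ofReal hc.le h3) (not_le.2 hy)
    have h2 := mul_volume_lt_hlM_le ({x | c < 2 * γ x}.indicator f) (ENNReal.ofReal (c / 2))
    calc _ ≤ volume {y | ENNReal.ofReal (c / 2) < hlM ({x | c < 2 * γ x}.indicator f) y} *
          ENNReal.ofReal c := by gcongr
      _ = 2 * (ENNReal.ofReal (c / 2) *
          volume {y | ENNReal.ofReal (c / 2) < hlM ({x | c < 2 * γ x}.indicator f) y}) := by
          have : ENNReal.ofReal c = 2 * ENNReal.ofReal (c / 2) := by
            rw [← ENNReal.ofReal_ofNat, ← ENNReal.ofReal_mul (by norm_num)]; congr 1; ring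
          rw [this]; ring
      _ ≤ 2 * (5 * ∫⁻ x, {x | c < 2 * γ x}.indicator f x) := by gcongr
      _ = _ := by rw [← mul_assoc]; norm_num
  have hlc := lintegral_rpow_eq_lintegral_meas_lt_mul volume (f := fun y => (hlM f y).toReal)
    (Filter.Eventually.of_forall fun _ => ENNReal.toReal_nonneg)
    (measurable_hlM f).ennreal_toReal.aemeasurable (p := 2) (by norm_num)
  have e1 : ∫⁻ y, hlM f y ^ 2 = ∫⁻ y, ENNReal.ofReal ((hlM f y).toReal ^ (2 : ℝ)) := by
    refine lintegral_congr fun y => ?_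
    rw [Real.rpow_two, ENNReal.ofReal_pow ENNReal.toReal_nonneg, ENNReal.ofReal_toReal (hfin y)]
  rw [e1, hlc]
  have hmeas : Measurable fun q : ℝ × ℝ => {x | q.1 < 2 * γ x}.indicator f q.2 := by
    have : (fun q : ℝ × ℝ => {x | q.1 < 2 * γ x}.indicator f q.2) =
        {q : ℝ × ℝ | q.1 < 2 * γ q.2}.indicator fun q => f q.2 := by
      ext q; simp [indicator]
    rw [this]
    exact (by fun_prop : Measurable fun q : ℝ × ℝ => f q.2).indicator
      (measurableSet_lt (by fun_prop) (by fun_prop))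
  calc _ ≤ ENNReal.ofReal 2 * ∫⁻ c in Ioi 0, 10 * ∫⁻ x, {x | c < 2 * γ x}.indicator f x := by
        refine mul_le_mul_right (setLIntegral_mono' measurableSet_Ioi fun c hc => ?_) _
        have := hlev c hc
        rwa [show (2 : ℝ) - 1 = 1 by norm_num, Real.rpow_one]
    _ = 20 * ∫⁻ x, ∫⁻ c in Ioi 0, {x | c < 2 * γ x}.indicator f x := by
        rw [lintegral_const_mul' _ _ (by norm_num), lintegral_lintegral_swap hmeas.aemeasurable,
          ← mul_assoc]
        norm_num
    _ = 20 * ∫⁻ x, 2 * ENNReal.ofReal (γ x ^ 2) := by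
        congr 1
        refine lintegral_congr fun x => ?_
        have : ∀ c, {x | c < 2 * γ x}.indicator f x = (Iio (2 * γ x)).indicator (fun _ => f x) c := by
          intro c; simp [indicator]
        simp only [this]
        rw [lintegral_indicator measurableSet_Iio, lintegral_const, Measure.restrict_apply_univ,
          Measure.restrict_apply measurableSet_Iio, inter_comm, Ioi_inter_Iio, Real.volume_Ioo, hf,
          sub_zero, ENNReal.ofReal_mul (by norm_num), pow_two, ENNReal.ofReal_mul (h0 x)]
        simp only [ENNReal.ofReal_ofNat]
        ring
    _ = _ := by
        rw [lintegral_const_mul' _ _ (by norm_num), ← mul_assoc]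
        norm_num

section CarlesonHunt

open scoped FourierTransform SchwartzMap ComplexConjugate ContDiff

/-! ### Trees: geometry -/

/-- The point `x` is near some tile of `S` of generation at most `k`. -/
def Near (lam : ℝ) (S : Finset Tile) (k : ℤ) (x : ℝ) : Prop :=
  ∃ s ∈ S, s.k ≤ k ∧ |idx lam k (s.pt lam) - idx lam k x| ≤ 1

section TreeGeometry
variable {lam t : ℝ} {S : Finset Tile} {τ : TreeTop}

theorem Near.mono {k k' : ℤ} {x : ℝ} (hk : k ≤ k') (h : Near lam S k x) : Near lam S k' x := by
  obtain ⟨s, hs, h1, h2⟩ := h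
  exact ⟨s, hs, h1.trans hk, idx_near_mono hk h2⟩

theorem Near.congr {k : ℤ} {x y : ℝ} (hxy : idx lam k x = idx lam k y) (h : Near lam S k x) :
    Near lam S k y := by
  obtain ⟨s, hs, h1, h2⟩ := h
  exact ⟨s, hs, h1, hxy ▸ h2⟩

theorem measurableSet_near (lam : ℝ) (S : Finset Tile) (k : ℤ) :
    MeasurableSet {x | Near lam S k x} :=
  (measurable_idx lam k) (.of_discrete (s := {n | ∃ s ∈ S, s.k ≤ k ∧
    |idx lam k (s.pt lam) - n| ≤ 1}))

theorem Under.abs_ctr_sub_le (h : 0 < lam) (ht0 : 0 ≤ t) (ht1 : t < 1) {s : Tile}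
    (hs : Under lam s τ) : |s.ctr lam t - len lam τ.k * τ.m| ≤ 1 * len lam τ.k := by
  rw [one_mul]
  refine (abs_sub_lt_of_idx_eq h ?_).le
  rw [idx_ctr_eq_pt h ht0 ht1 s hs.1, hs.2.1, eq_comm, idx_eq_iff h]
  constructor <;> linarith [len_pos h τ.k]

theorem volume_near_top_le (h : 0 < lam) (hU : ∀ s ∈ S, Under lam s τ) :
    volume {x | Near lam S τ.k x} ≤ ENNReal.ofReal (3 * len lam τ.k) := by
  have hL := len_pos h τ.k
  have hsub : {x | Near lam S τ.k x} ⊆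
      Ico (len lam τ.k * (τ.m - 1)) (len lam τ.k * (τ.m + 2)) := by
    rintro x ⟨s, hs, -, h2⟩
    rw [(hU s hs).2.1, abs_le] at h2
    obtain ⟨h3, h4⟩ := (idx_eq_iff h τ.k _ x).1 rfl
    have h5 : ((τ.m - 1 : ℤ) : ℝ) ≤ idx lam τ.k x := by exact_mod_cast (by omega)
    have h6 : (idx lam τ.k x : ℝ) ≤ ((τ.m + 1 : ℤ) : ℝ) := by exact_mod_cast (by omega)
    push_cast at h5 h6
    constructor <;> nlinarith
  refine (measure_mono hsub).trans ?_
  rw [Real.volume_Ico]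
  exact ENNReal.ofReal_le_ofReal (by linarith)

open scoped Classical in
theorem sum_far_wt_le (h : 0 < lam) (ht0 : 0 ≤ t) (ht1 : t < 1) (hU : ∀ s ∈ S, Under lam s τ)
    (y : ℝ) : ∑ s ∈ S.filter (fun s => ¬ Near lam S s.k y),
      wt (s.ctr lam t) (len lam s.k) y ^ 5 ≤
      2048 * wt (len lam τ.k * τ.m) (len lam τ.k) y ^ 2 := by
  have hLT := len_pos h τ.k
  set V := S.filter (fun s => ¬ Near lam S s.k y) with hV
  set W := wt (len lam τ.k * τ.m) (len lam τ.k) y with hW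
  have hW0 : 0 ≤ W := wt_nonneg hLT
  rcases V.eq_empty_or_nonempty with he | hne
  · rw [he, Finset.sum_empty]; positivity
  obtain ⟨s₁, hs₁, hmax⟩ := Finset.exists_max_image V Tile.k hne
  set κ := s₁.k with hκ
  have hLκ := len_pos h κ
  have hnear : ¬ Near lam S κ y := (Finset.mem_filter.1 hs₁).2
  have hterm : ∀ s ∈ V, wt (s.ctr lam t) (len lam s.k) y ^ 5 ≤
      wt (s.ctr lam t) (len lam s.k) y ^ 2 * (4 * W ^ 2 / len lam κ * len lam s.k) := by
    intro s hs
    have hL := len_pos h s.k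
    have hsS := (Finset.mem_filter.1 hs).1
    have hk : s.k ≤ κ := hmax s hs
    have hdist : len lam κ ≤ |y - s.ctr lam t| := by
      rw [abs_sub_comm]
      refine le_abs_sub_of_idx_far (k := κ) h ?_
      rw [idx_ctr_eq_pt h ht0 ht1 s hk]
      exact fun hc => hnear ⟨s, hsS, hk, hc⟩
    have e1 := wt_le_div hL hLκ hdist
    have e2 : wt (s.ctr lam t) (len lam s.k) y ≤ 2 * W := by
      refine (wt_mono_len hL (len_mono h (hU s hsS).1)).trans ?_
      have := wt_le_of_abs_center_le (x := y) hLT zero_le_one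
        ((hU s hsS).abs_ctr_sub_le h ht0 ht1 (t := t))
      linarith
    have e0 := wt_nonneg (c := s.ctr lam t) (x := y) hL
    calc wt (s.ctr lam t) (len lam s.k) y ^ 5 = wt (s.ctr lam t) (len lam s.k) y ^ 2 *
          (wt (s.ctr lam t) (len lam s.k) y ^ 2 * wt (s.ctr lam t) (len lam s.k) y) := by ring
      _ ≤ wt (s.ctr lam t) (len lam s.k) y ^ 2 * ((2 * W) ^ 2 * (len lam s.k / len lam κ)) := by
          gcongr
      _ = _ := by ring
  have := sum_by_scale h V (fun s => wt (s.ctr lam t) (len lam s.k) y ^ 5)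
    (C := 256 * (4 * W ^ 2 / len lam κ)) (by positivity) (K := κ) hmax ?_
  · refine this.trans_eq ?_
    field_simp
    ring
  intro k hk
  have hL := len_pos h k
  calc _ ≤ ∑ s ∈ V.filter (·.k = k), wt (s.ctr lam t) (len lam k) y ^ 2 *
        (4 * W ^ 2 / len lam κ * len lam k) := by
        refine Finset.sum_le_sum fun s hs => ?_
        obtain ⟨h1, h2⟩ := Finset.mem_filter.1 hs
        have := hterm s h1
        rwa [h2] at this ⊢
    _ ≤ (16 * ((Finset.Icc (16 * fidx lam (k - 1) τ.ξ) (16 * fidx lam (k - 1) τ.ξ + 15)).card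
          : ℝ)) * (4 * W ^ 2 / len lam κ * len lam k) := by
        rw [← Finset.sum_mul]
        refine mul_le_mul_of_nonneg_right ?_ (by positivity)
        refine sum_wt_tiles_le ht0 ht1 h k _ (fun s hs => (Finset.mem_filter.1 hs).2) _
          (fun s hs => ?_) y
        obtain ⟨h1, h2⟩ := Finset.mem_filter.1 hs
        have := (hU s (Finset.mem_filter.1 h1).1).2.2
        rw [h2] at this
        rw [Finset.mem_Icc]
        omega
    _ = _ := by
        have : (Finset.Icc (16 * fidx lam (k - 1) τ.ξ) (16 * fidx lam (k - 1) τ.ξ + 15)).card =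
          16 := by simp only [Int.card_Icc]; omega
        rw [this]; push_cast; ring

theorem lintegral_far_tile_le (h : 0 < lam) (ht0 : 0 ≤ t) (ht1 : t < 1) {E : Set ℝ}
    (hEm : MeasurableSet E) {N : ℝ → ℝ} (hN : Measurable N) {μ : ℝ} (hμ : 0 ≤ μ)
    (hM : MassLE lam E N S μ) {s : Tile} (hs : s ∈ S) :
    ∫⁻ x in E ∩ {x | fidx lam s.k (N x) = s.l} ∩ {x | ¬ Near lam S s.k x},
      ENNReal.ofReal (wt (s.ctr lam t) (len lam s.k) x ^ 8) ≤
    ENNReal.ofReal (2048 * μ * ∫ x in {x | ¬ Near lam S s.k x},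
      wt (s.ctr lam t) (len lam s.k) x ^ 5) := by
  have hL := len_pos h s.k
  set L := len lam s.k with hLdef
  set c := s.ctr lam t with hc
  set R := {x | ¬ Near lam S s.k x} with hR
  have hRm : MeasurableSet R := (measurableSet_near lam S s.k).compl
  set I := ∫ x in R, wt c L x ^ 5 with hI
  have hw : ∀ x, 0 ≤ wt c L x := fun x => wt_nonneg hL
  have hI0 : 0 ≤ I := integral_nonneg fun x => pow_nonneg (hw x) 5
  have hsup : ∀ x ∈ R, wt c L x ^ 5 ≤ L⁻¹ * (2 ^ 5 * I) := by
    intro x hx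
    have h1 := len_mul_wt_le_integral (c := c) h (le_refl (len lam s.k)) (y := x) rfl
      (M := 5) (by norm_num)
    have h2 : ∫ x' in {x' | idx lam s.k x' = idx lam s.k x}, wt c (len lam s.k) x' ^ 5 ≤ I := by
      refine setIntegral_mono_set (integrable_wt_pow hL (by norm_num)).integrableOn
        (Filter.Eventually.of_forall fun x => pow_nonneg (hw x) 5) ?_
      refine LE.le.eventuallyLE fun x' hx' hc' => hx ?_
      exact Near.congr hx' hc'
    rw [inv_mul_eq_div, le_div_iff₀ hL, mul_comm]
    exact h1.trans (by gcongr)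
  set Es := E ∩ {x | fidx lam s.k (N x) = s.l} with hEs
  have hEsm : MeasurableSet Es :=
    hEm.inter (((measurable_fidx lam _).comp hN) (measurableSet_singleton _))
  have hW := lintegral_wt_cube_le (volume.restrict Es) (p := c) hL (ENNReal.ofReal (4 * μ * L)) ?_
  · calc _ ≤ ∫⁻ x in Es ∩ R, ENNReal.ofReal (L⁻¹ * (2 ^ 5 * I)) * ENNReal.ofReal (wt c L x ^ 3) := by
          refine setLIntegral_mono' (hEsm.inter hRm) fun x hx => ?_
          rw [← ENNReal.ofReal_mul (by positivity)]
          refine ENNReal.ofReal_le_ofReal ?_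
          calc wt c L x ^ 8 = wt c L x ^ 5 * wt c L x ^ 3 := by ring
            _ ≤ _ := mul_le_mul_of_nonneg_right (hsup x hx.2) (pow_nonneg (hw x) 3)
      _ ≤ ENNReal.ofReal (L⁻¹ * (2 ^ 5 * I)) * ∫⁻ x in Es, ENNReal.ofReal (wt c L x ^ 3) := by
          rw [lintegral_const_mul' _ _ ENNReal.ofReal_ne_top]
          gcongr
          exact inter_subset_left
      _ ≤ ENNReal.ofReal (L⁻¹ * (2 ^ 5 * I)) * (16 * ENNReal.ofReal (4 * μ * L)) := by gcongr
      _ = _ := by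
          rw [show (16 : ℝ≥0∞) = ENNReal.ofReal 16 by simp, ← ENNReal.ofReal_mul (by norm_num),
            ← ENNReal.ofReal_mul (by positivity)]
          congr 1
          field_simp
          ring
  intro j
  have hm := hM s hs s.k le_rfl (s.l / len lam s.k) (by rw [fidx_sub_one, fidx_left h]) (j + 1)
  rw [Measure.restrict_apply (measurableSet_le (by fun_prop) measurable_const)]
  calc _ ≤ _ := measure_mono ?_
    _ ≤ _ := hm
    _ = ENNReal.ofReal (4 * μ * L) * 4 ^ j := by
        rw [show (4 : ℝ≥0∞) ^ j = ENNReal.ofReal (4 ^ j) by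
          rw [ENNReal.ofReal_pow (by norm_num)]; simp, ← ENNReal.ofReal_mul (by positivity)]
        congr 1
        ring
  rintro x ⟨hx1, hx2, hx3⟩
  refine ⟨⟨hx2, ?_⟩, ?_⟩
  · refine fidx_congr (k' := s.k) (by omega) ?_
    rw [fidx_left h]; exact hx3
  · have h1 : |c - s.pt lam| ≤ L := by
      refine (abs_sub_lt_of_idx_eq (k := s.k) h ?_).le
      rw [idx_ctr h ht0 ht1, idx_pt h]
    have h2 : |x - s.pt lam| ≤ |x - c| + |c - s.pt lam| := abs_sub_le _ _ _
    have h3 : |x - c| ≤ 2 ^ j * L := hx1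
    have h4 : L ≤ 2 ^ j * L := le_mul_of_one_le_left hL.le (one_le_pow₀ (by norm_num))
    show |x - s.pt lam| ≤ 2 ^ (j + 1) * L
    rw [pow_succ]
    linarith

theorem sum_lintegral_far_le (h : 0 < lam) (ht0 : 0 ≤ t) (ht1 : t < 1) {E : Set ℝ}
    (hEm : MeasurableSet E) {N : ℝ → ℝ} (hN : Measurable N) {μ : ℝ} (hμ : 0 ≤ μ)
    (hM : MassLE lam E N S μ) (hU : ∀ s ∈ S, Under lam s τ) :
    ∑ s ∈ S, ∫⁻ x in E ∩ {x | fidx lam s.k (N x) = s.l} ∩ {x | ¬ Near lam S s.k x},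
      ENNReal.ofReal (wt (s.ctr lam t) (len lam s.k) x ^ 8) ≤
    ENNReal.ofReal (2 ^ 24 * μ * len lam τ.k) := by
  classical
  have hLT := len_pos h τ.k
  have hgInt : ∀ s : Tile, Integrable fun x => wt (s.ctr lam t) (len lam s.k) x ^ 5 := fun s =>
    integrable_wt_pow (len_pos h _) (by norm_num)
  have hRm : ∀ s : Tile, MeasurableSet {x | ¬ Near lam S s.k x} := fun s =>
    (measurableSet_near lam S s.k).compl
  have hreal : ∑ s ∈ S, ∫ x in {x | ¬ Near lam S s.k x},
      wt (s.ctr lam t) (len lam s.k) x ^ 5 ≤ 2048 * (4 * len lam τ.k) := by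
    calc _ = ∫ x, ∑ s ∈ S, {x | ¬ Near lam S s.k x}.indicator
          (fun x => wt (s.ctr lam t) (len lam s.k) x ^ 5) x := by
          rw [integral_finsetSum _ fun s _ => (hgInt s).indicator (hRm s)]
          exact Finset.sum_congr rfl fun s _ => (integral_indicator (hRm s)).symm
      _ ≤ ∫ x, 2048 * wt (len lam τ.k * τ.m) (len lam τ.k) x ^ 2 := by
          refine integral_mono (integrable_finsetSum _ fun s _ => (hgInt s).indicator (hRm s))
            ((integrable_wt_pow hLT le_rfl).const_mul _) fun x => ?_
          refine le_trans (le_of_eq ?_) (sum_far_wt_le h ht0 ht1 hU x)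
          rw [Finset.sum_filter]
          exact Finset.sum_congr rfl fun s _ => by simp [indicator]
      _ ≤ _ := by
          rw [integral_const_mul]
          exact mul_le_mul_of_nonneg_left (integral_wt_sq_le hLT) (by norm_num)
  calc _ ≤ ∑ s ∈ S, ENNReal.ofReal (2048 * μ * ∫ x in {x | ¬ Near lam S s.k x},
        wt (s.ctr lam t) (len lam s.k) x ^ 5) :=
        Finset.sum_le_sum fun s hs => lintegral_far_tile_le h ht0 ht1 hEm hN hμ hM hs
    _ = ENNReal.ofReal (2048 * μ * ∑ s ∈ S, ∫ x in {x | ¬ Near lam S s.k x},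
        wt (s.ctr lam t) (len lam s.k) x ^ 5) := by
        rw [Finset.mul_sum, ENNReal.ofReal_sum_of_nonneg fun s _ => ?_]
        exact mul_nonneg (by positivity)
          (integral_nonneg fun x => pow_nonneg (wt_nonneg (len_pos h _)) 5)
    _ ≤ _ := by
        refine ENNReal.ofReal_le_ofReal ?_
        have := mul_le_mul_of_nonneg_left hreal (by positivity : 0 ≤ 2048 * μ)
        refine this.trans_eq (by ring)

/-- Integration over the part of the set where the tree is near: local constancy against the
density of the frequency function. -/
theorem lintegral_near_le (h : 0 < lam) {E : Set ℝ} (hEm : MeasurableSet E) {N : ℝ → ℝ}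
    (hN : Measurable N) {μ : ℝ} (hμ : 0 ≤ μ) (hM : MassLE lam E N S μ)
    (hU : ∀ s ∈ S, Under lam s τ) (B H : ℝ → ℝ≥0∞)
    (hB : ∀ x, B x ≠ 0 → ∃ s ∈ S, Near lam S s.k x ∧ fidx lam s.k (N x) = s.l)
    (hBH : ∀ κ x y, idx lam κ x = idx lam κ y → ¬ Near lam S κ x → Near lam S (κ + 1) x →
      B x ≤ H y) :
    ∫⁻ x in E, B x ≤ ENNReal.ofReal (64 * μ) * ∫⁻ y in {y | Near lam S τ.k y}, H y := by
  set D : ℤ × ℤ → Set ℝ := fun i => {x | idx lam i.1 x = i.2 ∧ ¬ Near lam S i.1 x ∧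
    Near lam S (i.1 + 1) x ∧ i.1 < τ.k} with hD
  have hDm : ∀ i, MeasurableSet (D i) := fun i =>
    (measurableSet_idx_eq _ _ _).inter ((measurableSet_near _ _ _).compl.inter
      ((measurableSet_near _ _ _).inter (MeasurableSet.const _)))
  have hDd : Pairwise (Function.onFun Disjoint D) := by
    intro i i' hne
    rw [Function.onFun, Set.disjoint_left]
    rintro x ⟨h1, h2, h3, -⟩ ⟨h1', h2', h3', -⟩
    rcases lt_trichotomy i.1 i'.1 with hlt | he | hlt
    · exact h2' (h3.mono (by omega))
    · refine hne (Prod.ext he ?_)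
      rw [← h1, ← h1', he]
    · exact h2 (h3'.mono (by omega))
  have hcover : ∀ x, B x ≠ 0 → x ∈ ⋃ i, D i := by
    intro x hx
    obtain ⟨s, hs, hn, -⟩ := hB x hx
    obtain ⟨b, hb⟩ : ∃ b : ℤ, ∀ z, Near lam S z x → b ≤ z := by
      obtain ⟨s₀, hs₀, hmin⟩ := Finset.exists_min_image S Tile.k ⟨s, hs⟩
      exact ⟨s₀.k, fun z ⟨s', hs', h1, _⟩ => (hmin s' hs').trans h1⟩
    obtain ⟨k₁, hk₁, hmin⟩ := Int.exists_least_of_bdd ⟨b, hb⟩ ⟨s.k, hn⟩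
    refine mem_iUnion.2 ⟨(k₁ - 1, idx lam (k₁ - 1) x), rfl, ?_, ?_, ?_⟩
    · intro hc
      have := hmin _ hc
      omega
    · simpa using hk₁
    · have h1 := hmin _ hn
      have h2 := (hU s hs).1
      simp only
      omega
  have hpiece : ∀ i, ∫⁻ x in D i ∩ E, B x ≤ ENNReal.ofReal (64 * μ) * ∫⁻ y in D i, H y := by
    intro i
    rcases (D i).eq_empty_or_nonempty with he | ⟨x₀, hx₀⟩
    · simp [he]
    have hDeq : D i = {x | idx lam i.1 x = i.2} := by
      refine Subset.antisymm (fun x hx => hx.1) fun x hx => ?_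
      have hxx : idx lam i.1 x₀ = idx lam i.1 x := hx₀.1.trans (Eq.symm hx)
      exact ⟨hx, fun hc => hx₀.2.1 (hc.congr hxx.symm),
        hx₀.2.2.1.congr (idx_congr (by omega) hxx), hx₀.2.2.2⟩
    set I := ⨅ y ∈ D i, H y with hI
    set G := {x | fidx lam i.1 (N x) = fidx lam i.1 τ.ξ} with hG
    have hGm : MeasurableSet G := ((measurable_fidx lam _).comp hN) (measurableSet_singleton _)
    have hvol : volume (G ∩ (D i ∩ E)) ≤ ENNReal.ofReal (64 * μ) * volume (D i) := by
      obtain ⟨s₀, hs₀, h1, h2⟩ := hx₀.2.2.1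
      have hm := hM s₀ hs₀ (i.1 + 1) h1 τ.ξ (hU s₀ hs₀).2.2 1
      rw [hDeq, volume_idx_eq h, ← ENNReal.ofReal_mul (by positivity), ← hDeq]
      calc _ ≤ _ := measure_mono ?_
        _ ≤ _ := hm
        _ = _ := by
          congr 1
          rw [len_add_one]; ring
      rintro x ⟨hxG, hxD, hxE⟩
      refine ⟨⟨hxE, ?_⟩, ?_⟩
      · have hxG' : fidx lam i.1 (N x) = fidx lam i.1 τ.ξ := hxG
        simpa using hxG'
      · have hxx : idx lam (i.1 + 1) x₀ = idx lam (i.1 + 1) x :=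
          idx_congr (by omega) (hx₀.1.trans hxD.1.symm)
        rw [hxx, abs_sub_comm] at h2
        simpa using abs_sub_le_of_idx_near h h2
    calc ∫⁻ x in D i ∩ E, B x ≤ ∫⁻ x in D i ∩ E, G.indicator (fun _ => I) x := by
          refine setLIntegral_mono' ((hDm i).inter hEm) fun x hx => ?_
          by_cases h0 : B x = 0
          · rw [h0]; exact zero_le
          have hxG : x ∈ G := by
            obtain ⟨s, hs, hn, hl⟩ := hB x h0
            have hk : i.1 ≤ s.k - 1 := by
              by_contra hc
              push Not at hc
              exact hx.1.2.1 (hn.mono (by omega))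
            refine fidx_congr hk ?_
            rw [(hU s hs).2.2, fidx_sub_one, hl]
          rw [indicator_of_mem hxG]
          refine le_iInf₂ fun y hy => ?_
          exact hBH i.1 x y (hx.1.1.trans hy.1.symm) hx.1.2.1 hx.1.2.2.1
      _ = I * volume (G ∩ (D i ∩ E)) := by
          rw [lintegral_indicator hGm, lintegral_const, Measure.restrict_apply_univ,
            Measure.restrict_apply hGm]
      _ ≤ I * (ENNReal.ofReal (64 * μ) * volume (D i)) := by gcongr
      _ = ENNReal.ofReal (64 * μ) * ∫⁻ y in D i, I := by
          rw [lintegral_const, Measure.restrict_apply_univ]; ring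
      _ ≤ _ := by
          exact mul_le_mul' le_rfl
            (setLIntegral_mono' (hDm i) fun y (hy : y ∈ D i) => iInf₂_le (f := fun y _ => H y) y hy)
  calc ∫⁻ x in E, B x = ∫⁻ x in E, (⋃ i, D i).indicator B x := by
        congr 1
        ext x
        by_cases h0 : B x = 0
        · simp [indicator, h0]
        · rw [indicator_of_mem (hcover x h0)]
    _ = ∫⁻ x in ⋃ i, (D i ∩ E), B x := by
        rw [setLIntegral_indicator (MeasurableSet.iUnion hDm), iUnion_inter]
    _ ≤ ∑' i, ∫⁻ x in D i ∩ E, B x := lintegral_iUnion_le _ _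
    _ ≤ ∑' i, ENNReal.ofReal (64 * μ) * ∫⁻ y in D i, H y := ENNReal.tsum_le_tsum hpiece
    _ = ENNReal.ofReal (64 * μ) * ∫⁻ y in ⋃ i, D i, H y := by
        rw [ENNReal.tsum_mul_left, lintegral_iUnion hDm hDd]
    _ ≤ _ := by
        gcongr
        exact iUnion_subset fun i x hx => hx.2.2.1.mono (by have := hx.2.2.2; omega)

end TreeGeometry

/-! ### Trees: the analytic estimate -/

theorem integrable_pk_mul_conj_pk (Ψ Ψ' : 𝓢(ℝ, ℂ)) {L L' : ℝ} (hL : 0 < L) (hL' : 0 < L')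
    (z z' ν ν' : ℝ) : Integrable fun y => pk Ψ L z ν y * conj (pk Ψ' L' z' ν' y) := by
  obtain ⟨C, -, hC⟩ := pk_bounded Ψ'
  refine (integrable_pk Ψ hL z ν).mul_bdd (c := C * (√L')⁻¹)
    (Complex.continuous_conj.comp (continuous_pk Ψ' L' z' ν')).aestronglyMeasurable
    (Filter.Eventually.of_forall fun y => ?_)
  rw [RCLike.norm_conj]
  exact hC L' hL' z' ν' y

theorem integral_norm_sq_sum_pk_le (ζ : 𝓢(ℝ, ℂ)) :
    ∃ C : ℝ, 0 < C ∧ ∀ (lam t : ℝ) (_ : 0 < lam) (_ : 0 ≤ t) (_ : t < 1) (τ : TreeTop)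
      (F : Finset Tile) (_ : ∀ s ∈ F, Lac lam s τ) (ν : Tile → ℝ)
      (_ : ∀ s ∈ F, ∀ v, ζ v ≠ 0 → 1 ≤ (τ.ξ - ν s) * len lam s.k + v ∧
        (τ.ξ - ν s) * len lam s.k + v ≤ 14) (c : Tile → ℂ),
      ∫ y, ‖∑ s ∈ F, c s * pk ζ (len lam s.k) (s.ctr lam t) (ν s) y‖ ^ 2 ≤
        C * ∑ s ∈ F, ‖c s‖ ^ 2 := by
  classical
  obtain ⟨C, hC, hb⟩ := norm_integral_pk_mul_conj_le ζ ζ 2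
  refine ⟨C * 16, by positivity, fun lam t h ht0 ht1 τ F hF ν hν c => ?_⟩
  have hL : ∀ s : Tile, 0 < len lam s.k := fun s => len_pos h s.k
  set g : Tile → ℝ → ℂ := fun s => pk ζ (len lam s.k) (s.ctr lam t) (ν s) with hg
  set G : Tile → Tile → ℂ := fun s s' => ∫ y, g s y * conj (g s' y) with hG
  have hgInt : ∀ s s', Integrable fun y => g s y * conj (g s' y) := fun s s' =>
    integrable_pk_mul_conj_pk ζ ζ (hL s) (hL s') _ _ _ _
  have hGsymm : ∀ s s', ‖G s s'‖ = ‖G s' s‖ := by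
    intro s s'
    rw [← RCLike.norm_conj (G s s'), hG]
    simp only
    rw [← integral_conj]
    simp [mul_comm]
  have hzero : ∀ s ∈ F, ∀ s' ∈ F, s.k < s'.k → G s s' = 0 := by
    intro s hs s' hs' hk
    refine integral_pk_mul_conj_pk_eq_zero ζ ζ (hL s') _ _ _ _ fun v v' hv hv' he => ?_
    have h1 := (hν s hs v hv).1
    have h2 := (hν s' hs' v' hv').2
    have h3 := len_lt_of_lt h hk
    have h4 : (τ.ξ - ν s) * len lam s.k + v = (τ.ξ - (ν s - v / len lam s.k)) * len lam s.k := by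
      field_simp [(hL s).ne']; ring
    have h5 : (τ.ξ - ν s') * len lam s'.k + v' =
        (τ.ξ - (ν s - v / len lam s.k)) * len lam s'.k := by
      rw [he]; field_simp [(hL s').ne']; ring
    rw [h4] at h1
    rw [h5] at h2
    have h6 : 0 < τ.ξ - (ν s - v / len lam s.k) := by
      by_contra hc
      nlinarith [hL s, not_lt.1 hc]
    nlinarith [hL s, hL s']
  have hrow : ∀ s ∈ F, ∑ s' ∈ F, ‖G s s'‖ ≤ C * 16 := by
    intro s hs
    have hle : ∀ s' ∈ F, ‖G s s'‖ ≤ if s'.k = s.k then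
        C * wt (s'.ctr lam t) (len lam s.k) (s.ctr lam t) ^ 2 else 0 := by
      intro s' hs'
      split_ifs with hk
      · have h1 : len lam s'.k = len lam s.k := by rw [hk]
        have := hb (len lam s.k) (len lam s'.k) (hL s') h1.le (s.ctr lam t) (s'.ctr lam t) (ν s) (ν s')
        rw [h1, div_self (hL s).ne', Real.sqrt_one, mul_one, wt] at this
        rw [wt, abs_sub_comm]
        refine le_trans (le_of_eq ?_) this
        simp only [hG, hg, h1]
      · rcases lt_or_gt_of_ne hk with hk | hk
        · rw [hGsymm, hzero s' hs' s hs hk, norm_zero]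
        · rw [hzero s hs s' hs' hk, norm_zero]
    refine (Finset.sum_le_sum hle).trans ?_
    rw [← Finset.sum_filter, ← Finset.mul_sum]
    refine mul_le_mul_of_nonneg_left ?_ hC.le
    have := sum_wt_tiles_le ht0 ht1 h s.k (F.filter (·.k = s.k))
      (fun s' hs' => (Finset.mem_filter.1 hs').2) {s.l} (fun s' hs' => ?_) (s.ctr lam t)
    · simpa using this
    · obtain ⟨h1, h2⟩ := Finset.mem_filter.1 hs'
      have e1 := (hF s' h1).2.2
      have e2 := (hF s hs).2.2
      rw [h2] at e1
      rw [Finset.mem_singleton]; omega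
  have hexp : ((∫ y, ‖∑ s ∈ F, c s * g s y‖ ^ 2 : ℝ) : ℂ) =
      ∑ s ∈ F, ∑ s' ∈ F, c s * conj (c s') * G s s' := by
    rw [← integral_complex_ofReal]
    have : ∀ y, ((‖∑ s ∈ F, c s * g s y‖ ^ 2 : ℝ) : ℂ) =
        ∑ s ∈ F, ∑ s' ∈ F, c s * conj (c s') * (g s y * conj (g s' y)) := by
      intro y
      push_cast
      rw [← Complex.mul_conj', map_sum, Finset.sum_mul_sum]
      refine Finset.sum_congr rfl fun s _ => Finset.sum_congr rfl fun s' _ => ?_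
      rw [map_mul]; ring
    simp_rw [this]
    rw [integral_finsetSum _ fun s _ => integrable_finsetSum _ fun s' _ =>
      (hgInt s s').const_mul _]
    refine Finset.sum_congr rfl fun s _ => ?_
    rw [integral_finsetSum _ fun s' _ => (hgInt s s').const_mul _]
    exact Finset.sum_congr rfl fun s' _ => integral_const_mul _ _
  have hnn : 0 ≤ ∫ y, ‖∑ s ∈ F, c s * g s y‖ ^ 2 := integral_nonneg fun y => by positivity
  calc ∫ y, ‖∑ s ∈ F, c s * g s y‖ ^ 2 = ‖((∫ y, ‖∑ s ∈ F, c s * g s y‖ ^ 2 : ℝ) : ℂ)‖ := by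
        rw [Complex.norm_real, Real.norm_of_nonneg hnn]
    _ ≤ ∑ s ∈ F, ∑ s' ∈ F, ((‖c s‖ ^ 2 * ‖G s s'‖) / 2 + (‖c s'‖ ^ 2 * ‖G s' s‖) / 2) := by
        rw [hexp]
        refine (norm_sum_le _ _).trans (Finset.sum_le_sum fun s _ =>
          (norm_sum_le _ _).trans (Finset.sum_le_sum fun s' _ => ?_))
        rw [norm_mul, norm_mul, RCLike.norm_conj, hGsymm s' s]
        nlinarith [mul_nonneg (sq_nonneg (‖c s‖ - ‖c s'‖)) (norm_nonneg (G s s'))]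
    _ = ∑ s ∈ F, ‖c s‖ ^ 2 * ∑ s' ∈ F, ‖G s s'‖ := by
        simp_rw [Finset.sum_add_distrib]
        rw [Finset.sum_comm (f := fun s s' => ‖c s'‖ ^ 2 * ‖G s' s‖ / 2), ← Finset.sum_add_distrib]
        refine Finset.sum_congr rfl fun s _ => ?_
        rw [← Finset.sum_add_distrib, Finset.mul_sum]
        exact Finset.sum_congr rfl fun s' _ => by ring
    _ ≤ ∑ s ∈ F, ‖c s‖ ^ 2 * (C * 16) := by
        exact Finset.sum_le_sum fun s hs => mul_le_mul_of_nonneg_left (hrow s hs) (by positivity)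
    _ = _ := by rw [← Finset.sum_mul, mul_comm]

/-- A smooth cutoff which is `1` on `[-14, 14]` and vanishes off `(-16, 16)`. -/
theorem exists_lowpass : ∃ θ : 𝓢(ℝ, ℂ), (∀ u, |u| ≤ 14 → θ u = 1) ∧ ∀ u, 16 ≤ |u| → θ u = 0 := by
  let b : ContDiffBump (0 : ℝ) := ⟨14, 16, by norm_num, by norm_num⟩
  have h1 : HasCompactSupport fun x => ((b x : ℝ) : ℂ) :=
    b.hasCompactSupport.comp_left (g := Complex.ofReal) Complex.ofReal_zero
  have h2 : ContDiff ℝ ∞ fun x => ((b x : ℝ) : ℂ) := Complex.ofRealCLM.contDiff.comp b.contDiff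
  refine ⟨h1.toSchwartzMap h2, fun u hu => ?_, fun u hu => ?_⟩
  · simp [b.one_of_mem_closedBall (x := u) (by simpa using hu)]
  · simp [b.zero_of_le_dist (x := u) (by simpa using hu)]

/-- The smooth frequency truncations of a function are controlled by its maximal function. -/
theorem lintegral_pk_mul_le_hlM (θ : 𝓢(ℝ, ℂ)) : ∃ C : ℝ, 0 < C ∧ ∀ (L : ℝ) (_ : 0 < L)
    (ξ x y : ℝ) (_ : |y - x| ≤ L) (Γ : ℝ → ℂ) (_ : Continuous Γ),
    ‖((√L)⁻¹ : ℝ) * ∫ z, pk θ L x (-ξ) z * Γ z‖ₑ ≤ ENNReal.ofReal C * hlM (‖Γ ·‖ₑ) y := by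
  obtain ⟨C, hC, hb⟩ := pk_decay θ 3
  refine ⟨C * 64, by positivity, fun L hL ξ x y hxy Γ hΓ => ?_⟩
  have hs : 0 < √L := Real.sqrt_pos.2 hL
  have hW := lintegral_wt_cube_le (volume.withDensity (‖Γ ·‖ₑ)) (p := x) hL
    (hlM (‖Γ ·‖ₑ) y * ENNReal.ofReal (4 * L)) ?_
  · rw [lintegral_withDensity_eq_lintegral_mul _ (by fun_prop)
      (((measurable_wt).pow_const 3).ennreal_ofReal)] at hW
    calc _ ≤ ENNReal.ofReal (√L)⁻¹ * ∫⁻ z, ENNReal.ofReal (C * (√L)⁻¹) *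
          (‖Γ z‖ₑ * ENNReal.ofReal (wt x L z ^ 3)) := by
          rw [enorm_mul]
          gcongr
          · rw [← ofReal_norm, Complex.norm_real, Real.norm_of_nonneg (by positivity)]
          · refine (enorm_integral_le_lintegral_enorm _).trans (lintegral_mono fun z => ?_)
            rw [enorm_mul, mul_comm (‖Γ z‖ₑ), ← mul_assoc, ← ENNReal.ofReal_mul (by positivity)]
            gcongr
            rw [← ofReal_norm]
            exact ENNReal.ofReal_le_ofReal (hb L hL x (-ξ) z)
      _ ≤ ENNReal.ofReal (√L)⁻¹ * (ENNReal.ofReal (C * (√L)⁻¹) *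
          (16 * (hlM (‖Γ ·‖ₑ) y * ENNReal.ofReal (4 * L)))) := by
          rw [lintegral_const_mul' _ _ ENNReal.ofReal_ne_top]
          gcongr
          exact hW
      _ = ENNReal.ofReal ((√L)⁻¹ * (C * (√L)⁻¹) * 16 * (4 * L)) * hlM (‖Γ ·‖ₑ) y := by
          rw [ENNReal.ofReal_mul' (by positivity : 0 ≤ 4 * L),
            ENNReal.ofReal_mul' (by norm_num : (0 : ℝ) ≤ 16),
            ENNReal.ofReal_mul' (by positivity : 0 ≤ C * (√L)⁻¹), ENNReal.ofReal_ofNat 16]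
          ring
      _ = _ := by
          congr 2
          field_simp
          rw [Real.sq_sqrt hL.le]; ring
  intro j
  have h1 : L ≤ 2 ^ j * L := le_mul_of_one_le_left hL.le (one_le_pow₀ (by norm_num))
  have hm : MeasurableSet {z : ℝ | |z - x| ≤ 2 ^ j * L} := measurableSet_le (by fun_prop) (by fun_prop)
  rw [withDensity_apply _ hm]
  refine (lintegral_closedBall_le_hlM _ (by positivity) (hxy.trans h1)).trans ?_
  rw [mul_assoc]
  gcongr
  rw [show (4 : ℝ≥0∞) ^ j = ENNReal.ofReal (4 ^ j) by
    rw [ENNReal.ofReal_pow (by norm_num)]; simp, ← ENNReal.ofReal_mul (by positivity)]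
  refine ENNReal.ofReal_le_ofReal ?_
  have : (2 : ℝ) ^ j ≤ 4 ^ j := pow_le_pow_left₀ (by norm_num) (by norm_num) j
  nlinarith

open scoped Classical in
/-- Frequency truncation of a lacunary sum of wave packets removes the small scales. -/
theorem lowpass_sum_pk (θ ζ : 𝓢(ℝ, ℂ)) (hθ1 : ∀ u, |u| ≤ 14 → θ u = 1)
    (hθ0 : ∀ u, 16 ≤ |u| → θ u = 0) {lam : ℝ} (h : 0 < lam) (t ξ : ℝ) (F : Finset Tile)
    (ν : Tile → ℝ) (hν : ∀ s ∈ F, ∀ v, ζ v ≠ 0 → 1 ≤ (ξ - ν s) * len lam s.k + v ∧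
      (ξ - ν s) * len lam s.k + v ≤ 14) (c : Tile → ℂ) (k : ℤ) (x : ℝ) :
    ((√(len lam k))⁻¹ : ℝ) * ∫ z, pk θ (len lam k) x (-ξ) z *
        ∑ s ∈ F, c s * pk ζ (len lam s.k) (s.ctr lam t) (ν s) z =
      ∑ s ∈ F.filter (fun s => k ≤ s.k), c s * pk ζ (len lam s.k) (s.ctr lam t) (ν s) x := by
  have hL := len_pos h k
  have hgInt : ∀ s ∈ F, Integrable fun z => pk θ (len lam k) x (-ξ) z *
      (c s * pk ζ (len lam s.k) (s.ctr lam t) (ν s) z) := by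
    intro s _
    obtain ⟨C, -, hC⟩ := pk_bounded ζ
    refine (integrable_pk θ hL x _).mul_bdd (c := ‖c s‖ * (C * (√(len lam s.k))⁻¹))
      (continuous_const.mul (continuous_pk _ _ _ _)).aestronglyMeasurable
      (Filter.Eventually.of_forall fun z => ?_)
    rw [norm_mul]
    exact mul_le_mul_of_nonneg_left (hC _ (len_pos h _) _ _ _) (norm_nonneg _)
  simp only [Finset.mul_sum]
  rw [integral_finsetSum _ hgInt, Finset.mul_sum, Finset.sum_filter (fun s : Tile => k ≤ s.k)]
  refine Finset.sum_congr rfl fun s hs => ?_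
  have hLs := len_pos h s.k
  have := integral_lowpass_mul_pk θ ζ (L := len lam k) (L' := len lam s.k) hL x (s.ctr lam t)
    (ν s) ξ (if k ≤ s.k then 1 else 0) ?_
  · simp_rw [mul_left_comm _ (c s)]
    rw [integral_const_mul, mul_left_comm, this]
    split_ifs <;> simp
  · intro v hv
    obtain ⟨h1, h2⟩ := hν s hs v hv
    set u := (ξ - ν s) * len lam s.k + v with hu
    have he : len lam k * ((ξ - ν s) + v / len lam s.k) = len lam k * u / len lam s.k := by
      rw [hu]; field_simp
    have hav : |-(len lam k * ((ξ - ν s) + v / len lam s.k))| = len lam k * u / len lam s.k := by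
      rw [abs_neg, he, abs_of_nonneg (by positivity)]
    split_ifs with hk
    · refine hθ1 _ ?_
      rw [hav, div_le_iff₀ hLs]
      have := len_mono h hk
      nlinarith
    · refine hθ0 _ ?_
      rw [hav, le_div_iff₀ hLs]
      have := len_lt_of_lt h (not_le.1 hk)
      nlinarith

/-- The contribution of a tile to the linearised model operator. -/
noncomputable def modelTerm (ζ : 𝓢(ℝ, ℂ)) (lam t : ℝ) (N : ℝ → ℝ) (c : Tile → ℂ) (s : Tile)
    (x : ℝ) : ℂ :=
  if fidx lam s.k (N x) = s.l then c s * pk ζ (len lam s.k) (s.ctr lam t) (N x) x else 0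

section TreeEstimate

theorem lintegral_tree_far_le (ζ : 𝓢(ℝ, ℂ)) :
    ∃ C : ℝ, 0 < C ∧ ∀ (lam t : ℝ) (_ : 0 < lam) (_ : 0 ≤ t) (_ : t < 1) (τ : TreeTop)
      (S : Finset Tile) (_ : ∀ s ∈ S, Under lam s τ) (E : Set ℝ) (_ : MeasurableSet E)
      (N : ℝ → ℝ) (_ : Measurable N) (μ : ℝ) (_ : 0 ≤ μ) (_ : MassLE lam E N S μ)
      (c : Tile → ℂ) (ε : ℝ) (_ : 0 < ε) (_ : EnergyLE lam (fun s => ‖c s‖) S ε)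
      (B : ℝ → ℝ≥0∞) (_ : ∀ x, B x ≤ ∑ s ∈ S,
        {x | ¬ Near lam S s.k x}.indicator (fun x => ‖modelTerm ζ lam t N c s x‖ₑ) x),
      ∫⁻ x in E, B x ≤ ENNReal.ofReal (C * ε * μ * len lam τ.k) := by
  obtain ⟨C, hC, hb⟩ := pk_decay ζ 8
  refine ⟨C * 2 ^ 24, by positivity, fun lam t h ht0 ht1 τ S hU E hEm N hN μ hμ hM c ε hε hE B hB
    => ?_⟩
  have hRm : ∀ s : Tile, MeasurableSet {x | ¬ Near lam S s.k x} := fun s =>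
    (measurableSet_near lam S s.k).compl
  have hGm : ∀ s : Tile, MeasurableSet {x | fidx lam s.k (N x) = s.l} := fun s =>
    ((measurable_fidx lam _).comp hN) (measurableSet_singleton _)
  have hterm : ∀ s ∈ S, ∀ x, {x | ¬ Near lam S s.k x}.indicator
      (fun x => ‖modelTerm ζ lam t N c s x‖ₑ) x ≤ ENNReal.ofReal (C * ε) *
      ({x | fidx lam s.k (N x) = s.l} ∩ {x | ¬ Near lam S s.k x}).indicator
      (fun x => ENNReal.ofReal (wt (s.ctr lam t) (len lam s.k) x ^ 8)) x := by
    intro s hs x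
    have hL := len_pos h s.k
    by_cases h1 : x ∈ {x | ¬ Near lam S s.k x}
    · rw [indicator_of_mem h1, modelTerm]
      split_ifs with h2
      · rw [indicator_of_mem (show x ∈ _ ∩ _ from ⟨h2, h1⟩), ← ENNReal.ofReal_mul (by positivity), ← ofReal_norm,
          norm_mul]
        refine ENNReal.ofReal_le_ofReal ?_
        have h3 := hE.coeff_le h (fun s => norm_nonneg (c s)) hε.le hs
        calc _ ≤ (ε * √(len lam s.k)) * (C * (√(len lam s.k))⁻¹ *
              wt (s.ctr lam t) (len lam s.k) x ^ 8) :=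
              mul_le_mul h3 (hb _ hL _ _ _) (norm_nonneg _) (by positivity)
          _ = _ := by
              have := (Real.sqrt_pos.2 hL).ne'
              field_simp
      · simp
    · rw [indicator_of_notMem h1]; exact zero_le
  calc ∫⁻ x in E, B x ≤ ∫⁻ x in E, ∑ s ∈ S, ENNReal.ofReal (C * ε) *
          ({x | fidx lam s.k (N x) = s.l} ∩ {x | ¬ Near lam S s.k x}).indicator
            (fun x => ENNReal.ofReal (wt (s.ctr lam t) (len lam s.k) x ^ 8)) x :=
        lintegral_mono fun x => (hB x).trans (Finset.sum_le_sum fun s hs => hterm s hs x)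
    _ = ENNReal.ofReal (C * ε) * ∑ s ∈ S, ∫⁻ x in E ∩ {x | fidx lam s.k (N x) = s.l} ∩
          {x | ¬ Near lam S s.k x},
        ENNReal.ofReal (wt (s.ctr lam t) (len lam s.k) x ^ 8) := by
        rw [lintegral_finsetSum', Finset.mul_sum]
        · refine Finset.sum_congr rfl fun s _ => ?_
          rw [lintegral_const_mul' _ _ ENNReal.ofReal_ne_top,
            setLIntegral_indicator ((hGm s).inter (hRm s)), inter_comm, inter_assoc]
        · intro s _
          refine (Measurable.aemeasurable ?_)
          exact ((((measurable_wt).pow_const 8).ennreal_ofReal).indicator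
            ((hGm s).inter (hRm s))).const_mul _
    _ ≤ ENNReal.ofReal (C * ε) * ENNReal.ofReal (2 ^ 24 * μ * len lam τ.k) := by
        gcongr
        exact sum_lintegral_far_le h ht0 ht1 hEm hN hμ hM hU
    _ = _ := by
        rw [← ENNReal.ofReal_mul (by positivity)]
        congr 1; ring

open scoped Classical in
theorem norm_tree_ov_le (ζ : 𝓢(ℝ, ℂ)) :
    ∃ C : ℝ, 0 < C ∧ ∀ (lam t : ℝ) (_ : 0 < lam) (_ : 0 ≤ t) (_ : t < 1) (τ : TreeTop)
      (S : Finset Tile) (_ : ∀ s ∈ S, Under lam s τ)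
      (N : ℝ → ℝ) (c : Tile → ℂ) (ε : ℝ) (_ : 0 < ε) (_ : EnergyLE lam (fun s => ‖c s‖) S ε)
      (x : ℝ), ‖∑ s ∈ S.filter (fun s => fidx lam s.k τ.ξ ≠ s.l ∧ Near lam S s.k x),
        modelTerm ζ lam t N c s x‖ₑ ≤ ENNReal.ofReal (C * ε) := by
  obtain ⟨C, hC, hb⟩ := pk_decay ζ 2
  refine ⟨C * 16, by positivity, fun lam t h ht0 ht1 τ S hU N c ε hε hE x => ?_⟩
  set A := S.filter (fun s => (fidx lam s.k τ.ξ ≠ s.l ∧ Near lam S s.k x) ∧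
    fidx lam s.k (N x) = s.l) with hA
  have hsum : ∑ s ∈ S.filter (fun s => fidx lam s.k τ.ξ ≠ s.l ∧ Near lam S s.k x),
      modelTerm ζ lam t N c s x =
      ∑ s ∈ A, c s * pk ζ (len lam s.k) (s.ctr lam t) (N x) x := by
    simp only [modelTerm]
    rw [← Finset.sum_filter, Finset.filter_filter]
  rw [hsum]
  have hAk : ∀ s ∈ A, ∀ s' ∈ A, ¬ s.k < s'.k := by
    intro s hs s' hs' hlt
    obtain ⟨h1, ⟨h2, -⟩, h3⟩ := Finset.mem_filter.1 hs
    obtain ⟨h1', -, h3'⟩ := Finset.mem_filter.1 hs'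
    refine h2 ((fidx_congr (k' := s'.k - 1) (by omega) ?_).trans h3)
    rw [(hU s' h1').2.2, ← h3', fidx_sub_one]
  rcases A.eq_empty_or_nonempty with he | ⟨s₀, hs₀⟩
  · simp [he]
  have hk : ∀ s ∈ A, s.k = s₀.k := fun s hs =>
    le_antisymm (not_lt.1 (hAk s₀ hs₀ s hs)) (not_lt.1 (hAk s hs s₀ hs₀))
  have hL := len_pos h s₀.k
  have hsq := Real.sqrt_pos.2 hL
  rw [← ofReal_norm]
  refine ENNReal.ofReal_le_ofReal ?_
  calc _ ≤ ∑ s ∈ A, C * ε * wt (s.ctr lam t) (len lam s₀.k) x ^ 2 := by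
        refine (norm_sum_le _ _).trans (Finset.sum_le_sum fun s hs => ?_)
        have h3 := hE.coeff_le h (fun s => norm_nonneg (c s)) hε.le (Finset.mem_filter.1 hs).1
        have h4 := hb _ (len_pos h s.k) (s.ctr lam t) (N x) x
        rw [hk s hs] at h3 h4
        rw [norm_mul, hk s hs]
        refine (mul_le_mul h3 h4 (norm_nonneg _) (by positivity)).trans (le_of_eq ?_)
        field_simp
    _ ≤ C * ε * (16 * (({fidx lam s₀.k (N x)} : Finset ℤ).card : ℝ)) := by
        rw [← Finset.mul_sum]
        refine mul_le_mul_of_nonneg_left (sum_wt_tiles_le ht0 ht1 h s₀.k A hk _ (fun s hs => ?_) x)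
          (by positivity)
        rw [Finset.mem_singleton, ← hk s hs]
        exact (Finset.mem_filter.1 hs).2.2.symm
    _ = _ := by simp; ring

open scoped Classical in
theorem norm_tree_lac_le (ζ : 𝓢(ℝ, ℂ)) (hζ : ∀ v, ζ v ≠ 0 → 3 ≤ v ∧ v ≤ 12) :
    ∃ C : ℝ, 0 < C ∧ ∀ (lam t : ℝ) (_ : 0 < lam) (_ : 0 ≤ t) (_ : t < 1) (τ : TreeTop)
      (S : Finset Tile) (_ : ∀ s ∈ S, Under lam s τ)
      (N : ℝ → ℝ) (c : Tile → ℂ) (ε : ℝ) (_ : 0 < ε) (_ : EnergyLE lam (fun s => ‖c s‖) S ε)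
      (κ : ℤ) (x y : ℝ) (_ : idx lam κ x = idx lam κ y) (_ : ¬ Near lam S κ x)
      (_ : Near lam S (κ + 1) x),
      ‖∑ s ∈ S.filter (fun s => fidx lam s.k τ.ξ = s.l ∧ Near lam S s.k x),
        modelTerm ζ lam t N c s x‖ₑ ≤ ENNReal.ofReal (C * ε) +
          ENNReal.ofReal C * hlM (fun z => ‖∑ s ∈ S.filter (Lac lam · τ),
            c s * pk ζ (len lam s.k) (s.ctr lam t) τ.ξ z‖ₑ) y := by
  obtain ⟨C₁, hC₁, hb⟩ := pk_lipschitz_freq ζ 2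
  obtain ⟨θ, hθ1, hθ0⟩ := exists_lowpass
  obtain ⟨C₂, hC₂, hhl⟩ := lintegral_pk_mul_le_hlM θ
  refine ⟨32 * C₁ + 2 * C₂, by positivity, fun lam t h ht0 ht1 τ S hU N c ε hε hE κ x y hxy
    hfar hnear => ?_⟩
  set F := S.filter (Lac lam · τ) with hF
  set Γ : ℝ → ℂ := fun z => ∑ s ∈ F, c s * pk ζ (len lam s.k) (s.ctr lam t) τ.ξ z with hΓ
  have hΓc : Continuous Γ := by
    refine continuous_finsetSum _ fun s _ => ?_
    exact continuous_const.mul (continuous_pk _ _ _ _)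
  have hN : ∀ k, Near lam S k x ↔ κ < k := fun k => by
    constructor
    · intro hc
      by_contra hk
      exact hfar (hc.mono (not_lt.1 hk))
    · intro hk
      exact hnear.mono (by omega)
  have hsum : ∑ s ∈ S.filter (fun s => fidx lam s.k τ.ξ = s.l ∧ Near lam S s.k x),
      modelTerm ζ lam t N c s x =
      ∑ s ∈ F.filter (fun s => κ < s.k ∧ fidx lam s.k (N x) = s.l),
        c s * pk ζ (len lam s.k) (s.ctr lam t) (N x) x := by
    simp only [modelTerm]
    rw [← Finset.sum_filter, Finset.filter_filter, hF, Finset.filter_filter]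
    refine Finset.sum_congr (Finset.filter_congr fun s hs => ?_) fun _ _ => rfl
    have := hU s hs
    rw [hN, Lac]
    constructor
    · rintro ⟨⟨h1, h2⟩, h3⟩; exact ⟨⟨this.1, this.2.1, h1⟩, h2, h3⟩
    · rintro ⟨⟨-, -, h1⟩, h2, h3⟩; exact ⟨⟨h1, h2⟩, h3⟩
  rw [hsum]
  set A := F.filter (fun s => κ < s.k ∧ fidx lam s.k (N x) = s.l) with hA
  rcases A.eq_empty_or_nonempty with he | hne
  · simp [he]
  obtain ⟨s₁, hs₁, hmax⟩ := Finset.exists_max_image A Tile.k hne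
  obtain ⟨h11, h12, h13⟩ := Finset.mem_filter.1 hs₁
  have hlacF : ∀ s ∈ F, Lac lam s τ := fun s hs => (Finset.mem_filter.1 hs).2
  have hfe : fidx lam s₁.k (N x) = fidx lam s₁.k τ.ξ := h13.trans (hlacF s₁ h11).2.2.symm
  have hL1 := len_pos h s₁.k
  have hdist : |N x - τ.ξ| * len lam s₁.k ≤ 1 := by
    have h1 := (fidx_eq_iff (lam := lam) s₁.k _ (N x)).1 rfl
    have h2 := (fidx_eq_iff (lam := lam) s₁.k _ τ.ξ).1 rfl
    rw [hfe] at h1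
    rw [← abs_of_pos hL1, ← abs_mul, abs_le, sub_mul]
    constructor <;> linarith [h1.1, h1.2, h2.1, h2.2]
  have hAeq : A = F.filter (fun s => κ < s.k ∧ s.k ≤ s₁.k) := by
    refine Finset.filter_congr fun s hs => ⟨fun ⟨h1, h2⟩ =>
      ⟨h1, hmax s (Finset.mem_filter.2 ⟨hs, h1, h2⟩)⟩, fun ⟨h1, h2⟩ => ⟨h1, ?_⟩⟩
    rw [fidx_congr h2 hfe, (hlacF s hs).2.2]
  have herr : ‖∑ s ∈ A, c s * (pk ζ (len lam s.k) (s.ctr lam t) (N x) x -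
      pk ζ (len lam s.k) (s.ctr lam t) τ.ξ x)‖ ≤ 32 * C₁ * ε := by
    refine (norm_sum_le _ _).trans ?_
    have hterm : ∀ s ∈ A, ‖c s * (pk ζ (len lam s.k) (s.ctr lam t) (N x) x -
        pk ζ (len lam s.k) (s.ctr lam t) τ.ξ x)‖ ≤
        wt (s.ctr lam t) (len lam s.k) x ^ 2 * (C₁ * ε / len lam s₁.k * len lam s.k) := by
      intro s hs
      have hL := len_pos h s.k
      have hsq := Real.sqrt_pos.2 hL
      have h3 := hE.coeff_le h (fun s => norm_nonneg (c s)) hε.le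
        (Finset.mem_filter.1 (Finset.mem_filter.1 hs).1).1
      have h5 : |N x - τ.ξ| ≤ 1 / len lam s₁.k := by rwa [le_div_iff₀ hL1]
      rw [norm_mul]
      calc _ ≤ (ε * √(len lam s.k)) * (C₁ * (√(len lam s.k))⁻¹ *
            (1 / len lam s₁.k * len lam s.k) * wt (s.ctr lam t) (len lam s.k) x ^ 2) := by
            refine mul_le_mul h3 ((hb _ hL _ _ _ _).trans ?_) (norm_nonneg _) (by positivity)
            gcongr
        _ = _ := by field_simp
    refine (Finset.sum_le_sum hterm).trans ?_
    have := sum_by_scale h A (fun s => wt (s.ctr lam t) (len lam s.k) x ^ 2 *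
      (C₁ * ε / len lam s₁.k * len lam s.k)) (C := 16 * (C₁ * ε / len lam s₁.k))
      (by positivity) (K := s₁.k) hmax ?_
    · refine this.trans_eq ?_
      field_simp
      norm_num
    intro k hk
    have hL := len_pos h k
    calc _ = ∑ s ∈ A.filter (·.k = k), wt (s.ctr lam t) (len lam k) x ^ 2 *
          (C₁ * ε / len lam s₁.k * len lam k) :=
          Finset.sum_congr rfl fun s hs => by rw [(Finset.mem_filter.1 hs).2]
      _ ≤ (16 * (({fidx lam k τ.ξ} : Finset ℤ).card : ℝ)) *
          (C₁ * ε / len lam s₁.k * len lam k) := by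
          rw [← Finset.sum_mul]
          refine mul_le_mul_of_nonneg_right ?_ (by positivity)
          refine sum_wt_tiles_le ht0 ht1 h k _ (fun s hs => (Finset.mem_filter.1 hs).2) _
            (fun s hs => ?_) x
          obtain ⟨h1, h2⟩ := Finset.mem_filter.1 hs
          have := (hlacF s (Finset.mem_filter.1 h1).1).2.2
          rw [h2] at this
          rw [Finset.mem_singleton, this]
      _ = _ := by simp; ring
  have hLP : ∀ k : ℤ, ((√(len lam k))⁻¹ : ℝ) * ∫ z, pk θ (len lam k) x (-τ.ξ) z * Γ z =
      ∑ s ∈ F.filter (fun s => k ≤ s.k), c s * pk ζ (len lam s.k) (s.ctr lam t) τ.ξ x := fun k =>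
    lowpass_sum_pk θ ζ hθ1 hθ0 h t τ.ξ F (fun _ => τ.ξ) (fun s _ v hv => by
      have := hζ v hv
      rw [sub_self, zero_mul, zero_add]
      exact ⟨by linarith, by linarith⟩) c k x
  have hmain : ∑ s ∈ A, c s * pk ζ (len lam s.k) (s.ctr lam t) τ.ξ x =
      ((√(len lam (κ + 1)))⁻¹ : ℝ) * (∫ z, pk θ (len lam (κ + 1)) x (-τ.ξ) z * Γ z) -
      ((√(len lam (s₁.k + 1)))⁻¹ : ℝ) * (∫ z, pk θ (len lam (s₁.k + 1)) x (-τ.ξ) z * Γ z) := by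
    rw [hLP, hLP, hAeq, eq_sub_iff_add_eq, ← Finset.sum_union]
    · refine Finset.sum_congr ?_ fun _ _ => rfl
      ext s
      simp only [Finset.mem_union, Finset.mem_filter]
      constructor
      · rintro (⟨h1, h2, h3⟩ | ⟨h1, h2⟩) <;> exact ⟨h1, by omega⟩
      · rintro ⟨h1, h2⟩
        rcases le_or_gt s.k s₁.k with h3 | h3
        · exact Or.inl ⟨h1, by omega, h3⟩
        · exact Or.inr ⟨h1, by omega⟩
    · rw [Finset.disjoint_filter]
      intro s _ h1 h2; omega
  have hyx : ∀ k, κ ≤ k → |y - x| ≤ len lam k := fun k hk =>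
    (abs_sub_lt_of_idx_eq h hxy.symm).le.trans (len_mono h hk)
  have hspl : ∑ s ∈ A, c s * pk ζ (len lam s.k) (s.ctr lam t) (N x) x =
      ∑ s ∈ A, c s * (pk ζ (len lam s.k) (s.ctr lam t) (N x) x -
      pk ζ (len lam s.k) (s.ctr lam t) τ.ξ x) +
      ∑ s ∈ A, c s * pk ζ (len lam s.k) (s.ctr lam t) τ.ξ x := by
    rw [← Finset.sum_add_distrib]
    exact Finset.sum_congr rfl fun s _ => by ring
  rw [hspl, hmain]
  refine (enorm_add_le _ _).trans (add_le_add ?_ ?_)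
  · rw [← ofReal_norm]
    refine ENNReal.ofReal_le_ofReal (herr.trans ?_)
    have : 0 < C₂ * ε := by positivity
    nlinarith
  · refine (enorm_sub_le).trans ((add_le_add
      (hhl _ (len_pos h _) τ.ξ x y (hyx _ (by omega)) Γ hΓc)
      (hhl _ (len_pos h _) τ.ξ x y (hyx _ (by omega)) Γ hΓc)).trans ?_)
    rw [← add_mul, ← ENNReal.ofReal_add hC₂.le hC₂.le]
    exact mul_le_mul' (ENNReal.ofReal_le_ofReal (by linarith)) le_rfl

end TreeEstimate

theorem measurable_modelTerm (ζ : 𝓢(ℝ, ℂ)) (lam t : ℝ) {N : ℝ → ℝ} (hN : Measurable N)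
    (c : Tile → ℂ) (s : Tile) : Measurable (modelTerm ζ lam t N c s) := by
  unfold modelTerm
  refine Measurable.ite (((measurable_fidx lam _).comp hN) (measurableSet_singleton _)) ?_
    measurable_const
  exact ((continuous_pk₂ ζ (len lam s.k) (s.ctr lam t)).measurable.comp
    (hN.prodMk measurable_id)).const_mul (c s)

theorem enorm_le_ofReal_add_sq {u : ℝ≥0∞} {ε : ℝ} (hε : 0 < ε) :
    u ≤ ENNReal.ofReal ε + u ^ 2 * ENNReal.ofReal ε⁻¹ := by
  rcases le_total u (ENNReal.ofReal ε) with h | h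
  · exact h.trans le_self_add
  · refine le_trans ?_ le_add_self
    calc u = u * (ENNReal.ofReal ε * ENNReal.ofReal ε⁻¹) := by
          rw [← ENNReal.ofReal_mul hε.le, mul_inv_cancel₀ hε.ne', ENNReal.ofReal_one, mul_one]
      _ ≤ u * (u * ENNReal.ofReal ε⁻¹) := by gcongr
      _ = _ := by ring

set_option maxHeartbeats 400000 in
open scoped Classical in
theorem lintegral_near_hlM_le (ζ : 𝓢(ℝ, ℂ)) :
    ∃ C : ℝ, 0 < C ∧ ∀ (lam t : ℝ) (_ : 0 < lam) (_ : 0 ≤ t) (_ : t < 1) (τ : TreeTop)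
      (S : Finset Tile) (_ : ∀ s ∈ S, Under lam s τ) (ν : Tile → ℝ)
      (_ : ∀ s ∈ S, Lac lam s τ → ∀ v, ζ v ≠ 0 → 1 ≤ (τ.ξ - ν s) * len lam s.k + v ∧
        (τ.ξ - ν s) * len lam s.k + v ≤ 14)
      (c : Tile → ℂ) (ε : ℝ) (_ : 0 < ε) (_ : EnergyLE lam (fun s => ‖c s‖) S ε),
      ∫⁻ y in {y | Near lam S τ.k y}, hlM (fun z => ‖∑ s ∈ S.filter (Lac lam · τ),
        c s * pk ζ (len lam s.k) (s.ctr lam t) (ν s) z‖ₑ) y ≤ ENNReal.ofReal (C * ε * len lam τ.k) := by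
  obtain ⟨C, hC, hb⟩ := integral_norm_sq_sum_pk_le ζ
  obtain ⟨C', hC', hb'⟩ := pk_bounded ζ
  refine ⟨3 + 40 * C, by positivity, fun lam t h ht0 ht1 τ S hU ν hν c ε hε hE => ?_⟩
  have hL := len_pos h τ.k
  set F := S.filter (Lac lam · τ) with hF
  set Γ : ℝ → ℂ := fun z => ∑ s ∈ F, c s * pk ζ (len lam s.k) (s.ctr lam t) (ν s) z with hΓ
  have hΓc : Continuous Γ := by
    refine continuous_finsetSum _ fun s _ => ?_
    exact continuous_const.mul (continuous_pk _ _ _ _)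
  have hgInt : ∀ s : Tile, Integrable (pk ζ (len lam s.k) (s.ctr lam t) (ν s)) := fun s =>
    integrable_pk ζ (len_pos h s.k) _ _
  have hΓi : Integrable Γ := integrable_finsetSum _ fun s _ => (hgInt s).const_mul _
  have hbd : ∀ x, ‖Γ x‖ ≤ ∑ s ∈ F, ‖c s‖ * (C' * (√(len lam s.k))⁻¹) := fun x =>
    (norm_sum_le _ _).trans (Finset.sum_le_sum fun s _ => by
      rw [norm_mul]
      exact mul_le_mul_of_nonneg_left (hb' _ (len_pos h _) _ _ _) (norm_nonneg _))
  have h2 := lintegral_hlM_sq_le (γ := fun x => ‖Γ x‖) hΓc.norm.measurable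
    (fun x => norm_nonneg _) hbd
  simp only [ofReal_norm] at h2
  have hsqi : Integrable fun x => ‖Γ x‖ ^ 2 := by
    simp only [sq]
    exact hΓi.norm.mul_bdd (c := ∑ s ∈ F, ‖c s‖ * (C' * (√(len lam s.k))⁻¹))
      hΓc.norm.aestronglyMeasurable
      (Filter.Eventually.of_forall fun x => by rw [norm_norm]; exact hbd x)
  have h3 : ∫⁻ x, ENNReal.ofReal (‖Γ x‖ ^ 2) ≤ ENNReal.ofReal (C * (ε ^ 2 * len lam τ.k)) := by
    rw [← ofReal_integral_eq_lintegral_ofReal hsqi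
      (Filter.Eventually.of_forall fun x => by positivity)]
    refine ENNReal.ofReal_le_ofReal ((hb lam t h ht0 ht1 τ F
      (fun s hs => (Finset.mem_filter.1 hs).2) ν (fun s hs => hν s (Finset.mem_filter.1 hs).1
        (Finset.mem_filter.1 hs).2) c).trans ?_)
    exact mul_le_mul_of_nonneg_left (hE τ) hC.le
  calc _ ≤ ∫⁻ y in {y | Near lam S τ.k y},
        (ENNReal.ofReal ε + hlM (‖Γ ·‖ₑ) y ^ 2 * ENNReal.ofReal ε⁻¹) :=
        lintegral_mono fun y => enorm_le_ofReal_add_sq hε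
    _ = ENNReal.ofReal ε * volume {y | Near lam S τ.k y} +
        (∫⁻ y in {y | Near lam S τ.k y}, hlM (‖Γ ·‖ₑ) y ^ 2) * ENNReal.ofReal ε⁻¹ := by
        rw [lintegral_add_left measurable_const, lintegral_const, Measure.restrict_apply_univ,
          lintegral_mul_const' _ _ ENNReal.ofReal_ne_top]
    _ ≤ ENNReal.ofReal ε * ENNReal.ofReal (3 * len lam τ.k) +
        (40 * ENNReal.ofReal (C * (ε ^ 2 * len lam τ.k))) * ENNReal.ofReal ε⁻¹ := by
        gcongr
        · exact volume_near_top_le h hU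
        · exact (setLIntegral_le_lintegral _ _).trans (h2.trans (by gcongr))
    _ = _ := by
        rw [show (40 : ℝ≥0∞) = ENNReal.ofReal 40 by simp, ← ENNReal.ofReal_mul hε.le,
          ← ENNReal.ofReal_mul (by norm_num : (0 : ℝ) ≤ 40), ← ENNReal.ofReal_mul (by positivity),
          ← ENNReal.ofReal_add (by positivity) (by positivity)]
        congr 1
        field_simp

set_option maxHeartbeats 400000 in
/-- The tree estimate. -/
theorem lintegral_tree_le (ζ : 𝓢(ℝ, ℂ)) (hζ : ∀ v, ζ v ≠ 0 → 3 ≤ v ∧ v ≤ 12) :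
    ∃ C : ℝ, 0 < C ∧ ∀ (lam t : ℝ) (_ : 0 < lam) (_ : 0 ≤ t) (_ : t < 1) (τ : TreeTop)
      (S : Finset Tile) (_ : ∀ s ∈ S, Under lam s τ) (E : Set ℝ) (_ : MeasurableSet E)
      (N : ℝ → ℝ) (_ : Measurable N) (μ : ℝ) (_ : 0 ≤ μ) (_ : MassLE lam E N S μ)
      (c : Tile → ℂ) (ε : ℝ) (_ : 0 < ε) (_ : EnergyLE lam (fun s => ‖c s‖) S ε),
      ∫⁻ x in E, ‖∑ s ∈ S, modelTerm ζ lam t N c s x‖ₑ ≤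
        ENNReal.ofReal (C * ε * μ * len lam τ.k) := by
  classical
  obtain ⟨C₁, hC₁, h1⟩ := lintegral_tree_far_le ζ
  obtain ⟨C₂, hC₂, h2⟩ := norm_tree_ov_le ζ
  obtain ⟨C₃, hC₃, h3⟩ := norm_tree_lac_le ζ hζ
  obtain ⟨C₄, hC₄, h4⟩ := lintegral_near_hlM_le ζ
  refine ⟨C₁ + 64 * (C₂ * 3) + 64 * (C₃ * 3 + C₃ * C₄), by positivity,
    fun lam t h ht0 ht1 τ S hU E hEm N hN μ hμ hM c ε hε hE => ?_⟩
  have hL := len_pos h τ.k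
  set T := modelTerm ζ lam t N c with hT
  have hTm : ∀ s, Measurable (T s) := fun s => measurable_modelTerm ζ lam t hN c s
  have hNm : ∀ k, MeasurableSet {x | Near lam S k x} := fun k => measurableSet_near lam S k
  set B₁ : ℝ → ℝ≥0∞ := fun x => ∑ s ∈ S, {x | ¬ Near lam S s.k x}.indicator
    (fun x => ‖T s x‖ₑ) x with hB₁
  set B₂ : ℝ → ℝ≥0∞ := fun x => ‖∑ s ∈ S.filter
    (fun s => fidx lam s.k τ.ξ ≠ s.l ∧ Near lam S s.k x), T s x‖ₑ with hB₂
  set B₃ : ℝ → ℝ≥0∞ := fun x => ‖∑ s ∈ S.filter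
    (fun s => fidx lam s.k τ.ξ = s.l ∧ Near lam S s.k x), T s x‖ₑ with hB₃
  have hm₁ : Measurable B₁ := Finset.measurable_sum _ fun s _ =>
    (hTm s).enorm.indicator (hNm s.k).compl
  have hm₂ : Measurable B₂ := by
    refine Measurable.enorm ?_
    simp_rw [Finset.sum_filter]
    exact Finset.measurable_sum _ fun s _ =>
      Measurable.ite ((MeasurableSet.const _).inter (hNm s.k)) (hTm s) measurable_const
  have hsplit : ∀ x, ‖∑ s ∈ S, T s x‖ₑ ≤ B₁ x + B₂ x + B₃ x := by
    intro x
    have e1 : ∑ s ∈ S, T s x = ∑ s ∈ S, {x | ¬ Near lam S s.k x}.indicator (T s) x +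
        ∑ s ∈ S.filter (fun s => fidx lam s.k τ.ξ ≠ s.l ∧ Near lam S s.k x), T s x +
        ∑ s ∈ S.filter (fun s => fidx lam s.k τ.ξ = s.l ∧ Near lam S s.k x), T s x := by
      rw [Finset.sum_filter, Finset.sum_filter, ← Finset.sum_add_distrib,
        ← Finset.sum_add_distrib]
      refine Finset.sum_congr rfl fun s _ => ?_
      by_cases hn : Near lam S s.k x <;> by_cases hf : fidx lam s.k τ.ξ = s.l <;>
        simp [indicator, hn, hf]
    rw [e1]
    refine (enorm_add_le _ _).trans (add_le_add ((enorm_add_le _ _).trans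
      (add_le_add ?_ le_rfl)) le_rfl)
    refine (enorm_sum_le _ _).trans (Finset.sum_le_sum fun s _ => ?_)
    by_cases hn : x ∈ {x | ¬ Near lam S s.k x}
    · rw [indicator_of_mem hn, indicator_of_mem hn]
    · rw [indicator_of_notMem hn, indicator_of_notMem hn, enorm_zero]
  have hcond : ∀ (F : Finset Tile) (x : ℝ), (∀ s ∈ F, s ∈ S ∧ Near lam S s.k x) →
      ‖∑ s ∈ F, T s x‖ₑ ≠ 0 → ∃ s ∈ S, Near lam S s.k x ∧ fidx lam s.k (N x) = s.l := by
    intro F x hF hx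
    rw [enorm_ne_zero] at hx
    obtain ⟨s, hs, hne⟩ := Finset.exists_ne_zero_of_sum_ne_zero hx
    refine ⟨s, (hF s hs).1, (hF s hs).2, ?_⟩
    by_contra hc
    exact hne (by simp [hT, modelTerm, hc])
  have hI₁ := h1 lam t h ht0 ht1 τ S hU E hEm N hN μ hμ hM c ε hε hE B₁ fun x => le_rfl
  have hI₂ : ∫⁻ x in E, B₂ x ≤ ENNReal.ofReal (64 * (C₂ * 3) * ε * μ * len lam τ.k) := by
    refine (lintegral_near_le h hEm hN hμ hM hU B₂ (fun _ => ENNReal.ofReal (C₂ * ε))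
      (fun x hx => hcond _ x (fun s hs =>
        ⟨(Finset.mem_filter.1 hs).1, (Finset.mem_filter.1 hs).2.2⟩) hx)
      fun κ x y _ _ _ => h2 lam t h ht0 ht1 τ S hU N c ε hε hE x).trans ?_
    rw [lintegral_const, Measure.restrict_apply_univ]
    calc _ ≤ ENNReal.ofReal (64 * μ) * (ENNReal.ofReal (C₂ * ε) *
          ENNReal.ofReal (3 * len lam τ.k)) := by
          gcongr
          exact volume_near_top_le h hU
      _ = _ := by
          rw [← ENNReal.ofReal_mul (by positivity), ← ENNReal.ofReal_mul (by positivity)]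
          congr 1; ring
  have hI₃ : ∫⁻ x in E, B₃ x ≤
      ENNReal.ofReal (64 * (C₃ * 3 + C₃ * C₄) * ε * μ * len lam τ.k) := by
    refine (lintegral_near_le h hEm hN hμ hM hU B₃ (fun y => ENNReal.ofReal (C₃ * ε) +
        ENNReal.ofReal C₃ * hlM (fun z => ‖∑ s ∈ S.filter (Lac lam · τ),
          c s * pk ζ (len lam s.k) (s.ctr lam t) τ.ξ z‖ₑ) y)
      (fun x hx => hcond _ x (fun s hs =>
        ⟨(Finset.mem_filter.1 hs).1, (Finset.mem_filter.1 hs).2.2⟩) hx)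
      fun κ x y hxy hf hn => h3 lam t h ht0 ht1 τ S hU N c ε hε hE κ x y hxy hf hn).trans ?_
    rw [lintegral_add_left measurable_const, lintegral_const, Measure.restrict_apply_univ,
      lintegral_const_mul' _ _ ENNReal.ofReal_ne_top]
    calc _ ≤ ENNReal.ofReal (64 * μ) * (ENNReal.ofReal (C₃ * ε) *
          ENNReal.ofReal (3 * len lam τ.k) + ENNReal.ofReal C₃ *
            ENNReal.ofReal (C₄ * ε * len lam τ.k)) := by
          gcongr
          · exact volume_near_top_le h hU
          · exact h4 lam t h ht0 ht1 τ S hU (fun _ => τ.ξ) (fun s _ _ v hv => by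
            have := hζ v hv
            rw [sub_self, zero_mul, zero_add]
            exact ⟨by linarith, by linarith⟩) c ε hε hE
      _ = _ := by
          rw [← ENNReal.ofReal_mul (by positivity), ← ENNReal.ofReal_mul hC₃.le,
            ← ENNReal.ofReal_add (by positivity) (by positivity),
            ← ENNReal.ofReal_mul (by positivity)]
          congr 1; ring
  calc _ ≤ ∫⁻ x in E, (B₁ x + B₂ x + B₃ x) := lintegral_mono hsplit
    _ = (∫⁻ x in E, B₁ x) + (∫⁻ x in E, B₂ x) + ∫⁻ x in E, B₃ x := by
        rw [lintegral_add_left (f := fun x => B₁ x + B₂ x) (hm₁.add hm₂), lintegral_add_left hm₁]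
    _ ≤ _ := add_le_add (add_le_add hI₁ hI₂) hI₃
    _ = _ := by
        rw [← ENNReal.ofReal_add (by positivity) (by positivity),
          ← ENNReal.ofReal_add (by positivity) (by positivity)]
        congr 1; ring

/-! ### The size estimate -/

set_option maxHeartbeats 400000 in
/-- The tree estimate for a lacunary tree of wave packets with fixed frequencies. -/
theorem lintegral_lac_le (ψ : 𝓢(ℝ, ℂ)) (hψ : ∀ v, ψ v ≠ 0 → 1 ≤ v ∧ v ≤ 13) :
    ∃ C : ℝ, 0 < C ∧ ∀ (lam t : ℝ) (_ : 0 < lam) (_ : 0 ≤ t) (_ : t < 1) (τ : TreeTop)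
      (S : Finset Tile) (_ : ∀ s ∈ S, Lac lam s τ) (E : Set ℝ) (_ : MeasurableSet E)
      (μ : ℝ) (_ : 0 ≤ μ) (_ : MassLE lam E (fun _ => τ.ξ) S μ)
      (c : Tile → ℂ) (ε : ℝ) (_ : 0 < ε) (_ : EnergyLE lam (fun s => ‖c s‖) S ε),
      ∫⁻ x in E, ‖∑ s ∈ S, c s * pk ψ (len lam s.k) (s.ctr lam t) (s.l / len lam s.k) x‖ₑ ≤
        ENNReal.ofReal (C * ε * μ * len lam τ.k) := by
  classical
  obtain ⟨C₁, hC₁, h1⟩ := lintegral_tree_far_le ψ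
  obtain ⟨θ, hθ1, hθ0⟩ := exists_lowpass
  obtain ⟨C₃, hC₃, h3⟩ := lintegral_pk_mul_le_hlM θ
  obtain ⟨C₄, hC₄, h4⟩ := lintegral_near_hlM_le ψ
  refine ⟨C₁ + 64 * (C₃ * C₄), by positivity,
    fun lam t h ht0 ht1 τ S hU E hEm μ hμ hM c ε hε hE => ?_⟩
  have hL := len_pos h τ.k
  have hUn : ∀ s ∈ S, Under lam s τ := fun s hs => (hU s hs).under
  have hF : S.filter (Lac lam · τ) = S := Finset.filter_true_of_mem hU
  set T : Tile → ℝ → ℂ := fun s x =>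
    c s * pk ψ (len lam s.k) (s.ctr lam t) (s.l / len lam s.k) x with hT
  have hTc : ∀ s, Continuous (T s) := fun s => continuous_const.mul (continuous_pk _ _ _ _)
  have hNm : ∀ k, MeasurableSet {x | Near lam S k x} := fun k => measurableSet_near lam S k
  have hν : ∀ s ∈ S, ∀ v, ψ v ≠ 0 → 1 ≤ (τ.ξ - s.l / len lam s.k) * len lam s.k + v ∧
      (τ.ξ - s.l / len lam s.k) * len lam s.k + v ≤ 14 := by
    intro s hs v hv
    obtain ⟨h5, h6⟩ := hψ v hv
    obtain ⟨h7, h8⟩ := (fidx_eq_iff (lam := lam) s.k _ τ.ξ).1 (hU s hs).2.2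
    have : (τ.ξ - s.l / len lam s.k) * len lam s.k = τ.ξ * len lam s.k - s.l := by
      field_simp [(len_pos h s.k).ne']
    rw [this]
    exact ⟨by linarith, by linarith⟩
  set B₁ : ℝ → ℝ≥0∞ := fun x => ∑ s ∈ S, {x | ¬ Near lam S s.k x}.indicator
    (fun x => ‖T s x‖ₑ) x with hB₁
  set B₃ : ℝ → ℝ≥0∞ := fun x => ‖∑ s ∈ S.filter (fun s => Near lam S s.k x), T s x‖ₑ with hB₃
  have hm₁ : Measurable B₁ := Finset.measurable_sum _ fun s _ =>
    (hTc s).measurable.enorm.indicator (hNm s.k).compl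
  have hsplit : ∀ x, ‖∑ s ∈ S, T s x‖ₑ ≤ B₁ x + B₃ x := by
    intro x
    have e1 : ∑ s ∈ S, T s x = ∑ s ∈ S, {x | ¬ Near lam S s.k x}.indicator (T s) x +
        ∑ s ∈ S.filter (fun s => Near lam S s.k x), T s x := by
      rw [Finset.sum_filter, ← Finset.sum_add_distrib]
      refine Finset.sum_congr rfl fun s _ => ?_
      by_cases hn : Near lam S s.k x <;> simp [indicator, hn]
    rw [e1]
    refine (enorm_add_le _ _).trans (add_le_add ?_ le_rfl)
    refine (enorm_sum_le _ _).trans (Finset.sum_le_sum fun s _ => ?_)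
    by_cases hn : x ∈ {x | ¬ Near lam S s.k x}
    · rw [indicator_of_mem hn, indicator_of_mem hn]
    · rw [indicator_of_notMem hn, indicator_of_notMem hn, enorm_zero]
  have hI₁ := h1 lam t h ht0 ht1 τ S hUn E hEm (fun _ => τ.ξ) measurable_const μ hμ hM c ε hε hE
    B₁ fun x => Finset.sum_le_sum fun s hs => by
      refine indicator_le_indicator ?_
      rw [modelTerm, if_pos (hU s hs).2.2, hT, ← ofReal_norm, ← ofReal_norm, norm_mul, norm_mul,
        norm_pk, norm_pk]
  have hI₃ : ∫⁻ x in E, B₃ x ≤ ENNReal.ofReal (64 * (C₃ * C₄) * ε * μ * len lam τ.k) := by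
    refine (lintegral_near_le h hEm measurable_const hμ hM hUn B₃ (fun y =>
        ENNReal.ofReal C₃ * hlM (fun z => ‖∑ s ∈ S.filter (Lac lam · τ),
          c s * pk ψ (len lam s.k) (s.ctr lam t) (s.l / len lam s.k) z‖ₑ) y)
      (fun x hx => ?_) fun κ x y hxy hf hn => ?_).trans ?_
    · rw [hB₃, enorm_ne_zero] at hx
      obtain ⟨s, hs, -⟩ := Finset.exists_ne_zero_of_sum_ne_zero hx
      obtain ⟨hs1, hs2⟩ := Finset.mem_filter.1 hs
      exact ⟨s, hs1, hs2, (hU s hs1).2.2⟩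
    · have hlp := lowpass_sum_pk θ ψ hθ1 hθ0 h t τ.ξ S (fun s => s.l / len lam s.k) hν c (κ + 1) x
      have hN : S.filter (fun s => Near lam S s.k x) = S.filter (fun s => κ + 1 ≤ s.k) := by
        refine Finset.filter_congr fun s _ => ⟨fun hc => ?_, fun hk => hn.mono hk⟩
        by_contra hk
        exact hf (hc.mono (by omega))
      rw [hF, hB₃]
      simp only [hN, hT]
      rw [← hlp]
      have hyx : |y - x| ≤ len lam (κ + 1) :=
        (abs_sub_lt_of_idx_eq h hxy.symm).le.trans (len_mono h (by omega))
      exact h3 _ (len_pos h _) τ.ξ x y hyx (fun z => ∑ s ∈ S, T s z)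
        (continuous_finsetSum _ fun s _ => hTc s)
    rw [lintegral_const_mul' _ _ ENNReal.ofReal_ne_top]
    calc _ ≤ ENNReal.ofReal (64 * μ) * (ENNReal.ofReal C₃ *
            ENNReal.ofReal (C₄ * ε * len lam τ.k)) := by
          gcongr
          exact h4 lam t h ht0 ht1 τ S hUn _ (fun s hs _ => hν s hs) c ε hε hE
      _ = _ := by
          rw [← ENNReal.ofReal_mul hC₃.le, ← ENNReal.ofReal_mul (by positivity)]
          congr 1; ring
  calc _ ≤ ∫⁻ x in E, (B₁ x + B₃ x) := lintegral_mono hsplit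
    _ = (∫⁻ x in E, B₁ x) + ∫⁻ x in E, B₃ x := by
        rw [lintegral_add_left hm₁]
    _ ≤ _ := add_le_add hI₁ hI₃
    _ = _ := by
        rw [← ENNReal.ofReal_add (by positivity) (by positivity)]
        congr 1; ring

theorem EnergyLE.mono_right {lam : ℝ} (h : 0 < lam) {a : Tile → ℝ} {S : Finset Tile} {ε ε' : ℝ}
    (hε : 0 ≤ ε) (hle : ε ≤ ε') (hE : EnergyLE lam a S ε) : EnergyLE lam a S ε' := fun τ =>
  (hE τ).trans (by have := len_pos h τ.k; gcongr)

theorem exists_energyLE {lam : ℝ} (h : 0 < lam) (a : Tile → ℝ) (S : Finset Tile) :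
    ∃ ε, 0 < ε ∧ EnergyLE lam a S ε := by
  classical
  have h0 : 0 ≤ ∑ s ∈ S, a s ^ 2 / len lam s.k := Finset.sum_nonneg fun s _ => by
    have := len_pos h s.k; positivity
  refine ⟨√(1 + ∑ s ∈ S, a s ^ 2 / len lam s.k), Real.sqrt_pos.2 (by linarith), fun τ => ?_⟩
  have hL := len_pos h τ.k
  rw [Real.sq_sqrt (by linarith)]
  calc _ ≤ ∑ s ∈ S.filter (Lac lam · τ), a s ^ 2 / len lam s.k * len lam τ.k := by
        refine Finset.sum_le_sum fun s hs => ?_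
        have h1 := len_mono h (Finset.mem_filter.1 hs).2.1
        rw [div_mul_eq_mul_div, le_div_iff₀ (len_pos h s.k)]
        gcongr
    _ ≤ ∑ s ∈ S, a s ^ 2 / len lam s.k * len lam τ.k :=
        Finset.sum_le_sum_of_subset_of_nonneg (Finset.filter_subset _ _) fun s _ _ => by
          have := len_pos h s.k; positivity
    _ ≤ _ := by rw [← Finset.sum_mul]; nlinarith

theorem energyLE_of_self_improving {lam : ℝ} (h : 0 < lam) {a : Tile → ℝ} {S : Finset Tile} {A : ℝ}
    (hA : 0 < A) (himp : ∀ ε, 0 < ε → EnergyLE lam a S ε → EnergyLE lam a S √(A * ε)) :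
    EnergyLE lam a S (2 * A) := by
  set X : Set ℝ := {ε | 0 < ε ∧ EnergyLE lam a S ε} with hX
  obtain ⟨ε₀, hε₀⟩ := exists_energyLE h a S
  have hne : X.Nonempty := ⟨ε₀, hε₀⟩
  have hbdd : BddBelow X := ⟨0, fun ε hε => hε.1.le⟩
  have he0 : 0 ≤ sInf X := le_csInf hne fun ε hε => hε.1.le
  have h1 : ∀ ε ∈ X, sInf X ^ 2 / A ≤ ε := by
    intro ε hε
    have h2 : sInf X ≤ √(A * ε) :=
      csInf_le hbdd ⟨Real.sqrt_pos.2 (mul_pos hA hε.1), himp ε hε.1 hε.2⟩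
    rw [div_le_iff₀ hA]
    calc sInf X ^ 2 ≤ √(A * ε) ^ 2 := by gcongr
      _ = ε * A := by rw [Real.sq_sqrt (mul_pos hA hε.1).le, mul_comm]
  have h3 := le_csInf hne h1
  rw [div_le_iff₀ hA] at h3
  have h4 : sInf X < 2 * A := by
    by_contra hc
    nlinarith [not_lt.1 hc]
  obtain ⟨ε, hε, hlt⟩ := exists_lt_of_csInf_lt hne h4
  exact hε.2.mono_right h hε.1.le hlt.le

theorem conj_pk {χ χ' : 𝓢(ℝ, ℂ)} (hχ : ∀ v, χ' v = conj (χ (-v))) (L z ν y : ℝ) :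
    conj (pk χ L z ν y) = pk χ' L z (-ν) y := by
  have h1 : ∀ w, 𝓕 (χ' : ℝ → ℂ) w = conj (𝓕 (χ : ℝ → ℂ) w) := by
    intro w
    rw [fourier_eq_ee, fourier_eq_ee, ← integral_conj,
      ← integral_neg_eq_self (fun v => conj (χ v * ee (-(v * w))))]
    congr 1; ext v
    rw [hχ, map_mul, conj_ee]
    congr 2; ring
  rw [pk, pk, map_mul, map_mul, conj_ee, ← h1, Complex.conj_ofReal]
  congr 2; ring

/-- The energy of the wave packet coefficients of a function is controlled by the density of its
support near the tiles. -/
theorem energyLE_of_density (χ χ' : 𝓢(ℝ, ℂ)) (hχ : ∀ v, χ' v = conj (χ (-v)))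
    (hψ : ∀ v, χ' v ≠ 0 → 1 ≤ v ∧ v ≤ 13) :
    ∃ C : ℝ, 0 < C ∧ ∀ (lam t : ℝ) (_ : 0 < lam) (_ : 0 ≤ t) (_ : t < 1)
      (S : Finset Tile) (F : Set ℝ) (_ : MeasurableSet F) (μ : ℝ) (_ : 0 < μ)
      (_ : ∀ s ∈ S, ∀ k : ℤ, s.k ≤ k → ∀ j : ℕ,
        volume (F ∩ {x | |x - s.pt lam| ≤ 2 ^ j * len lam k}) ≤
          ENNReal.ofReal (μ * 4 ^ j * len lam k))
      (f : ℝ → ℂ) (_ : Integrable f) (_ : ∀ x, ‖f x‖ ≤ F.indicator 1 x),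
      EnergyLE lam (fun s => ‖∫ y, f y *
        pk χ (len lam s.k) (s.ctr lam t) (-(s.l / len lam s.k)) y‖) S (C * μ) := by
  classical
  obtain ⟨C, hC, hb⟩ := lintegral_lac_le χ' hψ
  refine ⟨2 * C, by positivity, fun lam t h ht0 ht1 S F hFm μ hμ hD f hf hfF => ?_⟩
  rw [mul_assoc]
  refine energyLE_of_self_improving h (by positivity) fun ε hε hE τ => ?_
  set a : Tile → ℂ := fun s => ∫ y, f y *
    pk χ (len lam s.k) (s.ctr lam t) (-(s.l / len lam s.k)) y with ha
  have hL := len_pos h τ.k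
  set T := S.filter (Lac lam · τ) with hT
  have hM : MassLE lam F (fun _ => τ.ξ) T μ := fun s hs k hk ξ _ j =>
    (measure_mono (inter_subset_inter_left _ inter_subset_left)).trans
      (hD s (Finset.mem_filter.1 hs).1 k hk j)
  have key := hb lam t h ht0 ht1 τ T (fun s hs => (Finset.mem_filter.1 hs).2) F hFm μ hμ.le hM a ε
    hε (hE.mono (Finset.filter_subset _ _))
  have hgInt : ∀ s : Tile, Integrable fun y => f y *
      pk χ (len lam s.k) (s.ctr lam t) (-(s.l / len lam s.k)) y := by
    intro s
    obtain ⟨C', -, hC'⟩ := pk_bounded χ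
    exact hf.mul_bdd (c := C' * (√(len lam s.k))⁻¹) (continuous_pk _ _ _ _).aestronglyMeasurable
      (Filter.Eventually.of_forall fun z => hC' _ (len_pos h _) _ _ _)
  have hid : ((∑ s ∈ T, ‖a s‖ ^ 2 : ℝ) : ℂ) = ∫ y, f y * conj (∑ s ∈ T, a s *
      pk χ' (len lam s.k) (s.ctr lam t) (s.l / len lam s.k) y) := by
    push_cast
    simp_rw [map_sum, Finset.mul_sum]
    have e : ∀ s y, f y * conj (a s * pk χ' (len lam s.k) (s.ctr lam t) (s.l / len lam s.k) y) =
        conj (a s) * (f y * pk χ (len lam s.k) (s.ctr lam t) (-(s.l / len lam s.k)) y) := by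
      intro s y
      have := conj_pk hχ (len lam s.k) (s.ctr lam t) (-(s.l / len lam s.k)) y
      rw [neg_neg] at this
      rw [map_mul, ← this, Complex.conj_conj]; ring
    simp_rw [e]
    rw [integral_finsetSum _ fun s _ => (hgInt s).const_mul _]
    refine Finset.sum_congr rfl fun s _ => ?_
    rw [integral_const_mul, ← Complex.conj_mul']
  have hle : ENNReal.ofReal (∑ s ∈ T, ‖a s‖ ^ 2) ≤ ENNReal.ofReal (C * ε * μ * len lam τ.k) := by
    refine le_trans ?_ key
    rw [← lintegral_indicator hFm]
    have h0 : 0 ≤ ∑ s ∈ T, ‖a s‖ ^ 2 := Finset.sum_nonneg fun s _ => by positivity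
    calc ENNReal.ofReal (∑ s ∈ T, ‖a s‖ ^ 2) = ‖((∑ s ∈ T, ‖a s‖ ^ 2 : ℝ) : ℂ)‖ₑ := by
          rw [← ofReal_norm, Complex.norm_real, Real.norm_of_nonneg h0]
      _ ≤ _ := by
          rw [hid]
          refine (enorm_integral_le_lintegral_enorm _).trans (lintegral_mono fun y => ?_)
          rw [enorm_mul]
          by_cases hy : y ∈ F
          · have := hfF y
            rw [indicator_of_mem hy, Pi.one_apply] at this
            rw [indicator_of_mem hy, ← ofReal_norm (conj _), RCLike.norm_conj, ofReal_norm]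
            refine (mul_le_mul' (b := 1) ?_ le_rfl).trans (one_mul _).le
            rw [← ofReal_norm]
            exact ENNReal.ofReal_le_one.2 this
          · have := hfF y
            rw [indicator_of_notMem hy] at this
            rw [norm_le_zero_iff.1 this]; simp
  rw [Real.sq_sqrt (by positivity)]
  refine ((ENNReal.ofReal_le_ofReal_iff (by positivity)).1 hle).trans (le_of_eq (by ring))

/-! ### The energy decomposition for wave packet coefficients -/

theorem sq_integral_norm_mul_le {f g : ℝ → ℂ} (hf : Integrable fun x => ‖f x‖ ^ 2)
    (hg : Integrable fun x => ‖g x‖ ^ 2) (hfg : Integrable fun x => ‖f x‖ * ‖g x‖) :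
    (∫ x, ‖f x‖ * ‖g x‖) ^ 2 ≤ (∫ x, ‖f x‖ ^ 2) * ∫ x, ‖g x‖ ^ 2 := by
  have := discrim_le_zero (a := ∫ x, ‖f x‖ ^ 2) (b := -2 * ∫ x, ‖f x‖ * ‖g x‖)
    (c := ∫ x, ‖g x‖ ^ 2) fun u => by
      have h1 : ∫ x, (‖f x‖ * u - ‖g x‖) ^ 2 = (∫ x, ‖f x‖ ^ 2) * (u * u) +
          (-2 * ∫ x, ‖f x‖ * ‖g x‖) * u + ∫ x, ‖g x‖ ^ 2 := by
        have e : ∀ x, (‖f x‖ * u - ‖g x‖) ^ 2 =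
            (u * u) * ‖f x‖ ^ 2 + (-2 * u) * (‖f x‖ * ‖g x‖) + ‖g x‖ ^ 2 := fun x => by ring
        simp_rw [e]
        rw [integral_add (f := fun x => (u * u) * ‖f x‖ ^ 2 + (-2 * u) * (‖f x‖ * ‖g x‖))
          ((hf.const_mul _).add (hfg.const_mul _)) hg,
          integral_add (hf.const_mul _) (hfg.const_mul _), integral_const_mul, integral_const_mul]
        ring
      rw [← h1]
      exact integral_nonneg fun x => sq_nonneg _
  rw [discrim] at this
  nlinarith

theorem integral_norm_sq_sum_le (g : Tile → ℝ → ℂ)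
    (hgInt : ∀ s s', Integrable fun y => g s y * conj (g s' y)) (U : Finset Tile) (c : Tile → ℂ) :
    ∫ y, ‖∑ s ∈ U, c s * g s y‖ ^ 2 ≤
      ∑ s ∈ U, ∑ s' ∈ U, ‖c s‖ * ‖c s'‖ * ‖∫ y, g s y * conj (g s' y)‖ := by
  have hexp : ((∫ y, ‖∑ s ∈ U, c s * g s y‖ ^ 2 : ℝ) : ℂ) =
      ∑ s ∈ U, ∑ s' ∈ U, c s * conj (c s') * ∫ y, g s y * conj (g s' y) := by
    rw [← integral_complex_ofReal]
    have : ∀ y, ((‖∑ s ∈ U, c s * g s y‖ ^ 2 : ℝ) : ℂ) =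
        ∑ s ∈ U, ∑ s' ∈ U, c s * conj (c s') * (g s y * conj (g s' y)) := by
      intro y
      push_cast
      rw [← Complex.mul_conj', map_sum, Finset.sum_mul_sum]
      refine Finset.sum_congr rfl fun s _ => Finset.sum_congr rfl fun s' _ => ?_
      rw [map_mul]; ring
    simp_rw [this]
    rw [integral_finsetSum _ fun s _ => integrable_finsetSum _ fun s' _ =>
      (hgInt s s').const_mul _]
    refine Finset.sum_congr rfl fun s _ => ?_
    rw [integral_finsetSum _ fun s' _ => (hgInt s s').const_mul _]
    exact Finset.sum_congr rfl fun s' _ => integral_const_mul _ _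
  have hnn : 0 ≤ ∫ y, ‖∑ s ∈ U, c s * g s y‖ ^ 2 := integral_nonneg fun y => by positivity
  calc ∫ y, ‖∑ s ∈ U, c s * g s y‖ ^ 2 = ‖((∫ y, ‖∑ s ∈ U, c s * g s y‖ ^ 2 : ℝ) : ℂ)‖ := by
        rw [Complex.norm_real, Real.norm_of_nonneg hnn]
    _ ≤ _ := by
        rw [hexp]
        refine (norm_sum_le _ _).trans (Finset.sum_le_sum fun s _ =>
          (norm_sum_le _ _).trans (Finset.sum_le_sum fun s' _ => ?_))
        rw [norm_mul, norm_mul, RCLike.norm_conj]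

open scoped Classical in
theorem packet_energy_decomposition (χ : 𝓢(ℝ, ℂ)) (hχ : ∀ v, χ v ≠ 0 → -13 < v ∧ v < -1) :
    ∃ C : ℝ, 0 < C ∧ ∀ (lam t : ℝ) (_ : 0 < lam) (_ : 0 ≤ t) (_ : t < 1)
      (S : Finset Tile) (_ : ∀ s ∈ S, 13 ≤ s.l % 16) (F : Set ℝ) (_ : MeasurableSet F)
      (_ : volume F ≠ ⊤) (f : ℝ → ℂ) (_ : Integrable f) (_ : ∀ x, ‖f x‖ ≤ F.indicator 1 x)
      (ε : ℝ) (_ : 0 ≤ ε) (_ : EnergyLE lam (fun s => ‖∫ y, f y *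
        pk χ (len lam s.k) (s.ctr lam t) (-(s.l / len lam s.k)) y‖) S (2 * ε)),
      ∃ 𝒯 : Finset TreeTop, ε ^ 2 * ∑ τ ∈ 𝒯, len lam τ.k ≤ C * volume.real F ∧
        EnergyLE lam (fun s => ‖∫ y, f y *
          pk χ (len lam s.k) (s.ctr lam t) (-(s.l / len lam s.k)) y‖)
          (S.filter fun s => ∀ τ ∈ 𝒯, ¬ Under lam s τ) ε := by
  obtain ⟨C, hC, hb⟩ := norm_integral_pk_mul_conj_le χ χ 4
  refine ⟨400000 * C, by positivity, fun lam t h ht0 ht1 S hS F hFm hFf f hf hfF ε hε hE => ?_⟩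
  set φ : Tile → ℝ → ℂ := fun s =>
    pk χ (len lam s.k) (s.ctr lam t) (-(s.l / len lam s.k)) with hφ
  have hL : ∀ s : Tile, 0 < len lam s.k := fun s => len_pos h s.k
  have hf1 : ∀ x, ‖f x‖ ≤ 1 := fun x => (hfF x).trans
    (indicator_le_self' (fun _ _ => zero_le_one) x)
  have hgInt : ∀ s s', Integrable fun y => φ s y * conj (φ s' y) := fun s s' =>
    integrable_pk_mul_conj_pk χ χ (hL s) (hL s') _ _ _ _
  have hfφ : ∀ s, Integrable fun y => f y * φ s y := by
    intro s
    obtain ⟨C', -, hC'⟩ := pk_bounded χ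
    exact hf.mul_bdd (c := C' * (√(len lam s.k))⁻¹) (continuous_pk _ _ _ _).aestronglyMeasurable
      (Filter.Eventually.of_forall fun z => hC' _ (len_pos h _) _ _ _)
  have hf2 : Integrable fun x => ‖f x‖ ^ 2 := by
    simp_rw [sq]
    exact hf.norm.mul_bdd (c := 1) hf.norm.aestronglyMeasurable
      (Filter.Eventually.of_forall fun x => by rw [norm_norm]; exact hf1 x)
  have hA : ∫ x, ‖f x‖ ^ 2 ≤ volume.real F := by
    rw [← integral_indicator_one hFm]
    refine integral_mono hf2 ((integrable_indicator_iff hFm).2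
      (integrableOn_const hFf)) fun x => ?_
    have h1 := hfF x
    have h2 := hf1 x
    have h3 := norm_nonneg (f x)
    nlinarith
  refine energy_decomposition (G := fun s s' => ‖∫ y, φ s y * conj (φ s' y)‖) h ht0 ht1
    (fun s => norm_nonneg _) (fun s s' => norm_nonneg _) (fun s s' => ?_) (fun s s' hne => ?_)
    hC.le measureReal_nonneg (fun s s' hk => ?_) (fun U => ?_) hS hε hE |>.imp
      fun 𝒯 h𝒯 => ⟨h𝒯.1.trans (le_of_eq (by ring)), h𝒯.2⟩
  · rw [← RCLike.norm_conj, ← integral_conj]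
    simp [mul_comm]
  · by_contra hc
    refine hne ?_
    rw [norm_eq_zero]
    refine integral_pk_mul_conj_pk_eq_zero χ χ (hL s') _ _ _ _ fun v v' hv hv' he => hc ?_
    have hin : ∀ (s : Tile) v, χ v ≠ 0 → InPacket lam s ((s.l + v) / len lam s.k) := by
      intro s v hv
      obtain ⟨h1, h2⟩ := hχ v hv
      have h3 := (fidx_eq_iff (lam := lam) s.k _ ((s.l + v) / len lam s.k)).1 rfl
      rw [div_mul_cancel₀ _ (hL s).ne'] at h3
      constructor
      · have : ((s.l - 13 : ℤ) : ℝ) < fidx lam s.k ((s.l + v) / len lam s.k) + 1 := by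
          push_cast; linarith [h3.2]
        have : s.l - 13 < fidx lam s.k ((s.l + v) / len lam s.k) + 1 := by exact_mod_cast this
        omega
      · have : (fidx lam s.k ((s.l + v) / len lam s.k) : ℝ) < ((s.l - 1 : ℤ) : ℝ) := by
          push_cast; linarith [h3.1]
        have : fidx lam s.k ((s.l + v) / len lam s.k) < s.l - 1 := by exact_mod_cast this
        omega
    refine ⟨_, hin s v hv, ?_⟩
    have : (s.l + v) / len lam s.k = (s'.l + v') / len lam s'.k := by
      rw [add_div, add_div]; linarith
    rw [this]
    exact hin s' v' hv'
  · exact hb _ _ (hL s') (len_mono h hk) _ _ _ _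
  · set a : Tile → ℂ := fun s => ∫ y, f y * φ s y with ha
    set g : ℝ → ℂ := fun y => ∑ s ∈ U, conj (a s) * φ s y with hg
    have hfgi : Integrable fun x => ‖f x‖ * ‖g x‖ := by
      have : Integrable fun x => f x * g x := by
        simp_rw [hg, Finset.mul_sum, mul_left_comm (f _)]
        exact integrable_finsetSum _ fun s _ => (hfφ s).const_mul _
      simpa only [norm_mul] using this.norm
    have hg2 : Integrable fun x => ‖g x‖ ^ 2 := by
      have : Integrable fun x => g x * conj (g x) := by
        simp_rw [hg, map_sum, Finset.sum_mul_sum]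
        refine integrable_finsetSum _ fun s _ => integrable_finsetSum _ fun s' _ => ?_
        have e : ∀ x, conj (a s) * φ s x * conj (conj (a s') * φ s' x) =
            (conj (a s) * a s') * (φ s x * conj (φ s' x)) := fun x => by
          rw [map_mul, Complex.conj_conj]; ring
        simp_rw [e]
        exact (hgInt s s').const_mul _
      refine this.norm.congr (Filter.Eventually.of_forall fun x => ?_)
      simp only [norm_mul, RCLike.norm_conj, sq]
    have hid : ((∑ s ∈ U, ‖a s‖ ^ 2 : ℝ) : ℂ) = ∫ y, f y * g y := by
      push_cast
      simp_rw [hg, Finset.mul_sum, mul_left_comm (f _)]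
      rw [integral_finsetSum _ fun s _ => (hfφ s).const_mul _]
      refine Finset.sum_congr rfl fun s _ => ?_
      rw [integral_const_mul, ← Complex.conj_mul']
    have h0 : 0 ≤ ∑ s ∈ U, ‖a s‖ ^ 2 := Finset.sum_nonneg fun s _ => by positivity
    have h1 : ∑ s ∈ U, ‖a s‖ ^ 2 ≤ ∫ x, ‖f x‖ * ‖g x‖ := by
      calc ∑ s ∈ U, ‖a s‖ ^ 2 = ‖((∑ s ∈ U, ‖a s‖ ^ 2 : ℝ) : ℂ)‖ := by
            rw [Complex.norm_real, Real.norm_of_nonneg h0]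
        _ ≤ _ := by
            rw [hid]
            refine (norm_integral_le_integral_norm _).trans (le_of_eq ?_)
            simp only [norm_mul]
    have h2 := integral_norm_sq_sum_le φ hgInt U (fun s => conj (a s))
    simp only [RCLike.norm_conj] at h2
    calc (∑ s ∈ U, ‖a s‖ ^ 2) ^ 2 ≤ (∫ x, ‖f x‖ * ‖g x‖) ^ 2 := by gcongr
      _ ≤ (∫ x, ‖f x‖ ^ 2) * ∫ x, ‖g x‖ ^ 2 := sq_integral_norm_mul_le hf2 hg2 hfgi
      _ ≤ _ := mul_le_mul hA h2 (integral_nonneg fun x => sq_nonneg _) measureReal_nonneg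

/-! ### Combining the trees -/

theorem massLE_two {lam : ℝ} (h : 0 < lam) (E : Set ℝ) (N : ℝ → ℝ) (S : Finset Tile) :
    MassLE lam E N S 2 := by
  intro s _ k _ ξ _ j
  have hL := len_pos h k
  calc _ ≤ volume {x | |x - s.pt lam| ≤ 2 ^ j * len lam k} := measure_mono inter_subset_right
    _ = ENNReal.ofReal (2 * (2 ^ j * len lam k)) := by
        rw [← Real.volume_closedBall (s.pt lam) (2 ^ j * len lam k)]
        rfl
    _ ≤ _ := by
        refine ENNReal.ofReal_le_ofReal ?_
        have : (2 : ℝ) ^ j ≤ 4 ^ j := pow_le_pow_left₀ (by norm_num) (by norm_num) j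
        nlinarith

open scoped Classical in
theorem lintegral_sum_le_of_trees {lam : ℝ} (h : 0 < lam) {E : Set ℝ} {u : Tile → ℝ → ℂ}
    (hu : ∀ s, Measurable (u s)) {S : Finset Tile} {B : ℝ} (hB : 0 ≤ B)
    (hT : ∀ (τ : TreeTop) (T : Finset Tile), T ⊆ S → (∀ s ∈ T, Under lam s τ) →
      ∫⁻ x in E, ‖∑ s ∈ T, u s x‖ₑ ≤ ENNReal.ofReal (B * len lam τ.k)) (𝒯 : Finset TreeTop) :
    ∫⁻ x in E, ‖∑ s ∈ S, u s x‖ₑ ≤ ENNReal.ofReal (B * ∑ τ ∈ 𝒯, len lam τ.k) +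
      ∫⁻ x in E, ‖∑ s ∈ S.filter (fun s => ∀ τ ∈ 𝒯, ¬ Under lam s τ), u s x‖ₑ := by
  have hm : ∀ T : Finset Tile, Measurable fun x => ‖∑ s ∈ T, u s x‖ₑ := fun T =>
    (Finset.measurable_sum _ fun s _ => hu s).enorm
  induction 𝒯 using Finset.induction_on with
  | empty => simp
  | insert τ 𝒯 hτ ih =>
    set R := S.filter (fun s => ∀ τ ∈ 𝒯, ¬ Under lam s τ) with hR
    have hL : 0 ≤ B * len lam τ.k := mul_nonneg hB (len_pos h _).le
    have hLs : 0 ≤ B * ∑ τ ∈ 𝒯, len lam τ.k :=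
      mul_nonneg hB (Finset.sum_nonneg fun τ _ => (len_pos h _).le)
    have hRR : S.filter (fun s => ∀ τ' ∈ insert τ 𝒯, ¬ Under lam s τ') =
        R.filter (fun s => ¬ Under lam s τ) := by
      ext s
      simp only [hR, Finset.mem_filter, Finset.forall_mem_insert]
      tauto
    rw [hRR, Finset.sum_insert hτ, mul_add, ENNReal.ofReal_add hL hLs]
    refine ih.trans ?_
    rw [add_comm (ENNReal.ofReal (B * len lam τ.k)), add_assoc]
    refine add_le_add le_rfl ?_
    calc _ ≤ ∫⁻ x in E, (‖∑ s ∈ R.filter (Under lam · τ), u s x‖ₑ +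
          ‖∑ s ∈ R.filter (fun s => ¬ Under lam s τ), u s x‖ₑ) := by
          refine lintegral_mono fun x => ?_
          rw [← Finset.sum_filter_add_sum_filter_not R (Under lam · τ)]
          exact enorm_add_le _ _
      _ = _ := lintegral_add_left (hm _) _
      _ ≤ _ := add_le_add (hT τ _ ((Finset.filter_subset _ _).trans (Finset.filter_subset _ _))
          fun s hs => (Finset.mem_filter.1 hs).2) le_rfl

set_option maxHeartbeats 400000 in
open scoped Classical in
/-- The estimate for the model operator in terms of the energy. -/
theorem lintegral_model_le (χ ζ : 𝓢(ℝ, ℂ)) (hχ : ∀ v, χ v ≠ 0 → -13 < v ∧ v < -1)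
    (hζ : ∀ v, ζ v ≠ 0 → 3 ≤ v ∧ v ≤ 12) :
    ∃ C : ℝ, 0 < C ∧ ∀ (lam t : ℝ) (_ : 0 < lam) (_ : 0 ≤ t) (_ : t < 1)
      (S : Finset Tile) (_ : ∀ s ∈ S, 13 ≤ s.l % 16) (F : Set ℝ) (_ : MeasurableSet F)
      (_ : volume F ≠ ⊤) (f : ℝ → ℂ) (_ : Integrable f) (_ : ∀ x, ‖f x‖ ≤ F.indicator 1 x)
      (E : Set ℝ) (_ : MeasurableSet E) (_ : volume E ≠ ⊤) (N : ℝ → ℝ) (_ : Measurable N)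
      (σ : ℝ) (_ : 0 < σ) (_ : EnergyLE lam (fun s => ‖∫ y, f y *
        pk χ (len lam s.k) (s.ctr lam t) (-(s.l / len lam s.k)) y‖) S σ)
      (m : ℕ) (_ : 2 * volume.real F ≤ 2 ^ m * (σ ^ 2 * volume.real E)),
      ∫⁻ x in E, ‖∑ s ∈ S, modelTerm ζ lam t N (fun s => ∫ y, f y *
        pk χ (len lam s.k) (s.ctr lam t) (-(s.l / len lam s.k)) y) s x‖ₑ ≤
        ENNReal.ofReal (C * σ * volume.real E * (m + 1)) := by
  obtain ⟨C₁, hC₁, h1⟩ := lintegral_tree_le ζ hζ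
  obtain ⟨C₂, hC₂, h2⟩ := packet_energy_decomposition χ hχ
  obtain ⟨C₃, hC₃, h3⟩ := pk_bounded ζ
  refine ⟨32 * C₁ + 2 * (64 * C₁ + 4 * C₁ * C₂) + C₃, by positivity,
    fun lam t h ht0 ht1 S hS F hFm hFf f hf hfF E hEm hEf N hN σ hσ hE m hm => ?_⟩
  set a : Tile → ℂ := fun s => ∫ y, f y *
    pk χ (len lam s.k) (s.ctr lam t) (-(s.l / len lam s.k)) y with ha
  set e := volume.real E with he
  have he0 : 0 ≤ e := measureReal_nonneg
  set u := modelTerm ζ lam t N a with hu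
  have hum : ∀ s, Measurable (u s) := fun s => measurable_modelTerm ζ lam t hN a s
  -- removing trees, with the mass lowered
  have stepM : ∀ (S' : Finset Tile) (μ μ' ε : ℝ), S' ⊆ S → 0 ≤ μ → 0 < μ' → 0 < ε →
      MassLE lam E N S' μ → EnergyLE lam (fun s => ‖a s‖) S' ε →
      ∃ R ⊆ S', MassLE lam E N R μ' ∧ ∫⁻ x in E, ‖∑ s ∈ S', u s x‖ₑ ≤
        ENNReal.ofReal (C₁ * ε * μ * (16 * e / μ')) + ∫⁻ x in E, ‖∑ s ∈ R, u s x‖ₑ := by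
    intro S' μ μ' ε _ hμ hμ' hε hMs hEs
    obtain ⟨𝒯, h𝒯, hMR⟩ := mass_decomposition h hEm hEf hN S' hμ'
    refine ⟨_, Finset.filter_subset _ _, hMR, ?_⟩
    refine (lintegral_sum_le_of_trees h hum (B := C₁ * ε * μ) (by positivity)
      (fun τ T hT hTU => h1 lam t h ht0 ht1 τ T hTU E hEm N hN μ hμ (hMs.mono hT) a ε hε
        (hEs.mono hT)) 𝒯).trans ?_
    gcongr
    rw [le_div_iff₀ hμ']
    linarith
  have stepE : ∀ (S' : Finset Tile) (μ ε : ℝ), S' ⊆ S → 0 ≤ μ → 0 < ε →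
      MassLE lam E N S' μ → EnergyLE lam (fun s => ‖a s‖) S' ε →
      ∃ R ⊆ S', EnergyLE lam (fun s => ‖a s‖) R (ε / 2) ∧ ∫⁻ x in E, ‖∑ s ∈ S', u s x‖ₑ ≤
        ENNReal.ofReal (C₁ * ε * μ * (C₂ * volume.real F / (ε / 2) ^ 2)) +
          ∫⁻ x in E, ‖∑ s ∈ R, u s x‖ₑ := by
    intro S' μ ε hS' hμ hε hMs hEs
    obtain ⟨𝒯, h𝒯, hMR⟩ := h2 lam t h ht0 ht1 S' (fun s hs => hS s (hS' hs)) F hFm hFf f hf hfF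
      (ε / 2) (by positivity) (by rw [mul_div_cancel₀ ε two_ne_zero]; exact hEs)
    refine ⟨_, Finset.filter_subset _ _, hMR, ?_⟩
    refine (lintegral_sum_le_of_trees h hum (B := C₁ * ε * μ) (by positivity)
      (fun τ T hT hTU => h1 lam t h ht0 ht1 τ T hTU E hEm N hN μ hμ (hMs.mono hT) a ε hε
        (hEs.mono hT)) 𝒯).trans ?_
    gcongr
    rw [le_div_iff₀ (by positivity)]
    linarith
  have phase1 : ∀ i : ℕ, ∃ R ⊆ S, MassLE lam E N R (2 / 2 ^ i) ∧ ∫⁻ x in E, ‖∑ s ∈ S, u s x‖ₑ ≤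
      ENNReal.ofReal (32 * C₁ * σ * e * i) + ∫⁻ x in E, ‖∑ s ∈ R, u s x‖ₑ := by
    intro i
    induction i with
    | zero => exact ⟨S, subset_rfl, by simpa using massLE_two h E N S, by simp⟩
    | succ i ih =>
      obtain ⟨R, hR, hRM, hRe⟩ := ih
      obtain ⟨R', hR', hRM', hRe'⟩ := stepM R _ (2 / 2 ^ (i + 1)) σ hR (by positivity)
        (by positivity) hσ hRM (hE.mono hR)
      refine ⟨R', hR'.trans hR, hRM', hRe.trans ((add_le_add le_rfl hRe').trans (le_of_eq ?_))⟩
      rw [← add_assoc, ← ENNReal.ofReal_add (by positivity) (by positivity)]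
      congr 2
      push_cast
      field_simp
      ring
  obtain ⟨R₀, hR₀, hM₀, hI₀⟩ := phase1 m
  have phase2 : ∀ n : ℕ, ∃ R ⊆ R₀, MassLE lam E N R (2 / 2 ^ m / 4 ^ n) ∧
      EnergyLE lam (fun s => ‖a s‖) R (σ / 2 ^ n) ∧ ∫⁻ x in E, ‖∑ s ∈ R₀, u s x‖ₑ ≤
      ENNReal.ofReal ((64 * C₁ + 4 * C₁ * C₂) * σ * e * (2 * (1 - 1 / 2 ^ n))) +
        ∫⁻ x in E, ‖∑ s ∈ R, u s x‖ₑ := by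
    intro n
    induction n with
    | zero => exact ⟨R₀, subset_rfl, by simpa using hM₀, by simpa using hE.mono hR₀, by simp⟩
    | succ n ih =>
      obtain ⟨R, hR, hRM, hRE, hRe⟩ := ih
      obtain ⟨R', hR', hRM', hRe'⟩ := stepM R _ (2 / 2 ^ m / 4 ^ (n + 1)) (σ / 2 ^ n)
        (hR.trans hR₀) (by positivity) (by positivity) (by positivity) hRM hRE
      obtain ⟨R'', hR'', hRE'', hRe''⟩ := stepE R' (2 / 2 ^ m / 4 ^ n) (σ / 2 ^ n)
        ((hR'.trans hR).trans hR₀) (by positivity) (by positivity) (hRM.mono hR') (hRE.mono hR')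
      refine ⟨R'', (hR''.trans hR').trans hR, hRM'.mono hR'', ?_, ?_⟩
      · rwa [pow_succ, ← div_div]
      refine hRe.trans ((add_le_add le_rfl (hRe'.trans (add_le_add le_rfl hRe''))).trans ?_)
      have hpos : (1 : ℝ) / 2 ^ n ≤ 1 := by
        rw [div_le_one (by positivity)]; exact one_le_pow₀ (by norm_num)
      have hpos' : 0 ≤ (64 * C₁ + 4 * C₁ * C₂) * σ * e * (2 * (1 - 1 / 2 ^ n)) :=
        mul_nonneg (by positivity) (by linarith)
      have hvol : (0 : ℝ) ≤ volume.real F := measureReal_nonneg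
      rw [← add_assoc, ← add_assoc, ← ENNReal.ofReal_add hpos' (by positivity),
        ← ENNReal.ofReal_add (by positivity) (by positivity)]
      refine add_le_add (ENNReal.ofReal_le_ofReal ?_) le_rfl
      have e1 : C₁ * (σ / 2 ^ n) * (2 / 2 ^ m / 4 ^ n) * (16 * e / (2 / 2 ^ m / 4 ^ (n + 1))) =
          64 * C₁ * σ * e * (1 / 2 ^ n) := by
        field_simp; ring
      have e2 : C₁ * (σ / 2 ^ n) * (2 / 2 ^ m / 4 ^ n) *
          (C₂ * volume.real F / (σ / 2 ^ n / 2) ^ 2) =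
          4 * C₁ * C₂ * (1 / 2 ^ n) * (2 * volume.real F / (2 ^ m * σ)) := by
        have : (4 : ℝ) ^ n = 2 ^ n * 2 ^ n := by rw [← mul_pow]; norm_num
        rw [this]
        field_simp; ring_nf
      have e3 : 2 * volume.real F / (2 ^ m * σ) ≤ σ * e := by
        rw [div_le_iff₀ (by positivity)]
        linarith
      have e4 : 4 * C₁ * C₂ * (1 / 2 ^ n) * (2 * volume.real F / (2 ^ m * σ)) ≤
          4 * C₁ * C₂ * (1 / 2 ^ n) * (σ * e) := by gcongr
      have e5 : (1 : ℝ) / 2 ^ (n + 1) = (1 / 2 ^ n) / 2 := by rw [pow_succ]; field_simp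
      rw [e1, e2, e5]
      nlinarith
  obtain ⟨n, hn⟩ := pow_unbounded_of_one_lt (S.card : ℝ) (one_lt_two)
  obtain ⟨R, hR, -, hRE, hRe⟩ := phase2 n
  have hrem : ∫⁻ x in E, ‖∑ s ∈ R, u s x‖ₑ ≤ ENNReal.ofReal (C₃ * σ * e) := by
    calc _ ≤ ∫⁻ x in E, ENNReal.ofReal (C₃ * σ) := by
          refine lintegral_mono fun x => ?_
          rw [← ofReal_norm]
          refine ENNReal.ofReal_le_ofReal ((norm_sum_le _ _).trans ?_)
          have hb : ∀ s ∈ R, ‖u s x‖ ≤ C₃ * (σ / 2 ^ n) := by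
            intro s hs
            have hsq := Real.sqrt_pos.2 (len_pos h s.k)
            rw [hu, modelTerm]
            split_ifs
            · rw [norm_mul]
              have h4 := hRE.coeff_le h (fun s => norm_nonneg (a s)) (by positivity) hs
              have h5 := h3 _ (len_pos h s.k) (s.ctr lam t) (N x) x
              refine (mul_le_mul h4 h5 (norm_nonneg _) (by positivity)).trans (le_of_eq ?_)
              field_simp
            · rw [norm_zero]; positivity
          refine (Finset.sum_le_card_nsmul R _ _ hb).trans ?_
          rw [nsmul_eq_mul]
          have hc : (R.card : ℝ) ≤ 2 ^ n := by
            refine le_trans ?_ hn.le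
            exact_mod_cast Finset.card_le_card (hR.trans hR₀)
          calc (R.card : ℝ) * (C₃ * (σ / 2 ^ n)) ≤ 2 ^ n * (C₃ * (σ / 2 ^ n)) := by gcongr
            _ = C₃ * σ := by field_simp
      _ = _ := by
          rw [lintegral_const, Measure.restrict_apply_univ, ← ofReal_measureReal hEf,
            ← ENNReal.ofReal_mul (by positivity)]
  refine hI₀.trans ((add_le_add le_rfl (hRe.trans (add_le_add le_rfl hrem))).trans ?_)
  have hpos : (1 : ℝ) / 2 ^ n ≤ 1 := by
    rw [div_le_one (by positivity)]; exact one_le_pow₀ (by norm_num)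
  have hpos2 : (0 : ℝ) ≤ 1 / 2 ^ n := by positivity
  have hpos' : 0 ≤ (64 * C₁ + 4 * C₁ * C₂) * σ * e * (2 * (1 - 1 / 2 ^ n)) :=
    mul_nonneg (by positivity) (by linarith)
  rw [← ENNReal.ofReal_add hpos' (by positivity), ← ENNReal.ofReal_add (by positivity)
    (add_nonneg hpos' (by positivity))]
  refine ENNReal.ofReal_le_ofReal ?_
  have hm0 : (0 : ℝ) ≤ m := Nat.cast_nonneg m
  have k1 : (64 * C₁ + 4 * C₁ * C₂) * σ * e * (2 * (1 - 1 / 2 ^ n)) ≤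
      (64 * C₁ + 4 * C₁ * C₂) * σ * e * 2 := by
    refine mul_le_mul_of_nonneg_left (by linarith) (by positivity)
  have k2 : 0 ≤ (2 * (64 * C₁ + 4 * C₁ * C₂) + C₃) * σ * e * m := by positivity
  have k3 : 0 ≤ 32 * C₁ * σ * e := by positivity
  nlinarith

/-! ### The restricted type estimate for the model operator -/

theorem exists_le_two_pow {δ : ℝ} (hδ : 0 < δ) :
    ∃ C : ℝ, 0 < C ∧ ∀ X : ℝ, 1 ≤ X → ∃ m : ℕ, X ≤ 2 ^ m ∧ (m : ℝ) + 1 ≤ C * X ^ δ := by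
  have hl2 : 0 < Real.log 2 := Real.log_pos (by norm_num)
  refine ⟨2 + 1 / (δ * Real.log 2), by positivity, fun X hX => ⟨⌈Real.log X / Real.log 2⌉₊, ?_, ?_⟩⟩
  · have h1 := Nat.le_ceil (Real.log X / Real.log 2)
    rw [div_le_iff₀ hl2] at h1
    rw [← Real.rpow_natCast, ← Real.log_le_log_iff (by linarith) (by positivity),
      Real.log_rpow (by norm_num)]
    exact h1
  · have h0 : 0 ≤ Real.log X / Real.log 2 := div_nonneg (Real.log_nonneg hX) hl2.le
    have h1 := (Nat.ceil_lt_add_one h0).le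
    have h2 := Real.log_le_rpow_div (by linarith : 0 ≤ X) hδ
    have h3 : 1 ≤ X ^ δ := Real.one_le_rpow hX hδ.le
    have h4 : Real.log X / Real.log 2 ≤ 1 / (δ * Real.log 2) * X ^ δ := by
      rw [div_le_iff₀ hl2]
      refine h2.trans (le_of_eq ?_)
      field_simp
    nlinarith

theorem lintegral_model_le_rpow (χ χ' ζ : 𝓢(ℝ, ℂ)) (hχ : ∀ v, χ v ≠ 0 → -13 < v ∧ v < -1)
    (hχ' : ∀ v, χ' v = conj (χ (-v))) (hζ : ∀ v, ζ v ≠ 0 → 3 ≤ v ∧ v ≤ 12) {q : ℝ} (hq : 1 < q) :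
    ∃ C : ℝ, 0 < C ∧ ∀ (lam t : ℝ) (_ : 0 < lam) (_ : 0 ≤ t) (_ : t < 1)
      (S : Finset Tile) (_ : ∀ s ∈ S, 13 ≤ s.l % 16) (F : Set ℝ) (_ : MeasurableSet F)
      (_ : volume F ≠ ⊤) (_ : 0 < volume.real F) (f : ℝ → ℂ) (_ : Integrable f)
      (_ : ∀ x, ‖f x‖ ≤ F.indicator 1 x)
      (E : Set ℝ) (_ : MeasurableSet E) (_ : volume E ≠ ⊤) (_ : 0 < volume.real E)
      (N : ℝ → ℝ) (_ : Measurable N)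
      (_ : ∀ s ∈ S, ∀ k : ℤ, s.k ≤ k → ∀ j : ℕ,
        volume (F ∩ {x | |x - s.pt lam| ≤ 2 ^ j * len lam k}) ≤
          ENNReal.ofReal (80 * min 1 (volume.real F / volume.real E) * 4 ^ j * len lam k)),
      ∫⁻ x in E, ‖∑ s ∈ S, modelTerm ζ lam t N (fun s => ∫ y, f y *
        pk χ (len lam s.k) (s.ctr lam t) (-(s.l / len lam s.k)) y) s x‖ₑ ≤
        ENNReal.ofReal (C * volume.real E * (volume.real F / volume.real E) ^ (1 / q)) := by
  obtain ⟨C₁, hC₁, h1⟩ := lintegral_model_le χ ζ hχ hζ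
  obtain ⟨C₂, hC₂, h2⟩ := energyLE_of_density χ χ' hχ' (fun v hv => by
    rw [hχ'] at hv
    have := hχ (-v) (fun h => hv (by rw [h, map_zero]))
    constructor <;> linarith)
  have hq0 : 0 < q := by linarith
  have hq1 : 1 / q < 1 := by rw [div_lt_one hq0]; exact hq
  have hq2 : 0 < 1 / q := by positivity
  have hδ : 0 < min (1 / q) (1 - 1 / q) := lt_min hq2 (by linarith)
  obtain ⟨C₃, hC₃, h3⟩ := exists_le_two_pow hδ
  set δ := min (1 / q) (1 - 1 / q)
  refine ⟨C₁ * (80 * C₂ + 2) * C₃, by positivity,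
    fun lam t h ht0 ht1 S hS F hFm hFf hF0 f hf hfF E hEm hEf hE0 N hN hD => ?_⟩
  set e := volume.real E
  set ρ := volume.real F / e with hρ
  have hρ0 : 0 < ρ := by positivity
  have hFe : volume.real F = ρ * e := by rw [hρ]; field_simp
  set w := min 1 ρ with hw
  have hw0 : 0 < w := lt_min one_pos hρ0
  have hen := h2 lam t h ht0 ht1 S F hFm (80 * w) (by positivity) hD f hf hfF
  have hen' := EnergyLE.mono_right h (by positivity)
    (show C₂ * (80 * w) ≤ (80 * C₂ + 2) * w by nlinarith) hen
  obtain ⟨m, hm1, hm2⟩ := h3 (max ρ ρ⁻¹) (by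
    rcases le_total 1 ρ with h | h
    · exact h.trans (le_max_left _ _)
    · exact (one_le_inv_iff₀.2 ⟨hρ0, h⟩).trans (le_max_right _ _))
  have hwX : w * max ρ ρ⁻¹ ^ δ ≤ ρ ^ (1 / q) := by
    rcases le_total 1 ρ with h | h
    · rw [hw, min_eq_left h, max_eq_left ((inv_le_one_of_one_le₀ h).trans h), one_mul]
      exact Real.rpow_le_rpow_of_exponent_le h (min_le_left _ _)
    · rw [hw, min_eq_right h, max_eq_right (h.trans (one_le_inv_iff₀.2 ⟨hρ0, h⟩)),
        Real.inv_rpow hρ0.le, ← Real.rpow_neg hρ0.le]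
      nth_rw 1 [← Real.rpow_one ρ]
      rw [← Real.rpow_add hρ0]
      refine Real.rpow_le_rpow_of_exponent_ge hρ0 h ?_
      have : δ ≤ 1 - 1 / q := min_le_right _ _
      linarith
  have hm3 : 2 * volume.real F ≤ 2 ^ m * (((80 * C₂ + 2) * w) ^ 2 * e) := by
    have h5 : ρ ≤ 2 ^ m * w ^ 2 := by
      rcases le_total 1 ρ with h | h
      · rw [hw, min_eq_left h]
        have := (le_max_left _ _).trans hm1
        linarith
      · rw [hw, min_eq_right h]
        have := (le_max_right _ _).trans hm1
        rw [inv_le_iff_one_le_mul₀ hρ0] at this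
        nlinarith
    have h6 : 2 ^ m * (2 * w ^ 2) ≤ 2 ^ m * (((80 * C₂ + 2) * w) ^ 2) := by
      gcongr
      nlinarith [mul_pos hC₂ (sq_pos_of_pos hw0), mul_pos (mul_pos hC₂ hC₂) (sq_pos_of_pos hw0),
        sq_pos_of_pos hw0]
    rw [hFe, ← mul_assoc, ← mul_assoc]
    refine mul_le_mul_of_nonneg_right ?_ hE0.le
    linarith
  refine (h1 lam t h ht0 ht1 S hS F hFm hFf f hf hfF E hEm hEf N hN _ (by positivity) hen' m
    hm3).trans (ENNReal.ofReal_le_ofReal ?_)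
  calc C₁ * ((80 * C₂ + 2) * w) * e * (m + 1)
      ≤ C₁ * ((80 * C₂ + 2) * w) * e * (C₃ * max ρ ρ⁻¹ ^ δ) := by gcongr
    _ = C₁ * (80 * C₂ + 2) * C₃ * e * (w * max ρ ρ⁻¹ ^ δ) := by ring
    _ ≤ _ := by gcongr

/-! ### Tiles inside the exceptional set -/

theorem norm_integral_mul_pk_le (χ : 𝓢(ℝ, ℂ)) :
    ∃ C : ℝ, 0 < C ∧ ∀ (L : ℝ) (_ : 0 < L) (z p d : ℝ) (_ : |z - p| ≤ L) (_ : L ≤ d)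
      (lam : ℝ) (_ : 0 ≤ lam) (F : Set ℝ) (_ : MeasurableSet F)
      (_ : ∀ R, d ≤ R → volume (F ∩ {x | |x - p| ≤ R}) ≤ ENNReal.ofReal (lam * R))
      (f : ℝ → ℂ) (_ : ∀ x, ‖f x‖ ≤ F.indicator 1 x) (ν : ℝ),
      ‖∫ y, f y * pk χ L z ν y‖ ≤ C * lam * √L * (d / L) := by
  obtain ⟨C, hC, hb⟩ := pk_decay χ 3
  refine ⟨C * 8 * 16, by positivity, fun L hL z p d hzp hd lam hlam F hFm hF f hf ν => ?_⟩
  have hd0 : 0 < d := hL.trans_le hd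
  have hW := lintegral_wt_cube_le (volume.restrict F) (p := p) hL (ENNReal.ofReal (lam * d)) (by
    intro j
    rw [Measure.restrict_apply (measurableSet_le (by fun_prop) (by fun_prop)), inter_comm]
    have h1 : F ∩ {x | |x - p| ≤ 2 ^ j * L} ⊆ F ∩ {x | |x - p| ≤ 2 ^ j * d} := by
      refine inter_subset_inter subset_rfl fun x (hx : |x - p| ≤ _) => ?_
      exact hx.trans (by gcongr)
    have h2 : d ≤ 2 ^ j * d := le_mul_of_one_le_left hd0.le (one_le_pow₀ (by norm_num))
    refine (measure_mono h1).trans ((hF _ h2).trans ?_)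
    rw [show (4 : ℝ≥0∞) ^ j = ENNReal.ofReal (4 ^ j) by
      rw [ENNReal.ofReal_pow (by norm_num)]; norm_num, ← ENNReal.ofReal_mul (by positivity)]
    refine ENNReal.ofReal_le_ofReal ?_
    have : (2 : ℝ) ^ j ≤ 4 ^ j := by gcongr; norm_num
    nlinarith [mul_nonneg hlam hd0.le])
  have hpt : ∀ y, ‖f y * pk χ L z ν y‖ₑ ≤
      F.indicator (fun y => ENNReal.ofReal (C * 8 * (√L)⁻¹) * ENNReal.ofReal (wt p L y ^ 3)) y := by
    intro y
    by_cases hy : y ∈ F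
    · rw [indicator_of_mem hy, ← ENNReal.ofReal_mul (by positivity), ← ofReal_norm, norm_mul]
      refine ENNReal.ofReal_le_ofReal ?_
      have h1 := hf y
      rw [indicator_of_mem hy, Pi.one_apply] at h1
      have h2 : wt z L y ≤ 2 * wt p L y := by
        have := wt_le_of_abs_center_le (x := y) hL zero_le_one (by simpa using hzp)
        linarith
      have h3 : wt z L y ^ 3 ≤ 8 * wt p L y ^ 3 := by
        have := pow_le_pow_left₀ (wt_nonneg hL) h2 3
        rw [mul_pow] at this; linarith
      calc ‖f y‖ * ‖pk χ L z ν y‖ ≤ 1 * (C * (√L)⁻¹ * (8 * wt p L y ^ 3)) := by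
            gcongr
            exact (hb L hL z ν y).trans (by gcongr)
        _ = _ := by ring
    · have h1 := hf y
      rw [indicator_of_notMem hy] at h1
      have : f y = 0 := norm_le_zero_iff.1 h1
      rw [this]; simp
  have hfin : ∫⁻ y, ‖f y * pk χ L z ν y‖ₑ ≤ ENNReal.ofReal (C * 8 * 16 * lam * √L * (d / L)) := by
    refine (lintegral_mono hpt).trans ?_
    rw [lintegral_indicator hFm, lintegral_const_mul' _ _ ENNReal.ofReal_ne_top]
    refine (mul_le_mul' le_rfl hW).trans (le_of_eq ?_)
    rw [show (16 : ℝ≥0∞) = ENNReal.ofReal 16 by norm_num, ← ENNReal.ofReal_mul (by norm_num),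
      ← ENNReal.ofReal_mul (by positivity)]
    congr 1
    have hs : √L * √L = L := Real.mul_self_sqrt hL.le
    have hs0 : 0 < √L := Real.sqrt_pos.2 hL
    nth_rw 3 [← hs]
    field_simp
  have h5 := enorm_integral_le_lintegral_enorm (μ := volume) fun y => f y * pk χ L z ν y
  have h6 := h5.trans hfin
  rw [← ofReal_norm, ENNReal.ofReal_le_ofReal_iff (by positivity)] at h6
  exact h6

/-- The intervals deep inside an open set carry little mass, relative to their depth. -/
theorem sum_len_sq_div_infDist_le {lam : ℝ} (h : 0 < lam) {Ω : Set ℝ} (hΩm : MeasurableSet Ω)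
    (hne : (Ωᶜ).Nonempty) (P : Finset (ℤ × ℤ))
    (hP : ∀ a ∈ P, ∀ y, |y - len lam a.1 * a.2| ≤ 2 * len lam a.1 → y ∈ Ω) :
    ∑ a ∈ P, ENNReal.ofReal (len lam a.1 * (len lam a.1 /
      Metric.infDist (len lam a.1 * a.2) Ωᶜ)) ≤ 4 * volume Ω := by
  classical
  set d : ℤ × ℤ → ℝ := fun a => Metric.infDist (len lam a.1 * a.2) Ωᶜ with hd
  have hd2 : ∀ a ∈ P, 2 * len lam a.1 ≤ d a := by
    intro a ha
    refine (Metric.le_infDist hne).2 fun y hy => ?_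
    by_contra hlt
    push Not at hlt
    rw [dist_comm, Real.dist_eq] at hlt
    exact hy (hP a ha y hlt.le)
  have e1 : ∀ a ∈ P, ENNReal.ofReal (len lam a.1 * (len lam a.1 / d a)) =
      ∫⁻ y, {y | idx lam a.1 y = a.2}.indicator
        (fun _ => ENNReal.ofReal (len lam a.1 / d a)) y := by
    intro a _
    have := len_pos h a.1
    have hd0 : 0 ≤ d a := Metric.infDist_nonneg
    rw [lintegral_indicator_const (measurableSet_idx_eq lam _ _), volume_idx_eq h,
      ← ENNReal.ofReal_mul (by positivity), mul_comm]
  rw [Finset.sum_congr rfl e1, ← lintegral_finsetSum _ fun a _ =>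
    measurable_const.indicator (measurableSet_idx_eq lam _ _)]
  have hpt : ∀ y, ∑ a ∈ P, {y | idx lam a.1 y = a.2}.indicator
      (fun _ => ENNReal.ofReal (len lam a.1 / d a)) y ≤ Ω.indicator (fun _ => 4) y := by
    intro y
    set Q := P.filter fun a => idx lam a.1 y = a.2 with hQ
    have e2 : ∑ a ∈ P, {y | idx lam a.1 y = a.2}.indicator
        (fun _ => ENNReal.ofReal (len lam a.1 / d a)) y =
        ∑ a ∈ Q, ENNReal.ofReal (len lam a.1 / d a) := by
      rw [hQ, Finset.sum_filter]
      refine Finset.sum_congr rfl fun a _ => ?_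
      simp only [indicator_apply, mem_ofPred_eq]
    rw [e2]
    have hQ1 : ∀ a ∈ Q, a ∈ P ∧ |y - len lam a.1 * a.2| < len lam a.1 := by
      intro a ha
      obtain ⟨ha, hy⟩ := Finset.mem_filter.1 ha
      have h1 := (idx_eq_iff h _ _ _).1 hy
      refine ⟨ha, ?_⟩
      rw [abs_lt]
      have := len_pos h a.1
      constructor <;> linarith [h1.1, h1.2]
    rcases Q.eq_empty_or_nonempty with hQe | ⟨b, hb⟩
    · rw [hQe]; simp
    · have hy : y ∈ Ω := hP b (hQ1 b hb).1 y (by linarith [(hQ1 b hb).2, len_pos h b.1])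
      rw [indicator_of_mem hy]
      set D := Metric.infDist y Ωᶜ with hD
      have hcmp : ∀ a ∈ Q, len lam a.1 ≤ D ∧ D ≤ 2 * d a := by
        intro a ha
        obtain ⟨haP, hay⟩ := hQ1 a ha
        have h2 := hd2 a haP
        have h3 : d a ≤ D + dist (len lam a.1 * a.2) y := Metric.infDist_le_infDist_add_dist
        have h4 : D ≤ d a + dist y (len lam a.1 * a.2) := Metric.infDist_le_infDist_add_dist
        rw [dist_comm] at h3
        rw [Real.dist_eq] at h3 h4
        have := len_pos h a.1
        constructor <;> linarith
      have hD0 : 0 < D := (len_pos h b.1).trans_le (hcmp b hb).1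
      have h5 : ∀ a ∈ Q, ENNReal.ofReal (len lam a.1 / d a) ≤
          ENNReal.ofReal (2 / D * len lam a.1) := by
        intro a ha
        have h6 := hcmp a ha
        have := len_pos h a.1
        have hd0 : 0 < d a := by linarith
        refine ENNReal.ofReal_le_ofReal ?_
        rw [div_mul_eq_mul_div, div_le_div_iff₀ hd0 hD0]
        nlinarith [h6.2]
      refine (Finset.sum_le_sum h5).trans ?_
      rw [← ENNReal.ofReal_sum_of_nonneg fun a _ => by have := len_pos h a.1; positivity,
        ← Finset.mul_sum]
      have hinj : Set.InjOn (fun a : ℤ × ℤ => a.1) Q := by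
        intro a ha a' ha' (hh : a.1 = a'.1)
        have h7 := (Finset.mem_filter.1 ha).2
        have h8 := (Finset.mem_filter.1 ha').2
        exact Prod.ext hh (by rw [← h7, ← h8, hh])
      have e3 : ∑ a ∈ Q, len lam a.1 = ∑ k ∈ Q.image (fun a => a.1), len lam k :=
        (Finset.sum_image hinj).symm
      have hne' : (Q.image (fun a => a.1)).Nonempty := ⟨b.1, Finset.mem_image_of_mem _ hb⟩
      obtain ⟨a₀, ha₀, hmax⟩ := Finset.mem_image.1 (Finset.max'_mem _ hne')
      have h9 := sum_len_le h (Q.image (fun a => a.1)) a₀.1 (fun k hk => by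
        rw [hmax]; exact Finset.le_max' _ _ hk)
      rw [show (4 : ℝ≥0∞) = ENNReal.ofReal 4 by norm_num, e3]
      refine ENNReal.ofReal_le_ofReal ?_
      rw [div_mul_eq_mul_div, div_le_iff₀ hD0]
      have := (hcmp a₀ ha₀).1
      linarith
  refine (lintegral_mono hpt).trans ?_
  rw [lintegral_indicator_const hΩm]

theorem lintegral_exceptional_le (χ ζ : 𝓢(ℝ, ℂ)) :
    ∃ C : ℝ, 0 < C ∧ ∀ (lam t : ℝ) (_ : 0 < lam) (_ : 0 ≤ t) (_ : t < 1)
      (S : Finset Tile) (F : Set ℝ) (_ : MeasurableSet F)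
      (f : ℝ → ℂ) (_ : ∀ x, ‖f x‖ ≤ F.indicator 1 x)
      (Ω : Set ℝ) (_ : IsOpen Ω) (_ : (Ωᶜ).Nonempty) (B : ℝ) (_ : 0 ≤ B)
      (_ : ∀ y ∉ Ω, ∀ p r : ℝ, 0 < r → |y - p| ≤ r →
        volume (F ∩ {x | |x - p| ≤ r}) ≤ ENNReal.ofReal (B * r))
      (_ : ∀ s ∈ S, ∀ y, |y - s.pt lam| ≤ 2 * len lam s.k → y ∈ Ω)
      (N : ℝ → ℝ) (_ : Measurable N),
      ∫⁻ x in Ωᶜ, ‖∑ s ∈ S, modelTerm ζ lam t N (fun s => ∫ y, f y *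
        pk χ (len lam s.k) (s.ctr lam t) (-(s.l / len lam s.k)) y) s x‖ₑ ≤
        ENNReal.ofReal (C * B) * volume Ω := by
  classical
  obtain ⟨C₁, hC₁, h1⟩ := norm_integral_mul_pk_le χ
  obtain ⟨C₂, hC₂, h2⟩ := pk_decay ζ 4
  refine ⟨4 * (C₁ * C₂ * 16 * 4), by positivity,
    fun lam t h ht0 ht1 S F hFm f hf Ω hΩ hne B hB hF hS N hN => ?_⟩
  set a : Tile → ℂ := fun s => ∫ y, f y *
    pk χ (len lam s.k) (s.ctr lam t) (-(s.l / len lam s.k)) y with ha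
  set P : Finset (ℤ × ℤ) := S.image fun s => (s.k, s.n) with hP
  set d : ℤ × ℤ → ℝ := fun p => Metric.infDist (len lam p.1 * p.2) Ωᶜ with hd
  have hPΩ : ∀ p ∈ P, ∀ y, |y - len lam p.1 * p.2| ≤ 2 * len lam p.1 → y ∈ Ω := by
    intro p hp
    obtain ⟨s, hs, rfl⟩ := Finset.mem_image.1 hp
    exact hS s hs
  have hdp : ∀ p ∈ P, len lam p.1 ≤ d p := by
    intro a ha
    refine (Metric.le_infDist hne).2 fun y hy => ?_
    by_contra hlt
    push Not at hlt
    rw [dist_comm, Real.dist_eq] at hlt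
    exact hy (hPΩ a ha y (by linarith [len_pos h a.1]))
  have hctr : ∀ s : Tile, |s.ctr lam t - s.pt lam| ≤ len lam s.k := by
    intro s
    have := len_pos h s.k
    rw [Tile.ctr, Tile.pt, ← mul_sub, add_sub_cancel_left, abs_of_nonneg (by positivity)]
    nlinarith
  have hcoef : ∀ s ∈ S, ‖a s‖ ≤ C₁ * B * √(len lam s.k) * (d (s.k, s.n) / len lam s.k) := by
    intro s hs
    have hpP : (s.k, s.n) ∈ P := Finset.mem_image_of_mem _ hs
    obtain ⟨y, hy, hyd⟩ := hΩ.isClosed_compl.exists_infDist_eq_dist hne (s.pt lam)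
    refine h1 _ (len_pos h s.k) _ (s.pt lam) _ (hctr s) (hdp _ hpP) B hB F hFm (fun R hR => ?_)
      f hf _
    refine hF y hy _ _ (((len_pos h s.k).trans_le (hdp _ hpP)).trans_le hR) ?_
    rw [← Real.dist_eq, dist_comm, ← hyd]
    exact hR
  set G : ℤ × ℤ → ℝ → ℝ≥0∞ := fun p x => ENNReal.ofReal (C₁ * C₂ * 16 * B) *
    ENNReal.ofReal (len lam p.1 / d p) * ENNReal.ofReal (wt (len lam p.1 * p.2) (len lam p.1) x ^ 2)
    with hG
  have hGm : ∀ p, Measurable (G p) := fun p =>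
    (((continuous_wt (len_pos h p.1)).measurable.pow_const 2).ennreal_ofReal).const_mul _
  have hterm : ∀ s ∈ S, ∀ x ∈ Ωᶜ, ‖modelTerm ζ lam t N a s x‖ₑ ≤
      if fidx lam s.k (N x) = s.l then G (s.k, s.n) x else 0 := by
    intro s hs x hx
    have hL := len_pos h s.k
    have hpP : (s.k, s.n) ∈ P := Finset.mem_image_of_mem _ hs
    have hdL := hdp _ hpP
    have hd0 : 0 < d (s.k, s.n) := hL.trans_le hdL
    rw [modelTerm]
    split_ifs with hl
    · simp only [hG]
      rw [← ENNReal.ofReal_mul (by positivity), ← ENNReal.ofReal_mul (by positivity),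
        ← ofReal_norm, norm_mul]
      refine ENNReal.ofReal_le_ofReal ?_
      have hw : wt (s.ctr lam t) (len lam s.k) x ≤ 2 * wt (s.pt lam) (len lam s.k) x := by
        have := wt_le_of_abs_center_le (x := x) hL zero_le_one (by simpa using hctr s)
        linarith
      have hw4 := pow_le_pow_left₀ (wt_nonneg hL) hw 4
      have hwd : wt (s.pt lam) (len lam s.k) x ≤ len lam s.k / d (s.k, s.n) := by
        refine wt_le_div hL hd0 ?_
        rw [← Real.dist_eq, dist_comm]
        exact Metric.infDist_le_dist_of_mem hx
      have hwd2 := pow_le_pow_left₀ (wt_nonneg hL) hwd 2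
      set w := wt (s.pt lam) (len lam s.k) x with hw_def
      set r := len lam s.k / d (s.k, s.n) with hr
      have hr0 : 0 < r := by positivity
      have hsq : 0 < √(len lam s.k) := Real.sqrt_pos.2 hL
      have hdr : d (s.k, s.n) / len lam s.k = r⁻¹ := by rw [hr, inv_div]
      calc ‖a s‖ * ‖pk ζ (len lam s.k) (s.ctr lam t) (N x) x‖
          ≤ (C₁ * B * √(len lam s.k) * r⁻¹) * (C₂ * (√(len lam s.k))⁻¹ *
            (16 * (r ^ 2 * w ^ 2))) := by
            refine mul_le_mul (by rw [← hdr]; exact hcoef s hs) ((h2 _ hL _ _ _).trans ?_)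
              (norm_nonneg _) (by positivity)
            have : wt (s.ctr lam t) (len lam s.k) x ^ 4 ≤ 16 * (r ^ 2 * w ^ 2) := by
              nlinarith [sq_nonneg w]
            gcongr
        _ = C₁ * C₂ * 16 * B * r * w ^ 2 := by field_simp
        _ = _ := rfl
    · simp
  have hsum : ∀ x ∈ Ωᶜ, ‖∑ s ∈ S, modelTerm ζ lam t N a s x‖ₑ ≤ ∑ p ∈ P, G p x := by
    intro x hx
    refine (enorm_sum_le _ _).trans ((Finset.sum_le_sum fun s hs => hterm s hs x hx).trans ?_)
    rw [← Finset.sum_filter]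
    have hinj : Set.InjOn (fun s : Tile => (s.k, s.n))
        (S.filter fun s => fidx lam s.k (N x) = s.l) := by
      intro s hs s' hs' hh
      have h7 := (Finset.mem_filter.1 hs).2
      have h8 := (Finset.mem_filter.1 hs').2
      obtain ⟨k, n, l⟩ := s
      obtain ⟨k', n', l'⟩ := s'
      simp only [Prod.mk.injEq] at hh h7 h8
      obtain ⟨rfl, rfl⟩ := hh
      rw [← h7, ← h8]
    rw [← Finset.sum_image (f := fun p => G p x) hinj]
    exact Finset.sum_le_sum_of_subset (Finset.image_subset_image (Finset.filter_subset _ _))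
  calc _ ≤ ∫⁻ x in Ωᶜ, ∑ p ∈ P, G p x := setLIntegral_mono' hΩ.measurableSet.compl hsum
    _ ≤ ∫⁻ x, ∑ p ∈ P, G p x := setLIntegral_le_lintegral _ _
    _ = ∑ p ∈ P, ∫⁻ x, G p x := lintegral_finsetSum _ fun p _ => hGm p
    _ ≤ ∑ p ∈ P, ENNReal.ofReal (C₁ * C₂ * 16 * 4 * B) *
          ENNReal.ofReal (len lam p.1 * (len lam p.1 / d p)) := by
        refine Finset.sum_le_sum fun p hp => ?_
        have hL := len_pos h p.1
        have hd0 : 0 < d p := hL.trans_le (hdp p hp)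
        simp only [hG]
        rw [lintegral_const_mul' _ _ (by finiteness)]
        refine (mul_le_mul' le_rfl (lintegral_wt_pow_le hL le_rfl)).trans (le_of_eq ?_)
        rw [← ENNReal.ofReal_mul (by positivity), ← ENNReal.ofReal_mul (by positivity),
          ← ENNReal.ofReal_mul (by positivity)]
        congr 1; ring
    _ ≤ ENNReal.ofReal (C₁ * C₂ * 16 * 4 * B) * (4 * volume Ω) := by
        rw [← Finset.mul_sum]
        exact mul_le_mul' le_rfl (sum_len_sq_div_infDist_le h hΩ.measurableSet hne P hPΩ)
    _ = _ := by
        rw [← mul_assoc, show (4 : ℝ≥0∞) = ENNReal.ofReal 4 by norm_num,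
          ← ENNReal.ofReal_mul (by positivity)]
        congr 2; ring

/-- The restricted type estimate for the model operator, outside a minor part of `E`. -/
theorem exists_major_subset_model_le (χ χ' ζ : 𝓢(ℝ, ℂ)) (hχ : ∀ v, χ v ≠ 0 → -13 < v ∧ v < -1)
    (hχ' : ∀ v, χ' v = conj (χ (-v))) (hζ : ∀ v, ζ v ≠ 0 → 3 ≤ v ∧ v ≤ 12) {q : ℝ} (hq : 1 < q) :
    ∃ C : ℝ, 0 < C ∧ ∀ (F : Set ℝ) (_ : MeasurableSet F) (_ : volume F ≠ ⊤)
      (_ : 0 < volume.real F) (E : Set ℝ) (_ : MeasurableSet E) (_ : volume E ≠ ⊤)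
      (_ : 0 < volume.real E),
      ∃ E' ⊆ E, MeasurableSet E' ∧ volume.real E ≤ 2 * volume.real E' ∧
      ∀ (lam t : ℝ) (_ : 0 < lam) (_ : 0 ≤ t) (_ : t < 1)
      (S : Finset Tile) (_ : ∀ s ∈ S, 13 ≤ s.l % 16) (f : ℝ → ℂ) (_ : Integrable f)
      (_ : ∀ x, ‖f x‖ ≤ F.indicator 1 x) (N : ℝ → ℝ) (_ : Measurable N),
      ∫⁻ x in E', ‖∑ s ∈ S, modelTerm ζ lam t N (fun s => ∫ y, f y *
        pk χ (len lam s.k) (s.ctr lam t) (-(s.l / len lam s.k)) y) s x‖ₑ ≤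
        ENNReal.ofReal (C * volume.real E * (volume.real F / volume.real E) ^ (1 / q)) := by
  classical
  obtain ⟨C₁, hC₁, h1⟩ := lintegral_model_le_rpow χ χ' ζ hχ hχ' hζ hq
  obtain ⟨C₂, hC₂, h2⟩ := lintegral_exceptional_le χ ζ
  refine ⟨C₁ + 20 * C₂, by positivity, fun F hFm hFf hF0 E hEm hEf hE0 => ?_⟩
  set e := volume.real E with he
  set ρ := volume.real F / e with hρ
  have hρ0 : 0 < ρ := by positivity
  have hFe : volume.real F = ρ * e := by rw [hρ]; field_simp
  rcases le_total 1 ρ with hρ1 | hρ1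
  · refine ⟨E, subset_rfl, hEm, by linarith, fun lam t h ht0 ht1 S hS f hf hfF N hN => ?_⟩
    refine (h1 lam t h ht0 ht1 S hS F hFm hFf hF0 f hf hfF E hEm hEf hE0 N hN ?_).trans
      (ENNReal.ofReal_le_ofReal ?_)
    · intro s _ k _ j
      have hk := len_pos h k
      refine (measure_mono inter_subset_right).trans ?_
      have : {x | |x - s.pt lam| ≤ 2 ^ j * len lam k} =
          Metric.closedBall (s.pt lam) (2 ^ j * len lam k) := by
        ext x; rw [Metric.mem_closedBall, Real.dist_eq]; rfl
      rw [this, Real.volume_closedBall, ← hρ, min_eq_left hρ1]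
      refine ENNReal.ofReal_le_ofReal ?_
      have : (2 : ℝ) ^ j ≤ 4 ^ j := by gcongr; norm_num
      have h4 : (0 : ℝ) < 4 ^ j := by positivity
      nlinarith [mul_le_mul_of_nonneg_right this hk.le, mul_pos h4 hk]
    · gcongr
      linarith
  · set Ω := {y | ENNReal.ofReal (10 * ρ) < hlM (F.indicator 1) y} with hΩ
    have hΩo : IsOpen Ω := isOpen_lt_hlM _ _
    have hvol : volume Ω ≤ ENNReal.ofReal (e / 2) := by
      have h3 := mul_volume_lt_hlM_le (F.indicator 1) (ENNReal.ofReal (10 * ρ))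
      rw [lintegral_indicator_one hFm, ← ofReal_measureReal hFf, hFe,
        show (5 : ℝ≥0∞) = ENNReal.ofReal 5 by norm_num, ← ENNReal.ofReal_mul (by norm_num)] at h3
      rw [← ENNReal.mul_le_mul_iff_right (a := ENNReal.ofReal (10 * ρ)) (by simpa using hρ0)
        ENNReal.ofReal_ne_top]
      refine h3.trans (le_of_eq ?_)
      rw [← ENNReal.ofReal_mul (by positivity)]
      congr 1; ring
    have hΩf : volume Ω ≠ ⊤ := (hvol.trans_lt ENNReal.ofReal_lt_top).ne
    have hne : (Ωᶜ).Nonempty := by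
      rw [nonempty_compl]
      intro hu
      rw [hu, Real.volume_univ] at hΩf
      exact hΩf rfl
    have hball : ∀ y ∉ Ω, ∀ p r : ℝ, 0 < r → |y - p| ≤ r →
        volume (F ∩ {x | |x - p| ≤ r}) ≤ ENNReal.ofReal (40 * ρ * r) := by
      intro y hy p r hr hyp
      have h3 := lintegral_closedBall_le_hlM (F.indicator 1) hr hyp
      rw [lintegral_indicator_one hFm, Measure.restrict_apply hFm] at h3
      refine h3.trans ((mul_le_mul' (not_lt.1 hy) le_rfl).trans (le_of_eq ?_))
      rw [← ENNReal.ofReal_mul (by positivity)]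
      congr 1; ring
    refine ⟨E \ Ω, sdiff_subset, hEm.diff hΩo.measurableSet, ?_,
      fun lam t h ht0 ht1 S hS f hf hfF N hN => ?_⟩
    · have h3 : volume.real E ≤ volume.real (E \ Ω) + volume.real Ω := by
        have h4 := measureReal_mono (μ := volume) (show E ⊆ (E \ Ω) ∪ Ω by
          intro x hx; by_cases hxΩ : x ∈ Ω
          · exact Or.inr hxΩ
          · exact Or.inl ⟨hx, hxΩ⟩) (by
          refine (measure_union_lt_top ?_ hΩf.lt_top).ne
          exact (measure_mono sdiff_subset).trans_lt hEf.lt_top)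
        exact h4.trans (measureReal_union_le _ _)
      have h4 : volume.real Ω ≤ e / 2 := ENNReal.toReal_le_of_le_ofReal (by positivity) hvol
      linarith
    · set a : Tile → ℂ := fun s => ∫ y, f y *
        pk χ (len lam s.k) (s.ctr lam t) (-(s.l / len lam s.k)) y with ha
      set p : Tile → Prop := fun s => ∀ y, |y - s.pt lam| ≤ 2 * len lam s.k → y ∈ Ω with hp
      have hum : ∀ T : Finset Tile, Measurable fun x => ∑ s ∈ T, modelTerm ζ lam t N a s x :=
        fun T => Finset.measurable_sum _ fun s _ => measurable_modelTerm ζ lam t hN a s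
      have hA := h1 lam t h ht0 ht1 (S.filter fun s => ¬ p s)
        (fun s hs => hS s (Finset.mem_filter.1 hs).1) F hFm hFf hF0 f hf hfF E hEm hEf hE0 N hN (by
          intro s hs k hk j
          have hs' := (Finset.mem_filter.1 hs).2
          simp only [hp] at hs'
          push Not at hs'
          obtain ⟨y, hy, hyΩ⟩ := hs'
          have hlk := len_mono h hk
          have hL := len_pos h s.k
          have h2j : (1 : ℝ) ≤ 2 ^ j := one_le_pow₀ (by norm_num)
          have hr : 2 * len lam s.k ≤ 2 * (2 ^ j * len lam k) := by nlinarith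
          have h3 := hball y hyΩ (s.pt lam) (2 * (2 ^ j * len lam k)) (by linarith) (hy.trans hr)
          refine (measure_mono (inter_subset_inter subset_rfl fun x hx => ?_)).trans (h3.trans ?_)
          · have hx' : |x - s.pt lam| ≤ 2 ^ j * len lam k := hx
            change |x - s.pt lam| ≤ _
            linarith
          · refine ENNReal.ofReal_le_ofReal ?_
            rw [← hρ, min_eq_right hρ1]
            have : (2 : ℝ) ^ j ≤ 4 ^ j := by gcongr; norm_num
            have h4 : 0 ≤ 80 * ρ * len lam k := by nlinarith [mul_pos hρ0 (hL.trans_le hlk)]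
            nlinarith [mul_le_mul_of_nonneg_left this h4])
      have hB := h2 lam t h ht0 ht1 (S.filter p) F hFm f hfF Ω hΩo hne (40 * ρ) (by positivity)
        hball (fun s hs => (Finset.mem_filter.1 hs).2) N hN
      have hρq : ρ ≤ ρ ^ (1 / q) := by
        nth_rw 1 [← Real.rpow_one ρ]
        refine Real.rpow_le_rpow_of_exponent_ge hρ0 hρ1 ?_
        rw [div_le_one (by linarith)]; exact hq.le
      calc ∫⁻ x in E \ Ω, ‖∑ s ∈ S, modelTerm ζ lam t N a s x‖ₑ
          ≤ ∫⁻ x in E \ Ω, (‖∑ s ∈ S.filter p, modelTerm ζ lam t N a s x‖ₑ +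
            ‖∑ s ∈ S.filter (fun s => ¬ p s), modelTerm ζ lam t N a s x‖ₑ) := by
            refine lintegral_mono fun x => ?_
            rw [← Finset.sum_filter_add_sum_filter_not S p]
            exact enorm_add_le _ _
        _ = (∫⁻ x in E \ Ω, ‖∑ s ∈ S.filter p, modelTerm ζ lam t N a s x‖ₑ) +
            ∫⁻ x in E \ Ω, ‖∑ s ∈ S.filter (fun s => ¬ p s), modelTerm ζ lam t N a s x‖ₑ :=
            lintegral_add_left (hum _).enorm _
        _ ≤ ENNReal.ofReal (C₂ * (40 * ρ)) * ENNReal.ofReal (e / 2) +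
            ENNReal.ofReal (C₁ * e * ρ ^ (1 / q)) := by
            refine add_le_add ?_ ?_
            · exact (lintegral_mono_set fun x hx => hx.2).trans
                (hB.trans (mul_le_mul' le_rfl hvol))
            · exact (lintegral_mono_set sdiff_subset).trans hA
        _ ≤ _ := by
            rw [← ENNReal.ofReal_mul (by positivity), ← ENNReal.ofReal_add (by positivity)
              (by positivity)]
            refine ENNReal.ofReal_le_ofReal ?_
            nlinarith [mul_le_mul_of_nonneg_left hρq (by positivity : 0 ≤ 20 * C₂ * e)]

/-! ### The convolution operators as averages of model operators -/

/-- The frequency cutoff `ζ (L (N - ·))`, as a convolution operator. -/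
noncomputable def cutOp (ζ : 𝓢(ℝ, ℂ)) (L N : ℝ) (f : ℝ → ℂ) (x : ℝ) : ℂ :=
  ∫ y, f y * ((L⁻¹ : ℝ) * (ee (N * (x - y)) * 𝓕 (ζ : ℝ → ℂ) ((x - y) / L)))

/-- The product of a wave packet with the corresponding coefficient of `f`. -/
noncomputable def packetTerm (χ ζ : 𝓢(ℝ, ℂ)) (L N : ℝ) (l : ℤ) (f : ℝ → ℂ) (x z : ℝ) : ℂ :=
  (∫ y, f y * pk χ L z (-(l / L)) y) * pk ζ L z N x

theorem continuous_pk_centre (Ψ : 𝓢(ℝ, ℂ)) (L ν y : ℝ) : Continuous fun z => pk Ψ L z ν y := by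
  have h : Continuous fun z : ℝ => (z, y) := by fun_prop
  have h2 := (continuous_pk₃ Ψ L ν).comp h
  simpa only [Function.comp_def] using h2

theorem continuous_coeff (χ : 𝓢(ℝ, ℂ)) {L : ℝ} (hL : 0 < L) {f : ℝ → ℂ} (hf : Integrable f)
    (ν : ℝ) : Continuous fun z => ∫ y, f y * pk χ L z ν y := by
  obtain ⟨C, hC, hb⟩ := pk_bounded χ
  refine continuous_of_dominated (bound := fun y => ‖f y‖ * (C * (√L)⁻¹)) (fun z => ?_)
    (fun z => Filter.Eventually.of_forall fun y => ?_) (hf.norm.mul_const _)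
    (Filter.Eventually.of_forall fun y => ?_)
  · exact hf.aestronglyMeasurable.mul (continuous_pk χ L z ν).aestronglyMeasurable
  · rw [norm_mul]
    exact mul_le_mul_of_nonneg_left (hb L hL z ν y) (norm_nonneg _)
  · exact (continuous_pk_centre χ L ν y).const_mul (f y)

theorem norm_coeff_le (χ : 𝓢(ℝ, ℂ)) {f : ℝ → ℂ} (hf : Integrable f) :
    ∃ C : ℝ, 0 ≤ C ∧ ∀ L > 0, ∀ z ν : ℝ, ‖∫ y, f y * pk χ L z ν y‖ ≤ C * (√L)⁻¹ := by
  obtain ⟨C, hC, hb⟩ := pk_bounded χ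
  refine ⟨(∫ y, ‖f y‖) * C, mul_nonneg (integral_nonneg fun _ => norm_nonneg _) hC.le,
    fun L hL z ν => ?_⟩
  rw [mul_assoc, ← integral_mul_const]
  refine (norm_integral_le_integral_norm _).trans (integral_mono_of_nonneg
    (Filter.Eventually.of_forall fun _ => norm_nonneg _) (hf.norm.mul_const _)
    (Filter.Eventually.of_forall fun y => ?_))
  simp only [norm_mul]
  exact mul_le_mul_of_nonneg_left (hb L hL z ν y) (norm_nonneg _)

theorem integrable_packetTerm (χ ζ : 𝓢(ℝ, ℂ)) {L : ℝ} (hL : 0 < L) (N : ℝ) (l : ℤ) {f : ℝ → ℂ}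
    (hf : Integrable f) (x : ℝ) : Integrable (packetTerm χ ζ L N l f x) := by
  obtain ⟨C, hC, hb⟩ := pk_decay ζ 2
  obtain ⟨C', hC', hb'⟩ := norm_coeff_le χ hf
  refine ((integrable_wt_pow (c := x) hL le_rfl).const_mul (C' * (√L)⁻¹ * (C * (√L)⁻¹))).mono'
    ?_ (Filter.Eventually.of_forall fun z => ?_)
  · exact ((continuous_coeff χ hL hf (-(l / L))).mul
      (continuous_pk_centre ζ L N x)).aestronglyMeasurable
  · rw [packetTerm, norm_mul, mul_assoc, wt_comm]
    exact mul_le_mul (hb' L hL z _) (hb L hL z N x) (norm_nonneg _) (by positivity)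

theorem integral_packetTerm (χ ζ : 𝓢(ℝ, ℂ)) (hχ : ∀ v, -12 ≤ v → v ≤ -2 → χ v = 1)
    (hζ : ∀ v, ζ v ≠ 0 → 3 ≤ v ∧ v ≤ 12) {L : ℝ} (hL : 0 < L) (N : ℝ) {f : ℝ → ℂ}
    (hf : Integrable f) (x : ℝ) :
    ∫ z, packetTerm χ ζ L N ⌊N * L⌋ f x z = L * cutOp ζ L N f x := by
  obtain ⟨C, hC, hb⟩ := pk_decay ζ 2
  obtain ⟨C', hC', hb'⟩ := pk_bounded χ
  set μ : ℝ := ⌊N * L⌋ / L with hμ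
  have hgInt : Integrable (Function.uncurry fun z y => f y * pk χ L z (-μ) y * pk ζ L z N x)
      (volume.prod volume) := by
    have hw := ((integrable_wt_pow (c := x) hL le_rfl).const_mul (C * (√L)⁻¹))
    refine Integrable.mono' ((hw.mul_prod hf.norm).const_mul (C' * (√L)⁻¹)) ?_
      (Filter.Eventually.of_forall fun p => ?_)
    · refine ((hf.aestronglyMeasurable.comp_snd).mul ?_).mul ?_
      · exact (continuous_pk₃ χ L (-μ)).aestronglyMeasurable
      · have h := (continuous_pk_centre ζ L N x).comp (continuous_fst (X := ℝ) (Y := ℝ))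
        exact h.aestronglyMeasurable
    · obtain ⟨z, y⟩ := p
      simp only [Function.uncurry, norm_mul]
      have h1 := hb' L hL z (-μ) y
      have h2 := hb L hL z N x
      rw [wt_comm] at h2
      calc ‖f y‖ * ‖pk χ L z (-μ) y‖ * ‖pk ζ L z N x‖
          ≤ ‖f y‖ * (C' * (√L)⁻¹) * (C * (√L)⁻¹ * wt x L z ^ 2) := by gcongr
        _ = _ := by ring
  have e1 : ∀ z, packetTerm χ ζ L N ⌊N * L⌋ f x z =
      ∫ y, f y * pk χ L z (-μ) y * pk ζ L z N x := fun z => by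
    rw [packetTerm, integral_mul_const]
  simp_rw [e1]
  rw [integral_integral_swap hgInt, cutOp, ← integral_const_mul]
  refine integral_congr_ae (Filter.Eventually.of_forall fun y => ?_)
  have h3 := integral_pk_mul_pk χ ζ hL N μ x y (fun v hv => by
    obtain ⟨h4, h5⟩ := hζ v hv
    have h6 := Int.floor_le (N * L)
    have h7 := Int.lt_floor_add_one (N * L)
    have h8 : L * μ = ⌊N * L⌋ := by rw [hμ]; field_simp
    refine hχ _ ?_ ?_ <;> rw [h8] <;> linarith)
  have e2 : ∀ z, f y * pk χ L z (-μ) y * pk ζ L z N x =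
      f y * (pk ζ L z N x * pk χ L z (-μ) y) := fun z => by ring
  have hL' : (L : ℂ) ≠ 0 := by exact_mod_cast hL.ne'
  simp only [e2]
  rw [integral_const_mul, h3]
  push_cast
  field_simp

theorem tendsto_sum_packetTerm (χ ζ : 𝓢(ℝ, ℂ)) (hχ : ∀ v, -12 ≤ v → v ≤ -2 → χ v = 1)
    (hζ : ∀ v, ζ v ≠ 0 → 3 ≤ v ∧ v ≤ 12) {L : ℝ} (hL : 0 < L) (N : ℝ) {f : ℝ → ℂ}
    (hf : Integrable f) (x : ℝ) :
    Filter.Tendsto (fun m : ℕ => ∑ i ∈ Finset.range (2 * m), ∫ t in (0 : ℝ)..1,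
      packetTerm χ ζ L N ⌊N * L⌋ f x (L * (((i - m : ℤ) : ℝ) + t))) Filter.atTop
      (nhds (cutOp ζ L N f x)) := by
  set Φ := packetTerm χ ζ L N ⌊N * L⌋ f x with hΦ
  have hi : Integrable fun u => Φ (L * u) :=
    (integrable_packetTerm χ ζ hL N _ hf x).comp_mul_left' hL.ne'
  have e1 : ∫ u, Φ (L * u) = cutOp ζ L N f x := by
    rw [Measure.integral_comp_mul_left, integral_packetTerm χ ζ hχ hζ hL N hf x,
      abs_of_pos (by positivity)]
    have hL' : (L : ℂ) ≠ 0 := by exact_mod_cast hL.ne'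
    rw [Complex.real_smul]
    push_cast
    field_simp
  rw [← e1]
  have h2 := intervalIntegral_tendsto_integral hi (a := fun m : ℕ => -(m : ℝ))
    (b := fun m : ℕ => (m : ℝ)) (l := Filter.atTop)
    (Filter.tendsto_neg_atTop_atBot.comp tendsto_natCast_atTop_atTop) tendsto_natCast_atTop_atTop
  refine h2.congr fun m => ?_
  have h3 := intervalIntegral.sum_integral_adjacent_intervals (f := fun u => Φ (L * u))
    (μ := volume) (a := fun i : ℕ => (i : ℝ) - m) (n := 2 * m)
    (fun k _ => hi.intervalIntegrable)
  have e2 : ((2 * m : ℕ) : ℝ) - m = m := by push_cast; ring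
  rw [e2, Nat.cast_zero, zero_sub] at h3
  rw [← h3]
  refine Finset.sum_congr rfl fun i _ => ?_
  have h4 := intervalIntegral.integral_comp_add_left (a := 0) (b := 1) (fun u => Φ (L * u))
    ((i : ℝ) - m)
  rw [add_zero] at h4
  push_cast
  rw [h4]
  congr 1
  ring

theorem continuous_pk_joint (Ψ : 𝓢(ℝ, ℂ)) (L : ℝ) :
    Continuous fun p : ℝ × ℝ × ℝ => pk Ψ L p.1 p.2.1 p.2.2 := by
  have := continuous_fourier_schwartz Ψ
  unfold pk
  fun_prop

theorem measurable_modelTerm_prod (χ ζ : 𝓢(ℝ, ℂ)) {lam : ℝ} (h : 0 < lam) {N : ℝ → ℝ}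
    (hN : Measurable N) {f : ℝ → ℂ} (hf : Integrable f) (s : Tile) :
    Measurable fun p : ℝ × ℝ => modelTerm ζ lam p.1 N (fun s => ∫ y, f y *
      pk χ (len lam s.k) (s.ctr lam p.1) (-(s.l / len lam s.k)) y) s p.2 := by
  unfold modelTerm
  have hctr : Measurable fun p : ℝ × ℝ => s.ctr lam p.1 := by unfold Tile.ctr; fun_prop
  refine Measurable.ite (measurableSet_eq_fun
    ((measurable_fidx lam s.k).comp (hN.comp measurable_snd)) measurable_const) ?_ measurable_const
  refine Measurable.mul ?_ ?_
  · have h1 := (continuous_coeff χ (len_pos h s.k) hf (-(s.l / len lam s.k))).measurable.comp hctr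
    simpa only [Function.comp_def] using h1
  · have h1 := (continuous_pk_joint ζ (len lam s.k)).measurable.comp
      (hctr.prodMk ((hN.comp measurable_snd).prodMk measurable_snd))
    simpa only [Function.comp_def] using h1

theorem continuous_packetTerm (χ ζ : 𝓢(ℝ, ℂ)) {L : ℝ} (hL : 0 < L) (N : ℝ) (l : ℤ) {f : ℝ → ℂ}
    (hf : Integrable f) (x : ℝ) : Continuous (packetTerm χ ζ L N l f x) :=
  (continuous_coeff χ hL hf (-(l / L))).mul (continuous_pk_centre ζ L N x)

theorem exists_sum_modelTerm_eq (χ ζ : 𝓢(ℝ, ℂ)) (lam : ℝ) (A : Finset ℤ) (D : Finset ℝ)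
    (f : ℝ → ℂ) (m : ℕ) :
    ∃ S : Finset Tile, (∀ s ∈ S, 13 ≤ s.l % 16) ∧ ∀ (N : ℝ → ℝ) (_ : ∀ x, N x ∈ D) (t x : ℝ),
      ∑ s ∈ S, modelTerm ζ lam t N (fun s => ∫ y, f y *
        pk χ (len lam s.k) (s.ctr lam t) (-(s.l / len lam s.k)) y) s x =
      ∑ k ∈ A, if 13 ≤ fidx lam k (N x) % 16 then ∑ i ∈ Finset.range (2 * m),
        packetTerm χ ζ (len lam k) (N x) (fidx lam k (N x)) f x
          (len lam k * (((i - m : ℤ) : ℝ) + t)) else 0 := by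
  classical
  set Q : Finset ℤ := (A ×ˢ D).image fun p => fidx lam p.1 p.2 with hQ
  set U : Finset (ℤ × ℕ × ℤ) :=
    (A ×ˢ Finset.range (2 * m) ×ˢ Q).filter fun p => 13 ≤ p.2.2 % 16 with hU
  set T : ℤ × ℕ × ℤ → Tile := fun p => ⟨p.1, p.2.1 - m, p.2.2⟩ with hT
  have hTi : Function.Injective T := by
    rintro ⟨k, i, l⟩ ⟨k', i', l'⟩ hh
    simp only [hT, Tile.mk.injEq] at hh
    obtain ⟨rfl, h2, rfl⟩ := hh
    have : i = i' := by omega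
    rw [this]
  refine ⟨U.image T, fun s hs => ?_, fun N hN t x => ?_⟩
  · obtain ⟨p, hp, rfl⟩ := Finset.mem_image.1 hs
    exact (Finset.mem_filter.1 hp).2
  · rw [Finset.sum_image hTi.injOn, hU, Finset.sum_filter, Finset.sum_product]
    refine Finset.sum_congr rfl fun k hk => ?_
    rw [Finset.sum_product]
    have hmem : fidx lam k (N x) ∈ Q :=
      Finset.mem_image.2 ⟨(k, N x), Finset.mem_product.2 ⟨hk, hN x⟩, rfl⟩
    have e1 : ∀ i ∈ Finset.range (2 * m), (∑ l ∈ Q, if 13 ≤ l % 16 then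
        modelTerm ζ lam t N (fun s => ∫ y, f y *
          pk χ (len lam s.k) (s.ctr lam t) (-(s.l / len lam s.k)) y) (T (k, i, l)) x else 0) =
        if 13 ≤ fidx lam k (N x) % 16 then packetTerm χ ζ (len lam k) (N x) (fidx lam k (N x)) f x
          (len lam k * (((i - m : ℤ) : ℝ) + t)) else 0 := by
      intro i _
      rw [Finset.sum_eq_single (fidx lam k (N x))]
      · simp only [modelTerm, hT, if_true, packetTerm, Tile.ctr]
      · intro l _ hl
        simp only [modelTerm, hT, if_neg hl.symm, ite_self]
      · exact fun h => absurd hmem h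
    rw [Finset.sum_congr rfl e1]
    split_ifs <;> simp

/-- A uniform bound for the model operators passes to the convolution operators. -/
theorem lintegral_good_cutOp_le (χ ζ : 𝓢(ℝ, ℂ)) (hχ : ∀ v, -12 ≤ v → v ≤ -2 → χ v = 1)
    (hζ : ∀ v, ζ v ≠ 0 → 3 ≤ v ∧ v ≤ 12) {lam : ℝ} (h : 0 < lam) {f : ℝ → ℂ} (hf : Integrable f)
    {N : ℝ → ℝ} (hN : Measurable N) (D : Finset ℝ) (hD : ∀ x, N x ∈ D) (E : Set ℝ) (B : ℝ≥0∞)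
    (hB : ∀ t : ℝ, 0 ≤ t → t < 1 → ∀ S : Finset Tile, (∀ s ∈ S, 13 ≤ s.l % 16) →
      ∫⁻ x in E, ‖∑ s ∈ S, modelTerm ζ lam t N (fun s => ∫ y, f y *
        pk χ (len lam s.k) (s.ctr lam t) (-(s.l / len lam s.k)) y) s x‖ₑ ≤ B) (A : Finset ℤ) :
    ∫⁻ x in E, ‖∑ k ∈ A, if 13 ≤ fidx lam k (N x) % 16 then
      cutOp ζ (len lam k) (N x) f x else 0‖ₑ ≤ B := by
  choose S hS hSe using exists_sum_modelTerm_eq χ ζ lam A D f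
  set V : ℕ → ℝ → ℝ → ℂ := fun m t x => ∑ s ∈ S m, modelTerm ζ lam t N (fun s => ∫ y, f y *
        pk χ (len lam s.k) (s.ctr lam t) (-(s.l / len lam s.k)) y) s x with hV
  have hVm : ∀ m, Measurable fun p : ℝ × ℝ => V m p.1 p.2 := fun m =>
    Finset.measurable_sum _ fun s _ => measurable_modelTerm_prod χ ζ h hN hf s
  have hlim : ∀ x, Filter.Tendsto (fun m => ∫ t in (0 : ℝ)..1, V m t x) Filter.atTop
      (nhds (∑ k ∈ A, if 13 ≤ fidx lam k (N x) % 16 then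
        cutOp ζ (len lam k) (N x) f x else 0)) := by
    intro x
    have e1 : ∀ m, ∫ t in (0 : ℝ)..1, V m t x = ∑ k ∈ A, if 13 ≤ fidx lam k (N x) % 16 then
        ∑ i ∈ Finset.range (2 * m), ∫ t in (0 : ℝ)..1,
          packetTerm χ ζ (len lam k) (N x) (fidx lam k (N x)) f x
          (len lam k * (((i - m : ℤ) : ℝ) + t)) else 0 := by
      intro m
      simp only [hV, hSe m N hD]
      have hc : ∀ (k : ℤ) (i : ℕ), Continuous fun t : ℝ =>
          packetTerm χ ζ (len lam k) (N x) (fidx lam k (N x)) f x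
          (len lam k * (((i - m : ℤ) : ℝ) + t)) := fun k i =>
        (continuous_packetTerm χ ζ (len_pos h k) (N x) _ hf x).comp (by fun_prop)
      rw [intervalIntegral.integral_finsetSum]
      · refine Finset.sum_congr rfl fun k _ => ?_
        split_ifs
        · rw [intervalIntegral.integral_finsetSum]
          exact fun i _ => (hc k i).intervalIntegrable _ _
        · simp
      · intro k _
        split_ifs
        · exact (continuous_finsetSum _ fun i _ => hc k i).intervalIntegrable _ _
        · exact intervalIntegrable_const
    simp_rw [e1]
    refine tendsto_finsetSum _ fun k _ => ?_
    split_ifs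
    · exact tendsto_sum_packetTerm χ ζ hχ hζ (len_pos h k) (N x) hf x
    · exact tendsto_const_nhds
  have hpt : ∀ x, ‖∑ k ∈ A, if 13 ≤ fidx lam k (N x) % 16 then
      cutOp ζ (len lam k) (N x) f x else 0‖ₑ ≤
      Filter.liminf (fun m => ∫⁻ t in Ioc (0 : ℝ) 1, ‖V m t x‖ₑ) Filter.atTop := by
    intro x
    rw [← ((continuous_enorm.tendsto _).comp (hlim x)).liminf_eq]
    refine Filter.liminf_le_liminf (Filter.Eventually.of_forall fun m => ?_)
    simp only [Function.comp]
    rw [intervalIntegral.integral_of_le zero_le_one]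
    exact enorm_integral_le_lintegral_enorm _
  refine (lintegral_mono hpt).trans ((lintegral_liminf_le fun m => ?_).trans ?_)
  · exact (hVm m).enorm.lintegral_prod_left'
  · refine Filter.liminf_le_of_le (by isBoundedDefault) fun b hb => ?_
    obtain ⟨m, hm⟩ := hb.exists
    refine hm.trans ?_
    rw [lintegral_lintegral_swap]
    · rw [← setLIntegral_congr Ioo_ae_eq_Ioc]
      calc _ ≤ ∫⁻ t in Ioo (0 : ℝ) 1, B := setLIntegral_mono' measurableSet_Ioo fun t ht =>
            hB t ht.1.le ht.2 (S m) (hS m)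
        _ = B := by simp
    · exact ((hVm m).comp measurable_swap).enorm.aemeasurable

/-! ### Averaging over frequency shifts -/

theorem sum_range_mul_block (F : ℕ → ℕ) (m n : ℕ) :
    ∑ i ∈ Finset.range (m * n), F i =
      ∑ v ∈ Finset.range m, ∑ w ∈ Finset.range n, F (m * w + v) := by
  induction n with
  | zero => simp
  | succ n ih =>
    rw [mul_add, mul_one, Finset.sum_range_add, ih, ← Finset.sum_add_distrib]
    refine Finset.sum_congr rfl fun v _ => ?_
    rw [Finset.sum_range_succ]

theorem sum_good_block (c : ℤ) :
    ∑ v ∈ Finset.range 16, (if 13 ≤ (c + v) % 16 then 1 else 0) = 3 := by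
  have h0 : 0 ≤ c % 16 := by omega
  have h1 : c % 16 < 16 := by omega
  have h : ∀ v : ℕ, (c + v) % 16 = (c % 16 + v) % 16 := fun v => by omega
  simp_rw [h]
  generalize c % 16 = d at *
  interval_cases d <;> decide

theorem sum_good_shift (r M : ℕ) (hr : r < M) (c : ℤ) :
    ∑ i ∈ Finset.range (16 ^ M), (if 13 ≤ ((c + i) / 16 ^ r) % 16 then 1 else 0) =
      3 * 16 ^ (M - 1) := by
  obtain ⟨m, rfl⟩ : ∃ m, M = m + 1 := ⟨M - 1, by omega⟩
  rw [pow_succ', sum_range_mul_block, Nat.add_sub_cancel]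
  induction r generalizing m c with
  | zero =>
    rw [Finset.sum_comm]
    have : ∀ w ∈ Finset.range (16 ^ m), ∑ v ∈ Finset.range 16,
        (if 13 ≤ ((c + ((16 * w + v : ℕ) : ℤ)) / 16 ^ 0) % 16 then 1 else 0) = 3 := by
      intro w _
      rw [← sum_good_block (c + 16 * w)]
      refine Finset.sum_congr rfl fun v _ => ?_
      simp only [pow_zero, Int.ediv_one]; push_cast; rw [add_assoc]
    rw [Finset.sum_congr rfl this]; simp [mul_comm]
  | succ r ih =>
    obtain ⟨m', rfl⟩ : ∃ m', m = m' + 1 := ⟨m - 1, by omega⟩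
    have : ∀ v ∈ Finset.range 16, ∑ w ∈ Finset.range (16 ^ (m' + 1)),
        (if 13 ≤ ((c + ((16 * w + v : ℕ) : ℤ)) / 16 ^ (r + 1)) % 16 then 1 else 0)
        = 3 * 16 ^ m' := by
      intro v _
      rw [← ih ((c + (v : ℤ)) / 16) m' (by omega), ← sum_range_mul_block
        (fun i : ℕ => if 13 ≤ (((c + v) / 16 + (i : ℤ)) / 16 ^ r) % 16 then 1 else 0), ← pow_succ']
      refine Finset.sum_congr rfl fun w _ => ?_
      have e : (c + ((16 * w + v : ℕ) : ℤ)) / 16 ^ (r + 1) = ((c + v) / 16 + (w : ℤ)) / 16 ^ r := by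
        rw [pow_succ', ← Int.ediv_ediv_of_nonneg (by norm_num)]
        congr 1; push_cast; omega
      rw [e]
    rw [Finset.sum_congr rfl this]; simp [pow_succ]; ring

theorem cutOp_modulate (ζ : 𝓢(ℝ, ℂ)) (L N θ : ℝ) (f : ℝ → ℂ) (x : ℝ) :
    cutOp ζ L N f x = ee (-(θ * x)) * cutOp ζ L (N + θ) (fun y => ee (θ * y) * f y) x := by
  rw [cutOp, cutOp, ← integral_const_mul]
  congr 1; ext y
  have : ee (N * (x - y)) = ee (-(θ * x)) * ee (θ * y) * ee ((N + θ) * (x - y)) := by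
    rw [← ee_add, ← ee_add]; congr 1; ring
  rw [this]; ring

theorem continuous_cutOp (ζ : 𝓢(ℝ, ℂ)) (L : ℝ) {f : ℝ → ℂ} (hf : Integrable f) :
    Continuous fun p : ℝ × ℝ => cutOp ζ L p.1 f p.2 := by
  obtain ⟨C, hC, hb⟩ := fourier_decay ζ 0
  have hc := continuous_fourier_schwartz ζ
  have key : ∀ p : ℝ × ℝ, ∀ y, ‖f y * (((L⁻¹ : ℝ) : ℂ) * (ee (p.1 * (p.2 - y)) *
      𝓕 (ζ : ℝ → ℂ) ((p.2 - y) / L)))‖ ≤ ‖f y‖ * (|L⁻¹| * C) := by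
    intro p y
    rw [norm_mul, norm_mul, norm_mul, norm_ee, one_mul, Complex.norm_real, Real.norm_eq_abs]
    have : ‖𝓕 (ζ : ℝ → ℂ) ((p.2 - y) / L)‖ ≤ C := by
      simpa using hb 1 one_pos 0 ((p.2 - y) / L)
    gcongr
  refine continuous_of_dominated (bound := fun y => ‖f y‖ * (|L⁻¹| * C)) (fun p => ?_)
    (fun p => Filter.Eventually.of_forall (key p)) (hf.norm.mul_const _)
    (Filter.Eventually.of_forall fun y => ?_)
  · refine hf.aestronglyMeasurable.mul (Continuous.aestronglyMeasurable ?_)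
    have h2 := hc.comp (f := fun y : ℝ => (p.2 - y) / L) (by fun_prop)
    simp only [Function.comp_def] at h2
    fun_prop
  · have h2 := hc.comp (f := fun p : ℝ × ℝ => (p.2 - y) / L) (by fun_prop)
    simp only [Function.comp_def] at h2
    fun_prop

/-- The bounds for the model operators control the full sum of cutoff operators. -/
theorem lintegral_cutOp_le (χ ζ : 𝓢(ℝ, ℂ)) (hχ : ∀ v, -12 ≤ v → v ≤ -2 → χ v = 1)
    (hζ : ∀ v, ζ v ≠ 0 → 3 ≤ v ∧ v ≤ 12) {lam : ℝ} (h : 0 < lam) {f : ℝ → ℂ} (hf : Integrable f)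
    {N : ℝ → ℝ} (hN : Measurable N) (D : Finset ℝ) (hD : ∀ x, N x ∈ D) (E : Set ℝ) (B : ℝ≥0∞)
    (hB : ∀ f' : ℝ → ℂ, Integrable f' → (∀ y, ‖f' y‖ = ‖f y‖) → ∀ N' : ℝ → ℝ, Measurable N' →
      ∀ t : ℝ, 0 ≤ t → t < 1 → ∀ S : Finset Tile, (∀ s ∈ S, 13 ≤ s.l % 16) →
      ∫⁻ x in E, ‖∑ s ∈ S, modelTerm ζ lam t N' (fun s => ∫ y, f' y *
        pk χ (len lam s.k) (s.ctr lam t) (-(s.l / len lam s.k)) y) s x‖ₑ ≤ B) (K : ℕ) :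
    ∫⁻ x in E, ‖∑ k ∈ Finset.Icc (-K : ℤ) K, cutOp ζ (len lam k) (N x) f x‖ₑ ≤ 6 * B := by
  classical
  set M := 2 * K + 1 with hM
  set θ : ℕ → ℝ := fun i => i / len lam K with hθ
  set G : ℕ → ℝ → ℂ := fun i x => ∑ k ∈ Finset.Icc (-K : ℤ) K,
    if 13 ≤ fidx lam k (N x + θ i) % 16 then
      cutOp ζ (len lam k) (N x + θ i) (fun y => ee (θ i * y) * f y) x else 0 with hG
  have hfi : ∀ i, Integrable fun y => ee (θ i * y) * f y := fun i =>
    hf.bdd_mul (c := 1) (by fun_prop)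
      (Filter.Eventually.of_forall fun y => by rw [norm_ee])
  have hGB : ∀ i, ∫⁻ x in E, ‖G i x‖ₑ ≤ B := by
    intro i
    refine lintegral_good_cutOp_le χ ζ hχ hζ h (hfi i) (hN.add_const (θ i))
      (D.image (· + θ i)) (fun x => Finset.mem_image_of_mem _ (hD x)) E B
      (fun t ht0 ht1 S hS => hB _ (hfi i) (fun y => by simp) _ (hN.add_const (θ i)) t ht0 ht1 S hS)
      _
  have hGm : ∀ i, Measurable fun x => ‖G i x‖ₑ := by
    intro i
    refine (Finset.measurable_sum _ fun k _ => Measurable.ite ?_ ?_ measurable_const).enorm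
    · exact (measurable_fidx lam k).comp (hN.add_const (θ i)) (MeasurableSet.of_discrete
          (s := {z : ℤ | 13 ≤ z % 16}))
    · have h2 := (continuous_cutOp ζ (len lam k) (hfi i)).measurable.comp
        ((hN.add_const (θ i)).prodMk measurable_id)
      simpa only [Function.comp_def, id] using h2
  have hcount : ∀ x, ∀ k ∈ Finset.Icc (-K : ℤ) K, ∑ i ∈ Finset.range (16 ^ M),
      (if 13 ≤ fidx lam k (N x + θ i) % 16 then (1 : ℂ) else 0) = 3 * 16 ^ (2 * K) := by
    intro x k hk
    rw [Finset.mem_Icc] at hk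
    obtain ⟨r, hr⟩ : ∃ r : ℕ, k = K - r := ⟨(K - k).toNat, by omega⟩
    have e := sum_good_shift r M (by omega) (fidx lam K (N x))
    have e2 : ∀ i : ℕ, fidx lam k (N x + θ i) = (fidx lam K (N x) + i) / 16 ^ r := by
      intro i
      rw [hr, fidx_sub_nat]
      congr 1
      have hl := len_pos h (K : ℤ)
      rw [fidx, fidx, ← Int.floor_add_natCast]
      congr 1; rw [hθ]; field_simp
    simp_rw [e2]
    have e3 := congrArg (Nat.cast (R := ℂ)) e
    push_cast at e3
    rw [e3]; simp [hM]
  have hsum : ∀ x, ∑ i ∈ Finset.range (16 ^ M), ee (-(θ i * x)) * G i x =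
      3 * 16 ^ (2 * K) * ∑ k ∈ Finset.Icc (-K : ℤ) K, cutOp ζ (len lam k) (N x) f x := by
    intro x
    simp only [hG, Finset.mul_sum]
    rw [Finset.sum_comm]
    refine Finset.sum_congr rfl fun k hk => ?_
    rw [← hcount x k hk, Finset.sum_mul]
    refine Finset.sum_congr rfl fun i _ => ?_
    split_ifs
    · rw [one_mul, ← cutOp_modulate]
    · simp
  have hpt : ∀ x, (3 * 16 ^ (2 * K) : ℝ≥0∞) *
      ‖∑ k ∈ Finset.Icc (-K : ℤ) K, cutOp ζ (len lam k) (N x) f x‖ₑ ≤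
      ∑ i ∈ Finset.range (16 ^ M), ‖G i x‖ₑ := by
    intro x
    have : (3 * 16 ^ (2 * K) : ℝ≥0∞) = ‖(3 * 16 ^ (2 * K) : ℂ)‖ₑ := by
      rw [← ofReal_norm]; simp [ENNReal.ofReal_mul]
    rw [this, ← enorm_mul, ← hsum]
    refine (enorm_sum_le _ _).trans (Finset.sum_le_sum fun i _ => ?_)
    rw [enorm_mul, ← ofReal_norm, norm_ee]; simp
  have hfin : (3 * 16 ^ (2 * K) : ℝ≥0∞) * ∫⁻ x in E,
      ‖∑ k ∈ Finset.Icc (-K : ℤ) K, cutOp ζ (len lam k) (N x) f x‖ₑ ≤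
      (3 * 16 ^ (2 * K) : ℝ≥0∞) * (6 * B) := by
    rw [← lintegral_const_mul']
    · refine (lintegral_mono hpt).trans ?_
      rw [lintegral_finsetSum _ fun i _ => hGm i]
      refine (Finset.sum_le_sum fun i _ => hGB i).trans ?_
      simp only [Finset.sum_const, Finset.card_range, nsmul_eq_mul, hM, pow_succ]
      push_cast
      rw [← mul_assoc]
      refine mul_le_mul' ?_ le_rfl
      rw [mul_comm (3 : ℝ≥0∞), mul_assoc]
      exact mul_le_mul' le_rfl (by norm_num)
    · finiteness
  exact (ENNReal.mul_le_mul_iff_right (by positivity) (by finiteness)).1 hfin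

/-! ### Cutoffs and truncated frequency projections -/

theorem exists_schwartz_eq (g : ℝ → ℝ) (hg : ContDiff ℝ ∞ g) {a b : ℝ}
    (h : ∀ x, g x ≠ 0 → a ≤ x ∧ x ≤ b) : ∃ φ : 𝓢(ℝ, ℂ), ∀ x, φ x = g x := by
  have h1 : HasCompactSupport fun x => ((g x : ℝ) : ℂ) := by
    refine HasCompactSupport.of_support_subset_isCompact (isCompact_Icc (a := a) (b := b)) fun x hx => ?_
    exact h x fun h0 => hx (by simp [h0])
  exact ⟨h1.toSchwartzMap (Complex.ofRealCLM.contDiff.comp hg), fun x => rfl⟩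

/-- A smooth step which vanishes on `(-∞, 3]` and equals `1` on `[6, ∞)`. -/
noncomputable def step (u : ℝ) : ℝ := Real.smoothTransition (u / 3 - 1)

theorem contDiff_step : ContDiff ℝ ∞ step :=
  Real.smoothTransition.contDiff.comp (by fun_prop)

@[fun_prop] theorem continuous_step : Continuous step := contDiff_step.continuous

theorem step_eq_zero {u : ℝ} (h : u ≤ 3) : step u = 0 :=
  Real.smoothTransition.zero_of_nonpos (by linarith)

theorem step_eq_one {u : ℝ} (h : 6 ≤ u) : step u = 1 :=
  Real.smoothTransition.one_of_one_le (by linarith)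

theorem step_mem (u : ℝ) : 0 ≤ step u ∧ step u ≤ 1 :=
  ⟨Real.smoothTransition.nonneg _, Real.smoothTransition.le_one _⟩

theorem exists_cutoffs : ∃ χ χ' ζ : 𝓢(ℝ, ℂ), (∀ v, χ v ≠ 0 → -13 < v ∧ v < -1) ∧
    (∀ v, -12 ≤ v → v ≤ -2 → χ v = 1) ∧ (∀ v, χ' v = conj (χ (-v))) ∧
    (∀ v, ζ v ≠ 0 → 3 ≤ v ∧ v ≤ 12) ∧ ∀ v, ζ v = ((step v - step (v / 2) : ℝ) : ℂ) := by
  have hst : ∀ x, Real.smoothTransition x ≠ 0 → 0 < x := fun x hx => by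
    by_contra h0; exact hx (Real.smoothTransition.zero_of_nonpos (not_lt.1 h0))
  set g : ℝ → ℝ := fun v => Real.smoothTransition (v + 13) * Real.smoothTransition (-1 - v) with hgd
  have hg : ContDiff ℝ ∞ g := (Real.smoothTransition.contDiff.comp (by fun_prop)).mul
    (Real.smoothTransition.contDiff.comp (by fun_prop))
  have hgs : ∀ v, g v ≠ 0 → -13 < v ∧ v < -1 := fun v hv => by
    have h1 := hst _ (left_ne_zero_of_mul hv)
    have h2 := hst _ (right_ne_zero_of_mul hv)
    constructor <;> linarith
  obtain ⟨χ, hχ⟩ := exists_schwartz_eq g hg (a := -13) (b := -1)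
    fun v hv => ⟨(hgs v hv).1.le, (hgs v hv).2.le⟩
  obtain ⟨χ', hχ'⟩ := exists_schwartz_eq (fun v => g (-v)) (hg.comp (by fun_prop)) (a := 1) (b := 13)
    fun v hv => ⟨by linarith [(hgs _ hv).2], by linarith [(hgs _ hv).1]⟩
  have hζs : ∀ v, step v - step (v / 2) ≠ 0 → 3 ≤ v ∧ v ≤ 12 := fun v hv => by
    constructor
    · by_contra h
      exact hv (by rw [step_eq_zero (by linarith), step_eq_zero (by linarith), sub_zero])
    · by_contra h
      exact hv (by rw [step_eq_one (by linarith), step_eq_one (by linarith), sub_self])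
  obtain ⟨ζ, hζ⟩ := exists_schwartz_eq (fun v => step v - step (v / 2))
    (contDiff_step.sub (contDiff_step.comp (by fun_prop))) hζs
  refine ⟨χ, χ', ζ, fun v hv => hgs v fun h0 => hv (by rw [hχ, h0]; simp), fun v h1 h2 => ?_,
    fun v => by rw [hχ', hχ, Complex.conj_ofReal],
    fun v hv => hζs v fun h0 => hv (by rw [hζ, h0]; simp), hζ⟩
  rw [hχ, hgd]
  simp only
  rw [Real.smoothTransition.one_of_one_le (by linarith),
    Real.smoothTransition.one_of_one_le (by linarith)]
  simp

theorem fourierT_eq_ee (f : ℝ → ℂ) (ξ : ℝ) : fourierT f ξ = ∫ x, f x * ee (-(ξ * x)) := by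
  unfold fourierT; simp_rw [eChar_eq, neg_mul]

theorem continuous_fourierT {f : ℝ → ℂ} (hf : Integrable f) : Continuous (fourierT f) := by
  have : fourierT f = fun ξ => ∫ x, f x * ee (-(ξ * x)) := funext (fourierT_eq_ee f)
  rw [this]
  refine continuous_of_dominated (bound := fun x => ‖f x‖) (fun ξ => ?_)
    (fun ξ => Filter.Eventually.of_forall fun x => by simp) hf.norm
    (Filter.Eventually.of_forall fun x => by fun_prop)
  exact hf.aestronglyMeasurable.mul (Continuous.aestronglyMeasurable (by fun_prop))

theorem cutOp_kernel_eq (ζ : 𝓢(ℝ, ℂ)) {L : ℝ} (hL : 0 < L) (N w : ℝ) :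
    ((L⁻¹ : ℝ) : ℂ) * (ee (N * w) * 𝓕 (ζ : ℝ → ℂ) (w / L)) = ∫ ξ, ζ (L * (N - ξ)) * ee (ξ * w) := by
  have h1 : ∫ ξ, ζ (L * (N - ξ)) * ee (ξ * w) = ∫ u, ζ (L * u) * ee ((N - u) * w) := by
    rw [← integral_sub_left_eq_self (fun u => ζ (L * u) * ee ((N - u) * w)) volume N]
    simp
  have h2 : ∫ u, ζ (L * u) * ee ((N - u) * w) = |L⁻¹| • ∫ v, ζ v * ee ((N - v / L) * w) := by
    rw [← Measure.integral_comp_mul_left]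
    congr 1; ext u; congr 3; field_simp
  rw [h1, h2, fourier_eq_ee, abs_of_pos (by positivity), Complex.real_smul, ← integral_const_mul]
  congr 2; ext v
  have : ee ((N - v / L) * w) = ee (N * w) * ee (-(v * (w / L))) := by
    rw [← ee_add]; congr 1; field_simp; ring
  rw [this]; ring

theorem cutOp_eq_multiplier (ζ : 𝓢(ℝ, ℂ)) {L : ℝ} (hL : 0 < L) (N : ℝ) {f : ℝ → ℂ}
    (hf : Integrable f) (x : ℝ) :
    cutOp ζ L N f x = ∫ ξ, fourierT f ξ * (ζ (L * (N - ξ)) * ee (ξ * x)) := by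
  have hζi : Integrable fun ξ => ζ (L * (N - ξ)) :=
    (((ζ.integrable).comp_mul_left' hL.ne').comp_sub_left N)
  have e1 : ∀ y, f y * ((L⁻¹ : ℝ) * (ee (N * (x - y)) * 𝓕 (ζ : ℝ → ℂ) ((x - y) / L))) =
      ∫ ξ, f y * (ζ (L * (N - ξ)) * ee (ξ * (x - y))) := fun y => by
    rw [cutOp_kernel_eq ζ hL, integral_const_mul]
  have e2 : ∀ ξ, fourierT f ξ * (ζ (L * (N - ξ)) * ee (ξ * x)) =
      ∫ y, f y * (ζ (L * (N - ξ)) * ee (ξ * (x - y))) := fun ξ => by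
    rw [fourierT_eq_ee, ← integral_mul_const]
    congr 1; ext y
    have : ee (ξ * (x - y)) = ee (ξ * x) * ee (-(ξ * y)) := by rw [← ee_add]; congr 1; ring
    rw [this]; ring
  rw [cutOp]
  simp_rw [e1, e2]
  refine integral_integral_swap ?_
  have h := hf.mul_prod hζi
  refine (h.mul_bdd (g := fun p : ℝ × ℝ => ee (p.2 * (x - p.1))) (c := 1) ?_ ?_).congr ?_
  · exact Continuous.aestronglyMeasurable (by fun_prop)
  · exact Filter.Eventually.of_forall fun p => by rw [norm_ee]
  · exact Filter.Eventually.of_forall fun p => by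
      simp only [Function.uncurry]; ring

/-- The truncated frequency projection onto `(-∞, N)`. -/
noncomputable def carlT (ζ : 𝓢(ℝ, ℂ)) (K : ℕ) (N : ℝ) (f : ℝ → ℂ) (x : ℝ) : ℂ :=
  ∑ i ∈ Finset.range 4, ∑ k ∈ Finset.Icc (-K : ℤ) K, cutOp ζ (len (2 ^ i) k) N f x

theorem continuous_carlT (ζ : 𝓢(ℝ, ℂ)) (K : ℕ) {f : ℝ → ℂ} (hf : Integrable f) :
    Continuous fun p : ℝ × ℝ => carlT ζ K p.1 f p.2 :=
  continuous_finsetSum _ fun _ _ => continuous_finsetSum _ fun _ _ => continuous_cutOp ζ _ hf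

theorem sum_cutoff_telescope (K : ℕ) (u : ℝ) :
    ∑ i ∈ Finset.range 4, ∑ k ∈ Finset.Icc (-K : ℤ) K,
      (step (len (2 ^ i) k * u) - step (len (2 ^ i) k * u / 2)) =
    step (8 * 16 ^ K * u) - step (8 * u / 16 ^ (K + 1)) := by
  have h1 : ∀ k : ℤ, ∑ i ∈ Finset.range 4,
      (step (len (2 ^ i) k * u) - step (len (2 ^ i) k * u / 2)) =
      step (len 8 k * u) - step (len 8 (k - 1) * u) := by
    intro k
    simp only [Finset.sum_range_succ, Finset.sum_range_zero, len]
    norm_num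
    rw [zpow_sub_one₀ (by norm_num), show 2 * (16 : ℝ) ^ k * u / 2 = 16 ^ k * u by ring,
      show 4 * (16 : ℝ) ^ k * u / 2 = 2 * 16 ^ k * u by ring,
      show 8 * (16 : ℝ) ^ k * u / 2 = 4 * 16 ^ k * u by ring,
      show 8 * ((16 : ℝ) ^ k * 16⁻¹) * u = 16 ^ k * u / 2 by ring]
    ring
  rw [Finset.sum_comm, Finset.sum_congr rfl fun k _ => h1 k]
  have h2 : ∀ m : ℕ, ∑ k ∈ Finset.Icc (-m : ℤ) m, (step (len 8 k * u) - step (len 8 (k - 1) * u)) =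
      step (len 8 m * u) - step (len 8 (-m - 1) * u) := by
    intro m
    induction m with
    | zero => simp
    | succ m ih =>
      have : Finset.Icc (-((m + 1 : ℕ) : ℤ)) (m + 1 : ℕ) =
          insert (-((m + 1 : ℕ) : ℤ)) (insert ((m + 1 : ℕ) : ℤ) (Finset.Icc (-m : ℤ) m)) := by
        ext z; simp only [Finset.mem_insert, Finset.mem_Icc]; push_cast; omega
      rw [this, Finset.sum_insert (by simp only [Finset.mem_insert, Finset.mem_Icc]; push_cast; omega),
        Finset.sum_insert (by simp only [Finset.mem_Icc]; push_cast; omega), ih]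
      rw [show ((m + 1 : ℕ) : ℤ) - 1 = m by push_cast; ring,
        show (-m - 1 : ℤ) = -((m + 1 : ℕ) : ℤ) by push_cast; ring]
      ring
  rw [h2]
  congr 2
  rw [len, show (-K - 1 : ℤ) = -((K + 1 : ℕ) : ℤ) by push_cast; ring, zpow_neg, zpow_natCast]
  field_simp

theorem carlT_eq_multiplier {ζ : 𝓢(ℝ, ℂ)} (hζ : ∀ v, ζ v = ((step v - step (v / 2) : ℝ) : ℂ))
    (K : ℕ) (N : ℝ) {f : ℝ → ℂ} (hf : Integrable f) (x : ℝ) :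
    carlT ζ K N f x = ∫ ξ, fourierT f ξ *
      (((step (8 * 16 ^ K * (N - ξ)) - step (8 * (N - ξ) / 16 ^ (K + 1)) : ℝ) : ℂ) * ee (ξ * x)) := by
  have hi : ∀ (i : ℕ) (k : ℤ), Integrable fun ξ => fourierT f ξ *
      (ζ (len (2 ^ i) k * (N - ξ)) * ee (ξ * x)) := by
    intro i k
    have hL : 0 < len (2 ^ i) k := len_pos (by positivity) k
    refine Integrable.bdd_mul (c := ∫ y, ‖f y‖) (Integrable.mul_bdd (c := 1)
      ((ζ.integrable.comp_mul_left' hL.ne').comp_sub_left N) ?_ ?_) ?_ ?_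
    · exact Continuous.aestronglyMeasurable (by fun_prop)
    · exact Filter.Eventually.of_forall fun p => by rw [norm_ee]
    · exact (continuous_fourierT hf).aestronglyMeasurable
    · refine Filter.Eventually.of_forall fun ξ => ?_
      rw [fourierT_eq_ee]
      refine (norm_integral_le_integral_norm _).trans (le_of_eq ?_)
      simp
  rw [carlT]
  simp_rw [fun i k => cutOp_eq_multiplier ζ (len_pos (lam := 2 ^ i) (by positivity) k) N hf x]
  have : ∀ i ∈ Finset.range 4, ∑ k ∈ Finset.Icc (-K : ℤ) K, ∫ ξ, fourierT f ξ *
      (ζ (len (2 ^ i) k * (N - ξ)) * ee (ξ * x)) = ∫ ξ, ∑ k ∈ Finset.Icc (-K : ℤ) K, fourierT f ξ *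
      (ζ (len (2 ^ i) k * (N - ξ)) * ee (ξ * x)) := fun i _ =>
    (integral_finsetSum _ fun k _ => hi i k).symm
  rw [Finset.sum_congr rfl this, ← integral_finsetSum _ fun i _ => integrable_finsetSum _ fun k _ => hi i k]
  congr 1; ext ξ
  rw [← sum_cutoff_telescope]
  simp_rw [← Finset.mul_sum, ← Finset.sum_mul, hζ]
  push_cast; rfl

theorem tendsto_carlT {ζ : 𝓢(ℝ, ℂ)} (hζ : ∀ v, ζ v = ((step v - step (v / 2) : ℝ) : ℂ))
    (N : ℝ) (f : 𝓢(ℝ, ℂ)) (x : ℝ) :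
    Filter.Tendsto (fun K => carlT ζ K N f x) Filter.atTop (nhds (fproj (Iio N) f x)) := by
  have e0 : ∀ ξ, fourierT f ξ = 𝓕 (f : ℝ → ℂ) ξ := fun ξ => by
    rw [fourierT_eq_ee, fourier_eq_ee]; simp_rw [mul_comm ξ]
  have hfi : Integrable (fourierT f) := by
    rw [funext e0, ← SchwartzMap.fourier_coe]; exact (𝓕 f).integrable
  have hfc := continuous_fourierT f.integrable
  simp_rw [carlT_eq_multiplier hζ _ N f.integrable x]
  rw [fproj, ← integral_indicator measurableSet_Iio]
  refine tendsto_integral_of_dominated_convergence (fun ξ => ‖fourierT f ξ‖) (fun K => ?_)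
    hfi.norm (fun K => Filter.Eventually.of_forall fun ξ => ?_)
    (Filter.Eventually.of_forall fun ξ => ?_)
  · exact Continuous.aestronglyMeasurable (by fun_prop)
  · rw [norm_mul, norm_mul, norm_ee, mul_one, Complex.norm_real, Real.norm_eq_abs]
    refine mul_le_of_le_one_right (norm_nonneg _) ?_
    have h1 := step_mem (8 * 16 ^ K * (N - ξ))
    have h2 := step_mem (8 * (N - ξ) / 16 ^ (K + 1))
    rw [abs_le]; constructor <;> linarith
  · have hp : Filter.Tendsto (fun K : ℕ => (16 : ℝ) ^ K) Filter.atTop Filter.atTop :=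
      tendsto_pow_atTop_atTop_of_one_lt (by norm_num)
    refine tendsto_const_nhds.congr' ?_
    by_cases h : ξ < N
    · filter_upwards [hp.eventually_ge_atTop (N - ξ), hp.eventually_ge_atTop (1 / (N - ξ))] with K h1 h2
      rw [indicator_of_mem (mem_Iio.2 h), eChar_eq, step_eq_one, step_eq_zero]
      · simp
      · rw [div_le_iff₀ (by positivity), pow_succ]; linarith [h1]
      · have h3 := (div_le_iff₀ (sub_pos.2 h)).1 h2
        linarith
    · refine Filter.Eventually.of_forall fun K => ?_
      have h0 : N - ξ ≤ 0 := by linarith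
      simp only
      rw [indicator_of_notMem (by simpa using h), step_eq_zero, step_eq_zero]
      · simp
      · refine (div_nonpos_of_nonpos_of_nonneg (by linarith) (by positivity)).trans (by norm_num)
      · exact (mul_nonpos_of_nonneg_of_nonpos (by positivity) h0).trans (by norm_num)

/-! ### Restricted weak type bounds for the maximal truncated projections -/

theorem exists_measurable_choice {𝒩 : Finset ℝ} (h : 𝒩.Nonempty) (P : ℝ → Set ℝ)
    (hP : ∀ N, MeasurableSet (P N)) : ∃ N : ℝ → ℝ, Measurable N ∧ (∀ x, N x ∈ 𝒩) ∧
      ∀ x, (∃ M ∈ 𝒩, x ∈ P M) → x ∈ P (N x) := by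
  classical
  induction h using Finset.Nonempty.cons_induction with
  | singleton a => exact ⟨fun _ => a, measurable_const, by simp, by simp⟩
  | cons a s ha hs ih =>
    obtain ⟨N, hN, hNs, hNP⟩ := ih
    refine ⟨fun x => if x ∈ P a then a else N x, Measurable.ite (hP a) measurable_const hN,
      fun x => ?_, fun x hx => ?_⟩
    · rw [Finset.mem_cons]; dsimp only; split_ifs
      · exact Or.inl rfl
      · exact Or.inr (hNs x)
    · by_cases hxa : x ∈ P a
      · simp [hxa]
      · obtain ⟨M, hM, hxM⟩ := hx
        rcases Finset.mem_cons.1 hM with rfl | hM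
        · exact absurd hxM hxa
        · simpa [hxa] using hNP x ⟨M, hM, hxM⟩

theorem volume_carlT_compact_le (χ χ' ζ : 𝓢(ℝ, ℂ)) (hχ : ∀ v, χ v ≠ 0 → -13 < v ∧ v < -1)
    (hχ1 : ∀ v, -12 ≤ v → v ≤ -2 → χ v = 1)
    (hχ' : ∀ v, χ' v = conj (χ (-v))) (hζ : ∀ v, ζ v ≠ 0 → 3 ≤ v ∧ v ≤ 12) {q : ℝ} (hq : 1 < q) :
    ∃ C : ℝ, 0 < C ∧ ∀ (F : Set ℝ) (_ : MeasurableSet F) (_ : volume F ≠ ⊤)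
      (f : ℝ → ℂ) (_ : Integrable f) (_ : ∀ x, ‖f x‖ ≤ F.indicator 1 x) (K : ℕ) (𝒩 : Finset ℝ)
      (α : ℝ) (_ : 0 < α),
      volume {x | ∃ N ∈ 𝒩, α < ‖carlT ζ K N f x‖} ≤
        ENNReal.ofReal ((C / α) ^ q) * volume F := by
  obtain ⟨C, hC, hmain⟩ := exists_major_subset_model_le χ χ' ζ hχ hχ' hζ hq
  refine ⟨48 * C, by positivity, fun F hFm hFf f hf hfF K 𝒩 α hα => ?_⟩
  have hcont : ∀ N, Continuous fun x => carlT ζ K N f x := fun N => by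
    have h2 := (continuous_carlT ζ K hf).comp (f := fun x : ℝ => (N, x)) (by fun_prop)
    simpa only [Function.comp_def] using h2
  have hopen : ∀ N, IsOpen {x | α < ‖carlT ζ K N f x‖} := fun N =>
    isOpen_lt continuous_const (hcont N).norm
  have hE : MeasurableSet {x | ∃ N ∈ 𝒩, α < ‖carlT ζ K N f x‖} := by
    have : {x | ∃ N ∈ 𝒩, α < ‖carlT ζ K N f x‖} = ⋃ N ∈ 𝒩, {x | α < ‖carlT ζ K N f x‖} := by
      ext x; simp
    rw [this]
    exact (isOpen_biUnion fun N _ => hopen N).measurableSet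
  rcases eq_or_ne (volume F) 0 with hF0 | hF0
  · have hf0 : f =ᵐ[volume] 0 := by
      have : ∀ᵐ x, x ∉ F := measure_eq_zero_iff_ae_notMem.1 hF0
      filter_upwards [this] with x hx
      have := hfF x
      rw [indicator_of_notMem hx] at this
      simpa using this
    have hz : ∀ L N x, cutOp ζ L N f x = 0 := fun L N x => by
      rw [cutOp]
      refine integral_eq_zero_of_ae ?_
      filter_upwards [hf0] with y hy
      rw [hy]; simp
    have : {x | ∃ N ∈ 𝒩, α < ‖carlT ζ K N f x‖} = ∅ := by
      ext x; simp [carlT, hz, hα.le]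
    rw [this]; simp
  have hF0' : 0 < volume.real F := ENNReal.toReal_pos hF0 hFf
  rw [hE.measure_eq_iSup_isCompact]
  refine iSup₂_le fun E hEs => iSup_le fun hEc => ?_
  rcases eq_or_ne (volume E) 0 with hE0 | hE0
  · rw [hE0]; exact zero_le
  have hEf : volume E ≠ ⊤ := hEc.measure_lt_top.ne
  have hE0' : 0 < volume.real E := ENNReal.toReal_pos hE0 hEf
  have hne : 𝒩.Nonempty := by
    obtain ⟨x, hx⟩ := nonempty_of_measure_ne_zero hE0
    obtain ⟨N, hN, -⟩ := hEs hx
    exact ⟨N, hN⟩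
  obtain ⟨N, hNm, hN𝒩, hNP⟩ := exists_measurable_choice hne
    (fun N => {x | α < ‖carlT ζ K N f x‖}) (fun N => (hopen N).measurableSet)
  obtain ⟨E', hE'E, hE'm, hE2, hE'⟩ := hmain F hFm hFf hF0' E hEc.measurableSet hEf hE0'
  set e := volume.real E with he
  set R := volume.real F / e with hR
  have hR0 : 0 < R := by positivity
  have hbd : ∀ i ∈ Finset.range 4, ∫⁻ x in E', ‖∑ k ∈ Finset.Icc (-K : ℤ) K,
      cutOp ζ (len (2 ^ i) k) (N x) f x‖ₑ ≤ 6 * ENNReal.ofReal (C * e * R ^ (1 / q)) := by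
    intro i _
    refine lintegral_cutOp_le χ ζ hχ1 hζ (by positivity) hf hNm 𝒩 hN𝒩 E' _
      (fun f' hf' hff N' hN' t ht0 ht1 S hS => ?_) K
    exact hE' _ t (by positivity) ht0 ht1 S hS f' hf' (fun x => (hff x).le.trans (hfF x)) N' hN'
  have hlow : ENNReal.ofReal α * volume E' ≤ ∫⁻ x in E', ‖carlT ζ K (N x) f x‖ₑ := by
    rw [← setLIntegral_const]
    refine setLIntegral_mono' hE'm fun x hx => ?_
    rw [← ofReal_norm]
    exact ENNReal.ofReal_le_ofReal (hNP x (hEs (hE'E hx))).le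
  have hup : ∫⁻ x in E', ‖carlT ζ K (N x) f x‖ₑ ≤
      24 * ENNReal.ofReal (C * e * R ^ (1 / q)) := by
    calc _ ≤ ∫⁻ x in E', ∑ i ∈ Finset.range 4, ‖∑ k ∈ Finset.Icc (-K : ℤ) K,
          cutOp ζ (len (2 ^ i) k) (N x) f x‖ₑ := lintegral_mono fun x => enorm_sum_le _ _
      _ ≤ ∑ i ∈ Finset.range 4, 6 * ENNReal.ofReal (C * e * R ^ (1 / q)) := by
          rw [lintegral_finsetSum]
          · exact Finset.sum_le_sum hbd
          · intro i _
            refine (Finset.measurable_sum _ fun k _ => ?_).enorm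
            have h2 := (continuous_cutOp ζ (len (2 ^ i) k) hf).measurable.comp
              (hNm.prodMk measurable_id)
            simpa only [Function.comp_def, id] using h2
      _ = _ := by
          rw [Finset.sum_const, Finset.card_range, nsmul_eq_mul, ← mul_assoc]; norm_num
  have hE'f : volume E' ≠ ⊤ := measure_ne_top_of_subset hE'E hEf
  have hreal : α * volume.real E' ≤ 24 * (C * e * R ^ (1 / q)) := by
    have h := hlow.trans hup
    rw [← ofReal_measureReal hE'f, ← ENNReal.ofReal_mul hα.le, ← ENNReal.ofReal_ofNat 24,
      ← ENNReal.ofReal_mul (by norm_num)] at h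
    exact (ENNReal.ofReal_le_ofReal_iff (by positivity)).1 h
  have h1 : α ≤ 48 * C * R ^ (1 / q) := by
    have : α * e ≤ (48 * C * R ^ (1 / q)) * e := by nlinarith
    exact le_of_mul_le_mul_right this hE0'
  have h2 : 1 ≤ (48 * C / α) ^ q * R := by
    have h3 : 1 ≤ 48 * C / α * R ^ (1 / q) := by
      rw [div_mul_eq_mul_div, le_div_iff₀ hα]; linarith
    have h4 := Real.one_le_rpow h3 (by linarith : 0 ≤ q)
    rwa [Real.mul_rpow (by positivity) (by positivity), ← Real.rpow_mul hR0.le,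
      one_div_mul_cancel (by linarith), Real.rpow_one] at h4
  have h3 : e ≤ (48 * C / α) ^ q * volume.real F := by
    have : e * 1 ≤ e * ((48 * C / α) ^ q * R) := by gcongr
    calc e = e * 1 := (mul_one _).symm
      _ ≤ e * ((48 * C / α) ^ q * R) := this
      _ = _ := by rw [hR]; field_simp
  rw [← ofReal_measureReal hEf, ← ofReal_measureReal hFf, ← ENNReal.ofReal_mul (by positivity)]
  exact ENNReal.ofReal_le_ofReal h3

/-! ### Interpolation -/

theorem exists_tsum_geometric_natAbs_le {r : ℝ} (h0 : 0 ≤ r) (h1 : r < 1) :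
    ∃ S : ℝ, 0 < S ∧ ∑' d : ℤ, ENNReal.ofReal (r ^ d.natAbs) ≤ ENNReal.ofReal S := by
  have hs : Summable fun d : ℤ => r ^ d.natAbs := by
    refine Summable.of_nat_of_neg ?_ ?_ <;>
    · simp only [Int.natAbs_neg, Int.natAbs_natCast]
      exact summable_geometric_of_lt_one h0 h1
  refine ⟨∑' d : ℤ, r ^ d.natAbs + 1, by positivity, ?_⟩
  rw [← ENNReal.ofReal_tsum_of_nonneg (fun d => by positivity) hs]
  exact ENNReal.ofReal_le_ofReal (by linarith)

theorem lintegral_rpow_le_tsum_levels {p : ℝ} (hp : 0 < p) {T : ℝ → ℝ≥0∞} (hT : Measurable T)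
    (hTf : ∀ x, T x ≠ ⊤) :
    ∫⁻ x, T x ^ p ≤ ∑' j : ℤ, ENNReal.ofReal (((2 : ℝ) ^ (j + 1)) ^ p) *
      volume {x | ENNReal.ofReal ((2 : ℝ) ^ j) < T x} := by
  have hm : ∀ j : ℤ, MeasurableSet {x | ENNReal.ofReal ((2 : ℝ) ^ j) < T x} := fun j =>
    measurableSet_lt measurable_const hT
  calc _ ≤ ∫⁻ x, ∑' j : ℤ, {x | ENNReal.ofReal ((2 : ℝ) ^ j) < T x}.indicator
          (fun _ => ENNReal.ofReal (((2 : ℝ) ^ (j + 1)) ^ p)) x := by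
        refine lintegral_mono fun x => ?_
        rcases eq_or_ne (T x) 0 with h0 | h0
        · simp [h0, hp]
        obtain ⟨n, hn1, hn2⟩ := ENNReal.exists_mem_Ioc_zpow h0 (hTf x) (y := 2) (by norm_num)
          (by norm_num)
        have hz : ∀ n : ℤ, ENNReal.ofReal ((2 : ℝ) ^ n) = 2 ^ n := fun n => by
          rw [← Real.rpow_intCast, ← ENNReal.ofReal_rpow_of_pos (by norm_num),
            ENNReal.rpow_intCast]; simp
        refine le_trans ?_ (ENNReal.le_tsum n)
        rw [indicator_of_mem (by simpa [hz] using hn1), ← ENNReal.ofReal_rpow_of_nonneg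
          (by positivity) hp.le, hz]
        exact ENNReal.rpow_le_rpow hn2 hp.le
    _ = _ := by
        rw [lintegral_tsum fun j => (measurable_const.indicator (hm j)).aemeasurable]
        congr 1; ext j
        rw [lintegral_indicator_const (hm j)]

/-- Interpolation between two weak type estimates for functions decomposed into level sets. -/
theorem lintegral_rpow_le_of_level_bounds {p q₀ q₁ r C : ℝ} (hp : 0 < p) (hr0 : 0 < r) (hr1 : r < 1)
    (hC : 0 < C) (h0 : 2 ^ (-p) * (2 / r) ^ q₀ < 1) (h1 : 2 ^ p * (1 / (2 * r)) ^ q₁ < 1) :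
    ∃ D : ℝ, 0 < D ∧ ∀ (T : ℝ → ℝ≥0∞) (_ : Measurable T) (_ : ∀ x, T x ≠ ⊤)
      (G : ℤ → ℝ → ℝ≥0∞) (_ : ∀ x, T x ≤ ∑' m, G m x) (a : ℤ → ℝ≥0∞)
      (_ : ∀ m, ∀ β : ℝ, 0 < β → volume {x | ENNReal.ofReal β < G m x} ≤
        ENNReal.ofReal ((C * 2 ^ m / β) ^ q₀) * a m)
      (_ : ∀ m, ∀ β : ℝ, 0 < β → volume {x | ENNReal.ofReal β < G m x} ≤
        ENNReal.ofReal ((C * 2 ^ m / β) ^ q₁) * a m),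
      ∫⁻ x, T x ^ p ≤ ENNReal.ofReal D * ∑' m : ℤ, ENNReal.ofReal (((2 : ℝ) ^ m) ^ p) * a m := by
  obtain ⟨S, hS, hSr⟩ := exists_tsum_geometric_natAbs_le hr0.le hr1
  set κ := max (2 ^ (-p) * (2 / r) ^ q₀) (2 ^ p * (1 / (2 * r)) ^ q₁) with hκ
  have hκ0 : 0 ≤ κ := le_max_of_le_left (by positivity)
  have hκ1 : κ < 1 := max_lt h0 h1
  obtain ⟨S', hS', hSκ⟩ := exists_tsum_geometric_natAbs_le hκ0 hκ1
  set c := S⁻¹ with hc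
  have hc0 : 0 < c := by positivity
  set A := max ((C / c) ^ q₀) ((C / c) ^ q₁) with hA
  have hA0 : 0 < A := lt_max_of_lt_left (by positivity)
  refine ⟨2 ^ p * A * S', by positivity, fun T hT hTf G hTG a hw0 hw1 => ?_⟩
  refine (lintegral_rpow_le_tsum_levels hp hT hTf).trans ?_
  have hlev : ∀ j : ℤ, volume {x | ENNReal.ofReal ((2 : ℝ) ^ j) < T x} ≤
      ∑' m : ℤ, volume {x | ENNReal.ofReal (c * 2 ^ j * r ^ (m - j).natAbs) < G m x} := by
    intro j
    refine (measure_mono ?_).trans (measure_iUnion_le _)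
    intro x hx
    by_contra hn
    simp only [mem_iUnion, mem_ofPred_eq, not_exists, not_lt] at hn hx
    refine hx.not_ge ((hTG x).trans ((ENNReal.tsum_le_tsum hn).trans ?_))
    have : ∀ m : ℤ, ENNReal.ofReal (c * 2 ^ j * r ^ (m - j).natAbs) =
        ENNReal.ofReal (c * 2 ^ j) * ENNReal.ofReal (r ^ (m - j).natAbs) := fun m =>
      ENNReal.ofReal_mul (by positivity)
    simp_rw [this]
    rw [ENNReal.tsum_mul_left]
    have he := (Equiv.subRight j).tsum_eq (fun d : ℤ => ENNReal.ofReal (r ^ d.natAbs))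
    simp only [Equiv.subRight_apply] at he
    rw [he]
    refine (mul_le_mul' le_rfl hSr).trans ?_
    rw [← ENNReal.ofReal_mul (by positivity)]
    refine ENNReal.ofReal_le_ofReal (le_of_eq ?_)
    rw [hc]; field_simp
  have hterm : ∀ j m : ℤ, ENNReal.ofReal (((2 : ℝ) ^ (j + 1)) ^ p) *
      volume {x | ENNReal.ofReal (c * 2 ^ j * r ^ (m - j).natAbs) < G m x} ≤
      ENNReal.ofReal (2 ^ p * A) * (ENNReal.ofReal (((2 : ℝ) ^ m) ^ p) * a m) *
        ENNReal.ofReal (κ ^ (m - j).natAbs) := by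
    intro j m
    have hβ : 0 < c * 2 ^ j * r ^ (m - j).natAbs := by positivity
    have hj : ((2 : ℝ) ^ (j + 1)) ^ p = 2 ^ p * ((2 : ℝ) ^ j) ^ p := by
      rw [zpow_add_one₀ (by norm_num), Real.mul_rpow (by positivity) (by positivity), mul_comm]
    have key : ∀ x : ℝ, ((2 : ℝ) ^ (j + 1)) ^ p * x ≤ 2 ^ p * A * ((2 : ℝ) ^ m) ^ p * κ ^ (m - j).natAbs →
      volume {x | ENNReal.ofReal (c * 2 ^ j * r ^ (m - j).natAbs) < G m x} ≤ ENNReal.ofReal x * a m →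
      ENNReal.ofReal (((2 : ℝ) ^ (j + 1)) ^ p) *
      volume {x | ENNReal.ofReal (c * 2 ^ j * r ^ (m - j).natAbs) < G m x} ≤
      ENNReal.ofReal (2 ^ p * A) * (ENNReal.ofReal (((2 : ℝ) ^ m) ^ p) * a m) *
        ENNReal.ofReal (κ ^ (m - j).natAbs) := by
      intro x hx hv
      refine (mul_le_mul' le_rfl hv).trans ?_
      rw [← mul_assoc, ← ENNReal.ofReal_mul (by positivity)]
      refine (mul_le_mul' (ENNReal.ofReal_le_ofReal hx) le_rfl).trans (le_of_eq ?_)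
      rw [ENNReal.ofReal_mul (by positivity), ENNReal.ofReal_mul (p := 2 ^ p * A) (by positivity)]
      ring
    rcases le_total j m with hjm | hjm
    · obtain ⟨n, rfl⟩ := Int.le.dest hjm
      refine key _ ?_ (hw0 _ _ hβ)
      rw [show (j + (n : ℤ) - j).natAbs = n by simp, hj, zpow_add₀ (by norm_num), zpow_natCast]
      have e1 : C * (2 ^ j * 2 ^ n) / (c * 2 ^ j * r ^ n) = C / c * (2 / r) ^ n := by
        rw [div_pow]; field_simp
      rw [e1, Real.mul_rpow (by positivity) (by positivity),
        Real.mul_rpow (by positivity) (by positivity)]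
      have e2 : ((2 / r) ^ n) ^ q₀ = ((2 : ℝ) ^ n) ^ p * (2 ^ (-p) * (2 / r) ^ q₀) ^ n := by
        rw [mul_pow, ← Real.rpow_natCast, ← Real.rpow_natCast, ← Real.rpow_natCast,
          ← Real.rpow_natCast, ← Real.rpow_mul (by positivity), ← Real.rpow_mul (by positivity),
          ← Real.rpow_mul (by positivity), ← Real.rpow_mul (by positivity), ← mul_assoc,
          ← Real.rpow_add (by positivity)]
        rw [show (n : ℝ) * p + -p * n = 0 by ring, Real.rpow_zero, one_mul, mul_comm q₀]
      rw [e2]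
      have h3 : (2 ^ (-p) * (2 / r) ^ q₀) ^ n ≤ κ ^ n :=
        pow_le_pow_left₀ (by positivity) (le_max_left _ _) n
      have h4 : (C / c) ^ q₀ ≤ A := le_max_left _ _
      calc _ = 2 ^ p * (C / c) ^ q₀ * (((2 : ℝ) ^ j) ^ p * ((2 : ℝ) ^ n) ^ p) *
            (2 ^ (-p) * (2 / r) ^ q₀) ^ n := by ring
        _ ≤ _ := by gcongr
    · obtain ⟨n, rfl⟩ := Int.le.dest hjm
      refine key _ ?_ (hw1 _ _ hβ)
      rw [show (m - (m + (n : ℤ))).natAbs = n by simp, hj, zpow_add₀ (by norm_num), zpow_natCast]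
      have e1 : C * 2 ^ m / (c * (2 ^ m * 2 ^ n) * r ^ n) = C / c * (1 / (2 * r)) ^ n := by
        rw [div_pow, mul_pow]; field_simp; simp
      rw [e1, Real.mul_rpow (by positivity) (by positivity),
        Real.mul_rpow (by positivity) (by positivity)]
      have e2 : ((2 : ℝ) ^ n) ^ p * ((1 / (2 * r)) ^ n) ^ q₁ = (2 ^ p * (1 / (2 * r)) ^ q₁) ^ n := by
        rw [mul_pow, ← Real.rpow_natCast, ← Real.rpow_natCast, ← Real.rpow_natCast,
          ← Real.rpow_natCast, ← Real.rpow_mul (by positivity), ← Real.rpow_mul (by positivity),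
          ← Real.rpow_mul (by positivity), ← Real.rpow_mul (by positivity), mul_comm (n : ℝ) p,
          mul_comm (n : ℝ) q₁]
      have h3 : (2 ^ p * (1 / (2 * r)) ^ q₁) ^ n ≤ κ ^ n :=
        pow_le_pow_left₀ (by positivity) (le_max_right _ _) n
      have h4 : (C / c) ^ q₁ ≤ A := le_max_right _ _
      calc _ = 2 ^ p * (C / c) ^ q₁ * ((2 : ℝ) ^ m) ^ p *
            (((2 : ℝ) ^ n) ^ p * ((1 / (2 * r)) ^ n) ^ q₁) := by ring
        _ ≤ _ := by rw [e2]; gcongr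
  calc _ ≤ ∑' j : ℤ, ∑' m : ℤ, ENNReal.ofReal (2 ^ p * A) * (ENNReal.ofReal (((2 : ℝ) ^ m) ^ p) * a m) *
        ENNReal.ofReal (κ ^ (m - j).natAbs) := by
        refine ENNReal.tsum_le_tsum fun j => (mul_le_mul' le_rfl (hlev j)).trans ?_
        rw [← ENNReal.tsum_mul_left]
        exact ENNReal.tsum_le_tsum fun m => hterm j m
    _ = ∑' m : ℤ, ENNReal.ofReal (2 ^ p * A) * (ENNReal.ofReal (((2 : ℝ) ^ m) ^ p) * a m) *
        ∑' j : ℤ, ENNReal.ofReal (κ ^ (m - j).natAbs) := by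
        rw [ENNReal.tsum_comm]
        simp_rw [ENNReal.tsum_mul_left]
    _ ≤ ∑' m : ℤ, ENNReal.ofReal (2 ^ p * A) * (ENNReal.ofReal (((2 : ℝ) ^ m) ^ p) * a m) *
        ENNReal.ofReal S' := by
        refine ENNReal.tsum_le_tsum fun m => mul_le_mul' le_rfl ?_
        have he := (Equiv.subLeft m).tsum_eq (fun d : ℤ => ENNReal.ofReal (κ ^ d.natAbs))
        simp only [Equiv.subLeft_apply] at he
        rw [he]
        exact hSκ
    _ = _ := by
        rw [ENNReal.tsum_mul_right, ENNReal.tsum_mul_left, ENNReal.ofReal_mul (p := 2 ^ p * A) (by positivity)]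
        ring

theorem measurable_finset_sup {ι : Type*} (s : Finset ι) {f : ι → ℝ → ℝ≥0∞}
    (hf : ∀ i, Measurable (f i)) : Measurable fun x => s.sup fun i => f i x := by
  classical
  induction s using Finset.induction_on with
  | empty => simp
  | insert i s hi ih => simpa only [Finset.sup_insert] using (hf i).max ih

/-! ### The Carleson–Hunt theorem -/

/-- The dyadic level set of a function. -/
def levelSet (f : ℝ → ℂ) (m : ℤ) : Set ℝ := {x | (2 : ℝ) ^ m ≤ ‖f x‖ ∧ ‖f x‖ < 2 ^ (m + 1)}

theorem measurableSet_levelSet {f : ℝ → ℂ} (hf : Measurable f) (m : ℤ) :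
    MeasurableSet (levelSet f m) :=
  (measurableSet_le measurable_const hf.norm).inter (measurableSet_lt hf.norm measurable_const)

theorem pairwise_disjoint_levelSet (f : ℝ → ℂ) : Pairwise (Function.onFun Disjoint (levelSet f)) := by
  have key : ∀ m n : ℤ, m < n → Disjoint (levelSet f m) (levelSet f n) := fun m n hmn => by
    refine Set.disjoint_left.2 fun x hx hx' => ?_
    have := zpow_le_zpow_right₀ (by norm_num : (1 : ℝ) ≤ 2) (show m + 1 ≤ n by omega)
    linarith [hx.2, hx'.1]
  intro m n hmn
  rcases lt_or_gt_of_ne hmn with h | h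
  · exact key m n h
  · exact (key n m h).symm

theorem iUnion_levelSet (f : ℝ → ℂ) : ⋃ m, levelSet f m = {x | f x ≠ 0} := by
  ext x
  simp only [mem_iUnion, mem_ofPred_eq]
  constructor
  · rintro ⟨m, h1, h2⟩ h0
    rw [h0, norm_zero] at h1
    have : (0 : ℝ) < 2 ^ m := by positivity
    linarith
  · intro h
    obtain ⟨n, h1, h2⟩ := exists_mem_Ico_zpow (norm_pos_iff.2 h) (by norm_num : (1 : ℝ) < 2)
    exact ⟨n, h1, h2⟩

theorem hasSum_cutOp_levelSet (ζ : 𝓢(ℝ, ℂ)) (L N : ℝ) {f : ℝ → ℂ} (hf : Integrable f)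
    (hfm : Measurable f) (x : ℝ) :
    HasSum (fun m => cutOp ζ L N ((levelSet f m).indicator f) x) (cutOp ζ L N f x) := by
  obtain ⟨C, hC, hb⟩ := fourier_decay ζ 0
  have hc := continuous_fourier_schwartz ζ
  set k : ℝ → ℂ := fun y => (L⁻¹ : ℝ) * (ee (N * (x - y)) * 𝓕 (ζ : ℝ → ℂ) ((x - y) / L)) with hk
  have hkc : Continuous k := by
    have h2 := hc.comp (f := fun y : ℝ => (x - y) / L) (by fun_prop)
    simp only [Function.comp_def] at h2
    fun_prop
  have hkb : ∀ y, ‖k y‖ ≤ |L⁻¹| * C := by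
    intro y
    simp only [hk]
    rw [norm_mul, norm_mul, norm_ee, one_mul, Complex.norm_real, Real.norm_eq_abs]
    have : ‖𝓕 (ζ : ℝ → ℂ) ((x - y) / L)‖ ≤ C := by simpa using hb 1 one_pos 0 ((x - y) / L)
    gcongr
  have hfk : Integrable fun y => f y * k y :=
    hf.mul_bdd hkc.aestronglyMeasurable (Filter.Eventually.of_forall hkb)
  have h := hasSum_integral_iUnion (f := fun y => f y * k y) (μ := volume)
    (fun m => measurableSet_levelSet hfm m) (pairwise_disjoint_levelSet f) hfk.integrableOn
  rw [iUnion_levelSet, setIntegral_eq_integral_of_forall_compl_eq_zero] at h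
  · have e : ∀ m, cutOp ζ L N ((levelSet f m).indicator f) x = ∫ y in levelSet f m, f y * k y := by
      intro m
      rw [← integral_indicator (measurableSet_levelSet hfm m), cutOp]
      congr 1; ext y
      rw [indicator_mul_left]
    simp_rw [e]
    exact h
  · intro y hy
    have : f y = 0 := by simpa using hy
    simp [this]

theorem carlT_const_mul (ζ : 𝓢(ℝ, ℂ)) (K : ℕ) (N : ℝ) (c : ℂ) (f : ℝ → ℂ) (x : ℝ) :
    carlT ζ K N (fun y => c * f y) x = c * carlT ζ K N f x := by
  simp only [carlT, Finset.mul_sum, cutOp, ← integral_const_mul, mul_assoc]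

theorem tsum_levelSet_le {f : ℝ → ℂ} (hfm : Measurable f) {p : ℝ} (hp : 0 < p) :
    ∑' m : ℤ, ENNReal.ofReal (((2 : ℝ) ^ m) ^ p) * volume (levelSet f m) ≤ ∫⁻ x, ‖f x‖ₑ ^ p := by
  calc _ ≤ ∑' m : ℤ, ∫⁻ x in levelSet f m, ‖f x‖ₑ ^ p := by
        refine ENNReal.tsum_le_tsum fun m => ?_
        rw [← setLIntegral_const]
        refine setLIntegral_mono' (measurableSet_levelSet hfm m) fun x hx => ?_
        rw [← ofReal_norm, ENNReal.ofReal_rpow_of_nonneg (norm_nonneg _) hp.le]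
        exact ENNReal.ofReal_le_ofReal (Real.rpow_le_rpow (by positivity) hx.1 hp.le)
    _ = ∫⁻ x in ⋃ m, levelSet f m, ‖f x‖ₑ ^ p :=
        (lintegral_iUnion (fun m => measurableSet_levelSet hfm m) (pairwise_disjoint_levelSet f) _).symm
    _ ≤ _ := setLIntegral_le_lintegral _ _

theorem lintegral_sup_carlT_le (χ χ' ζ : 𝓢(ℝ, ℂ)) (hχ : ∀ v, χ v ≠ 0 → -13 < v ∧ v < -1)
    (hχ1 : ∀ v, -12 ≤ v → v ≤ -2 → χ v = 1)
    (hχ' : ∀ v, χ' v = conj (χ (-v))) (hζ : ∀ v, ζ v ≠ 0 → 3 ≤ v ∧ v ≤ 12) {p : ℝ} (hp : 1 < p) :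
    ∃ D : ℝ, 0 < D ∧ ∀ (f : ℝ → ℂ) (_ : Integrable f) (_ : Measurable f) (K : ℕ) (𝒩 : Finset ℝ),
      ∫⁻ x, (𝒩.sup fun N => ‖carlT ζ K N f x‖ₑ) ^ p ≤ ENNReal.ofReal D * ∫⁻ x, ‖f x‖ₑ ^ p := by
  set q₀ := (p + 1) / 2 with hq₀
  set q₁ := 2 * p with hq₁
  set ε := (p - 1) / (2 * (p + 1)) with hε
  have hε0 : 0 < ε := by have : 0 < p - 1 := by linarith
                         positivity
  have hε1 : ε < 1 / 2 := by rw [hε, div_lt_div_iff₀ (by positivity) (by positivity)]; linarith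
  have hεq : ε * q₀ = (p - 1) / 4 := by rw [hε, hq₀]; field_simp; ring
  set r : ℝ := 2 ^ (-ε) with hr
  have hr0 : 0 < r := by positivity
  have hr1 : r < 1 := Real.rpow_lt_one_of_one_lt_of_neg (by norm_num) (by linarith)
  have h0 : 2 ^ (-p) * (2 / r) ^ q₀ < 1 := by
    have e1 : 2 / r = 2 ^ (1 + ε) := by
      rw [hr, Real.rpow_neg (by norm_num), Real.rpow_add (by norm_num), Real.rpow_one]; simp
    rw [e1, ← Real.rpow_mul (by norm_num), ← Real.rpow_add (by norm_num)]
    exact Real.rpow_lt_one_of_one_lt_of_neg (by norm_num) (by nlinarith)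
  have h1 : 2 ^ p * (1 / (2 * r)) ^ q₁ < 1 := by
    have e1 : 1 / (2 * r) = 2 ^ (ε - 1) := by
      rw [hr, Real.rpow_neg (by norm_num), Real.rpow_sub (by norm_num), Real.rpow_one]; field_simp
    rw [e1, ← Real.rpow_mul (by norm_num), ← Real.rpow_add (by norm_num)]
    exact Real.rpow_lt_one_of_one_lt_of_neg (by norm_num) (by nlinarith)
  obtain ⟨C₀, hC₀, hw₀⟩ := volume_carlT_compact_le χ χ' ζ hχ hχ1 hχ' hζ (q := q₀) (by rw [hq₀]; linarith)
  obtain ⟨C₁, hC₁, hw₁⟩ := volume_carlT_compact_le χ χ' ζ hχ hχ1 hχ' hζ (q := q₁) (by rw [hq₁]; linarith)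
  set C := 2 * max C₀ C₁ with hC
  have hCpos : 0 < C := by have : 0 < max C₀ C₁ := lt_max_of_lt_left hC₀; positivity
  obtain ⟨D, hD, hmain⟩ := lintegral_rpow_le_of_level_bounds (by linarith : 0 < p) hr0 hr1 hCpos h0 h1
  refine ⟨D, hD, fun f hf hfm K 𝒩 => ?_⟩
  set fm : ℤ → ℝ → ℂ := fun m => (levelSet f m).indicator f with hfmd
  have hfmi : ∀ m, Integrable (fm m) := fun m => hf.indicator (measurableSet_levelSet hfm m)
  have hcont : ∀ (g : ℝ → ℂ), Integrable g → ∀ N, Continuous fun x => carlT ζ K N g x := fun g hg N => by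
    have h2 := (continuous_carlT ζ K hg).comp (f := fun x : ℝ => (N, x)) (by fun_prop)
    simpa only [Function.comp_def] using h2
  have hweak : ∀ (q C' : ℝ), 0 < q → 0 < C' → 2 * C' ≤ C → (∀ (F : Set ℝ) (_ : MeasurableSet F) (_ : volume F ≠ ⊤)
      (f : ℝ → ℂ) (_ : Integrable f) (_ : ∀ x, ‖f x‖ ≤ F.indicator 1 x) (K : ℕ) (𝒩 : Finset ℝ)
      (α : ℝ) (_ : 0 < α),
      volume {x | ∃ N ∈ 𝒩, α < ‖carlT ζ K N f x‖} ≤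
        ENNReal.ofReal ((C' / α) ^ q) * volume F) → ∀ m : ℤ, ∀ β : ℝ, 0 < β →
      volume {x | ENNReal.ofReal β < 𝒩.sup fun N => ‖carlT ζ K N (fm m) x‖ₑ} ≤
        ENNReal.ofReal ((C * 2 ^ m / β) ^ q) * volume (levelSet f m) := by
    intro q C' hq hC' hCC h m β hβ
    have h2 : (0 : ℝ) < 2 ^ (m + 1) := by positivity
    have hA : volume (levelSet f m) ≠ ⊤ := by
      refine ((measure_mono fun x hx => ?_).trans_lt
        (hf.measure_norm_ge_lt_top (ε := (2 : ℝ) ^ m) (by positivity))).ne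
      exact hx.1
    have := h (levelSet f m) (measurableSet_levelSet hfm m) hA
      (fun y => (((2 : ℝ) ^ (m + 1))⁻¹ : ℝ) * fm m y) ((hfmi m).const_mul _) ?_ K 𝒩
      (β / 2 ^ (m + 1)) (by positivity)
    · refine le_trans (measure_mono fun x hx => ?_) (this.trans (mul_le_mul' (ENNReal.ofReal_le_ofReal
        (Real.rpow_le_rpow (by positivity) ?_ hq.le)) le_rfl))
      · simp only [mem_ofPred_eq, Finset.lt_sup_iff] at hx ⊢
        obtain ⟨N, hN, hx⟩ := hx
        refine ⟨N, hN, ?_⟩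
        rw [carlT_const_mul, norm_mul, Complex.norm_real, Real.norm_of_nonneg (by positivity),
          div_eq_inv_mul]
        refine mul_lt_mul_of_pos_left ?_ (by positivity)
        rw [← ofReal_norm] at hx
        exact (ENNReal.ofReal_lt_ofReal_iff_of_nonneg hβ.le).1 hx
      · rw [div_div_eq_mul_div, zpow_add_one₀ (by norm_num)]
        have : (0 : ℝ) < 2 ^ m := by positivity
        refine div_le_div_of_nonneg_right ?_ hβ.le
        nlinarith
    · intro y
      rw [norm_mul, Complex.norm_real, Real.norm_of_nonneg (by positivity)]
      by_cases hy : y ∈ levelSet f m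
      · simp only [hfmd, indicator_of_mem hy, Pi.one_apply]
        rw [inv_mul_le_iff₀ h2, mul_one]
        exact hy.2.le
      · simp [hfmd, indicator_of_notMem hy]
  refine (hmain (fun x => 𝒩.sup fun N => ‖carlT ζ K N f x‖ₑ) ?_ ?_
    (fun m x => 𝒩.sup fun N => ‖carlT ζ K N (fm m) x‖ₑ) ?_ (fun m => volume (levelSet f m))
    ?_ ?_).trans ?_
  · exact measurable_finset_sup _ fun N => (hcont f hf N).measurable.enorm
  · intro x
    refine ne_of_lt ((Finset.sup_lt_iff (by simp)).2 fun N _ => enorm_lt_top)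
  · intro x
    refine Finset.sup_le fun N hN => ?_
    have hs : HasSum (fun m => carlT ζ K N (fm m) x) (carlT ζ K N f x) :=
      hasSum_sum fun i _ => hasSum_sum fun k _ => hasSum_cutOp_levelSet ζ _ N hf hfm x
    rw [← hs.tsum_eq]
    refine (enorm_tsum_le_tsum_enorm).trans (ENNReal.tsum_le_tsum fun m => ?_)
    exact Finset.le_sup (f := fun N => ‖carlT ζ K N (fm m) x‖ₑ) hN
  · exact hweak q₀ C₀ (by rw [hq₀]; linarith) hC₀ (by rw [hC]; gcongr; exact le_max_left _ _) hw₀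
  · exact hweak q₁ C₁ (by rw [hq₁]; linarith) hC₁ (by rw [hC]; gcongr; exact le_max_right _ _) hw₁
  · exact mul_le_mul' le_rfl (tsum_levelSet_le hfm (by linarith))

/-- The Carleson–Hunt theorem on the real line, for finitely many frequencies. -/
theorem lintegral_sup_fproj_Iio_le {p : ℝ} (hp : 1 < p) :
    ∃ D : ℝ, 0 < D ∧ ∀ (f : 𝓢(ℝ, ℂ)) (𝒩 : Finset ℝ),
      ∫⁻ x, (𝒩.sup fun N => ‖fproj (Iio N) f x‖ₑ) ^ p ≤ ENNReal.ofReal D * ∫⁻ x, ‖f x‖ₑ ^ p := by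
  obtain ⟨χ, χ', ζ, hχ, hχ1, hχ', hζ, hζe⟩ := exists_cutoffs
  obtain ⟨D, hD, h⟩ := lintegral_sup_carlT_le χ χ' ζ hχ hχ1 hχ' hζ hp
  refine ⟨D, hD, fun f 𝒩 => ?_⟩
  have hlim : ∀ x, Filter.Tendsto (fun K => (𝒩.sup fun N => ‖carlT ζ K N f x‖ₑ) ^ p) Filter.atTop
      (nhds ((𝒩.sup fun N => ‖fproj (Iio N) f x‖ₑ) ^ p)) := fun x =>
    (ENNReal.continuous_rpow_const.tendsto _).comp
      (Filter.Tendsto.finset_sup_nhds_apply fun N _ =>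
        (continuous_enorm.tendsto _).comp (tendsto_carlT hζe N f x))
  have hcont : ∀ K N, Continuous fun x => carlT ζ K N f x := fun K N => by
    have h2 := (continuous_carlT ζ K f.integrable).comp (f := fun x : ℝ => (N, x)) (by fun_prop)
    simpa only [Function.comp_def] using h2
  calc _ = ∫⁻ x, Filter.liminf (fun K => (𝒩.sup fun N => ‖carlT ζ K N f x‖ₑ) ^ p) Filter.atTop :=
        lintegral_congr fun x => (hlim x).liminf_eq.symm
    _ ≤ Filter.liminf (fun K => ∫⁻ x, (𝒩.sup fun N => ‖carlT ζ K N f x‖ₑ) ^ p) Filter.atTop :=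
        lintegral_liminf_le fun K =>
          (measurable_finset_sup _ fun N => (hcont K N).measurable.enorm).pow_const p
    _ ≤ _ := Filter.liminf_le_of_le (by isBoundedDefault) fun b hb => by
        obtain ⟨K, hK⟩ := hb.exists
        exact hK.trans (h f f.integrable f.continuous.measurable K 𝒩)

theorem fourierT_eq_fourier (f : ℝ → ℂ) : fourierT f = 𝓕 f := by
  ext ξ
  rw [fourierT_eq_ee, fourier_eq_ee]; simp_rw [mul_comm ξ]

theorem integrable_fourierT (f : 𝓢(ℝ, ℂ)) : Integrable (fourierT f) := by
  rw [fourierT_eq_fourier, ← SchwartzMap.fourier_coe]; exact (𝓕 f).integrable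

theorem fproj_eq_fourier {S : Set ℝ} (hS : MeasurableSet S) (f : ℝ → ℂ) (x : ℝ) :
    fproj S f x = 𝓕 (S.indicator (fourierT f)) (-x) := by
  rw [fproj, fourier_eq_ee, ← integral_indicator hS]
  congr 1; ext ξ
  by_cases h : ξ ∈ S
  · simp [h, eChar_eq]
  · simp [h]

theorem fproj_univ (f : 𝓢(ℝ, ℂ)) (x : ℝ) : fproj univ f x = f x := by
  have h : 𝓕⁻ (𝓕 (f : ℝ → ℂ)) x = f x := by
    rw [f.continuous.fourierInv_fourier_eq f.integrable]
    rw [← SchwartzMap.fourier_coe]; exact (𝓕 f).integrable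
  rw [fproj_eq_fourier MeasurableSet.univ, indicator_univ, fourierT_eq_fourier, ← h,
    Real.fourierInv_eq_fourier_neg]

theorem continuous_fproj {S : Set ℝ} (hS : MeasurableSet S) (f : 𝓢(ℝ, ℂ)) :
    Continuous (fproj S f) := by
  have h : Continuous (𝓕 (S.indicator (fourierT f))) := by
    rw [← fourierT_eq_fourier]
    exact continuous_fourierT ((integrable_fourierT f).indicator hS)
  have h2 := h.comp continuous_neg
  rw [funext (fproj_eq_fourier hS f)]
  simpa only [Function.comp_def] using h2

theorem fproj_union {S T : Set ℝ} (hT : MeasurableSet T) (h : Disjoint S T) (f : 𝓢(ℝ, ℂ)) (x : ℝ) :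
    fproj (S ∪ T) f x = fproj S f x + fproj T f x := by
  have hi : Integrable fun ξ => fourierT f ξ * eChar ξ x := by
    refine (integrable_fourierT f).mul_bdd (c := 1) ?_ ?_
    · simp_rw [eChar_eq]; exact Continuous.aestronglyMeasurable (by fun_prop)
    · exact Filter.Eventually.of_forall fun ξ => by rw [eChar_eq, norm_ee]
  exact setIntegral_union h hT hi.integrableOn hi.integrableOn

theorem fproj_congr_ae {S T : Set ℝ} (h : S =ᵐ[volume] T) (f : ℝ → ℂ) : fproj S f = fproj T f := by
  ext x; exact setIntegral_congr_set h

theorem fproj_Ico {s t : ℝ} (h : s ≤ t) (f : 𝓢(ℝ, ℂ)) (x : ℝ) :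
    fproj (Ico s t) f x = fproj (Iio t) f x - fproj (Iio s) f x := by
  rw [← Iio_union_Ico_eq_Iio h, fproj_union measurableSet_Ico, add_sub_cancel_left]
  exact disjoint_left.2 fun y hy hz => (not_le.2 hy) hz.1

/-- If `F`, `G` are supported in `A`, `B` and `K` lives off `-(A + B)`, the trilinear form
of the Fourier transforms vanishes. -/
theorem integral_fourier_mul_mul_eq_zero {F G K : ℝ → ℂ} (hF : Integrable F) (hG : Integrable G)
    (hK : Integrable K) (hFG : Integrable fun x => 𝓕 F x * 𝓕 G x) {T : Set ℝ} (hT : IsClosed T)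
    (hFGT : ∀ ξ η, F ξ ≠ 0 → G η ≠ 0 → ξ + η ∈ T) (hKT : ∀ᵐ ζ, -ζ ∈ T → K ζ = 0) :
    ∫ x, 𝓕 F x * 𝓕 G x * 𝓕 K x = 0 := by
  set Φ : ℝ → ℂ := convolution F G (ContinuousLinearMap.mul ℂ ℂ) volume with hΦ
  have hΦi : Integrable Φ := hF.integrable_convolution _ hG
  have hΦF : 𝓕 Φ = fun x => 𝓕 F x * 𝓕 G x := by
    ext x; exact Real.fourier_mul_convolution_eq hF hG x
  have hΦ0 : ∀ z, z ∉ T → Φ z = 0 := by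
    intro z hz
    rw [hΦ, convolution_def]
    refine integral_eq_zero_of_ae (Filter.Eventually.of_forall fun t => ?_)
    by_contra h
    have h' : F t * G (z - t) ≠ 0 := h
    have := hFGT t (z - t) (left_ne_zero_of_mul h') (right_ne_zero_of_mul h')
    rw [add_sub_cancel] at this
    exact hz this
  have hinv : ∀ ζ, -ζ ∉ T → 𝓕 (𝓕 Φ) ζ = 0 := by
    intro ζ hζ
    have hc : ContinuousAt Φ (-ζ) := by
      refine (continuousAt_const (y := (0 : ℂ))).congr ?_
      filter_upwards [hT.isOpen_compl.mem_nhds hζ] with z hz using (hΦ0 z hz).symm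
    have := hΦi.fourierInv_fourier_eq (by rw [hΦF]; exact hFG) hc
    rw [Real.fourierInv_eq_fourier_neg, neg_neg, hΦ0 _ hζ] at this
    exact this
  have hsymm : ∫ x, 𝓕 Φ x * 𝓕 K x = ∫ x, 𝓕 (𝓕 Φ) x * K x := by
    have h := VectorFourier.integral_fourierIntegral_smul_eq_flip (L := innerₗ ℝ) (μ := volume)
      (ν := volume) (f := 𝓕 Φ) (g := K) Real.continuous_fourierChar continuous_inner
      (by rw [hΦF]; exact hFG) hK
    simp only [smul_eq_mul, flip_innerₗ] at h
    exact h.symm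
  have e1 : ∀ x, 𝓕 F x * 𝓕 G x * 𝓕 K x = 𝓕 Φ x * 𝓕 K x := fun x => by rw [hΦF]
  rw [integral_congr_ae (Filter.Eventually.of_forall e1), hsymm]
  refine integral_eq_zero_of_ae ?_
  filter_upwards [hKT] with ζ h
  by_cases hζ : -ζ ∈ T
  · simp [h hζ]
  · simp [hinv ζ hζ]

theorem mink2_Ico {s t u v : ℝ} (h : s < t) (h' : u < v) :
    mink2 (Ico s t) (Ico u v) = Ioc (-t - v) (-s - u) := by
  ext z
  simp only [mink2, mem_image2, mem_Ico, mem_Ioc]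
  constructor
  · rintro ⟨x, hx, y, hy, rfl⟩
    constructor <;> linarith [hx.1, hx.2, hy.1, hy.2]
  · rintro ⟨h1, h2⟩
    set θ := (-z - s - u) / (t + v - s - u) with hθ
    have hd : 0 < t + v - s - u := by linarith
    have hθ0 : 0 ≤ θ := div_nonneg (by linarith) hd.le
    have hθ1 : θ < 1 := (div_lt_one hd).2 (by linarith)
    have e : θ * (t + v - s - u) = -z - s - u := div_mul_cancel₀ _ hd.ne'
    refine ⟨s + θ * (t - s), ⟨?_, ?_⟩, u + θ * (v - u), ⟨?_, ?_⟩, ?_⟩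
    · nlinarith
    · nlinarith
    · nlinarith
    · nlinarith
    · linarith

end CarlesonHunt

section Paraproduct

open scoped FourierTransform SchwartzMap ComplexConjugate

theorem eLpNorm_ofReal_eq {p : ℝ} (hp : 1 < p) (f : ℝ → ℂ) :
    eLpNorm f (ENNReal.ofReal p) volume = (∫⁻ x, ‖f x‖ₑ ^ p) ^ (1 / p) := by
  rw [eLpNorm_eq_lintegral_rpow_enorm_toReal (by simp; linarith) ENNReal.ofReal_ne_top,
    ENNReal.toReal_ofReal (by linarith)]

/-- The maximal partial Fourier integral over finitely many frequencies, in `L^p`. -/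
theorem exists_sup_fproj_Iio_le {p : ℝ} (hp : 1 < p) :
    ∃ D : ℝ, 0 < D ∧ ∀ (f : 𝓢(ℝ, ℂ)) (𝒩 : Finset ℝ),
      (∫⁻ x, (𝒩.sup fun N => ‖fproj (Iio N) f x‖ₑ) ^ p) ^ (1 / p) ≤
        ENNReal.ofReal D * eLpNorm f (ENNReal.ofReal p) volume := by
  obtain ⟨D, hD, h⟩ := lintegral_sup_fproj_Iio_le hp
  refine ⟨D ^ (1 / p), by positivity, fun f 𝒩 => ?_⟩
  have hp0 : 0 ≤ 1 / p := by positivity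
  rw [eLpNorm_ofReal_eq hp, ← ENNReal.ofReal_rpow_of_pos hD, ← ENNReal.mul_rpow_of_nonneg _ _ hp0]
  exact ENNReal.rpow_le_rpow (h f 𝒩) hp0

theorem memLp_fproj_Iio {p : ℝ} (hp : 1 < p) (f : 𝓢(ℝ, ℂ)) (N : ℝ) :
    MemLp (fproj (Iio N) f) (ENNReal.ofReal p) volume := by
  obtain ⟨D, hD, h⟩ := exists_sup_fproj_Iio_le hp
  refine ⟨(continuous_fproj measurableSet_Iio f).aestronglyMeasurable, ?_⟩
  have := h f {N}
  simp only [Finset.sup_singleton] at this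
  rw [eLpNorm_ofReal_eq hp]
  exact this.trans_lt (ENNReal.mul_lt_top ENNReal.ofReal_lt_top (f.memLp _ _).2)

theorem memLp_fproj_Ico {p : ℝ} (hp : 1 < p) (f : 𝓢(ℝ, ℂ)) {s t : ℝ} (h : s ≤ t) :
    MemLp (fproj (Ico s t) f) (ENNReal.ofReal p) volume := by
  rw [funext (fproj_Ico h f)]
  exact (memLp_fproj_Iio hp f t).sub (memLp_fproj_Iio hp f s)

theorem integrable_fproj_Ico_mul (f g : 𝓢(ℝ, ℂ)) {s t u v : ℝ} (h : s ≤ t) (h' : u ≤ v) :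
    Integrable fun x => fproj (Ico s t) f x * fproj (Ico u v) g x := by
  have h1 := memLp_fproj_Ico one_lt_two f h
  have h2 := memLp_fproj_Ico one_lt_two g h'
  rw [ENNReal.ofReal_ofNat] at h1 h2
  exact h1.integrable_mul h2

theorem norm_fproj_le (S : Set ℝ) (f : 𝓢(ℝ, ℂ)) (x : ℝ) :
    ‖fproj S f x‖ ≤ ∫ ξ, ‖fourierT f ξ‖ := by
  refine (norm_integral_le_integral_norm _).trans ?_
  simp_rw [norm_mul, eChar_eq, norm_ee, mul_one]
  exact setIntegral_le_integral (integrable_fourierT f).norm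
    (Filter.Eventually.of_forall fun _ => norm_nonneg _)

/-- The third function may be localised to the frequencies `-(A + B)`. -/
theorem integral_fproj_mul_fproj_mul (f g h : 𝓢(ℝ, ℂ)) {s t u v : ℝ} (hst : s < t) (huv : u < v) :
    ∫ x, fproj (Ico s t) f x * fproj (Ico u v) g x * h x =
      ∫ x, fproj (Ico s t) f x * fproj (Ico u v) g x * fproj (mink2 (Ico s t) (Ico u v)) h x := by
  rw [mink2_Ico hst huv]
  set S := Ioc (-t - v) (-s - u)
  have hS : MeasurableSet S := measurableSet_Ioc
  have hφ := integrable_fproj_Ico_mul f g hst.le huv.le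
  have hi : ∀ T : Set ℝ, MeasurableSet T →
      Integrable fun x => fproj (Ico s t) f x * fproj (Ico u v) g x * fproj T h x := fun T hT =>
    hφ.mul_bdd (c := ∫ ξ, ‖fourierT h ξ‖) (continuous_fproj hT h).aestronglyMeasurable
      (Filter.Eventually.of_forall fun x => norm_fproj_le T h x)
  have hsplit : ∀ x, h x = fproj S h x + fproj Sᶜ h x := fun x => by
    rw [← fproj_union hS.compl disjoint_compl_right, union_compl_self, fproj_univ]
  have hF := fun (k : 𝓢(ℝ, ℂ)) {A : Set ℝ} (hA : MeasurableSet A) => (integrable_fourierT k).indicator hA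
  have hz : ∫ x, fproj (Ico s t) f x * fproj (Ico u v) g x * fproj Sᶜ h x = 0 := by
    rw [← integral_neg_eq_self]
    simp_rw [fproj_eq_fourier measurableSet_Ico, fproj_eq_fourier hS.compl] at hφ ⊢
    simp only [neg_neg]
    refine integral_fourier_mul_mul_eq_zero (hF f measurableSet_Ico) (hF g measurableSet_Ico)
      (hF h hS.compl) ?_ (T := Icc (s + u) (t + v)) isClosed_Icc ?_ ?_
    · have := hφ.comp_neg
      simpa only [neg_neg] using this
    · intro ξ η h1 h2
      have h1 := mem_of_indicator_ne_zero h1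
      have h2 := mem_of_indicator_ne_zero h2
      constructor <;> linarith [h1.1, h1.2, h2.1, h2.2]
    · have : ∀ᵐ ζ : ℝ, ζ ≠ -t - v := by simp [ae_iff]
      filter_upwards [this] with ζ h1 h2
      refine indicator_of_notMem ?_ _
      rw [notMem_compl_iff]
      refine ⟨lt_of_le_of_ne (by linarith [h2.2]) (Ne.symm h1), by linarith [h2.1]⟩
  have e : ∀ x, fproj (Ico s t) f x * fproj (Ico u v) g x * h x =
      fproj (Ico s t) f x * fproj (Ico u v) g x * fproj S h x +
      fproj (Ico s t) f x * fproj (Ico u v) g x * fproj Sᶜ h x := fun x => by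
    rw [← mul_add, ← hsplit]
  simp_rw [e]
  rw [integral_add (hi S hS) (hi _ hS.compl), hz, add_zero]

theorem lintegral_mul_mul_le {p q r : ℝ} (hp : 0 < p) (hq : 0 < q) (hr : 0 < r)
    (h : 1 / p + 1 / q + 1 / r = 1) {u v w : ℝ → ℝ≥0∞} (hu : Measurable u) (hv : Measurable v)
    (hw : Measurable w) :
    ∫⁻ x, u x * v x * w x ≤
      (∫⁻ x, u x ^ p) ^ (1 / p) * (∫⁻ x, v x ^ q) ^ (1 / q) * (∫⁻ x, w x ^ r) ^ (1 / r) := by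
  have := ENNReal.lintegral_prod_norm_pow_le (μ := volume) (Finset.univ : Finset (Fin 3))
    (f := ![fun x => u x ^ p, fun x => v x ^ q, fun x => w x ^ r]) (p := ![1 / p, 1 / q, 1 / r])
    ?_ ?_ ?_
  · simp only [Fin.prod_univ_three, Matrix.cons_val_zero, Matrix.cons_val_one, Matrix.cons_val] at this
    simp_rw [← ENNReal.rpow_mul, mul_one_div_cancel hp.ne', mul_one_div_cancel hq.ne',
      mul_one_div_cancel hr.ne', ENNReal.rpow_one] at this
    exact this
  · intro i _
    fin_cases i
    · exact (hu.pow_const p).aemeasurable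
    · exact (hv.pow_const q).aemeasurable
    · exact (hw.pow_const r).aemeasurable
  · simpa [Fin.sum_univ_three] using h
  · intro i _
    fin_cases i <;> simp <;> positivity

theorem sum_mul_mul_le {ι : Type*} (s : Finset ι) (u v w : ι → ℝ≥0∞) (M : ℝ≥0∞)
    (hv : ∀ i ∈ s, v i ≤ M) :
    ∑ i ∈ s, u i * v i * w i ≤
      (∑ i ∈ s, u i ^ 2) ^ (1 / 2 : ℝ) * M * (∑ i ∈ s, w i ^ 2) ^ (1 / 2 : ℝ) := by
  have h := ENNReal.inner_le_Lp_mul_Lq s u w Real.HolderConjugate.two_two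
  calc _ ≤ ∑ i ∈ s, M * (u i * w i) := Finset.sum_le_sum fun i hi => by
        rw [mul_right_comm, mul_comm]; exact mul_le_mul' (hv i hi) le_rfl
    _ = M * ∑ i ∈ s, u i * w i := by rw [Finset.mul_sum]
    _ ≤ M * ((∑ i ∈ s, u i ^ (2 : ℝ)) ^ (1 / 2 : ℝ) * (∑ i ∈ s, w i ^ (2 : ℝ)) ^ (1 / 2 : ℝ)) :=
        mul_le_mul' le_rfl h
    _ = _ := by simp only [ENNReal.rpow_ofNat]; ring

theorem sum_le_sqNormLp {ι κ : Type*} {T : ι → Set ℝ} {s : Finset κ} {U : κ → Set ℝ} {f : ℝ → ℂ}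
    (e : s → ι) (he : Function.Injective e) (hU : ∀ j : s, fproj (U j) f = fproj (T (e j)) f)
    {p : ℝ} (hp : 0 < p) :
    (∫⁻ x, ((∑ j ∈ s, ‖fproj (U j) f x‖ₑ ^ 2) ^ (1 / 2 : ℝ)) ^ p) ^ (1 / p) ≤ sqNormLp T f p := by
  refine ENNReal.rpow_le_rpow (lintegral_mono fun x => ?_) (by positivity)
  rw [← ENNReal.rpow_mul, one_div_mul_eq_div]
  refine ENNReal.rpow_le_rpow ?_ (by positivity)
  rw [← Finset.sum_coe_sort]
  simp_rw [hU]
  rw [← tsum_fintype (L := SummationFilter.unconditional _)]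
  exact ENNReal.tsum_comp_le_tsum_of_injective he fun i => ‖fproj (T i) f x‖ₑ ^ 2

theorem Ioo_mem_componentsOf {a : ℕ → ℝ} (ha : StrictAnti a) (j : ℕ) :
    Ioo (a (j + 1)) (a j) ∈ componentsOf (closure (range a))ᶜ := by
  have hlt := ha (Nat.lt_succ_self j)
  obtain ⟨x, hx⟩ := nonempty_Ioo.2 hlt
  have hsub : Ioo (a (j + 1)) (a j) ⊆ (closure (range a))ᶜ := by
    rw [subset_compl_comm]
    refine closure_minimal ?_ isOpen_Ioo.isClosed_compl
    rintro _ ⟨k, rfl⟩ ⟨h1, h2⟩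
    have h1 := ha.lt_iff_gt.1 h1
    have h2 := ha.lt_iff_gt.1 h2
    omega
  refine ⟨x, hsub hx, subset_antisymm
    (isPreconnected_Ioo.subset_connectedComponentIn hx hsub) fun y hy => ?_⟩
  have hc : OrdConnected (connectedComponentIn (closure (range a))ᶜ x) :=
    isPreconnected_connectedComponentIn.ordConnected
  have hxc := mem_connectedComponentIn (hsub hx)
  have hn : ∀ k, a k ∉ connectedComponentIn (closure (range a))ᶜ x := fun k hk =>
    connectedComponentIn_subset _ _ hk (subset_closure (mem_range_self k))
  constructor
  · by_contra! h
    exact hn (j + 1) (hc.out hy hxc ⟨h, hx.1.le⟩)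
  · by_contra! h
    exact hn j (hc.out hxc hy ⟨hx.2.le, h⟩)

theorem exists_sum_fproj_Ico_le {a : ℕ → ℝ} (ha : StrictAnti a) (hLP : IsLPSeq a) {p : ℝ} (hp : 1 < p) :
    ∃ C : ℝ, 0 < C ∧ ∀ (f : 𝓢(ℝ, ℂ)) (s : Finset ℕ),
      (∫⁻ x, ((∑ j ∈ s, ‖fproj (Ico (a (j + 1)) (a j)) f x‖ₑ ^ 2) ^ (1 / 2 : ℝ)) ^ p) ^ (1 / p) ≤
        ENNReal.ofReal C * eLpNorm f (ENNReal.ofReal p) volume := by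
  obtain ⟨-, -, h⟩ := hLP
  obtain ⟨_, _, C, hC, h'⟩ := h p hp
  refine ⟨C, hC, fun f s => le_trans ?_ (h' f).2⟩
  refine sum_le_sqNormLp (fun j : s => ⟨_, Ioo_mem_componentsOf ha j⟩) ?_ ?_ (by linarith)
  · intro j k hjk
    have := congrArg sSup (congrArg Subtype.val hjk)
    simp only at this
    rw [csSup_Ioo (ha (Nat.lt_succ_self _)), csSup_Ioo (ha (Nat.lt_succ_self _))] at this
    exact Subtype.ext (ha.injective this)
  · intro j
    exact fproj_congr_ae Ioo_ae_eq_Ico.symm f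

theorem enorm_fproj_Ico_le_sup {b : ℕ → ℝ} (hb : StrictAnti b) (g : 𝓢(ℝ, ℂ)) {s : Finset ℕ} {j : ℕ}
    (hj : j ∈ s) (x : ℝ) : ‖fproj (Ico (b j) (b 0)) g x‖ₑ ≤
      2 * (insert (b 0) (s.image b)).sup fun N => ‖fproj (Iio N) g x‖ₑ := by
  rw [fproj_Ico (hb.antitone (Nat.zero_le j)), two_mul]
  refine enorm_sub_le.trans (add_le_add ?_ ?_)
  · exact Finset.le_sup (f := fun N => ‖fproj (Iio N) g x‖ₑ) (Finset.mem_insert_self _ _)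
  · exact Finset.le_sup (f := fun N => ‖fproj (Iio N) g x‖ₑ)
      (Finset.mem_insert_of_mem (Finset.mem_image_of_mem b hj))

/-- The trilinear form restricted to frequency intervals of one colour. -/
theorem exists_trilinear_bound {a b : ℕ → ℝ} (ha : StrictAnti a) (hb : StrictAnti b) (hLP : IsLPSeq a)
    {P : ℕ → Prop} (hP : ∀ j, P j → 1 ≤ j) (hI : IsLPFamily fun j : {j // P j} => Iab a b j.1)
    {p1 p2 p3 : ℝ} (hp1 : 1 < p1) (hp2 : 1 < p2) (hp3 : 1 < p3)
    (hsum : 1 / p1 + 1 / p2 + 1 / p3 = 1) :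
    ∃ C : ℝ, 0 < C ∧ ∀ (f g h : 𝓢(ℝ, ℂ)) (s : Finset ℕ), (∀ j ∈ s, P j) →
      ‖∑ j ∈ s, ∫ x, fproj (Ico (a (j + 1)) (a j)) f x * fproj (Ico (b j) (b 0)) g x * h x‖ₑ ≤
        ENNReal.ofReal C * eLpNorm f (ENNReal.ofReal p1) volume *
          eLpNorm g (ENNReal.ofReal p2) volume * eLpNorm h (ENNReal.ofReal p3) volume := by
  obtain ⟨C1, hC1, h1⟩ := exists_sum_fproj_Ico_le ha hLP hp1
  obtain ⟨C2, hC2, h2⟩ := exists_sup_fproj_Iio_le hp2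
  obtain ⟨C3, hC3, h3⟩ := hI p3 hp3
  refine ⟨C1 * (2 * C2) * C3, by positivity, fun f g h s hs => ?_⟩
  set u := fun (j : ℕ) x => ‖fproj (Ico (a (j + 1)) (a j)) f x‖ₑ with hu
  set v := fun (j : ℕ) x => ‖fproj (Ico (b j) (b 0)) g x‖ₑ with hv
  set w := fun (j : ℕ) x => ‖fproj (Iab a b j) h x‖ₑ with hw
  have hIab : ∀ j, P j → Iab a b j = Ioc (-a j - b 0) (-a (j + 1) - b j) := fun j hj =>
    mink2_Ico (ha (Nat.lt_succ_self j)) (hb (hP j hj))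
  have hum : ∀ j, Measurable (u j) := fun j => (continuous_fproj measurableSet_Ico f).measurable.enorm
  have hvm : ∀ j, Measurable (v j) := fun j => (continuous_fproj measurableSet_Ico g).measurable.enorm
  have hwm : ∀ j ∈ s, Measurable (w j) := fun j hj => by
    simp only [hw, hIab j (hs j hj)]
    exact (continuous_fproj measurableSet_Ioc h).measurable.enorm
  set M := fun x => (insert (b 0) (s.image b)).sup fun N => ‖fproj (Iio N) g x‖ₑ with hM
  have hMm : Measurable M :=
    measurable_finset_sup _ fun N => (continuous_fproj measurableSet_Iio g).measurable.enorm
  calc _ ≤ ∑ j ∈ s, ∫⁻ x, u j x * v j x * w j x := by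
        refine (enorm_sum_le _ _).trans (Finset.sum_le_sum fun j hj => ?_)
        rw [integral_fproj_mul_fproj_mul f g h (ha (Nat.lt_succ_self j)) (hb (hP j (hs j hj)))]
        refine (enorm_integral_le_lintegral_enorm _).trans (le_of_eq ?_)
        simp_rw [enorm_mul]; rfl
    _ = ∫⁻ x, ∑ j ∈ s, u j x * v j x * w j x :=
        (lintegral_finsetSum' _ fun j hj => (((hum j).mul (hvm j)).mul (hwm j hj)).aemeasurable).symm
    _ ≤ ∫⁻ x, (∑ j ∈ s, u j x ^ 2) ^ (1 / 2 : ℝ) * (2 * M x) * (∑ j ∈ s, w j x ^ 2) ^ (1 / 2 : ℝ) :=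
        lintegral_mono fun x => sum_mul_mul_le s (fun j => u j x) (fun j => v j x) (fun j => w j x) _
          fun j hj => enorm_fproj_Ico_le_sup hb g hj x
    _ ≤ (∫⁻ x, ((∑ j ∈ s, u j x ^ 2) ^ (1 / 2 : ℝ)) ^ p1) ^ (1 / p1) *
          (∫⁻ x, (2 * M x) ^ p2) ^ (1 / p2) *
          (∫⁻ x, ((∑ j ∈ s, w j x ^ 2) ^ (1 / 2 : ℝ)) ^ p3) ^ (1 / p3) := by
        refine lintegral_mul_mul_le (by linarith) (by linarith) (by linarith) hsum ?_
          (hMm.const_mul 2) ?_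
        · exact (Finset.measurable_fun_sum _ fun j _ => (hum j).pow_const 2).pow_const _
        · exact (Finset.measurable_fun_sum _ fun j hj => (hwm j hj).pow_const 2).pow_const _
    _ ≤ (ENNReal.ofReal C1 * eLpNorm f (ENNReal.ofReal p1) volume) *
          (2 * (ENNReal.ofReal C2 * eLpNorm g (ENNReal.ofReal p2) volume)) *
          (ENNReal.ofReal C3 * eLpNorm h (ENNReal.ofReal p3) volume) := by
        refine mul_le_mul' (mul_le_mul' (h1 f s) ?_) (le_trans ?_ (h3 h))
        · simp_rw [ENNReal.mul_rpow_of_nonneg _ _ (by linarith : 0 ≤ p2)]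
          rw [lintegral_const_mul _ (hMm.pow_const _),
            ENNReal.mul_rpow_of_nonneg _ _ (by positivity : 0 ≤ 1 / p2), ← ENNReal.rpow_mul,
            mul_one_div_cancel (by linarith), ENNReal.rpow_one]
          exact mul_le_mul' le_rfl (h2 g _)
        · refine sum_le_sqNormLp (fun j : s => ⟨j, hs j j.2⟩) ?_ (fun j => rfl) (by linarith)
          intro j k hjk
          exact Subtype.ext (congrArg (fun z : {j // P j} => (z : ℕ)) hjk)
    _ = _ := by
        rw [ENNReal.ofReal_mul (by positivity), ENNReal.ofReal_mul (by positivity),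
          ENNReal.ofReal_mul (by positivity), ENNReal.ofReal_ofNat]
        ring

theorem enorm_integral_mul_le {p q : ℝ} (hpq : p.HolderConjugate q) {f g : ℝ → ℂ}
    (hf : AEStronglyMeasurable f) (hg : AEStronglyMeasurable g) :
    ‖∫ x, f x * g x‖ₑ ≤ (∫⁻ x, ‖f x‖ₑ ^ p) ^ (1 / p) * (∫⁻ x, ‖g x‖ₑ ^ q) ^ (1 / q) := by
  refine (enorm_integral_le_lintegral_enorm _).trans ?_
  simp_rw [enorm_mul]
  exact ENNReal.lintegral_mul_le_Lp_mul_Lq volume hpq hf.enorm hg.enorm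

/-- An `L^q` norm bound follows by duality with Schwartz functions. -/
theorem eLpNorm_le_of_schwartz_duality {p : ℝ} (hp : 1 < p) {B : ℝ → ℂ}
    (hB : MemLp B (ENNReal.ofReal (p / (p - 1))) volume) {M : ℝ≥0∞} (hM : M ≠ ⊤)
    (h : ∀ φ : 𝓢(ℝ, ℂ), ‖∫ x, B x * φ x‖ₑ ≤ M * eLpNorm φ (ENNReal.ofReal p) volume) :
    eLpNorm B (ENNReal.ofReal (p / (p - 1))) volume ≤ M := by
  set q := p / (p - 1) with hq
  have hpq : p.HolderConjugate q := Real.HolderConjugate.conjExponent hp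
  have hq1 : 1 < q := hpq.symm.lt
  have hqp : (q - 1) * p = q := hpq.symm.sub_one_mul_conj
  rw [eLpNorm_ofReal_eq hq1]
  set N := ∫⁻ x, ‖B x‖ₑ ^ q with hN
  have hNt : N ≠ ⊤ := by
    have h1 := hB.2
    rw [eLpNorm_ofReal_eq hq1] at h1
    intro h2
    rw [← hN, h2, ENNReal.top_rpow_of_pos (by positivity)] at h1
    exact lt_irrefl _ h1
  set k : ℝ → ℂ := fun x => conj (B x) * ((‖B x‖ ^ (q - 2) : ℝ) : ℂ) with hk
  have hkm : AEStronglyMeasurable k := by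
    have hB1 := hB.1
    refine AEStronglyMeasurable.mul (Complex.continuous_conj.comp_aestronglyMeasurable hB1) ?_
    exact Complex.continuous_ofReal.comp_aestronglyMeasurable
      ((hB1.norm.aemeasurable.pow_const _).aestronglyMeasurable)
  have hkn : ∀ x, ‖k x‖ₑ = ‖B x‖ₑ ^ (q - 1) := by
    intro x
    rw [← ofReal_norm, ← ofReal_norm, ENNReal.ofReal_rpow_of_nonneg (norm_nonneg _) (by linarith)]
    congr 1
    rw [hk]
    simp only [norm_mul, RCLike.norm_conj, Complex.norm_real, Real.norm_eq_abs,
      abs_of_nonneg (Real.rpow_nonneg (norm_nonneg (B x)) _)]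
    rcases eq_or_ne (B x) 0 with h0 | h0
    · simp [h0, Real.zero_rpow (by linarith : q - 1 ≠ 0)]
    · have : 0 < ‖B x‖ := norm_pos_iff.2 h0
      rw [← Real.rpow_one_add' this.le (by linarith)]; congr 1; ring
  have hkp : ∫⁻ x, ‖k x‖ₑ ^ p = N := by
    simp_rw [hkn, ← ENNReal.rpow_mul, hqp]; rfl
  have hBk : ∀ x, B x * k x = ((‖B x‖ ^ q : ℝ) : ℂ) := by
    intro x
    rw [hk]
    simp only
    rw [← mul_assoc, Complex.mul_conj, Complex.normSq_eq_norm_sq, ← Complex.ofReal_mul]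
    congr 1
    rcases eq_or_ne (B x) 0 with h0 | h0
    · simp [h0, Real.zero_rpow (by linarith : q ≠ 0)]
    · have : 0 < ‖B x‖ := norm_pos_iff.2 h0
      rw [← Real.rpow_natCast, ← Real.rpow_add this]; congr 1; push_cast; ring
  have hBkN : ‖∫ x, B x * k x‖ₑ = N := by
    simp_rw [hBk]
    rw [integral_complex_ofReal, ← ofReal_norm, Complex.norm_real, Real.norm_of_nonneg
      (integral_nonneg fun x => by positivity), integral_eq_lintegral_of_nonneg_ae
      (Filter.Eventually.of_forall fun x => by positivity)
      ((hB.1.norm.aemeasurable.pow_const _).aestronglyMeasurable)]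
    simp_rw [← ENNReal.ofReal_rpow_of_nonneg (norm_nonneg _) (by linarith : 0 ≤ q), ofReal_norm]
    exact ENNReal.ofReal_toReal hNt
  have hkL : MemLp k (ENNReal.ofReal p) volume := by
    refine ⟨hkm, ?_⟩
    rw [eLpNorm_ofReal_eq hp, hkp]
    exact ENNReal.rpow_lt_top_of_nonneg (by positivity) hNt
  have hNr : N ^ (1 / q) ≠ ⊤ := ENNReal.rpow_ne_top_of_nonneg (by positivity) hNt
  have hmain : N ≤ M * N ^ (1 / p) := by
    refine ENNReal.le_of_forall_pos_le_add fun ε hε _ => ?_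
    set R := M + N ^ (1 / q) with hR
    have hRt : R ≠ ⊤ := ENNReal.add_ne_top.2 ⟨hM, hNr⟩
    set c := R.toReal + 1 with hc
    have hc0 : 0 < c := by positivity
    obtain ⟨φ₀, hφc, hφs, hφ⟩ := hkL.exist_eLpNorm_sub_le ENNReal.ofReal_ne_top
      (by rw [ENNReal.one_le_ofReal]; linarith) (ε := ε / c) (by positivity)
    set φ : 𝓢(ℝ, ℂ) := hφc.toSchwartzMap hφs with hφd
    have hφe : (φ : ℝ → ℂ) = φ₀ := rfl
    rw [← hφe] at hφ
    have hB' : ∀ {u : ℝ → ℂ}, MemLp u (ENNReal.ofReal p) volume → Integrable fun x => B x * u x := by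
      intro u hu
      have : ENNReal.HolderConjugate (ENNReal.ofReal q) (ENNReal.ofReal p) :=
        hpq.symm.ennrealOfReal
      exact hB.integrable_mul hu
    have hφL : MemLp φ (ENNReal.ofReal p) volume := φ.memLp _ _
    have hdec : ∫ x, B x * k x = (∫ x, B x * φ x) + ∫ x, B x * (k - φ) x := by
      rw [← integral_add (hB' hφL) (hB' (hkL.sub hφL))]
      congr 1; ext x; simp only [Pi.sub_apply]; ring
    have hφn : eLpNorm φ (ENNReal.ofReal p) volume ≤ N ^ (1 / p) + ENNReal.ofReal (ε / c) := by
      have e : (φ : ℝ → ℂ) = k - (k - φ) := by simp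
      rw [e]
      refine (eLpNorm_sub_le hkm (hkm.sub hφL.1) (by rw [ENNReal.one_le_ofReal]; linarith)).trans
        (add_le_add (le_of_eq ?_) hφ)
      rw [eLpNorm_ofReal_eq hp, hkp]
    calc N = ‖(∫ x, B x * φ x) + ∫ x, B x * (k - φ) x‖ₑ := by rw [← hdec, hBkN]
      _ ≤ M * (N ^ (1 / p) + ENNReal.ofReal (ε / c)) + N ^ (1 / q) * ENNReal.ofReal (ε / c) := by
          refine (enorm_add_le _ _).trans (add_le_add ((h φ).trans (mul_le_mul' le_rfl hφn)) ?_)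
          refine (enorm_integral_mul_le hpq.symm hB.1 (hkL.sub hφL).1).trans (mul_le_mul' le_rfl ?_)
          rw [← eLpNorm_ofReal_eq hp]; exact hφ
      _ = M * N ^ (1 / p) + R * ENNReal.ofReal (ε / c) := by rw [hR]; ring
      _ ≤ M * N ^ (1 / p) + ε := by
          refine add_le_add le_rfl ?_
          rw [← ENNReal.ofReal_toReal hRt, ← ENNReal.ofReal_mul ENNReal.toReal_nonneg,
            ← ENNReal.ofReal_coe_nnreal]
          refine ENNReal.ofReal_le_ofReal ?_
          rw [← mul_div_assoc, div_le_iff₀ hc0, mul_comm]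
          exact mul_le_mul_of_nonneg_left (by rw [hc]; linarith) ε.2
  rcases eq_or_ne N 0 with h0 | h0
  · rw [h0, ENNReal.zero_rpow_of_pos (by positivity)]; exact zero_le
  · have hsplit : N = N ^ (1 / q) * N ^ (1 / p) := by
      rw [← ENNReal.rpow_add _ _ h0 hNt, one_div, one_div, hpq.symm.inv_add_inv_eq_one,
        ENNReal.rpow_one]
    have hp0 : N ^ (1 / p) ≠ 0 := by simp [h0, hNt]
    have hpt : N ^ (1 / p) ≠ ⊤ := ENNReal.rpow_ne_top_of_nonneg (by positivity) hNt
    refine (ENNReal.mul_le_mul_iff_left hp0 hpt).1 ?_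
    rw [← hsplit]
    exact hmain

theorem eChar_add (ξ η x : ℝ) : eChar (ξ + η) x = eChar ξ x * eChar η x := by
  rw [eChar_eq, eChar_eq, eChar_eq, ← ee_add, add_mul]

theorem integral_indC_mul {S : Set ℝ} (hS : MeasurableSet S) (f : ℝ → ℂ) (x : ℝ) :
    ∫ ξ, indC S ξ * (fourierT f ξ * eChar ξ x) = fproj S f x := by
  rw [fproj, ← integral_indicator hS]
  congr 1; ext ξ
  by_cases h : ξ ∈ S <;> simp [indC, h]

theorem norm_fourierT_mul_eChar (f : ℝ → ℂ) (ξ x : ℝ) :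
    ‖fourierT f ξ * eChar ξ x‖ = ‖fourierT f ξ‖ := by
  rw [norm_mul, eChar_eq, norm_ee, mul_one]

theorem integrable_fourierT_mul_eChar (f : 𝓢(ℝ, ℂ)) (x : ℝ) :
    Integrable fun ξ => fourierT f ξ * eChar ξ x := by
  refine (integrable_fourierT f).mul_bdd (c := 1) ?_ ?_
  · simp_rw [eChar_eq]; exact Continuous.aestronglyMeasurable (by fun_prop)
  · exact Filter.Eventually.of_forall fun ξ => by rw [eChar_eq, norm_ee]

theorem eq_of_mem_Ico_of_mem_Ico {a : ℕ → ℝ} (ha : StrictAnti a) {j k : ℕ} {ξ : ℝ}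
    (hj : ξ ∈ Ico (a (j + 1)) (a j)) (hk : ξ ∈ Ico (a (k + 1)) (a k)) : j = k := by
  have h1 := ha.lt_iff_gt.1 (hj.1.trans_lt hk.2)
  have h2 := ha.lt_iff_gt.1 (hk.1.trans_lt hj.2)
  omega

theorem sum_indC_mul_eq {a : ℕ → ℝ} (ha : StrictAnti a) {ξ : ℝ} {j : ℕ}
    (hj : ξ ∈ Ico (a (j + 2)) (a (j + 1))) (s : Finset ℕ) (v : ℕ → ℂ) :
    ∑ i ∈ s, indC (Ico (a (i + 2)) (a (i + 1))) ξ * v i = if j ∈ s then v j else 0 := by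
  rw [← Finset.sum_ite_eq s j v]
  refine Finset.sum_congr rfl fun i _ => ?_
  split_ifs with h
  · subst h; simp [indC, hj]
  · have : ξ ∉ Ico (a (i + 2)) (a (i + 1)) := fun hi => h (by
      have := eq_of_mem_Ico_of_mem_Ico ha hj hi
      omega)
    simp [indC, this]

theorem mab_eq_indC {a : ℕ → ℝ} (b : ℕ → ℝ) (ha : StrictAnti a) {ξ : ℝ} {j : ℕ}
    (hj : ξ ∈ Ico (a (j + 2)) (a (j + 1))) (η : ℝ) : mab a b ξ η = indC (Ico (b (j + 1)) (b 0)) η := by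
  rw [mab, tsum_eq_single j]
  · simp [indC, hj]
  · intro i hi
    have : ξ ∉ Ico (a (i + 2)) (a (i + 1)) := fun h => hi (by
      have := eq_of_mem_Ico_of_mem_Ico ha hj h
      omega)
    simp [indC, this]

/-- The partial sums of the paraproduct converge pointwise. -/
theorem tendsto_sum_fproj_mul_fproj {a b : ℕ → ℝ} (ha : StrictAnti a) (f g : 𝓢(ℝ, ℂ)) (x : ℝ) :
    Filter.Tendsto (fun J => ∑ j ∈ Finset.range J,
      fproj (Ico (a (j + 2)) (a (j + 1))) f x * fproj (Ico (b (j + 1)) (b 0)) g x) Filter.atTop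
      (nhds (Bm (mab a b) f g x)) := by
  set v : ℕ → ℂ := fun j => fproj (Ico (b (j + 1)) (b 0)) g x with hv
  have hi : ∀ j, Integrable fun ξ => indC (Ico (a (j + 2)) (a (j + 1))) ξ *
      (fourierT f ξ * eChar ξ x) := fun j => by
    have := (integrable_fourierT_mul_eChar f x).indicator
      (measurableSet_Ico (a := a (j + 2)) (b := a (j + 1)))
    refine this.congr (Filter.Eventually.of_forall fun ξ => ?_)
    by_cases h : ξ ∈ Ico (a (j + 2)) (a (j + 1)) <;> simp [indC, h]
  have e : ∀ (j : ℕ) (ξ : ℝ), indC (Ico (a (j + 2)) (a (j + 1))) ξ * v j *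
      (fourierT f ξ * eChar ξ x) =
      indC (Ico (a (j + 2)) (a (j + 1))) ξ * (fourierT f ξ * eChar ξ x) * v j := by
    intros; ring
  have hsum : ∀ J, ∑ j ∈ Finset.range J, fproj (Ico (a (j + 2)) (a (j + 1))) f x * v j =
      ∫ ξ, ∑ j ∈ Finset.range J, indC (Ico (a (j + 2)) (a (j + 1))) ξ * v j *
        (fourierT f ξ * eChar ξ x) := by
    intro J
    simp_rw [e]
    rw [integral_finsetSum _ fun j _ => (hi j).mul_const _]
    refine Finset.sum_congr rfl fun j _ => ?_
    rw [integral_mul_const, integral_indC_mul measurableSet_Ico]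
  have hinner : ∀ ξ, ∫ η, mab a b ξ η * fourierT f ξ * fourierT g η * eChar (ξ + η) x =
      (fourierT f ξ * eChar ξ x) * ∫ η, mab a b ξ η * (fourierT g η * eChar η x) := by
    intro ξ
    rw [← integral_const_mul]
    congr 1; ext η
    rw [eChar_add]; ring
  have hfun : (fun J => ∑ j ∈ Finset.range J, fproj (Ico (a (j + 2)) (a (j + 1))) f x * v j) =
      fun J => ∫ ξ, (∑ j ∈ Finset.range J, indC (Ico (a (j + 2)) (a (j + 1))) ξ * v j) *
        (fourierT f ξ * eChar ξ x) := by
    funext J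
    simp_rw [hsum, Finset.sum_mul]
  have hlim : Bm (mab a b) f g x =
      ∫ ξ, (fourierT f ξ * eChar ξ x) * ∫ η, mab a b ξ η * (fourierT g η * eChar η x) :=
    integral_congr_ae (Filter.Eventually.of_forall hinner)
  rw [hlim, hfun]
  refine tendsto_integral_of_dominated_convergence
    (fun ξ => (∫ η, ‖fourierT g η‖) * ‖fourierT f ξ‖) (fun J => ?_)
    ((integrable_fourierT f).norm.const_mul _) (fun J => Filter.Eventually.of_forall fun ξ => ?_)
    (Filter.Eventually.of_forall fun ξ => ?_)
  · simp_rw [Finset.sum_mul, e]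
    exact (integrable_finsetSum _ fun j _ => (hi j).mul_const _).aestronglyMeasurable
  · rw [norm_mul, norm_fourierT_mul_eChar]
    refine mul_le_mul_of_nonneg_right ?_ (norm_nonneg _)
    have h0 : 0 ≤ ∫ η, ‖fourierT g η‖ := integral_nonneg fun _ => norm_nonneg _
    by_cases h : ∃ j, ξ ∈ Ico (a (j + 2)) (a (j + 1))
    · obtain ⟨j, hj⟩ := h
      rw [sum_indC_mul_eq ha hj]
      split_ifs
      · exact norm_fproj_le _ g x
      · simpa using h0
    · push Not at h
      rw [Finset.sum_eq_zero fun j _ => by simp [indC, h j]]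
      simpa using h0
  · refine tendsto_const_nhds.congr' ?_
    by_cases h : ∃ j, ξ ∈ Ico (a (j + 2)) (a (j + 1))
    · obtain ⟨j, hj⟩ := h
      filter_upwards [Filter.eventually_gt_atTop j] with J hJ
      rw [sum_indC_mul_eq ha hj, if_pos (Finset.mem_range.2 hJ), mul_comm]
      simp_rw [mab_eq_indC b ha hj]
      rw [integral_indC_mul measurableSet_Ico]
    · push Not at h
      refine Filter.Eventually.of_forall fun J => ?_
      beta_reduce
      rw [Finset.sum_eq_zero fun j _ => by simp [indC, h j]]
      have : ∀ η, mab a b ξ η = 0 := fun η => by simp [mab, indC, h]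
      simp [this]

theorem integrable_fproj_mul_fproj_mul (f g h : 𝓢(ℝ, ℂ)) {s t u v : ℝ} (hst : s ≤ t) (huv : u ≤ v) :
    Integrable fun x => fproj (Ico s t) f x * fproj (Ico u v) g x * h x := by
  refine (integrable_fproj_Ico_mul f g hst huv).mul_bdd (c := ∫ ξ, ‖fourierT h ξ‖)
    h.continuous.aestronglyMeasurable (Filter.Eventually.of_forall fun x => ?_)
  rw [← fproj_univ h x]
  exact norm_fproj_le univ h x

theorem memLp_fproj_Ico_mul {q : ℝ} (hq : 1 < q) (f g : 𝓢(ℝ, ℂ)) {s t u v : ℝ} (hst : s ≤ t) :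
    MemLp (fun x => fproj (Ico s t) f x * fproj (Ico u v) g x) (ENNReal.ofReal q) volume := by
  refine (memLp_fproj_Ico hq f hst).of_le_mul (c := ∫ ξ, ‖fourierT g ξ‖)
    ((continuous_fproj measurableSet_Ico f).mul
      (continuous_fproj measurableSet_Ico g)).aestronglyMeasurable
    (Filter.Eventually.of_forall fun x => ?_)
  rw [norm_mul, mul_comm]
  exact mul_le_mul_of_nonneg_right (norm_fproj_le _ g x) (norm_nonneg _)

/-- Uniform bounds for the partial sums of the paraproduct. -/
theorem eLpNorm_sum_fproj_mul_fproj_le {a b : ℕ → ℝ} (ha : StrictAnti a) (hb : StrictAnti b)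
    {n : ℕ} {σ : ℕ → Fin n} {C : Fin n → ℝ} (hC : ∀ i, 0 < C i) {p1 p2 p3 : ℝ} (hp3 : 1 < p3)
    (f g : 𝓢(ℝ, ℂ)) (hf : eLpNorm f (ENNReal.ofReal p1) volume ≠ ⊤)
    (hg : eLpNorm g (ENNReal.ofReal p2) volume ≠ ⊤)
    (h : ∀ (i : Fin n) (k : 𝓢(ℝ, ℂ)) (s : Finset ℕ), (∀ j ∈ s, 1 ≤ j ∧ σ j = i) →
      ‖∑ j ∈ s, ∫ x, fproj (Ico (a (j + 1)) (a j)) f x * fproj (Ico (b j) (b 0)) g x * k x‖ₑ ≤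
        ENNReal.ofReal (C i) * eLpNorm f (ENNReal.ofReal p1) volume *
          eLpNorm g (ENNReal.ofReal p2) volume * eLpNorm k (ENNReal.ofReal p3) volume) (J : ℕ) :
    eLpNorm (fun x => ∑ j ∈ Finset.range J,
      fproj (Ico (a (j + 2)) (a (j + 1))) f x * fproj (Ico (b (j + 1)) (b 0)) g x)
        (ENNReal.ofReal (p3 / (p3 - 1))) volume ≤
      ENNReal.ofReal (∑ i, C i) * eLpNorm f (ENNReal.ofReal p1) volume *
        eLpNorm g (ENNReal.ofReal p2) volume := by
  have hq : 1 < p3 / (p3 - 1) := by rw [one_lt_div (by linarith)]; linarith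
  have haj : ∀ j, a (j + 1) ≤ a j := fun j => ha.antitone (Nat.le_succ j)
  have hbj : ∀ j, b j ≤ b 0 := fun j => hb.antitone (Nat.zero_le j)
  refine eLpNorm_le_of_schwartz_duality hp3
    (memLp_finsetSum _ fun j _ => memLp_fproj_Ico_mul hq f g (haj (j + 1)))
    (ENNReal.mul_ne_top (ENNReal.mul_ne_top ENNReal.ofReal_ne_top hf) hg) fun k => ?_
  have e : ∫ x, (∑ j ∈ Finset.range J, fproj (Ico (a (j + 2)) (a (j + 1))) f x *
      fproj (Ico (b (j + 1)) (b 0)) g x) * k x =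
      ∑ i, ∑ j ∈ ((Finset.range J).map (addRightEmbedding 1)).filter (fun j => σ j = i),
        ∫ x, fproj (Ico (a (j + 1)) (a j)) f x * fproj (Ico (b j) (b 0)) g x * k x := by
    rw [Finset.sum_fiberwise, Finset.sum_map]
    simp_rw [Finset.sum_mul]
    rw [integral_finsetSum _ fun j _ =>
      integrable_fproj_mul_fproj_mul f g k (haj (j + 1)) (hbj (j + 1))]
    rfl
  rw [e]
  refine (enorm_sum_le _ _).trans ?_
  rw [ENNReal.ofReal_sum_of_nonneg fun i _ => (hC i).le, Finset.sum_mul, Finset.sum_mul,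
    Finset.sum_mul]
  refine Finset.sum_le_sum fun i _ => h i k _ fun j hj => ?_
  rw [Finset.mem_filter, Finset.mem_map] at hj
  obtain ⟨⟨l, -, rfl⟩, hj⟩ := hj
  exact ⟨Nat.le_add_left 1 l, hj⟩

end Paraproduct

/-- Theorem 1.1 (Hyp 1, `a` Littlewood--Paley, and `I_{a,b}` splitting into
Littlewood--Paley subcollections): the paraproduct bound holds for all
`1 < p₁, p₂, p₃ < ∞` with `1/p₁ + 1/p₂ + 1/p₃ = 1`. -/
theorem paraproduct_hyp1_LP_full_bound (a b : ℕ → ℝ) (ha : StrictAnti a) (hb : StrictAnti b)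
    (hLP : IsLPSeq a)
    (hyp1LP : ∃ n : ℕ, ∃ σ : ℕ → Fin n,
      (∀ j k : ℕ, 1 ≤ j → 1 ≤ k → j ≠ k → σ j = σ k →
        Disjoint (Iab a b j) (Iab a b k)) ∧
      ∀ i : Fin n, IsLPFamily (fun j : {j : ℕ // 1 ≤ j ∧ σ j = i} => Iab a b j.1))
    (p1 p2 p3 : ℝ) (hp1 : 1 < p1) (hp2 : 1 < p2) (hp3 : 1 < p3)
    (hsum : 1 / p1 + 1 / p2 + 1 / p3 = 1) :
    ∃ C : ℝ, 0 < C ∧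
      ∀ f g : SchwartzMap ℝ ℂ,
        eLpNorm (Bm (mab a b) (⇑f) (⇑g)) (ENNReal.ofReal (p3 / (p3 - 1))) volume ≤
          ENNReal.ofReal C * eLpNorm (⇑f) (ENNReal.ofReal p1) volume *
            eLpNorm (⇑g) (ENNReal.ofReal p2) volume := by
  obtain ⟨n, σ, -, hI⟩ := hyp1LP
  choose C hC h using fun i =>
    exists_trilinear_bound ha hb hLP (fun j hj => hj.1) (hI i) hp1 hp2 hp3 hsum
  have hC0 : 0 ≤ ∑ i, C i := Finset.sum_nonneg fun i _ => (hC i).le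
  refine ⟨(∑ i, C i) + 1, by linarith, fun f g => ?_⟩
  have hJ := eLpNorm_sum_fproj_mul_fproj_le ha hb hC hp3 f g
    (f.memLp (ENNReal.ofReal p1) volume).eLpNorm_ne_top
    (g.memLp (ENNReal.ofReal p2) volume).eLpNorm_ne_top fun i k s => h i f g k s
  refine (Lp.eLpNorm_lim_le_liminf_eLpNorm (fun J => ?_) _
    (Filter.Eventually.of_forall fun x => tendsto_sum_fproj_mul_fproj ha f g x)).trans ?_
  · exact (continuous_finsetSum _ fun j _ => (continuous_fproj measurableSet_Ico f).mul
      (continuous_fproj measurableSet_Ico g)).aestronglyMeasurable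
  · refine (Filter.liminf_le_liminf (Filter.Eventually.of_forall hJ)).trans ?_
    rw [Filter.liminf_const]
    gcongr
    linarith
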